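/- Assume the standing hypotheses on μ. There exist an exponent β₂ = β₂(α) > 0, constants A > 1 and C, and a radius r₀ > 0 such that θ^P_Σ(x,r) ≤ C·r^{β₂} for all x ∈ Σ ∩ B(0,r₀) with x ≠ 0 and all 0 < r ≤ |x|^{1+γ₁}/A, where 0 < γ₁ < β₁(α) is any fixed exponent and β₂ = γ₁β/(1+γ₁) for the Hölder–Reifenberg exponent β = β(α) of David–Kenig–Toro. -/

import Mathlib

open Metric Set MeasureTheory Filter Module
open scoped RealInnerProductSpace Topology Pointwise ENNReal

noncomputable section

/-- `ℝⁿ` as a Euclidean space. -/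
abbrev E (n : ℕ) : Type := EuclideanSpace ℝ (Fin n)

/-- `d(A,B) = sup_{a ∈ A} inf_{b ∈ B} |a - b|`. -/
def setD {n : ℕ} (A B : Set (E n)) : ℝ := ⨆ a ∈ A, Metric.infDist a B

/-- `d^{x,r}(A,B) = (1/r) d(A ∩ B(x,r), B ∩ B(x,r))`. -/
def dxr {n : ℕ} (x : E n) (r : ℝ) (A B : Set (E n)) : ℝ :=
  (1 / r) * setD (A ∩ closedBall x r) (B ∩ closedBall x r)

/-- `D^{x,r}(A,B) = max(d^{x,r}(A,B), d^{x,r}(B,A))`. -/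
def Dxr {n : ℕ} (x : E n) (r : ℝ) (A B : Set (E n)) : ℝ :=
  max (dxr x r A B) (dxr x r B A)

/-- `d̃^{x,r}(A,B) = (1/r) d(A ∩ B(x,r), B)`. -/
def dtxr {n : ℕ} (x : E n) (r : ℝ) (A B : Set (E n)) : ℝ :=
  (1 / r) * setD (A ∩ closedBall x r) B

/-- `D̃^{x,r}(A,B) = max(d̃^{x,r}(A,B), d̃^{x,r}(B,A))`. -/
def Dtxr {n : ℕ} (x : E n) (r : ℝ) (A B : Set (E n)) : ℝ :=
  max (dtxr x r A B) (dtxr x r B A)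

/-- `C` is a cone based at `y`: `y ∈ C` and `s • (C − y) = C − y` for all `s > 0`. -/
def IsConeAt {n : ℕ} (y : E n) (C : Set (E n)) : Prop :=
  y ∈ C ∧ ∀ s : ℝ, 0 < s → s • {z : E n | y + z ∈ C} = {z : E n | y + z ∈ C}

/-- The standard KP cone `{x₄² = x₁² + x₂² + x₃²}` in `ℝⁿ`, `n ≥ 4`. -/
def stdKP (n : ℕ) (hn : 4 ≤ n) : Set (E n) :=
  {x : E n | (x ⟨3, by omega⟩) ^ 2 =
    (x ⟨0, by omega⟩) ^ 2 + (x ⟨1, by omega⟩) ^ 2 + (x ⟨2, by omega⟩) ^ 2}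

/-- `C` is a KP cone based at `y`: in some orthonormal coordinates centered at the origin,
`C − y` is the standard KP cone. -/
def IsKPCone {n : ℕ} (hn : 4 ≤ n) (y : E n) (C : Set (E n)) : Prop :=
  ∃ f : E n ≃ₗᵢ[ℝ] E n, {z : E n | y + z ∈ C} = f ⁻¹' stdKP n hn

/-- `θ^P_Σ(x,r)` : best approximation of `S` in `B(x,r)` by affine `m`-planes through `x`. -/
def thetaP {n : ℕ} (m : ℕ) (S : Set (E n)) (x : E n) (r : ℝ) : ℝ :=
  ⨅ L : {L : AffineSubspace ℝ (E n) // x ∈ L ∧ Module.finrank ℝ L.direction = m},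
    Dxr x r S (L.1 : Set (E n))

/-- `θ^C_Σ(x,r)` : best approximation of `S` in `B(x,r)` by KP cones based at `x`. -/
def thetaC {n : ℕ} (hn : 4 ≤ n) (S : Set (E n)) (x : E n) (r : ℝ) : ℝ :=
  ⨅ C : {C : Set (E n) // IsKPCone hn x C}, Dxr x r S C.1

/-- `ϑ^C_Σ(x,r)` : best approximation of `S` in `B(x,r)` by KP cones containing `x`. -/
def varthetaC {n : ℕ} (hn : 4 ≤ n) (S : Set (E n)) (x : E n) (r : ℝ) : ℝ :=
  ⨅ C : {C : Set (E n) // (∃ y, IsKPCone hn y C) ∧ x ∈ C}, Dxr x r S C.1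

/-- The angle `∠(P₁,P₂) = arcsin Γ(P₁,P₂)` between two affine planes. -/
def planeAngle {n : ℕ} (P₁ P₂ : AffineSubspace ℝ (E n)) : ℝ :=
  Real.arcsin (dxr (0 : E n) 1 (P₁.direction : Set (E n)) (P₂.direction : Set (E n)))

/-- The support of a measure. -/
def msupp {n : ℕ} (μ : Measure (E n)) : Set (E n) :=
  {x : E n | ∀ r : ℝ, 0 < r → 0 < μ (closedBall x r)}

/-- Weak convergence of a sequence of measures in the sense of Radon measures. -/
def VagueTendsto {n : ℕ} (μs : ℕ → Measure (E n)) (ν : Measure (E n)) : Prop :=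
  ∀ f : E n → ℝ, Continuous f → HasCompactSupport f →
    Tendsto (fun i => ∫ y, f y ∂(μs i)) atTop (nhds (∫ y, f y ∂ν))

/-- `ν` is a tangent measure of `μ` at `x`: `ν ≠ 0` and for some `rᵢ ↓ 0`, `cᵢ > 0`,
`cᵢ (T_{x,rᵢ})₊μ → ν` weakly. -/
def IsTangentMeasure {n : ℕ} (μ ν : Measure (E n)) (x : E n) : Prop :=
  ν ≠ 0 ∧ ∃ r c : ℕ → ℝ, (∀ i, 0 < r i) ∧ Tendsto r atTop (nhds 0) ∧ (∀ i, 0 < c i) ∧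
    VagueTendsto (fun i => ENNReal.ofReal (c i) • Measure.map (fun y => (r i)⁻¹ • (y - x)) μ) ν

/-- `μ` is `m`-asymptotically optimally doubling. -/
def AOD {n : ℕ} (m : ℕ) (μ : Measure (E n)) : Prop :=
  ∀ K : Set (E n), K ⊆ msupp μ → IsCompact K → ∀ δ : ℝ, 0 < δ →
    ∃ r₀ : ℝ, 0 < r₀ ∧ ∀ x ∈ K, ∀ r : ℝ, 0 < r → r ≤ r₀ →
      ∀ τ : ℝ, τ ∈ Set.Icc (1/2 : ℝ) 1 →
        |(μ (closedBall x (τ * r))).toReal / (μ (closedBall x r)).toReal - τ ^ m| < δ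

/-- `ν` is `m`-flat: `m`-dimensional Hausdorff measure restricted to an affine `m`-plane. -/
def IsFlatMeasure {n : ℕ} (m : ℕ) (ν : Measure (E n)) : Prop :=
  ∃ L : AffineSubspace ℝ (E n), (L : Set (E n)).Nonempty ∧
    Module.finrank ℝ L.direction = m ∧
    ν = (Measure.hausdorffMeasure (m : ℝ)).restrict (L : Set (E n))

/-- Volume of the unit ball in `ℝᵐ`. -/
def unitBallVol (m : ℕ) : ℝ := (volume (Metric.ball (0 : EuclideanSpace ℝ (Fin m)) 1)).toReal

/-- `ω₃`, the volume of the unit `3`-ball. -/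
def omega3 : ℝ := unitBallVol 3

/-- The second moment `Q_{0,r}` of a measure on `ℝ⁴`. -/
def Qmom (μ : Measure (E 4)) (r : ℝ) (z : E 4) : ℝ :=
  (5 / (omega3 * r ^ 5)) * ∫ w in closedBall (0 : E 4) r, ⟪z, w⟫ ^ 2 ∂μ

/-- Entries `q_{ij}` of the second moment matrix in given directions. -/
def qmom (μ : Measure (E 4)) (r : ℝ) (u v : E 4) : ℝ :=
  (5 / (omega3 * r ^ 5)) * ∫ w in closedBall (0 : E 4) r, ⟪u, w⟫ * ⟪v, w⟫ ∂μ

/-- `μ` is `(α,m)`-Hölder asymptotically uniform. -/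
def HolderAsympUniform {n : ℕ} (α : ℝ) (m : ℕ) (μ : Measure (E n)) : Prop :=
  ∀ K : Set (E n), K ⊆ msupp μ → IsCompact K →
    ∃ C r₀ : ℝ, 0 < r₀ ∧ ∀ x ∈ K, ∀ r : ℝ, 0 < r → r ≤ r₀ →
      |(μ (closedBall x r)).toReal / (unitBallVol m * r ^ m) - 1| ≤ C * r ^ α

/-- `φ` is a `C^{1,β}` diffeomorphism from `U` onto `U'`: a continuously differentiable bijection
with `β`-Hölder derivative whose inverse is also `C^{1,β}`. -/
def IsC1HolderDiffeoOn (β : ℝ) (U U' : Set (E 4)) (φ : E 4 → E 4) : Prop :=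
  Set.BijOn φ U U' ∧
  (∀ x ∈ U, HasFDerivAt φ (fderiv ℝ φ x) x) ∧
  (∃ M : ℝ, ∀ x ∈ U, ∀ y ∈ U, ‖fderiv ℝ φ x - fderiv ℝ φ y‖ ≤ M * ‖x - y‖ ^ β) ∧
  ∃ ψ : E 4 → E 4, Set.BijOn ψ U' U ∧
    (∀ x ∈ U, ψ (φ x) = x) ∧ (∀ y ∈ U', φ (ψ y) = y) ∧
    (∀ y ∈ U', HasFDerivAt ψ (fderiv ℝ ψ y) y) ∧
    (∃ M : ℝ, ∀ x ∈ U', ∀ y ∈ U', ‖fderiv ℝ ψ x - fderiv ℝ ψ y‖ ≤ M * ‖x - y‖ ^ β)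


abbrev V := E 4

structure AU (μ : Measure V) (S : Set V) (δ : ℝ) : Prop where
  fin : IsFiniteMeasure μ
  cl : IsClosed S
  null : μ Sᶜ = 0
  pos : 0 < δ
  ball : ∀ x ∈ S, δ * ‖x‖ ≤ 1 → ∀ u : ℝ, 0 < u →
    |μ.real (closedBall x u) - omega3 * u ^ 3| ≤ δ * (1 + u) * u ^ 3

lemma om_eq : omega3 = Real.pi * 4 / 3 := by
  unfold omega3 unitBallVol
  rw [InnerProductSpace.volume_ball_of_dim_odd (k := 1) (by simp)]
  simp [Nat.doubleFactorial]
  rw [ENNReal.toReal_ofReal (by positivity)]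
  ring

lemma om_lo : 4 < omega3 := by
  rw [om_eq]; linarith only [Real.pi_gt_three]
lemma om_hi : omega3 < 5 := by
  rw [om_eq]; linarith only [Real.pi_lt_d2]

lemma lc (μ : Measure V) [IsFiniteMeasure μ] (φ ψ : ℝ → ℝ) (x : V)
    (hd : ∀ u, HasDerivAt φ (-ψ u) u) (hψ : IntegrableOn ψ (Ioi 0))
    (h0 : Tendsto φ atTop (𝓝 0)) :
    ∫ y, φ ‖y - x‖ ∂μ = ∫ u in Ioi (0:ℝ), ψ u * μ.real (closedBall x u) := by
  have key : ∀ y : V, φ ‖y - x‖ =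
      ∫ u in Ioi (0:ℝ), (if ‖y - x‖ ≤ u then ψ u else 0) := by
    intro y
    have h1 : ∫ u in Ioi ‖y - x‖, -ψ u = 0 - φ ‖y - x‖ :=
      integral_Ioi_of_hasDerivAt_of_tendsto' (fun u _ => hd u)
        ((hψ.mono_set (Ioi_subset_Ioi (norm_nonneg _))).neg) h0
    have h2 : ∫ u in Ioi (0:ℝ), (if ‖y - x‖ ≤ u then ψ u else 0) =
        ∫ u in Ioi (0:ℝ) ∩ Ici ‖y - x‖, ψ u := by
      rw [← setIntegral_indicator measurableSet_Ici]
      rfl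
    rw [h2, ← integral_indicator (measurableSet_Ioi.inter measurableSet_Ici),
      ]
    rw [integral_neg] at h1
    have h3 : ∫ u in Ioi ‖y - x‖, ψ u = φ ‖y - x‖ := by linarith
    rw [← h3, integral_indicator (measurableSet_Ioi.inter measurableSet_Ici)]
    apply setIntegral_congr_set
    have e1 : (Ioi ‖y - x‖ : Set ℝ) =ᵐ[volume] Ici ‖y - x‖ := Ioi_ae_eq_Ici
    have e2 : (Ioi (0:ℝ) ∩ Ici ‖y - x‖ : Set ℝ) =ᵐ[volume] (Ici 0 ∩ Ici ‖y - x‖ : Set ℝ) :=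
      Ioi_ae_eq_Ici.inter (ae_eq_refl _)
    refine e1.trans (EventuallyEq.trans ?_ e2.symm)
    rw [Ici_inter_Ici, sup_eq_right.2 (norm_nonneg _)]
    exact EventuallyEq.rfl
  simp_rw [key]
  rw [integral_integral_swap]
  · apply setIntegral_congr_fun measurableSet_Ioi
    intro u _
    have : (fun y : V => if ‖y - x‖ ≤ u then ψ u else 0) =
        (closedBall x u).indicator (fun _ => ψ u) := by
      ext y; simp [indicator, mem_closedBall, dist_eq_norm]
    show ∫ y, (if ‖y - x‖ ≤ u then ψ u else 0) ∂μ = _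
    rw [this, integral_indicator isClosed_closedBall.measurableSet]
    simp [mul_comm]
  · have hs : MeasurableSet {p : V × ℝ | ‖p.1 - x‖ ≤ p.2} :=
      measurableSet_le (by fun_prop) (by fun_prop)
    have hi : Integrable (fun p : V × ℝ => ψ p.2) (μ.prod (volume.restrict (Ioi 0))) := by
      have := (integrable_const (1:ℝ) (μ := μ)).mul_prod hψ
      simpa using this
    exact (hi.indicator hs).congr (ae_of_all _ fun p => by simp [indicator, Function.uncurry])

lemma ge_int (k : ℕ) {a : ℝ} (ha : 0 < a) :
    IntegrableOn (fun u : ℝ => u ^ k * Real.exp (-a * u ^ 2)) (Ioi 0) := by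
  have := integrableOn_rpow_mul_exp_neg_mul_sq ha (s := k) (by
    have : (0:ℝ) ≤ k := k.cast_nonneg
    linarith)
  simpa using this

def Ik (k : ℕ) : ℝ := ∫ u in Ioi (0:ℝ), u ^ k * Real.exp (-1 * u ^ 2)

lemma Ik_pos (k : ℕ) : 0 < Ik k := by
  unfold Ik
  rw [setIntegral_pos_iff_support_of_nonneg_ae]
  · have : Ioi (0:ℝ) ⊆ Function.support (fun u : ℝ => u ^ k * Real.exp (-1 * u ^ 2)) ∩ Ioi 0 := by
      intro u hu
      refine ⟨?_, hu⟩
      have : (0:ℝ) < u := hu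
      simp only [Function.mem_support]
      positivity
    exact lt_of_lt_of_le (by simp) (measure_mono this)
  · filter_upwards [ae_restrict_mem measurableSet_Ioi] with u hu
    have : (0:ℝ) < u := hu
    simp only [Pi.zero_apply]; positivity
  · exact ge_int k one_pos

lemma Ik_rec (k : ℕ) : Ik (k + 2) = ((k:ℝ) + 1) / 2 * Ik k := by
  have h : ∀ j : ℕ, Ik j = 1 / 2 * Real.Gamma ((j + 1) / 2) := by
    intro j
    have := integral_rpow_mul_exp_neg_rpow (p := 2) (q := j) (by norm_num) (by
      have : (0:ℝ) ≤ j := j.cast_nonneg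
      linarith)
    rw [← this]; unfold Ik
    apply setIntegral_congr_fun measurableSet_Ioi
    intro u _
    simp
  rw [h, h]
  have : ((k + 2 : ℕ) + 1 : ℝ) / 2 = (k + 1) / 2 + 1 := by push_cast; ring
  rw [this, Real.Gamma_add_one (by positivity)]
  ring

def cG : ℝ := 2 * omega3 * Ik 4
lemma cG_pos : 0 < cG := by
  unfold cG; have := om_lo; have := Ik_pos 4; positivity

lemma lc_est (φ ψ : ℝ → ℝ) 
    (hd : ∀ u, HasDerivAt φ (-ψ u) u)
    (h0 : Tendsto φ atTop (𝓝 0))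
    (hψ : ∀ k : ℕ, IntegrableOn (fun u => u ^ k * ψ u) (Ioi 0)) :
    ∃ C > 0, ∀ μ S δ, AU μ S δ → ∀ x ∈ S, δ * ‖x‖ ≤ 1 →
      |∫ y, φ ‖y - x‖ ∂μ - omega3 * ∫ u in Ioi (0:ℝ), u ^ 3 * ψ u| ≤ C * δ := by
  refine ⟨(∫ u in Ioi (0:ℝ), (|u ^ 3 * ψ u| + |u ^ 4 * ψ u|)) + 1,
    add_pos_of_nonneg_of_pos (integral_nonneg fun u => by positivity) one_pos, ?_⟩
  intro μ S δ h x hx hxd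
  have := h.fin
  have hd0 := h.pos
  suffices |∫ y, φ ‖y - x‖ ∂μ - omega3 * ∫ u in Ioi (0:ℝ), u ^ 3 * ψ u| ≤
      δ * ∫ u in Ioi (0:ℝ), (|u ^ 3 * ψ u| + |u ^ 4 * ψ u|) by linarith
  rw [lc μ φ ψ x hd (by simpa using hψ 0) h0]
  rw [← integral_const_mul, ← integral_const_mul, ← integral_sub]
  · rw [← Real.norm_eq_abs]
    apply norm_integral_le_of_norm_le
    · exact (((hψ 3).abs.add (hψ 4).abs).const_mul δ)
    · filter_upwards [ae_restrict_mem measurableSet_Ioi] with u hu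
      have hu : (0:ℝ) < u := hu
      have := h.ball x hx hxd u hu
      have e : ψ u * μ.real (closedBall x u) - omega3 * (u ^ 3 * ψ u) =
        ψ u * (μ.real (closedBall x u) - omega3 * u ^ 3) := by ring
      rw [e, Real.norm_eq_abs, abs_mul, abs_mul, abs_mul, abs_of_pos (pow_pos hu 3), abs_of_pos (pow_pos hu 4)]
      calc _ ≤ |ψ u| * (δ * (1 + u) * u ^ 3) := by gcongr
        _ = _ := by ring
  · have hm : Measurable fun u => μ.real (closedBall x u) := by
      apply Monotone.measurable
      intro a b hab
      exact measureReal_mono (closedBall_subset_closedBall hab)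
    have h1 : IntegrableOn ψ (Ioi 0) := by simpa using hψ 0
    refine (Integrable.mono' (h1.abs.const_mul (μ.real univ)) 
      (h1.aestronglyMeasurable.mul hm.aestronglyMeasurable) ?_)
    refine ae_of_all _ fun u => ?_
    rw [Real.norm_eq_abs, abs_mul, abs_of_nonneg measureReal_nonneg, mul_comm]
    exact mul_le_mul_of_nonneg_right (measureReal_mono (subset_univ _)) (abs_nonneg _)
  · exact (hψ 3).const_mul _

lemma exp_tend (k : ℕ) {a : ℝ} (ha : 0 < a) :
    Tendsto (fun u : ℝ => u ^ k * Real.exp (-a * u ^ 2)) atTop (𝓝 0) := by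
  have := (tendsto_rpow_abs_mul_exp_neg_mul_sq_cocompact ha (k:ℝ))
  have h2 := this.mono_left (atTop_le_cocompact)
  refine h2.congr' ?_
  filter_upwards [eventually_gt_atTop 0] with u hu
  simp [abs_of_pos hu]

lemma g0_est : ∃ C > 0, ∀ μ S δ, AU μ S δ → ∀ x ∈ S, δ * ‖x‖ ≤ 1 →
    |∫ y, Real.exp (-‖y - x‖ ^ 2) ∂μ - cG| ≤ C * δ := by
  have hint : ∀ k : ℕ, IntegrableOn (fun u : ℝ => u ^ k * (2 * u * Real.exp (-1 * u ^ 2))) (Ioi 0) := by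
    intro k
    refine ((ge_int (k+1) one_pos).const_mul 2).congr (ae_of_all _ fun u => ?_)
    simp only; ring
  obtain ⟨C, hC, this⟩ := lc_est (fun u => Real.exp (-1 * u ^ 2)) (fun u => 2 * u * Real.exp (-1 * u ^ 2))
    (fun u => by
      have := ((hasDerivAt_pow 2 u).const_mul (-1)).exp
      convert this using 1; simp; ring)
    (by simpa using exp_tend 0 one_pos) hint
  refine ⟨C, hC, ?_⟩
  intro μ S δ h x hx hxd
  have h1 := this μ S δ h x hx hxd
  rename_bvar zz → zz
  have e : omega3 * ∫ u in Ioi (0:ℝ), u ^ 3 * (2 * u * Real.exp (-1 * u ^ 2)) = cG := by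
    unfold cG Ik
    rw [mul_comm 2 omega3, mul_assoc, ← integral_const_mul 2]
    congr 2; ext u; ring
  rw [e] at h1
  simp only [neg_mul, one_mul] at h1 ⊢
  exact h1

lemma g2_est : ∃ C > 0, ∀ μ S δ, AU μ S δ → 0 ∈ S →
    |∫ y, ‖y‖ ^ 2 * Real.exp (-‖y‖ ^ 2) ∂μ - 3 / 2 * cG| ≤ C * δ := by
  have hint : ∀ k : ℕ, IntegrableOn (fun u : ℝ => u ^ k * (2 * (u ^ 3 - u) * Real.exp (-1 * u ^ 2))) (Ioi 0) := by
    intro k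
    refine (((ge_int (k+3) one_pos).sub (ge_int (k+1) one_pos)).const_mul 2).congr (ae_of_all _ fun u => ?_)
    simp only [Pi.sub_apply]; ring
  obtain ⟨C, hC, this⟩ := lc_est (fun u => u ^ 2 * Real.exp (-1 * u ^ 2)) (fun u => 2 * (u ^ 3 - u) * Real.exp (-1 * u ^ 2))
    (fun u => by
      have := (hasDerivAt_pow 2 u).mul ((hasDerivAt_pow 2 u).const_mul (-1)).exp
      exact this.congr_deriv (by push_cast; ring))
    (exp_tend 2 one_pos) hint
  refine ⟨C, hC, ?_⟩
  intro μ S δ h hx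
  have h1 := this μ S δ h 0 hx (by simp)
  rename_bvar zz → zz
  have e : omega3 * ∫ u in Ioi (0:ℝ), u ^ 3 * (2 * (u ^ 3 - u) * Real.exp (-1 * u ^ 2)) = 3 / 2 * cG := by
    have h3 : ∫ u in Ioi (0:ℝ), u ^ 3 * (2 * (u ^ 3 - u) * Real.exp (-1 * u ^ 2)) = 2 * (Ik 6 - Ik 4) := by
      unfold Ik
      rw [← integral_sub (ge_int 6 one_pos) (ge_int 4 one_pos), ← integral_const_mul]
      congr 1; ext u; ring
    have := Ik_rec 4
    norm_num at this
    rw [h3, this]; unfold cG; ring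
  rw [e] at h1
  simp only [neg_mul, one_mul, sub_zero] at h1 ⊢
  exact h1

lemma gh_est : ∃ C > 0, ∀ μ S δ, AU μ S δ → δ ≤ 1 → 0 ∈ S →
    ∫ y, Real.exp (-‖y‖ ^ 2 / 2) ∂μ ≤ C := by
  have hint : ∀ k : ℕ, IntegrableOn (fun u : ℝ => u ^ k * (u * Real.exp (-(1/2) * u ^ 2))) (Ioi 0) := by
    intro k
    refine (ge_int (k+1) (half_pos one_pos)).congr (ae_of_all _ fun u => ?_)
    simp only; ring
  obtain ⟨C, hC, this⟩ := lc_est (fun u => Real.exp (-(1/2) * u ^ 2)) (fun u => u * Real.exp (-(1/2) * u ^ 2))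
    (fun u => by
      have := ((hasDerivAt_pow 2 u).const_mul (-(1/2))).exp
      convert this using 1; simp; ring)
    (by simpa using exp_tend 0 (half_pos one_pos)) hint
  set a := omega3 * ∫ u in Ioi (0:ℝ), u ^ 3 * (u * Real.exp (-(1/2) * u ^ 2))
  refine ⟨|a| + C, by positivity, ?_⟩
  intro μ S δ h hd hx
  have h1 := (abs_le.1 (this μ S δ h 0 hx (by simp))).2
  rename_bvar zz → zz
  have e : ∀ y : V, Real.exp (-‖y‖ ^ 2 / 2) = Real.exp (-(1/2) * ‖y - 0‖ ^ 2) := by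
    intro y; congr 1; simp; ring
  simp_rw [e]
  have := mul_le_mul_of_nonneg_left hd hC.le
  linarith only [le_abs_self a, h1, this]


def G (μ : Measure V) (f : V → ℝ) : ℝ := ∫ y, Real.exp (-‖y‖ ^ 2) * f y ∂μ

lemma exp_dom (k : ℕ) {t : ℝ} (ht : 0 ≤ t) :
    Real.exp (-t ^ 2) * ((1 + t) ^ k * Real.exp (8 * t)) ≤
      k.factorial * Real.exp 42 * Real.exp (-t ^ 2 / 2) := by
  have h1 : (1 + t) ^ k ≤ k.factorial * Real.exp (1 + t) := by
    have := Real.pow_div_factorial_le_exp (1 + t) (by linarith) k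
    rw [div_le_iff₀ (by positivity)] at this
    linarith
  calc _ ≤ Real.exp (-t ^ 2) * ((k.factorial * Real.exp (1 + t)) * Real.exp (8 * t)) := by gcongr
    _ = k.factorial * Real.exp (-t ^ 2 + (1 + t) + 8 * t) := by
      rw [Real.exp_add _ (8 * t), Real.exp_add _ (1 + t)]; ring
    _ ≤ k.factorial * Real.exp (42 + -t ^ 2 / 2) := by
      have : -t ^ 2 + (1 + t) + 8 * t ≤ 42 + -t ^ 2 / 2 := by nlinarith only [sq_nonneg (t - 9)]
      gcongr
    _ = _ := by rw [Real.exp_add]; ring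

lemma AU.ae {μ : Measure V} {S : Set V} {δ : ℝ} (h : AU μ S δ) : ∀ᵐ y ∂μ, y ∈ S := by
  rw [ae_iff]; exact h.null

lemma G_bd (k : ℕ) : ∃ C > 0, ∀ μ S δ, AU μ S δ → δ ≤ 1 → 0 ∈ S → ∀ f : V → ℝ, Measurable f →
    ∀ K, 0 ≤ K → (∀ y ∈ S, |f y| ≤ K * ((1 + ‖y‖) ^ k * Real.exp (8 * ‖y‖))) →
    Integrable (fun y => Real.exp (-‖y‖ ^ 2) * f y) μ ∧ |G μ f| ≤ C * K := by
  obtain ⟨C, hC, hh⟩ := gh_est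
  refine ⟨k.factorial * Real.exp 42 * C, by positivity, ?_⟩
  intro μ S δ h hd h0 f hf K hK hb
  have := h.fin
  have hi : Integrable (fun y : V => K * (k.factorial * Real.exp 42 * Real.exp (-‖y‖ ^ 2 / 2))) μ := by
    apply Integrable.const_mul
    apply Integrable.const_mul
    refine Integrable.mono' (integrable_const 1) (by fun_prop) (ae_of_all _ fun y => ?_)
    rw [Real.norm_eq_abs, Real.abs_exp]
    apply Real.exp_le_one_iff.2
    have : 0 ≤ ‖y‖ ^ 2 := by positivity
    linarith
  rename_bvar zz → zz
  have hbd : ∀ᵐ y ∂μ, ‖Real.exp (-‖y‖ ^ 2) * f y‖ ≤ K * (k.factorial * Real.exp 42 * Real.exp (-‖y‖ ^ 2 / 2)) := by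
    filter_upwards [h.ae] with y hy
    rw [Real.norm_eq_abs, abs_mul, Real.abs_exp]
    calc _ ≤ Real.exp (-‖y‖ ^ 2) * (K * ((1 + ‖y‖) ^ k * Real.exp (8 * ‖y‖))) := by gcongr; exact hb y hy
      _ = K * (Real.exp (-‖y‖ ^ 2) * ((1 + ‖y‖) ^ k * Real.exp (8 * ‖y‖))) := by ring
      _ ≤ _ := mul_le_mul_of_nonneg_left (exp_dom k (norm_nonneg y)) hK
  refine ⟨hi.mono' (by fun_prop) hbd, ?_⟩
  have h2 := norm_integral_le_of_norm_le hi hbd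
  rw [integral_const_mul, integral_const_mul] at h2
  refine (h2.trans ?_)
  have := hh μ S δ h hd h0
  calc _ ≤ K * (k.factorial * Real.exp 42 * C) := by gcongr
    _ = _ := by ring

lemma one_le_gr (k : ℕ) (y : V) : 1 ≤ (1 + ‖y‖) ^ k * Real.exp (8 * ‖y‖) := by
  have h1 : 1 ≤ (1 + ‖y‖) ^ k := one_le_pow₀ (by linarith [norm_nonneg y])
  have h2 : 1 ≤ Real.exp (8 * ‖y‖) := Real.one_le_exp (by positivity)
  nlinarith only [h1, h2]

/-- polynomial growth is integrable -/
lemma G_int {μ S δ} (h : AU μ S δ) (hd : δ ≤ 1) (h0 : (0:V) ∈ S) (k : ℕ) {f : V → ℝ}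
    (hf : Measurable f) {K : ℝ} (hb : ∀ y ∈ S, |f y| ≤ K * ((1 + ‖y‖) ^ k * Real.exp (8 * ‖y‖))) :
    Integrable (fun y => Real.exp (-‖y‖ ^ 2) * f y) μ := by
  obtain ⟨C, hC, hh⟩ := G_bd k
  refine (hh μ S δ h hd h0 f hf |K| (abs_nonneg _) ?_).1
  intro y hy
  refine (hb y hy).trans ?_
  gcongr
  exact le_abs_self K

lemma gr_poly (k : ℕ) (y : V) : ‖y‖ ^ k ≤ (1 + ‖y‖) ^ k * Real.exp (8 * ‖y‖) := by
  have h1 : ‖y‖ ^ k ≤ (1 + ‖y‖) ^ k := by gcongr; linarith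
  have h2 : 1 ≤ Real.exp (8 * ‖y‖) := Real.one_le_exp (by positivity)
  have h3 : 0 ≤ (1 + ‖y‖) ^ k := by positivity
  nlinarith only [h1, h2, h3]

lemma G_add {μ : Measure V} {f g : V → ℝ} (hf : Integrable (fun y => Real.exp (-‖y‖ ^ 2) * f y) μ)
    (hg : Integrable (fun y => Real.exp (-‖y‖ ^ 2) * g y) μ) :
    G μ (fun y => f y + g y) = G μ f + G μ g := by
  unfold G; rw [← integral_add hf hg]; congr 1; ext y; ring

lemma G_sub {μ : Measure V} {f g : V → ℝ} (hf : Integrable (fun y => Real.exp (-‖y‖ ^ 2) * f y) μ)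
    (hg : Integrable (fun y => Real.exp (-‖y‖ ^ 2) * g y) μ) :
    G μ (fun y => f y - g y) = G μ f - G μ g := by
  unfold G; rw [← integral_sub hf hg]; congr 1; ext y; ring

lemma G_smul {μ : Measure V} (a : ℝ) (f : V → ℝ) :
    G μ (fun y => a * f y) = a * G μ f := by
  unfold G; rw [← integral_const_mul]; congr 1; ext y; ring

structure GD (μ : Measure V) (b : V) (q : V →ₗ[ℝ] V →ₗ[ℝ] ℝ) : Prop where
  beq : ∀ u, cG * ⟪b, u⟫ = G μ (fun y => ⟪u, y⟫)
  qeq : ∀ u v, cG * (q u v + ⟪u, v⟫) = 2 * G μ (fun y => ⟪u, y⟫ * ⟪v, y⟫)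

lemma GD.symm {μ b q} (h : GD μ b q) (u v : V) : q u v = q v u := by
  have h1 := h.qeq u v
  have h2 := h.qeq v u
  have : (fun y : V => ⟪u, y⟫ * ⟪v, y⟫) = fun y => ⟪v, y⟫ * ⟪u, y⟫ := by ext y; ring
  rw [this, ← h2, real_inner_comm] at h1
  rename_bvar zz → zz
  have := mul_left_cancel₀ cG_pos.ne' h1
  linarith

lemma li_int {μ S δ} (h : AU μ S δ) (hd : δ ≤ 1) (h0 : (0:V) ∈ S) (u : V) :
    Integrable (fun y => Real.exp (-‖y‖ ^ 2) * ⟪u, y⟫) μ := 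
  G_int h hd h0 1 (K := ‖u‖) (by fun_prop) fun y _ => by
    have := abs_real_inner_le_norm u y
    have := gr_poly 1 y
    rw [pow_one] at this
    nlinarith [norm_nonneg u]

lemma qu_int {μ S δ} (h : AU μ S δ) (hd : δ ≤ 1) (h0 : (0:V) ∈ S) (u v : V) :
    Integrable (fun y => Real.exp (-‖y‖ ^ 2) * (⟪u, y⟫ * ⟪v, y⟫)) μ := 
  G_int h hd h0 2 (K := ‖u‖ * ‖v‖) (by fun_prop) fun y _ => by
    have h1 := abs_real_inner_le_norm u y
    have h2 := abs_real_inner_le_norm v y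
    have h3 := gr_poly 2 y
    rw [abs_mul]
    calc _ ≤ (‖u‖ * ‖y‖) * (‖v‖ * ‖y‖) := by gcongr
      _ = ‖u‖ * ‖v‖ * ‖y‖ ^ 2 := by ring
      _ ≤ _ := by gcongr

lemma GD_exists {μ S δ} (h : AU μ S δ) (hd : δ ≤ 1) (h0 : (0:V) ∈ S) : ∃ b q, GD μ b q := by
  have hc := cG_pos.ne'
  let L : V →ₗ[ℝ] ℝ :=
    { toFun := fun u => cG⁻¹ * G μ (fun y => ⟪u, y⟫)
      map_add' := fun u v => by
        simp only [inner_add_left]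
        rw [G_add (li_int h hd h0 u) (li_int h hd h0 v)]; ring
      map_smul' := fun a u => by
        simp only [inner_smul_left]
        rw [G_smul]; simp; ring }
  refine ⟨(InnerProductSpace.toDual ℝ V).symm (LinearMap.toContinuousLinearMap L),
    LinearMap.mk₂ ℝ (fun u v => 2 * cG⁻¹ * G μ (fun y => ⟪u, y⟫ * ⟪v, y⟫) - ⟪u, v⟫) ?_ ?_ ?_ ?_, ?_, ?_⟩
  · intro u u' v
    simp only [inner_add_left, add_mul]
    rw [G_add (qu_int h hd h0 u v) (qu_int h hd h0 u' v)]; ring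
  · intro a u v
    simp only [inner_smul_left, mul_assoc]
    rw [G_smul]; simp; ring
  · intro u v v'
    simp only [inner_add_left, inner_add_right, mul_add]
    rw [G_add (qu_int h hd h0 u v) (qu_int h hd h0 u v')]; ring
  · intro a u v
    simp only [inner_smul_left, inner_smul_right, mul_left_comm _ ((starRingEnd ℝ) a)]
    rw [G_smul]; simp; ring
  · intro u
    rw [InnerProductSpace.toDual_symm_apply]
    simp only [LinearMap.coe_toContinuousLinearMap', L, LinearMap.coe_mk, AddHom.coe_mk]
    field_simp
  · intro u v
    simp only [LinearMap.mk₂_apply]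
    field_simp
    ring

lemma exp_id (x y : V) : Real.exp (-‖y - x‖ ^ 2) =
    Real.exp (-‖x‖ ^ 2) * (Real.exp (-‖y‖ ^ 2) * Real.exp (2 * ⟪x, y⟫)) := by
  rw [← Real.exp_add, ← Real.exp_add, norm_sub_sq_real, real_inner_comm]
  ring_nf

lemma exp3 (t : ℝ) : |Real.exp t - 1 - t - t ^ 2 / 2| ≤ |t| ^ 3 * Real.exp |t| := by
  have := Complex.norm_exp_sub_sum_le_norm_mul_exp (t : ℂ) 3
  have e : (Complex.exp t - ∑ m ∈ Finset.range 3, (t:ℂ) ^ m / m.factorial) =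
    ((Real.exp t - 1 - t - t ^ 2 / 2 : ℝ) : ℂ) := by
    simp [Finset.sum_range_succ]; ring
  rw [e, Complex.norm_real, Complex.norm_real] at this
  simpa using this

/-- generating function at points of S -/
lemma gen_est : ∃ C > 0, ∀ μ S δ, AU μ S δ → δ ≤ 1 → 0 ∈ S → ∀ x ∈ S, ‖x‖ ≤ 1 →
    |G μ (fun y => Real.exp (2 * ⟪x, y⟫)) - cG * Real.exp (‖x‖ ^ 2)| ≤ C * δ := by
  obtain ⟨C, hC, h⟩ := g0_est
  refine ⟨Real.exp 1 * C, by positivity, ?_⟩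
  intro μ S δ hA hd h0 x hx hx1
  have h1 := h μ S δ hA x hx (by nlinarith only [hA.pos, norm_nonneg x, hx1, hd])
  simp_rw [exp_id x] at h1
  rw [integral_const_mul] at h1
  have e : G μ (fun y => Real.exp (2 * ⟪x, y⟫)) - cG * Real.exp (‖x‖ ^ 2) = Real.exp (‖x‖ ^ 2) *
    (Real.exp (-‖x‖ ^ 2) * ∫ y, Real.exp (-‖y‖ ^ 2) * Real.exp (2 * ⟪x, y⟫) ∂μ - cG) := by
    unfold G
    rw [mul_sub, ← mul_assoc, ← Real.exp_add]; simp; ring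
  rw [e, abs_mul, Real.abs_exp, mul_assoc]
  rename_bvar zz → zz
  have : ‖x‖ ^ 2 ≤ 1 := by nlinarith only [norm_nonneg x, hx1]
  gcongr

lemma onb_sum (e : OrthonormalBasis (Fin 4) ℝ V) (y : V) :
    ∑ i, ⟪e i, y⟫ * ⟪e i, y⟫ = ‖y‖ ^ 2 := by
  have := e.sum_sq_norm_inner_right y
  rw [← this]; simp [pow_two]

lemma P_lemma : ∃ C > 0, ∀ μ S δ, AU μ S δ → δ ≤ 1 → 0 ∈ S → ∀ b q, GD μ b q →
    (∀ x ∈ S, ‖x‖ ≤ 1 → |2 * ⟪b, x⟫ + q x x| ≤ C * (‖x‖ ^ 3 + δ)) ∧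
    (∀ e : OrthonormalBasis (Fin 4) ℝ V, |∑ i, q (e i) (e i) + 1| ≤ C * δ) ∧
    (∀ u, -‖u‖ ^ 2 ≤ q u u) ∧ ‖b‖ ≤ C ∧ ∀ u v, |q u v| ≤ C * (‖u‖ * ‖v‖) := by
  obtain ⟨C1, hC1, g1⟩ := gen_est
  obtain ⟨C2, hC2, g2⟩ := g2_est
  obtain ⟨C3, hC3, g3⟩ := G_bd 3
  rename_bvar zz → zz
  obtain ⟨C4, hC4, g4⟩ := G_bd 1
  obtain ⟨C5, hC5, g5⟩ := G_bd 2
  have hc := cG_pos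
  refine ⟨1 + (C1 + C1 + 8 * C3) / cG + 2 + 2 * C2 / cG + C4 / cG + 2 * C5 / cG, by positivity, ?_⟩
  have absm : ∀ a, cG * |a| = |cG * a| := fun a => by rw [abs_mul, abs_of_pos hc]
  rename_bvar zz → zz
  have aux : ∀ {a b : ℝ}, cG * |a| ≤ b → |a| ≤ b / cG := by
    intro a b h; rw [le_div_iff₀ hc]; linarith
  intro μ S δ h hd h0 b q hG
  have hδ := h.pos
  refine ⟨?_, ?_, ?_, ?_, ?_⟩
  · intro x hx hx1
    have e0 := g1 μ S δ h hd h0 0 h0 (by simp)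
    have e1 := g1 μ S δ h hd h0 x hx hx1
    have hr : ∀ y ∈ S, |Real.exp (2 * ⟪x, y⟫) - 1 - 2 * ⟪x, y⟫ - (2 * ⟪x, y⟫) ^ 2 / 2| ≤
        8 * ‖x‖ ^ 3 * ((1 + ‖y‖) ^ 3 * Real.exp (8 * ‖y‖)) := by
      intro y _
      refine (exp3 _).trans ?_
      have hi : |2 * ⟪x, y⟫| ≤ 2 * (‖x‖ * ‖y‖) := by
        rw [abs_mul, abs_two]; gcongr; exact abs_real_inner_le_norm x y
      have hi2 : |2 * ⟪x, y⟫| ≤ 8 * ‖y‖ := hi.trans (by nlinarith only [norm_nonneg y, norm_nonneg x, hx1])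
      calc _ ≤ (2 * (‖x‖ * ‖y‖)) ^ 3 * Real.exp (8 * ‖y‖) := by gcongr
        _ = 8 * ‖x‖ ^ 3 * (‖y‖ ^ 3 * Real.exp (8 * ‖y‖)) := by ring
        _ ≤ _ := by gcongr; linarith
    rename_bvar zz → zz
    have e2 := (g3 μ S δ h hd h0 _ (by fun_prop) (8 * ‖x‖ ^ 3) (by positivity) hr)
    have i0 : Integrable (fun y : V => Real.exp (-‖y‖ ^ 2) * 1) μ :=
      G_int h hd h0 0 (K := 1) (by fun_prop) fun y _ => by
        simpa using one_le_gr 0 y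
    have i1 := li_int h hd h0 x
    have i2 := qu_int h hd h0 x x
    have es : G μ (fun y => Real.exp (2 * ⟪x, y⟫)) = G μ (fun y => Real.exp (2 * ⟪x, y⟫) - 1 - 2 * ⟪x, y⟫ - (2 * ⟪x, y⟫) ^ 2 / 2) + (G μ (fun _ => 1) + (2 * G μ (fun y => ⟪x, y⟫) + 2 * G μ (fun y => ⟪x, y⟫ * ⟪x, y⟫))) := by
      have i1' : Integrable (fun y : V => Real.exp (-‖y‖ ^ 2) * (2 * ⟪x, y⟫)) μ :=
        (i1.const_mul 2).congr (ae_of_all _ fun y => by simp only; ring)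
      have i2' : Integrable (fun y : V => Real.exp (-‖y‖ ^ 2) * (2 * (⟪x, y⟫ * ⟪x, y⟫))) μ :=
        (i2.const_mul 2).congr (ae_of_all _ fun y => by simp only; ring)
      rw [← G_smul, ← G_smul, ← G_add i1' i2', ← G_add i0 ((i1'.add i2').congr (ae_of_all _ fun y => by simp only [Pi.add_apply]; ring)), ← G_add e2.1
        ((i0.add (i1'.add i2')).congr (ae_of_all _ fun y => by simp only [Pi.add_apply]; ring))]
      congr 1; ext y; ring
    have h2 := e2.2
    rw [es, ← hG.beq x, ← hG.qeq x x, real_inner_self_eq_norm_sq] at e1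
    simp at e0
    have h5 : |Real.exp (‖x‖ ^ 2) - 1 - ‖x‖ ^ 2| ≤ ‖x‖ ^ 3 := by
      have : |‖x‖ ^ 2| ≤ 1 := by rw [abs_of_nonneg (by positivity)]; nlinarith only [norm_nonneg x, hx1]
      have := Real.abs_exp_sub_one_sub_id_le this
      refine this.trans ?_
      nlinarith only [norm_nonneg x, pow_nonneg (norm_nonneg x) 3, hx1]
    have : cG * |2 * ⟪b, x⟫ + q x x| ≤ cG * ‖x‖ ^ 3 + (C1 + C1 + 8 * C3) * (‖x‖ ^ 3 + δ) := by
      rw [absm]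
      have p := pow_nonneg (norm_nonneg x) 3
      have h6 := mul_le_mul_of_nonneg_left h5 hc.le
      rw [absm] at h6
      rw [abs_le] at *
      have n1 := mul_nonneg hC1.le p
      have n2 := mul_nonneg hC3.le hδ.le
      constructor <;> linarith only [e1.1, e1.2, e0.1, e0.2, h2.1, h2.2, h6.1, h6.2, n1, n2, p]
    have := aux this
    refine this.trans ?_
    rw [add_div, mul_div_cancel_left₀ _ hc.ne', mul_div_right_comm]
    have p := pow_nonneg (norm_nonneg x) 3
    have : 0 ≤ (2 + 2 * C2 / cG + C4 / cG + 2 * C5 / cG) * (‖x‖ ^ 3 + δ) := by positivity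
    nlinarith only [hδ, this]
  · intro e
    have h1 := g2 μ S δ h h0
    have es : cG * (∑ i, q (e i) (e i) + 4) = 2 * ∫ y, ‖y‖ ^ 2 * Real.exp (-‖y‖ ^ 2) ∂μ := by
      have e1 : ∀ i, cG * (q (e i) (e i) + 1) = 2 * G μ (fun y => ⟪e i, y⟫ * ⟪e i, y⟫) := by
        intro i; rw [← hG.qeq]; simp
      have : ∫ y, ‖y‖ ^ 2 * Real.exp (-‖y‖ ^ 2) ∂μ = ∑ i, G μ (fun y => ⟪e i, y⟫ * ⟪e i, y⟫) := by
        unfold G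
        rw [← integral_finsetSum _ (fun i _ => qu_int h hd h0 (e i) (e i))]
        congr 1; ext y
        rw [← Finset.mul_sum, onb_sum]; ring
      rw [this, Finset.mul_sum, ← Finset.sum_congr rfl (fun i _ => e1 i), ← Finset.mul_sum,
        Finset.sum_add_distrib]
      simp
    have h2 : cG * |∑ i, q (e i) (e i) + 1| ≤ 2 * C2 * δ := by
      rw [absm]
      rw [abs_le] at *
      constructor <;> nlinarith only [h1, es]
    have := aux h2
    refine this.trans ?_
    rw [mul_div_right_comm]
    gcongr
    have : 0 ≤ 1 + (C1 + C1 + 8 * C3) / cG + 2 + C4 / cG + 2 * C5 / cG := by positivity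
    linarith only [this]
  · intro u
    have h1 := hG.qeq u u
    have h2 : 0 ≤ G μ (fun y => ⟪u, y⟫ * ⟪u, y⟫) := by
      apply integral_nonneg; intro y
      exact mul_nonneg (Real.exp_pos _).le (mul_self_nonneg _)
    rw [real_inner_self_eq_norm_sq] at h1
    by_contra hcon
    nlinarith only [h1, h2, hc, hcon]
  · have h1 := hG.beq b
    rw [real_inner_self_eq_norm_sq] at h1
    have h2 := (g4 μ S δ h hd h0 (fun y => ⟪b, y⟫) (by fun_prop) ‖b‖ (norm_nonneg _) (fun y _ => by
      have := abs_real_inner_le_norm b y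
      have := gr_poly 1 y
      rw [pow_one] at this
      nlinarith [norm_nonneg b])).2
    rw [← h1, abs_of_nonneg (by positivity)] at h2
    have : ‖b‖ ≤ C4 / cG := by
      rw [le_div_iff₀ hc]
      by_contra hcon
      push Not at hcon
      have hb : 0 < ‖b‖ := by
        by_contra h'
        have : ‖b‖ = 0 := le_antisymm (not_lt.1 h') (norm_nonneg b)
        rw [this] at hcon; linarith
      nlinarith only [hC4, hcon, hc, h2]
    refine this.trans ?_
    have : 0 ≤ 1 + (C1 + C1 + 8 * C3) / cG + 2 + 2 * C2 / cG + 2 * C5 / cG := by positivity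
    linarith only [this]
  · intro u v
    have h1 := hG.qeq u v
    have h2 := (g5 μ S δ h hd h0 (fun y => ⟪u, y⟫ * ⟪v, y⟫) (by fun_prop) (‖u‖ * ‖v‖) (by positivity) (fun y _ => by
      have h1 := abs_real_inner_le_norm u y
      have h2 := abs_real_inner_le_norm v y
      have h3 := gr_poly 2 y
      rw [abs_mul]
      calc _ ≤ (‖u‖ * ‖y‖) * (‖v‖ * ‖y‖) := by gcongr
        _ = ‖u‖ * ‖v‖ * ‖y‖ ^ 2 := by ring
        _ ≤ _ := by gcongr)).2
    have h3 := abs_real_inner_le_norm u v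
    have h4 : cG * |q u v| ≤ cG * (‖u‖ * ‖v‖) + 2 * C5 * (‖u‖ * ‖v‖) := by
      rw [absm]
      have h6 := mul_le_mul_of_nonneg_left h3 hc.le
      rw [absm] at h6
      rw [abs_le] at *
      constructor <;> nlinarith only [h1, h2, h6]
    refine (aux h4).trans ?_
    rw [add_div, mul_div_cancel_left₀ _ hc.ne', mul_div_right_comm]
    have : 0 ≤ ((C1 + C1 + 8 * C3) / cG + 2 + 2 * C2 / cG + C4 / cG) * (‖u‖ * ‖v‖) := by positivity
    nlinarith only [this]


def rs (μ : Measure V) (z : V) (r : ℝ) : Measure V :=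
  ENNReal.ofReal ((r ^ 3)⁻¹) • μ.map (fun y => r⁻¹ • (y - z))
def rsS (S : Set V) (z : V) (r : ℝ) : Set V := {y | z + r • y ∈ S}

lemma rs_ball (μ : Measure V) (z : V) {r : ℝ} (hr : 0 < r) (x : V) (u : ℝ) :
    (rs μ z r).real (closedBall x u) = (r ^ 3)⁻¹ * μ.real (closedBall (z + r • x) (r * u)) := by
  unfold rs
  rw [measureReal_ennreal_smul_apply, ENNReal.toReal_ofReal (by positivity)]
  congr 1
  rw [map_measureReal_apply (by fun_prop) measurableSet_closedBall]
  congr 1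
  ext y
  simp only [mem_preimage, mem_closedBall, dist_eq_norm]
  have : y - (z + r • x) = r • (r⁻¹ • (y - z) - x) := by
    rw [smul_sub, smul_inv_smul₀ hr.ne']; abel
  rw [this, norm_smul, Real.norm_of_nonneg hr.le]
  exact (mul_le_mul_iff_right₀ hr).symm

lemma rs_aux {μ : Measure V} (hf : IsFiniteMeasure μ) {S : Set V} (hcl : IsClosed S) (hn : μ Sᶜ = 0) (z : V)
    {r : ℝ} (hr : 0 < r) :
    IsFiniteMeasure (rs μ z r) ∧ IsClosed (rsS S z r) ∧ rs μ z r (rsS S z r)ᶜ = 0 := by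
  have hc : IsClosed (rsS S z r) := hcl.preimage (by fun_prop : Continuous fun y : V => z + r • y)
  refine ⟨?_, hc, ?_⟩
  · have : IsFiniteMeasure (μ.map (fun y => r⁻¹ • (y - z))) := inferInstance
    constructor
    unfold rs
    simp only [Measure.smul_apply, smul_eq_mul]
    exact ENNReal.mul_lt_top ENNReal.ofReal_lt_top (measure_lt_top _ _)
  · unfold rs
    rw [Measure.smul_apply, Measure.map_apply (by fun_prop) hc.measurableSet.compl]
    have : (fun y : V => r⁻¹ • (y - z)) ⁻¹' (rsS S z r)ᶜ = Sᶜ := by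
      ext y; simp [rsS, smul_inv_smul₀ hr.ne']
    rw [this, hn]; simp

lemma AU.rs {μ S δ} (h : AU μ S δ) {z : V} (hz : 2 * δ * ‖z‖ ≤ 1) {r δ' : ℝ} (hr : 0 < r)
    (h1 : 2 * δ ≤ δ') (h2 : 2 * δ * r ≤ δ') : AU (rs μ z r) (rsS S z r) δ' := by
  obtain ⟨a, b, c⟩ := rs_aux h.fin h.cl h.null z hr
  have hd := h.pos
  refine ⟨a, b, c, by linarith, ?_⟩
  intro x hx hxd u hu
  have hb := h.ball (z + r • x) hx (by
    have : ‖z + r • x‖ ≤ ‖z‖ + r * ‖x‖ := by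
      refine (norm_add_le _ _).trans ?_
      rw [norm_smul, Real.norm_of_nonneg hr.le]
    have := mul_le_mul_of_nonneg_left this hd.le
    have := mul_le_mul_of_nonneg_right h2 (norm_nonneg x)
    nlinarith) (r * u) (by positivity)
  rw [rs_ball μ z hr]
  rename_bvar zz → zz
  have e : (r ^ 3)⁻¹ * μ.real (closedBall (z + r • x) (r * u)) - omega3 * u ^ 3 =
    (r ^ 3)⁻¹ * (μ.real (closedBall (z + r • x) (r * u)) - omega3 * (r * u) ^ 3) := by
    field_simp
  rw [e, abs_mul, abs_of_pos (by positivity), inv_mul_le_iff₀ (by positivity)]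
  refine hb.trans ?_
  have h3 : δ * (1 + r * u) ≤ δ' * (1 + u) := by
    have := mul_le_mul_of_nonneg_right h2 hu.le
    nlinarith only [h1, hd, this, hu]
  calc δ * (1 + r * u) * (r * u) ^ 3 ≤ δ' * (1 + u) * (r * u) ^ 3 := by gcongr
    _ = _ := by ring

lemma AU.mono {μ S δ δ'} (h : AU μ S δ) (hd : δ ≤ δ') : AU μ S δ' :=
  ⟨h.fin, h.cl, h.null, h.pos.trans_le hd, fun x hx hx1 u hu => (h.ball x hx
    ((mul_le_mul_of_nonneg_right hd (norm_nonneg x)).trans hx1) u hu).trans (by gcongr)⟩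

lemma AU.lo {μ S δ} (h : AU μ S δ) {x : V} (hx : x ∈ S) (hx1 : δ * ‖x‖ ≤ 1) {u : ℝ} (hu : 0 < u)
    (hd : δ * (1 + u) ≤ 1) : 3 * u ^ 3 ≤ μ.real (closedBall x u) := by
  have := (abs_le.1 (h.ball x hx hx1 u hu)).1
  have h3 : 0 < u ^ 3 := by positivity
  have := mul_le_mul_of_nonneg_right hd h3.le
  rename_bvar zz → zz
  have := mul_le_mul_of_nonneg_right om_lo.le h3.le
  linarith

lemma AU.hi {μ S δ} (h : AU μ S δ) {x : V} (hx : x ∈ S) (hx1 : δ * ‖x‖ ≤ 1) {u : ℝ} (hu : 0 < u)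
    (hd : δ * (1 + u) ≤ 1) : μ.real (closedBall x u) ≤ 6 * u ^ 3 := by
  have := (abs_le.1 (h.ball x hx hx1 u hu)).2
  have h3 : 0 < u ^ 3 := by positivity
  have := mul_le_mul_of_nonneg_right hd h3.le
  rename_bvar zz → zz
  have := mul_le_mul_of_nonneg_right om_hi.le h3.le
  linarith

lemma AU.real_null {μ S δ} (h : AU μ S δ) {T : Set V} (hT : ∀ y ∈ T, y ∉ S) : μ.real T = 0 := by
  have : μ T = 0 := measure_mono_null (fun y hy => hT y hy) h.null
  simp [measureReal_def, this]

lemma onb2 {n v : V} (hn : ‖n‖ = 1) (hv : ‖v‖ = 1) (h : ⟪n, v⟫ = 0) :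
    ∃ e : OrthonormalBasis (Fin 4) ℝ V, e 0 = n ∧ e 1 = v := by
  let w : Fin 4 → V := fun i => if i = 0 then n else if i = 1 then v else 0
  have ho : Orthonormal ℝ (({0, 1} : Set (Fin 4)).domRestrict w) := by
    constructor
    · rintro ⟨i, hi⟩
      rcases hi with rfl | rfl 
      exacts [by simpa [w] using hn, by simpa [w] using hv]
    · rintro ⟨i, hi⟩ ⟨j, hj⟩ hij
      have h' : ⟪v, n⟫ = 0 := by rw [real_inner_comm]; exact h
      rcases hi with rfl | rfl <;> rcases hj with rfl | rfl
      exacts [absurd rfl hij, by simpa [w] using h, by simpa [w] using h', absurd rfl hij]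
  obtain ⟨e, he⟩ := ho.exists_orthonormalBasis_extension_of_card_eq (by simp)
  exact ⟨e, by rw [he 0 (by simp)]; simp [w], by rw [he 1 (by simp)]; simp [w]⟩

lemma onb1 {n : V} (hn : ‖n‖ = 1) : ∃ e : OrthonormalBasis (Fin 4) ℝ V, e 0 = n := by
  let w : Fin 4 → V := fun _ => n
  have ho : Orthonormal ℝ (({0} : Set (Fin 4)).domRestrict w) := by
    constructor
    · rintro ⟨i, hi⟩
      simpa [w] using hn
    · rintro ⟨i, hi⟩ ⟨j, hj⟩ hij
      rcases hi with rfl; rcases hj with rfl; exact absurd rfl hij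
  obtain ⟨e, he⟩ := ho.exists_orthonormalBasis_extension_of_card_eq (by simp)
  exact ⟨e, by rw [he 0 (by simp)]⟩

lemma norm_sq4 (e : OrthonormalBasis (Fin 4) ℝ V) (y : V) :
    ‖y‖ ^ 2 = ⟪e 0, y⟫ ^ 2 + ⟪e 1, y⟫ ^ 2 + ⟪e 2, y⟫ ^ 2 + ⟪e 3, y⟫ ^ 2 := by
  rw [← onb_sum e, Fin.sum_univ_four]; ring

lemma onb_ip (e : OrthonormalBasis (Fin 4) ℝ V) (i j : Fin 4) : ⟪e i, e j⟫ = if i = j then 1 else 0 :=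
  orthonormal_iff_ite.1 e.orthonormal i j

/-- thin neighbourhoods of 2-planes have small mass -/
lemma D_lemma {μ S δ} (h : AU μ S δ) {n v : V} (hn : ‖n‖ = 1) (hv : ‖v‖ = 1) (hnv : ⟪n, v⟫ = 0)
    {r k : ℝ} (hk : 0 < k) (hkr : k ≤ r) (hd : δ * (1 + 4 * r) ≤ 1) :
    μ.real (closedBall 0 r ∩ {y | |⟪n, y⟫| ≤ k ∧ |⟪v, y⟫| ≤ k}) ≤ 9600 * r ^ 2 * k := by
  have := h.fin
  obtain ⟨e, e0, e1⟩ := onb2 hn hv hnv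
  set W := closedBall (0:V) r ∩ {y | |⟪n, y⟫| ≤ k ∧ |⟪v, y⟫| ≤ k} with hW
  let M : ℕ := ⌈r / k⌉₊ 
  let I : Finset ℤ := Finset.Icc (-(M:ℤ)) M
  let c : ℤ × ℤ → V := fun p => (k * p.1) • e 2 + (k * p.2) • e 3
  have hcov : W ⊆ ⋃ p ∈ I ×ˢ I, W ∩ closedBall (c p) (2 * k) := by
    intro y hy
    have hround : ∀ t : ℝ, |t| ≤ r → round (t / k) ∈ I ∧ (t - k * round (t / k)) ^ 2 ≤ (k / 2) ^ 2 := by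
      intro t ht
      have h1 := abs_sub_round (t / k)
      have h2 : |t / k| ≤ M := by
        rw [abs_div, abs_of_pos hk]
        exact (div_le_div_of_nonneg_right ht hk.le).trans (Nat.le_ceil _)
      constructor
      · rw [abs_le] at h1 h2
        simp only [I, Finset.mem_Icc]
        constructor
        · have : (-(M:ℤ) : ℝ) - 1 < round (t / k) := by push_cast; linarith only [h1, h2]
          have : -(M:ℤ) - 1 < round (t / k) := by exact_mod_cast this
          omega
        · have : (round (t / k) : ℝ) < M + 1 := by linarith only [h1, h2]
          have : round (t / k) < (M:ℤ) + 1 := by exact_mod_cast this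
          omega
      · have e : t - k * round (t / k) = k * (t / k - round (t / k)) := by field_simp
        rw [e, ← sq_abs (k * _), abs_mul, abs_of_pos hk]
        apply pow_le_pow_left₀ (by positivity)
        nlinarith only [hk, h1]
    have hy1 : ‖y‖ ≤ r := by simpa using hy.1
    have hc : ∀ i, |⟪e i, y⟫| ≤ r := fun i => by
      have := abs_real_inner_le_norm (e i) y
      rw [e.norm_eq_one, one_mul] at this
      linarith
    have r2 := hround _ (hc 2)
    have r3 := hround _ (hc 3)
    simp only [mem_iUnion]
    refine ⟨(round (⟪e 2, y⟫ / k), round (⟪e 3, y⟫ / k)), Finset.mem_product.2 ⟨r2.1, r3.1⟩, hy, ?_⟩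
    rw [mem_closedBall, dist_eq_norm]
    apply le_of_sq_le_sq _ (by positivity)
    rw [norm_sq4 e]
    have p0 : ⟪e 0, y⟫ ^ 2 ≤ k ^ 2 := by rw [← sq_abs, e0]; gcongr; exact hy.2.1
    have p1 : ⟪e 1, y⟫ ^ 2 ≤ k ^ 2 := by rw [← sq_abs, e1]; gcongr; exact hy.2.2
    simp [c, inner_sub_right, inner_add_right, inner_smul_right, onb_ip]
    nlinarith only [r2, r3, p0, p1]
  rename_bvar zz → zz
  have hball : ∀ p ∈ I ×ˢ I, μ.real (W ∩ closedBall (c p) (2 * k)) ≤ 384 * k ^ 3 := by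
    intro p _
    by_cases hne : ∃ y ∈ W ∩ closedBall (c p) (2 * k), y ∈ S
    · obtain ⟨y, ⟨hyW, hyc⟩, hyS⟩ := hne
      have hy1 : ‖y‖ ≤ r := by simpa using hyW.1
      have hδ := h.pos
      have := h.hi hyS (by nlinarith only [hd, hδ, hk, hkr, hy1]) (u := 4 * k) (by positivity) (by nlinarith only [hd, hkr, hδ])
      refine (measureReal_mono (fun z hz => ?_)).trans (this.trans (by nlinarith only))
      have h1 := mem_closedBall.1 hz.2
      have h2 := mem_closedBall.1 hyc
      rw [mem_closedBall]
      have := dist_triangle_right z y (c p)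
      linarith
    · rw [h.real_null (fun y hy hyS => hne ⟨y, hy, hyS⟩)]; positivity
  have hr : 0 < r := hk.trans_le hkr
  calc μ.real W ≤ μ.real (⋃ p ∈ I ×ˢ I, W ∩ closedBall (c p) (2 * k)) := measureReal_mono hcov (measure_ne_top _ _)
    _ ≤ ∑ p ∈ I ×ˢ I, μ.real (W ∩ closedBall (c p) (2 * k)) := measureReal_biUnion_finset_le _ _
    _ ≤ ∑ p ∈ I ×ˢ I, 384 * k ^ 3 := Finset.sum_le_sum hball
    _ = (2 * M + 1) ^ 2 * (384 * k ^ 3) := by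
      rw [Finset.sum_const, Finset.card_product, nsmul_eq_mul]
      simp only [I, Int.card_Icc]
      have : ((M:ℤ) + 1 - -(M:ℤ)).toNat = 2 * M + 1 := by omega
      rw [this]; push_cast; ring
    _ ≤ (5 * (r / k)) ^ 2 * (384 * k ^ 3) := by
      have h1 : (M:ℝ) < r / k + 1 := Nat.ceil_lt_add_one (by positivity)
      have h2 : 1 ≤ r / k := by rw [le_div_iff₀ hk]; linarith
      gcongr
      linarith only [h1, h2]
    _ = _ := by field_simp; ring

lemma D_contra {μ S δ} (h : AU μ S δ) (h0 : (0:V) ∈ S) {n v : V} (hn : ‖n‖ = 1) (hv : ‖v‖ = 1) (hnv : ⟪n, v⟫ = 0)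
    {r k : ℝ} (hk : 0 < k) (hkr : 4000 * k ≤ r) (hd : δ * (1 + 4 * r) ≤ 1) :
    ∃ y ∈ S, ‖y‖ ≤ r ∧ (k < |⟪n, y⟫| ∨ k < |⟪v, y⟫|) := by
  have := h.fin
  by_contra hcon
  push Not at hcon
  have hr : 0 < r := by linarith
  have hδ := h.pos
  rename_bvar zz → zz
  have h1 := D_lemma h hn hv hnv hk (by linarith) hd
  have h2 := h.lo h0 (by simp) hr (by nlinarith only [hk, hd, hkr, hδ])
  have h3 : μ.real (closedBall 0 r) ≤ μ.real (closedBall 0 r ∩ {y | |⟪n, y⟫| ≤ k ∧ |⟪v, y⟫| ≤ k}) := by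
    unfold Measure.real
    apply ENNReal.toReal_mono (measure_ne_top _ _)
    apply measure_mono_ae
    filter_upwards [h.ae] with y hy hyb
    exact ⟨hyb, hcon y hy (mem_closedBall_zero_iff.1 hyb)⟩
  have : r ^ 2 * (4000 * k) ≤ r ^ 2 * r := by gcongr
  nlinarith only [pow_pos hr 2, pow_pos hr 3, h1, h2, h3, this]

lemma G_lower {μ S δ} (h : AU μ S δ) {f : V → ℝ}
    (hi : Integrable (fun y => Real.exp (-‖y‖ ^ 2) * f y) μ) (hf : ∀ y ∈ S, 0 ≤ f y)
    {T : Set V} (hT : MeasurableSet T) (hT1 : T ⊆ closedBall 0 1) {k : ℝ} (hk : 0 ≤ k) (hfk : ∀ y ∈ T, y ∈ S → k ≤ f y) :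
    k * μ.real T ≤ 3 * G μ f := by
  have := h.fin
  have h1 : ∫ y in T, k ∂μ ≤ ∫ y in T, 3 * (Real.exp (-‖y‖ ^ 2) * f y) ∂μ := by
    apply integral_mono_ae (integrable_const _) (hi.const_mul 3).integrableOn
    filter_upwards [ae_restrict_mem hT, ae_restrict_of_ae h.ae] with y hy hyS
    have h2 := hfk y hy hyS
    have h3 : ‖y‖ ≤ 1 := by simpa using hT1 hy
    have h4 : Real.exp (-1) ≤ Real.exp (-‖y‖ ^ 2) := by
      apply Real.exp_le_exp.2; nlinarith only [norm_nonneg y, h3]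
    have h5 : 1 / 3 ≤ Real.exp (-1) := by
      rw [Real.exp_neg, ← one_div]
      apply one_div_le_one_div_of_le (Real.exp_pos 1)
      linarith only [Real.exp_one_lt_d9]
    have h6 := mul_le_mul_of_nonneg_right (h5.trans h4) (hk.trans h2)
    linarith only [h2, h6]
  have h2 : ∫ y in T, 3 * (Real.exp (-‖y‖ ^ 2) * f y) ∂μ ≤ ∫ y, 3 * (Real.exp (-‖y‖ ^ 2) * f y) ∂μ := by
    apply setIntegral_le_integral (hi.const_mul 3)
    filter_upwards [h.ae] with y hy
    have := hf y hy
    simp only [Pi.zero_apply]; positivity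
  rw [integral_const_mul 3 (fun y => Real.exp (-‖y‖ ^ 2) * f y) (μ := μ)] at h2
  simp at h1
  unfold G
  linarith


lemma inner_abs_le_of_unit {n : V} (hn : ‖n‖ = 1) (y : V) : |⟪n, y⟫| ≤ ‖y‖ := by
  have := abs_real_inner_le_norm n y
  rwa [hn, one_mul] at this

lemma unit_proj {n b : V} (hn : ‖n‖ = 1) (hb : b - ⟪n, b⟫ • n ≠ 0) :
    ∃ v : V, ‖v‖ = 1 ∧ ⟪n, v⟫ = 0 ∧ b - ⟪n, b⟫ • n = ‖b - ⟪n, b⟫ • n‖ • v := by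
  have hp : ‖b - ⟪n, b⟫ • n‖ ≠ 0 := norm_ne_zero_iff.2 hb
  refine ⟨‖b - ⟪n, b⟫ • n‖⁻¹ • (b - ⟪n, b⟫ • n), ?_, ?_, ?_⟩
  · rw [norm_smul, norm_inv, norm_norm, inv_mul_cancel₀ hp]
  · rw [inner_smul_right, inner_sub_right, inner_smul_right, real_inner_self_eq_norm_sq, hn]; simp
  · rw [smul_inv_smul₀ hp]

/-- lower bound on `b` in a one-sided direction -/
lemma C_aux : ∃ k0 β0 ζ0 : ℝ, 0 < k0 ∧ k0 ≤ 1 ∧ 0 < β0 ∧ 0 < ζ0 ∧ ζ0 ≤ 1 / 4 ∧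
    ∀ μ S δ, AU μ S δ → δ ≤ 1 / 5 → (0:V) ∈ S → ∀ b q, GD μ b q → ∀ n v : V, ‖n‖ = 1 → ‖v‖ = 1 →
    |⟪n, v⟫| ≤ ζ0 → (∀ y ∈ S, -(k0 * ‖y‖ ^ 2 / 2) ≤ ⟪v, y⟫) → (∀ y ∈ S, ‖y‖ ≤ 1 → |⟪n, y⟫| ≤ ζ0) →
    β0 ≤ ⟪b, v⟫ := by
  obtain ⟨C, hC, hg⟩ := G_bd 2
  have hc := cG_pos
  obtain ⟨κ, hκe⟩ : ∃ κ : ℝ, κ = 1 / 40000 := ⟨_, rfl⟩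
  rename_bvar zz → zz
  have hκ : 0 < κ := by rw [hκe]; norm_num
  obtain ⟨k0, hk0, hk1, hk2⟩ : ∃ k0 : ℝ, 0 < k0 ∧ k0 ≤ 1 / 40000 ∧ k0 * C ≤ κ / 4 := by
    refine ⟨min (1 / 40000) (κ / (4 * C)), by positivity, min_le_left _ _, ?_⟩
    have : min (1 / 40000) (κ / (4 * C)) ≤ κ / (4 * C) := min_le_right _ _
    rw [le_div_iff₀ (by positivity)] at this
    linarith only [this]
  refine ⟨k0, κ / (8 * cG), κ, hk0, by linarith only [hκe, hκ, hk1], by positivity, hκ, by linarith only [hκe, hκ], ?_⟩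
  intro μ S δ h hd h0 b q hG n v hn hv hnv hlow hflat
  have := h.fin
  have hδ := h.pos
  let f : V → ℝ := fun y => ⟪v, y⟫ + k0 / 2 * ‖y‖ ^ 2
  rename_bvar zz → zz
  have i1 := li_int h (by linarith only [hd]) h0 v
  have g2 := hg μ S δ h (by linarith only [hd]) h0 (fun y => ‖y‖ ^ 2) (by fun_prop) 1 zero_le_one (fun y _ => by
    rw [abs_of_nonneg (by positivity), one_mul]; exact gr_poly 2 y)
  have i2 : Integrable (fun y : V => Real.exp (-‖y‖ ^ 2) * (k0 / 2 * ‖y‖ ^ 2)) μ :=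
    (g2.1.const_mul (k0 / 2)).congr (ae_of_all _ fun y => by simp only; ring)
  have hGf : G μ f = cG * ⟪b, v⟫ + k0 / 2 * G μ (fun y => ‖y‖ ^ 2) := by
    rw [hG.beq, ← G_smul, ← G_add i1 i2]
  rename_bvar zz → zz
  have hif : Integrable (fun y => Real.exp (-‖y‖ ^ 2) * f y) μ :=
    (i1.add i2).congr (ae_of_all _ fun y => by simp only [Pi.add_apply, f]; ring)
  let T : Set V := closedBall 0 1 ∩ {y | κ ≤ ⟪v, y⟫}
  have hT : MeasurableSet T := measurableSet_closedBall.inter (measurableSet_le (by fun_prop) (by fun_prop))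
  have hlowG := G_lower h hif (fun y hy => by have := hlow y hy; simp only [f]; linarith only [this]) hT
    inter_subset_left hκ.le (fun y hy _ => by
      have : κ ≤ ⟪v, y⟫ := hy.2
      simp only [f]; have : 0 ≤ k0 / 2 * ‖y‖ ^ 2 := by positivity
      linarith)
  -- mass of T
  have hmT : 1 ≤ μ.real T := by
    have hne : v - ⟪n, v⟫ • n ≠ 0 := by
      intro h0
      have : v = ⟪n, v⟫ • n := sub_eq_zero.1 h0
      have h1 : ‖v‖ = |⟪n, v⟫| := by
        conv_lhs => rw [this]
        rw [norm_smul, hn, mul_one, Real.norm_eq_abs]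
      rw [h1] at hv
      linarith only [hκe, hκ, hv, hnv]
    obtain ⟨w, hw, hnw, hvw⟩ := unit_proj hn hne
    set m := ‖v - ⟪n, v⟫ • n‖
    have hm : 1 / 2 ≤ m := by
      have := norm_sub_norm_le v (⟪n, v⟫ • n)
      rw [norm_smul, hn, hv, mul_one, Real.norm_eq_abs] at this
      linarith only [hκe, hκ, hnv, this]
    rename_bvar zz → zz
    have hD := D_lemma h hn hw hnw (r := 1) (k := 4 * κ) (by positivity) (by linarith only [hκe, hκ]) (by linarith only [hd])
    have hlo := h.lo h0 (by simp) one_pos (by linarith only [hd])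
    have hun : μ.real (closedBall 0 1) ≤ μ.real (T ∪ (closedBall 0 1 ∩ {y | |⟪n, y⟫| ≤ 4 * κ ∧ |⟪w, y⟫| ≤ 4 * κ})) := by
      unfold Measure.real
      apply ENNReal.toReal_mono (measure_ne_top _ _)
      apply measure_mono_ae
      filter_upwards [h.ae] with y hy hyb
      have hy1 : ‖y‖ ≤ 1 := mem_closedBall_zero_iff.1 hyb
      by_cases hyT : κ ≤ ⟪v, y⟫
      · exact Or.inl ⟨hyb, hyT⟩
      · refine Or.inr ⟨hyb, ?_, ?_⟩
        · linarith only [hflat y hy hy1, hκ]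
        · have h1 := hlow y hy
          have h2 : ‖y‖ ^ 2 ≤ 1 := by nlinarith only [norm_nonneg y, hκe, hy1, hκ]
          have h3 : |⟪v, y⟫| ≤ κ := by
            rw [abs_le]; constructor
            · nlinarith only [hκe, hκ, h1, h2, hk1]
            · linarith only [hyT]
          have h4 : m * ⟪w, y⟫ = ⟪v, y⟫ - ⟪n, v⟫ * ⟪n, y⟫ := by
            have := congrArg (fun z => ⟪z, y⟫) hvw
            simp only [inner_sub_left, real_inner_smul_left] at this
            linarith only [this]
          have h5 : |⟪n, v⟫ * ⟪n, y⟫| ≤ κ := by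
            rw [abs_mul]
            have := inner_abs_le_of_unit hn y
            nlinarith only [abs_nonneg ⟪n, v⟫, abs_nonneg ⟪n, y⟫, hy1, this, hκe, hκ, hnv]
          have h6 : m * |⟪w, y⟫| ≤ 2 * κ := by
            rw [← abs_of_nonneg (show 0 ≤ m by linarith only [hm]), ← abs_mul, h4]
            exact (abs_sub _ _).trans (by linarith only [h3, h5])
          nlinarith only [abs_nonneg ⟪w, y⟫, hm, h6, hκe, hκ]
    have := measureReal_union_le (μ := μ) T (closedBall 0 1 ∩ {y | |⟪n, y⟫| ≤ 4 * κ ∧ |⟪w, y⟫| ≤ 4 * κ})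
    subst hκe
    norm_num at *
    linarith only [hk0, hk1, hlo, hD, hun, this]
  rename_bvar zz → zz
  have h7 := (abs_le.1 g2.2).2
  have h8 : κ ≤ κ * μ.real T := by nlinarith only [hmT, hκe]
  have h9 : κ ≤ 3 * (cG * ⟪b, v⟫) + 3 * κ / 8 := by
    rw [hGf] at hlowG
    have : k0 / 2 * G μ (fun y => ‖y‖ ^ 2) ≤ k0 / 2 * (C * 1) := by gcongr
    linarith only [hk2, hlowG, h8, this]
  rw [div_le_iff₀ (by positivity)]
  linarith only [hκ, h9]


lemma C_lemma : ∃ δ1 C1 : ℝ, 0 < δ1 ∧ δ1 ≤ 1 / 10 ∧ 1 ≤ C1 ∧ ∀ μ S δ, AU μ S δ → δ ≤ δ1 → (0:V) ∈ S →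
    ∀ n : V, ‖n‖ = 1 → ∀ η : ℝ, 0 < η → (∀ y ∈ S, ‖y‖ ≤ 1 → |⟪n, y⟫| ≤ η) →
    ∀ p : V, ⟪n, p⟫ = 0 → ‖p‖ ≤ 1 / 4 → ∃ x ∈ S, ‖x - p‖ ≤ C1 * η := by
  obtain ⟨k0, β0, ζ0, hk0, hk1, hβ, hζ, hζ1, haux⟩ := C_aux
  obtain ⟨C, hC, hP⟩ := P_lemma
  obtain ⟨h, hh, hh1, hh2⟩ : ∃ h : ℝ, 0 < h ∧ h ≤ 1 ∧ C * h * 24000 ≤ β0 := by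
    refine ⟨min 1 (β0 / (C * 24000)), by positivity, min_le_left _ _, ?_⟩
    have : min 1 (β0 / (C * 24000)) ≤ β0 / (C * 24000) := min_le_right _ _
    rw [le_div_iff₀ (by positivity)] at this
    linarith only [this]
  rename_bvar zz → zz
  obtain ⟨ζ, hζp, hζ0, hζh, hζh'⟩ : ∃ ζ : ℝ, 0 < ζ ∧ ζ ≤ ζ0 ∧ ζ ≤ h ^ 2 ∧ ζ ≤ h / 4000 :=
    ⟨min ζ0 (min (h ^ 2) (h / 4000)), by positivity, min_le_left _ _,
      (min_le_right _ _).trans (min_le_left _ _), (min_le_right _ _).trans (min_le_right _ _)⟩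
  obtain ⟨C1, hC1, hC1a, hC1b, hC1c⟩ : ∃ C1 : ℝ, 1 ≤ C1 ∧ 2 ≤ k0 * C1 * ζ ∧ 1 ≤ ζ0 * C1 ∧ 2 * C ≤ β0 * C1 := by
    refine ⟨1 + 2 / (k0 * ζ) + 1 / ζ0 + 2 * C / β0, ?_, ?_, ?_, ?_⟩
    · have : 0 ≤ 2 / (k0 * ζ) + 1 / ζ0 + 2 * C / β0 := by positivity
      linarith only [this]
    · have e : k0 * (1 + 2 / (k0 * ζ) + 1 / ζ0 + 2 * C / β0) * ζ = 2 + k0 * ζ * (1 + 1 / ζ0 + 2 * C / β0) := by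
        field_simp; ring
      rw [e]; have : 0 ≤ k0 * ζ * (1 + 1 / ζ0 + 2 * C / β0) := by positivity
      linarith only [this]
    · have e : ζ0 * (1 + 2 / (k0 * ζ) + 1 / ζ0 + 2 * C / β0) = 1 + ζ0 * (1 + 2 / (k0 * ζ) + 2 * C / β0) := by
        field_simp; ring
      rw [e]; have : 0 ≤ ζ0 * (1 + 2 / (k0 * ζ) + 2 * C / β0) := by positivity
      linarith only [this]
    · have e : β0 * (1 + 2 / (k0 * ζ) + 1 / ζ0 + 2 * C / β0) = 2 * C + β0 * (1 + 2 / (k0 * ζ) + 1 / ζ0) := by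
        field_simp; ring
      rw [e]; have : 0 ≤ β0 * (1 + 2 / (k0 * ζ) + 1 / ζ0) := by positivity
      linarith only [this]
  refine ⟨min (1 / 10) (h ^ 2 / 2), C1, by positivity, min_le_left _ _, hC1, ?_⟩
  intro μ S δ hA hd h0 n hn η hη hflat p hp hp1
  have hd1 : δ ≤ 1 / 10 := hd.trans (min_le_left _ _)
  have hd2 : δ ≤ h ^ 2 / 2 := hd.trans (min_le_right _ _)
  rename_bvar zz → zz
  have hδ := hA.pos
  obtain ⟨x, hxS, hxd⟩ := hA.cl.exists_infDist_eq_dist ⟨0, h0⟩ p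
  have hmin : ∀ y ∈ S, ‖x - p‖ ≤ ‖y - p‖ := fun y hy => by
    have := infDist_le_dist_of_mem hy (x := p)
    rw [hxd, dist_comm, dist_comm p y, dist_eq_norm, dist_eq_norm] at this
    exact this
  refine ⟨x, hxS, ?_⟩
  by_contra hcon
  push Not at hcon
  obtain ⟨d, hd⟩ : ∃ d, d = ‖x - p‖ := ⟨_, rfl⟩
  rename_bvar zz → zz
  have hd14 : d ≤ 1 / 4 := by
    have := hmin 0 h0; rw [zero_sub, norm_neg] at this; linarith only [hp1, hd, this]
  have hdp : 0 < d := by rw [hd]; exact lt_trans (by positivity) hcon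
  rw [← hd] at hcon
  have hx12 : ‖x‖ ≤ 1 / 2 := by
    have : ‖x‖ ≤ ‖x - p‖ + ‖p‖ := by simpa using norm_add_le (x - p) p
    linarith only [hp1, hd, hd14, this]
  obtain ⟨v, hv⟩ : ∃ v : V, v = d⁻¹ • (x - p) := ⟨_, rfl⟩
  rename_bvar zz → zz
  have hv1 : ‖v‖ = 1 := by
    rw [hv, norm_smul, norm_inv, Real.norm_of_nonneg hdp.le, ← hd, inv_mul_cancel₀ hdp.ne']
  have hxp : x - p = d • v := by rw [hv, smul_inv_smul₀ hdp.ne']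
  have hlow : ∀ y ∈ S, -(‖y - x‖ ^ 2) ≤ 2 * d * ⟪v, y - x⟫ := by
    intro y hy
    have h1 := hmin y hy
    have e : y - p = (y - x) + d • v := by rw [← hxp]; abel
    have h2 : ‖y - p‖ ^ 2 = ‖y - x‖ ^ 2 + 2 * (d * ⟪v, y - x⟫) + d ^ 2 := by
      rw [e, norm_add_sq_real, real_inner_comm, real_inner_smul_left, norm_smul, hv1, mul_one, Real.norm_of_nonneg hdp.le]
    rename_bvar zz → zz
    have h3 : ‖x - p‖ ^ 2 ≤ ‖y - p‖ ^ 2 := by gcongr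
    rw [← hd] at h3; linarith only [h2, h3]
  have hnv : |⟪n, v⟫| * C1 ≤ 1 := by
    have h1 := hflat x hxS (by linarith only [hh1, hζp, hζh', hx12])
    have h2 : d * ⟪n, v⟫ = ⟪n, x⟫ := by
      have := congrArg (fun z => ⟪n, z⟫) hxp
      simp only [inner_sub_right, inner_smul_right, hp] at this
      linarith only [this]
    have h3 : d * |⟪n, v⟫| ≤ η := by rw [← abs_of_pos hdp, ← abs_mul, h2]; exact h1
    rename_bvar zz → zz
    have h4 : d * (|⟪n, v⟫| * C1) ≤ d * 1 := by
      have := mul_le_mul_of_nonneg_right h3 (show 0 ≤ C1 by linarith only [hh1, hζp, hζh', hC1])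
      linarith only [hcon, this]
    exact le_of_mul_le_mul_left h4 hdp
  rename_bvar zz → zz
  have hnvζ : |⟪n, v⟫| ≤ ζ0 := by
    have : |⟪n, v⟫| * C1 ≤ ζ0 * C1 := by linarith only [hC1b, hnv]
    exact le_of_mul_le_mul_right this (by linarith only [hh1, hζp, hζh', hC1])
  obtain ⟨τ, hτ⟩ : ∃ τ, τ = k0 * d := ⟨_, rfl⟩
  have hτp : 0 < τ := by rw [hτ]; positivity
  have hτd : τ ≤ 1 / 4 := by
    rw [hτ]; have := mul_le_mul_of_nonneg_right hk1 hdp.le; linarith only [hd14, this]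
  rename_bvar zz → zz
  have hxδ : 2 * δ * ‖x‖ ≤ 1 := by
    have := mul_le_mul hd1 hx12 (norm_nonneg x) (by norm_num); linarith only [hh1, hζp, hζh', this]
  have hA' := hA.rs (z := x) hxδ hτp (δ' := 2 * δ) le_rfl (by
    have := mul_le_mul_of_nonneg_left hτd hδ.le; linarith only [hδ, this])
  have h0' : (0:V) ∈ rsS S x τ := by simpa [rsS] using hxS
  have hlow' : ∀ y ∈ rsS S x τ, -(k0 * ‖y‖ ^ 2 / 2) ≤ ⟪v, y⟫ := by
    intro y hy
    have h1 := hlow (x + τ • y) hy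
    rw [add_sub_cancel_left, inner_smul_right, norm_smul, Real.norm_of_nonneg hτp.le, mul_pow] at h1
    have h2 : 2 * d * τ * -(k0 * ‖y‖ ^ 2 / 2) ≤ 2 * d * τ * ⟪v, y⟫ := by
      rw [hτ] at h1 ⊢; linarith only [h1]
    exact le_of_mul_le_mul_left h2 (by positivity)
  rename_bvar zz → zz
  have hflat' : ∀ y ∈ rsS S x τ, ‖y‖ ≤ 1 → |⟪n, y⟫| ≤ ζ := by
    intro y hy hy1
    have h1 : ‖x + τ • y‖ ≤ 1 := by
      refine (norm_add_le _ _).trans ?_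
      rw [norm_smul, Real.norm_of_nonneg hτp.le]
      have := mul_le_mul hτd hy1 (norm_nonneg y) (by norm_num); linarith only [hh1, hζp, hζh', hx12, this]
    have h2 := hflat _ hy h1
    have h3 := hflat x hxS (by linarith only [hh1, hζp, hζh', hx12])
    rw [inner_add_right, inner_smul_right] at h2
    rename_bvar zz → zz
    have h4 : τ * |⟪n, y⟫| ≤ 2 * η := by
      rw [← abs_of_pos hτp, ← abs_mul]
      rw [abs_le] at *; constructor <;> linarith only [h2, h3]
    have h5 : 2 * η ≤ τ * ζ := by
      rw [hτ]
      have := mul_le_mul_of_nonneg_right hC1a hdp.le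
      have := mul_le_mul_of_nonneg_left hcon.le (show 0 ≤ k0 * ζ by positivity)
      have := mul_le_mul_of_nonneg_right hC1a hη.le
      linarith
    exact le_of_mul_le_mul_left (h4.trans h5) hτp
  obtain ⟨b, q, hG⟩ := GD_exists hA' (by linarith only [hh1, hζp, hζh', hd1]) h0'
  have hb := haux _ _ _ hA' (by linarith only [hd1]) h0' b q hG n v hn hv1 hnvζ hlow'
    (fun y hy hy1 => (hflat' y hy hy1).trans hζ0)
  obtain ⟨hP1, -, -, hPb, hPq⟩ := hP _ _ _ hA' (by linarith only [hh1, hζp, hζh', hd1]) h0' b q hG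
  rename_bvar zz → zz
  have hnb : |⟪n, b⟫| ≤ C := (inner_abs_le_of_unit hn b).trans hPb
  have hbv : β0 / 2 ≤ ⟪b - ⟪n, b⟫ • n, v⟫ := by
    rw [inner_sub_left, real_inner_smul_left]
    have h1 : |⟪n, b⟫ * ⟪n, v⟫| * C1 ≤ C := by
      rw [abs_mul, mul_assoc]
      have := mul_le_mul hnb hnv (by positivity) hC.le
      linarith only [this]
    have h2 : |⟪n, b⟫ * ⟪n, v⟫| ≤ β0 / 2 := by
      have : |⟪n, b⟫ * ⟪n, v⟫| * C1 ≤ β0 / 2 * C1 := by linarith only [hC1c, h1]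
      exact le_of_mul_le_mul_right this (by linarith only [hh1, hζp, hζh', hC1])
    linarith only [(abs_le.1 h2).2, hb]
  have hbn : β0 / 2 ≤ ‖b - ⟪n, b⟫ • n‖ := by
    refine hbv.trans ((real_inner_le_norm _ _).trans ?_)
    rw [hv1, mul_one]
  obtain ⟨w, hw, hnw, hbw⟩ := unit_proj (b := b) hn (norm_ne_zero_iff.1 (by linarith only [hβ, hbn]))
  set m := ‖b - ⟪n, b⟫ • n‖
  rename_bvar zz → zz
  obtain ⟨y, hyS, hyh, hyk⟩ := D_contra hA' h0' hn hw hnw (r := h) (k := h / 4000) (by positivity)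
    (by linarith only) (by
      have := mul_le_mul_of_nonneg_left hh1 hδ.le; linarith only [hd1, this])
  have hn' := hflat' y hyS (by linarith only [hh1, hyh])
  rcases hyk with hyk | hyk
  · linarith only [hζh', hn', hyk]
  · have h1 := hP1 y hyS (by linarith only [hh1, hyh])
    have h2 := hPq y y
    have h3 : ‖y‖ * ‖y‖ ≤ h ^ 2 := by rw [pow_two]; gcongr
    have h4 : ‖y‖ ^ 3 ≤ h ^ 2 := by
      calc ‖y‖ ^ 3 ≤ h ^ 3 := by gcongr
        _ = h ^ 2 * h := by ring
        _ ≤ h ^ 2 * 1 := by gcongr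
        _ = _ := mul_one _
    rename_bvar zz → zz
    have h5 : |⟪b, y⟫| ≤ C * (h ^ 2 + h ^ 2) := by
      have a1 : C * (‖y‖ ^ 3 + 2 * δ) ≤ C * (h ^ 2 + h ^ 2) := by gcongr; linarith only [hd2]
      have a2 : C * (‖y‖ * ‖y‖) ≤ C * (h ^ 2 + h ^ 2) := by
        gcongr; have : 0 ≤ h ^ 2 := by positivity
        linarith only [hζp, hζh, h3]
      have := h1.trans a1
      have := h2.trans a2
      rw [abs_le] at *
      constructor <;> linarith only [h1, h2, a1, a2]
    have h6 : m * ⟪w, y⟫ = ⟪b, y⟫ - ⟪n, b⟫ * ⟪n, y⟫ := by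
      have := congrArg (fun z => ⟪z, y⟫) hbw
      simp only [inner_sub_left, real_inner_smul_left] at this
      linarith only [this]
    have h7 : |⟪n, b⟫ * ⟪n, y⟫| ≤ C * h ^ 2 := by
      rw [abs_mul]; exact mul_le_mul hnb (hn'.trans hζh) (abs_nonneg _) hC.le
    have h8 : m * |⟪w, y⟫| ≤ 3 * (C * h ^ 2) := by
      rw [← abs_of_nonneg (show 0 ≤ m by linarith only [hβ, hbn]), ← abs_mul, h6]
      exact (abs_sub _ _).trans (by linarith only [h5, h7])
    have h9 : β0 / 2 * (h / 4000) < m * |⟪w, y⟫| := 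
      mul_lt_mul' hbn hyk (by positivity) (by linarith only [hβ, hbn])
    have := mul_le_mul_of_nonneg_right hh2 hh.le
    linarith only [h8, h9, this]


lemma diag (q : V →ₗ[ℝ] V →ₗ[ℝ] ℝ) (hs : ∀ u v, q u v = q v u) :
    ∃ (e : OrthonormalBasis (Fin 4) ℝ V) (l : Fin 4 → ℝ), Antitone l ∧
      ∀ u v, q u v = l 0 * (⟪e 0, u⟫ * ⟪e 0, v⟫) + l 1 * (⟪e 1, u⟫ * ⟪e 1, v⟫)
        + l 2 * (⟪e 2, u⟫ * ⟪e 2, v⟫) + l 3 * (⟪e 3, u⟫ * ⟪e 3, v⟫) := by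
  have b := EuclideanSpace.basisFun (Fin 4) ℝ
  obtain ⟨T, hT⟩ : ∃ T : V →ₗ[ℝ] V, ∀ u v, ⟪T u, v⟫ = q u v := by
    refine ⟨{ toFun := fun u => ∑ i, q u (b i) • b i, map_add' := ?_, map_smul' := ?_ }, ?_⟩
    · intro u v; simp [add_smul, Finset.sum_add_distrib]
    · intro a u; simp [mul_smul, Finset.smul_sum]
    · intro u v
      simp only [LinearMap.coe_mk, AddHom.coe_mk, sum_inner, inner_smul_left]
      conv_rhs => rw [← b.sum_repr' v]
      simp only [map_sum, map_smul, smul_eq_mul]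
      refine Finset.sum_congr rfl fun i _ => ?_
      simp [mul_comm]
  have hsym : T.IsSymmetric := fun u v => by rw [hT, real_inner_comm, hT, hs]
  rename_bvar zz → zz
  have hn : Module.finrank ℝ V = 4 := by simp
  refine ⟨hsym.eigenvectorBasis hn, hsym.eigenvalues hn, hsym.eigenvalues_antitone hn, ?_⟩
  intro u v
  have h1 : ∀ i, q (hsym.eigenvectorBasis hn i) v = hsym.eigenvalues hn i * ⟪hsym.eigenvectorBasis hn i, v⟫ := by
    intro i
    rw [← hT, hsym.apply_eigenvectorBasis]
    simp [inner_smul_left]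
  conv_lhs => rw [← (hsym.eigenvectorBasis hn).sum_repr' u]
  simp only [Fin.sum_univ_four, map_add, map_smul, LinearMap.add_apply, LinearMap.smul_apply, smul_eq_mul, h1]
  ring

structure PD (S : Set V) (C R κ : ℝ) (b : V) (q : V →ₗ[ℝ] V →ₗ[ℝ] ℝ) : Prop where
  sym : ∀ u v, q u v = q v u
  poly : ∀ x ∈ S, ‖x‖ ≤ R → |2 * ⟪b, x⟫ + q x x| ≤ C * (‖x‖ ^ 3 / R + κ * R ^ 2)
  tr : ∀ e : OrthonormalBasis (Fin 4) ℝ V, |q (e 0) (e 0) + q (e 1) (e 1) + q (e 2) (e 2) + q (e 3) (e 3) + 1| ≤ C * κ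
  lo : ∀ u, -‖u‖ ^ 2 ≤ q u u
  bb : ‖b‖ ≤ C * R
  qb : ∀ u v, |q u v| ≤ C * (‖u‖ * ‖v‖)

lemma PS : ∃ C : ℝ, 1 ≤ C ∧ ∀ μ S δ, AU μ S δ → 0 ∈ S → ∀ R κ : ℝ, 0 < R → 2 * δ ≤ κ → 2 * δ * R ≤ κ →
    κ ≤ 1 → ∃ b q, GD (rs μ 0 R) (R⁻¹ • b) q ∧ PD S C R κ b q := by
  obtain ⟨C, hC, hP⟩ := P_lemma
  refine ⟨1 + C, by linarith, fun μ S δ h h0 R κ hR h1 h2 h3 => ?_⟩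
  have hr : AU (rs μ 0 R) (rsS S 0 R) κ := h.rs (by simp) hR h1 h2
  have h0' : (0:V) ∈ rsS S 0 R := by simpa [rsS] using h0
  rename_bvar zz → zz
  obtain ⟨b, q, hG⟩ := GD_exists hr h3 h0'
  obtain ⟨p1, p2, p3, p4, p5⟩ := hP _ _ _ hr h3 h0' b q hG
  have hκ : 0 < κ := hr.pos
  refine ⟨R • b, q, ?_, hG.symm, ?_, ?_, p3, ?_, ?_⟩
  · rwa [smul_smul, inv_mul_cancel₀ hR.ne', one_smul]
  · intro x hx hxR
    have hn : ‖R⁻¹ • x‖ = ‖x‖ / R := by rw [norm_smul, norm_inv, Real.norm_of_nonneg hR.le]; ring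
    have := p1 (R⁻¹ • x) (by simpa [rsS, smul_smul, hR.ne'] using hx) (by
      rw [hn, div_le_one hR]; exact hxR)
    rw [hn] at this
    simp only [inner_smul_right, map_smul, LinearMap.smul_apply, smul_eq_mul] at this
    rw [inner_smul_left, conj_trivial]
    have e1 : 2 * (R * ⟪b, x⟫) + q x x = R ^ 2 * (2 * (R⁻¹ * ⟪b, x⟫) + R⁻¹ * (R⁻¹ * q x x)) := by
      field_simp
    rw [e1, abs_mul, abs_of_pos (by positivity)]
    calc _ ≤ R ^ 2 * (C * ((‖x‖ / R) ^ 3 + κ)) := by gcongr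
      _ = C * (‖x‖ ^ 3 / R + κ * R ^ 2) := by field_simp
      _ ≤ _ := by gcongr; linarith only
  · intro e
    rename_bvar zz → zz
    have := p2 e
    rw [Fin.sum_univ_four] at this
    refine this.trans ?_
    gcongr; linarith
  · rw [norm_smul, Real.norm_of_nonneg hR.le, mul_comm]
    gcongr; linarith
  · intro u v; refine (p5 u v).trans ?_
    gcongr; linarith

lemma CS : ∃ δ1 C1 : ℝ, 0 < δ1 ∧ δ1 ≤ 1 / 10 ∧ 1 ≤ C1 ∧ ∀ μ S δ, AU μ S δ → ∀ z ∈ S, 2 * δ * ‖z‖ ≤ 1 →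
    ∀ m : ℝ, 0 < m → 2 * δ ≤ δ1 → 2 * δ * m ≤ δ1 → ∀ n : V, ‖n‖ = 1 → ∀ η : ℝ, 0 < η →
    (∀ y ∈ S, ‖y - z‖ ≤ m → |⟪n, y - z⟫| ≤ η * m) →
    ∀ p : V, ⟪n, p⟫ = 0 → ‖p‖ ≤ m / 4 → ∃ x ∈ S, ‖x - (z + p)‖ ≤ C1 * (η * m) := by
  obtain ⟨δ1, C1, h1, h2, h3, hC⟩ := C_lemma
  refine ⟨δ1, C1, h1, h2, h3, ?_⟩
  intro μ S δ h z hz hzd m hm hd1 hd2 n hn η hη hf p hp hpm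
  have hr : AU (rs μ z m) (rsS S z m) δ1 := h.rs hzd hm hd1 hd2
  obtain ⟨x, hx, hxp⟩ := hC _ _ _ hr le_rfl (by simpa [rsS] using hz) n hn η hη (by
    intro y hy hy1
    have := hf (z + m • y) hy (by
      rw [add_sub_cancel_left, norm_smul, Real.norm_of_nonneg hm.le]
      nlinarith only [h1, h2, hm, hy1])
    rw [add_sub_cancel_left, inner_smul_right, abs_mul, abs_of_pos hm] at this
    have : m * |⟪n, y⟫| ≤ m * η := by linarith
    exact le_of_mul_le_mul_left this hm) (m⁻¹ • p) (by rw [inner_smul_right, hp, mul_zero]) (by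
      rw [norm_smul, norm_inv, Real.norm_of_nonneg hm.le, inv_mul_le_iff₀ hm]; linarith only [hpm])
  refine ⟨z + m • x, hx, ?_⟩
  rename_bvar zz → zz
  have : z + m • x - (z + p) = m • (x - m⁻¹ • p) := by
    rw [smul_sub, smul_smul, mul_inv_cancel₀ hm.ne', one_smul]; abel
  rw [this, norm_smul, Real.norm_of_nonneg hm.le]
  nlinarith only [h1, h2, hm, hxp]

def Fl (S : Set V) (s η : ℝ) : Prop := ∃ n : V, ‖n‖ = 1 ∧ ∀ y ∈ S, ‖y‖ ≤ s → |⟪n, y⟫| ≤ η * s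


lemma sq_le_of_abs {x c : ℝ} (h : |x| ≤ c) : x ^ 2 ≤ c ^ 2 := by
  rw [← sq_abs]; exact pow_le_pow_left₀ (abs_nonneg _) h 2

lemma q_expand (q : V →ₗ[ℝ] V →ₗ[ℝ] ℝ) (hs : ∀ u v, q u v = q v u) {C : ℝ} (hC : 0 ≤ C)
    (hb : ∀ u v, |q u v| ≤ C * (‖u‖ * ‖v‖)) (x p : V) : |q x x - q p p| ≤ C * ((‖x‖ + ‖p‖) * ‖x - p‖) := by
  have : q x x - q p p = q (x + p) (x - p) := by
    simp only [map_add, map_sub, LinearMap.add_apply]; rw [hs x p]; ring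
  rw [this]
  refine (hb _ _).trans ?_
  gcongr
  exact norm_add_le _ _

lemma span2_perp (n u v : V) (hu : ‖u‖ = 1) (hv : ‖v‖ = 1) (huv : ⟪u, v⟫ = 0) :
    ∃ a b : ℝ, a ^ 2 + b ^ 2 = 1 ∧ ⟪n, a • u + b • v⟫ = 0 := by
  by_cases h : ⟪n, u⟫ ^ 2 + ⟪n, v⟫ ^ 2 = 0
  · refine ⟨1, 0, by norm_num, ?_⟩
    have : ⟪n, u⟫ = 0 := by nlinarith only [sq_nonneg ⟪n, u⟫, sq_nonneg ⟪n, v⟫, h]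
    simp [this]
  · have hp : 0 < ⟪n, u⟫ ^ 2 + ⟪n, v⟫ ^ 2 := lt_of_le_of_ne (by positivity) (Ne.symm h)
    obtain ⟨s, hs⟩ : ∃ s, s = Real.sqrt (⟪n, u⟫ ^ 2 + ⟪n, v⟫ ^ 2) := ⟨_, rfl⟩
    have hs2 : s ^ 2 = ⟪n, u⟫ ^ 2 + ⟪n, v⟫ ^ 2 := by rw [hs, Real.sq_sqrt hp.le]
    have hs0 : s ≠ 0 := by rw [hs]; positivity
    refine ⟨⟪n, v⟫ / s, -⟪n, u⟫ / s, ?_, ?_⟩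
    · field_simp; linarith
    · rw [inner_add_right, inner_smul_right, inner_smul_right]; field_simp; ring

lemma sq_lin {x a : ℝ} (hx1 : -(1/100) ≤ x - a) (hx2 : x - a ≤ 1/100) (ha : a ^ 2 ≤ 1) :
    a ^ 2 - 1 / 40 ≤ x ^ 2 ∧ x ^ 2 ≤ a ^ 2 + 1 / 40 := by
  have : |a| ≤ 1 := by rwa [← sq_le_one_iff_abs_le_one]
  rw [abs_le] at this
  constructor <;> nlinarith only [this, hx1, hx2]

lemma rank1_sc {l0 l1 l2 l3 e s0 s1 s2 s3 : ℝ} (he : 0 < e) (he1 : e ≤ 1 / 1000) (h01 : l1 ≤ l0) (h12 : l2 ≤ l1)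
    (h23 : l3 ≤ l2) (h3 : -1 ≤ l3) (t : l0 + l1 + l2 + l3 + 1 ≤ e)
    (p0 : 0 ≤ s0) (p1 : 0 ≤ s1) (p2 : 0 ≤ s2) (p3 : 0 ≤ s3) (q0 : s0 ≤ 1 / 10000) (q1 : s1 ≤ 1 / 10000)
    (q2 : 95 / 100 ≤ s2 + s3) (q3 : s2 + s3 ≤ 105 / 100)
    (hq : -e ≤ l0 * s0 + l1 * s1 + l2 * s2 + l3 * s3) : -(8 * e) ≤ l2 := by
  have m0 : l0 * s0 ≤ 3 * s0 := mul_le_mul_of_nonneg_right (by linarith only [he, he1, h12, h23, h3, t]) p0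
  have m1 : l1 * s1 ≤ 3 * s1 := mul_le_mul_of_nonneg_right (by linarith only [he, he1, h01, h23, h3, t]) p1
  have m3 : l3 * s3 ≤ l2 * s3 := mul_le_mul_of_nonneg_right (by linarith only [h23]) p3
  rename_bvar zz → zz
  have l2b : -(1/300) ≤ l2 := by
    by_contra hc; push Not at hc
    have : l2 * (s2 + s3) ≤ -(1/300) * (s2 + s3) := mul_le_mul_of_nonneg_right hc.le (by linarith only [he, he1, q2])
    linarith only [he, he1, q0, q1, q2, hq, m0, m1, m3, this]
  have m2 : l2 * s2 ≤ 1 / 100 * s2 := mul_le_mul_of_nonneg_right (by linarith only [he, he1, h01, h12, h3, t]) p2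
  have n3 : l3 * s3 ≤ -(98/100) * s3 := mul_le_mul_of_nonneg_right (by linarith only [he, he1, h01, h12, t, l2b]) p3
  have hx2 : 1 / 4 ≤ s2 := by linarith only [he, he1, q0, q1, q2, hq, m0, m1, m2, n3]
  by_contra hc; push Not at hc
  rename_bvar zz → zz
  have k0 : l0 * s0 ≤ (e - 2 * l2) * s0 := mul_le_mul_of_nonneg_right (by linarith only [h12, h3, t]) p0
  have k1 : l1 * s1 ≤ (e - 2 * l2) * s1 := mul_le_mul_of_nonneg_right (by linarith only [he, h01, h3, t, hc]) p1
  have k0' : (e - 2 * l2) * s0 ≤ (e - 2 * l2) * (1 / 10000) := mul_le_mul_of_nonneg_left q0 (by linarith only [he, hc])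
  have k1' : (e - 2 * l2) * s1 ≤ (e - 2 * l2) * (1 / 10000) := mul_le_mul_of_nonneg_left q1 (by linarith only [he, hc])
  rename_bvar zz → zz
  have k2 : l2 * s2 ≤ l2 * (1 / 4) := mul_le_mul_of_nonpos_left hx2 (by linarith only [he, hc])
  have k3 : l3 * s3 ≤ 0 := by linarith only [he, p3, hq, n3, hc, k0, k1, k0', k1', k2]
  linarith only [he, p3, hq, n3, hc, k0, k1, k0', k1', k2]

lemma rank1 (q : V →ₗ[ℝ] V →ₗ[ℝ] ℝ) (hs : ∀ u v, q u v = q v u) {e : ℝ} (he : 0 < e) (he1 : e ≤ 1 / 1000)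
    (lo : ∀ u, -‖u‖ ^ 2 ≤ q u u)
    (tr : ∀ f : OrthonormalBasis (Fin 4) ℝ V, |q (f 0) (f 0) + q (f 1) (f 1) + q (f 2) (f 2) + q (f 3) (f 3) + 1| ≤ e)
    (n : V) (H : ∀ v : V, ‖v‖ = 1 → ⟪n, v⟫ = 0 → ∃ x, ‖x - v‖ ≤ 1 / 100 ∧ |q x x| ≤ e) :
    ∃ ν : V, ‖ν‖ = 1 ∧ ∀ x, |q x x + ⟪ν, x⟫ ^ 2| ≤ 25 * e * ‖x‖ ^ 2 := by
  obtain ⟨f, l, hl, hq⟩ := diag q hs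
  have hf := onb_ip f
  have hf1 : ∀ i, ‖f i‖ = 1 := fun i => f.orthonormal.1 i
  rename_bvar zz → zz
  have hd : ∀ x, q x x = l 0 * ⟪f 0, x⟫ ^ 2 + l 1 * ⟪f 1, x⟫ ^ 2 + l 2 * ⟪f 2, x⟫ ^ 2 + l 3 * ⟪f 3, x⟫ ^ 2 := by
    intro x; rw [hq]; ring
  have t := abs_le.1 (tr f)
  have l3 := lo (f 3)
  simp only [hd, hf, hf1] at t l3
  simp at t l3
  have h01 : l 1 ≤ l 0 := hl (by decide)
  rename_bvar zz → zz
  have h12 : l 2 ≤ l 1 := hl (by decide)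
  have h23 : l 3 ≤ l 2 := hl (by decide)
  obtain ⟨a, b, hab, hv⟩ := span2_perp n (f 2) (f 3) (hf1 2) (hf1 3) (by simp [hf])
  have c0 : ⟪f 0, a • f 2 + b • f 3⟫ = 0 := by simp [inner_add_right, inner_smul_right, hf]
  rename_bvar zz → zz
  have c1 : ⟪f 1, a • f 2 + b • f 3⟫ = 0 := by simp [inner_add_right, inner_smul_right, hf]
  have c2 : ⟪f 2, a • f 2 + b • f 3⟫ = a := by simp [inner_add_right, inner_smul_right, hf]
  have c3 : ⟪f 3, a • f 2 + b • f 3⟫ = b := by simp [inner_add_right, inner_smul_right, hf]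
  have hvn : ‖a • f 2 + b • f 3‖ = 1 := by
    have := norm_sq4 f (a • f 2 + b • f 3)
    rw [c0, c1, c2, c3] at this
    have h2 : ‖a • f 2 + b • f 3‖ ^ 2 = 1 := by rw [this]; linarith only [hab]
    exact (pow_eq_one_iff_of_nonneg (norm_nonneg _) two_ne_zero).1 h2
  rename_bvar zz → zz
  obtain ⟨x, hx, hxq⟩ := H _ hvn hv
  have hw := fun i => (inner_abs_le_of_unit (hf1 i) (x - (a • f 2 + b • f 3))).trans hx
  simp only [inner_sub_right] at hw
  have w0 := hw 0
  have w1 := hw 1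
  rename_bvar zz → zz
  have w2 := hw 2
  have w3 := hw 3
  rw [c0, sub_zero] at w0
  rw [c1, sub_zero] at w1
  rw [c2] at w2
  rw [c3] at w3
  rw [hd] at hxq
  obtain ⟨x0, e0⟩ : ∃ x0, x0 = ⟪f 0, x⟫ := ⟨_, rfl⟩
  obtain ⟨x1, e1⟩ : ∃ x0, x0 = ⟪f 1, x⟫ := ⟨_, rfl⟩
  rename_bvar zz → zz
  obtain ⟨x2, e2⟩ : ∃ x0, x0 = ⟪f 2, x⟫ := ⟨_, rfl⟩
  obtain ⟨x3, e3⟩ : ∃ x0, x0 = ⟪f 3, x⟫ := ⟨_, rfl⟩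
  rw [← e0] at w0 hxq
  rw [← e1] at w1 hxq
  rw [← e2] at w2 hxq
  rw [← e3] at w3 hxq
  rw [abs_le] at hxq w2 w3
  have s0 : x0 ^ 2 ≤ 1 / 10000 := (sq_le_of_abs w0).trans (by norm_num)
  have s1 : x1 ^ 2 ≤ 1 / 10000 := (sq_le_of_abs w1).trans (by norm_num)
  rename_bvar zz → zz
  have d2 := sq_lin w2.1 w2.2 (by linarith only [sq_nonneg b, hab])
  have d3 := sq_lin w3.1 w3.2 (by linarith only [sq_nonneg a, hab])
  have l2b' := rank1_sc he he1 h01 h12 h23 l3 t.2 (sq_nonneg x0) (sq_nonneg x1) (sq_nonneg x2) (sq_nonneg x3)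
    s0 s1 (by linarith only [hab, d2, d3]) (by linarith only [hab, d2, d3]) hxq.1
  clear s0 s1 d2 d3 hxq w0 w1 w2 w3 hw
  refine ⟨f 3, hf1 3, fun y => ?_⟩
  rw [hd, norm_sq4 f y, abs_le]
  have u : ∀ i, i ≠ 3 → -(8 * e) ≤ l i ∧ l i ≤ 17 * e := by
    intro i hi
    fin_cases i <;> simp at hi ⊢ <;> constructor <;> linarith only [h01, h12, l2b', t, l3, he]
  rename_bvar zz → zz
  have u3 : l 3 + 1 ≤ 25 * e := by linarith
  have b0 := mul_le_mul_of_nonneg_right (u 0 (by decide)).1 (sq_nonneg ⟪f 0, y⟫)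
  have b1 := mul_le_mul_of_nonneg_right (u 1 (by decide)).1 (sq_nonneg ⟪f 1, y⟫)
  have b2 := mul_le_mul_of_nonneg_right (u 2 (by decide)).1 (sq_nonneg ⟪f 2, y⟫)
  rename_bvar zz → zz
  have b0' := mul_le_mul_of_nonneg_right (u 0 (by decide)).2 (sq_nonneg ⟪f 0, y⟫)
  have b1' := mul_le_mul_of_nonneg_right (u 1 (by decide)).2 (sq_nonneg ⟪f 1, y⟫)
  have b2' := mul_le_mul_of_nonneg_right (u 2 (by decide)).2 (sq_nonneg ⟪f 2, y⟫)
  have b3 := mul_le_mul_of_nonneg_right u3 (sq_nonneg ⟪f 3, y⟫)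
  rename_bvar zz → zz
  have b3' := mul_le_mul_of_nonneg_right l3 (sq_nonneg ⟪f 3, y⟫)
  have r := fun i => mul_nonneg he.le (sq_nonneg ⟪f i, y⟫)
  have r0 := r 0
  have r1 := r 1
  rename_bvar zz → zz
  have r2 := r 2
  have r3 := r 3
  constructor <;> linarith only [b0, b1, b2, b0', b1', b2', b3, b3']

lemma tang : ∃ C : ℝ, 1 ≤ C ∧ ∀ μ S δ, AU μ S δ → δ ≤ 1 → 0 ∈ S → ∀ b q, GD μ b q →
    ∀ v : V, ‖v‖ = 1 → ∀ h τ : ℝ, 0 < h → h ≤ 1 / 2 → 0 ≤ τ → τ ≤ h → 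
    ∀ x ∈ S, ∀ y ∈ S, ‖x - h • v‖ ≤ τ → ‖y - (-(h • v))‖ ≤ τ → |q v v| ≤ C * (h + (τ + δ) / h ^ 2) := by
  obtain ⟨C, hC, hP⟩ := P_lemma
  refine ⟨100 * (1 + C), by linarith, ?_⟩
  intro μ S δ hA hd h0 b q hG v hv h τ hh hh1 hτ hτh x hx y hy hxv hyv
  obtain ⟨p1, p2, p3, p4, p5⟩ := hP _ _ _ hA hd h0 b q hG
  have hn : ‖h • v‖ = h := by rw [norm_smul, hv, Real.norm_of_nonneg hh.le, mul_one]
  rename_bvar zz → zz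
  have hxn : ‖x‖ ≤ 2 * h := by
    calc ‖x‖ = ‖(x - h • v) + h • v‖ := by congr 1; abel
      _ ≤ _ := norm_add_le _ _
      _ ≤ 2 * h := by linarith
  have hyn : ‖y‖ ≤ 2 * h := by
    calc ‖y‖ = ‖(y - (-(h • v))) + (-(h • v))‖ := by congr 1; abel
      _ ≤ _ := norm_add_le _ _
      _ ≤ 2 * h := by rw [norm_neg]; linarith
  have hxy : ‖x + y‖ ≤ 2 * τ := by
    calc ‖x + y‖ = ‖(x - h • v) + (y - (-(h • v)))‖ := by congr 1; abel
      _ ≤ _ := norm_add_le _ _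
      _ ≤ 2 * τ := by linarith
  have a1 := p1 x hx (by linarith)
  rename_bvar zz → zz
  have a2 := p1 y hy (by linarith)
  have c1 : ‖x‖ ^ 3 ≤ 8 * h ^ 3 := by
    calc ‖x‖ ^ 3 ≤ (2 * h) ^ 3 := by gcongr
      _ = _ := by ring
  have c2 : ‖y‖ ^ 3 ≤ 8 * h ^ 3 := by
    calc ‖y‖ ^ 3 ≤ (2 * h) ^ 3 := by gcongr
      _ = _ := by ring
  have e1 := q_expand q hG.symm hC.le p5 x (h • v)
  rename_bvar zz → zz
  have e2 := q_expand q hG.symm hC.le p5 y (-(h • v))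
  have hb := abs_real_inner_le_norm b (x + y)
  have hb2 : ‖b‖ * ‖x + y‖ ≤ C * (2 * τ) := by gcongr
  have e1' : |q x x - q (h • v) (h • v)| ≤ C * (3 * h * τ) := e1.trans (by rw [hn]; gcongr; linarith)
  rename_bvar zz → zz
  have e2' : |q y y - q (-(h • v)) (-(h • v))| ≤ C * (3 * h * τ) := e2.trans (by rw [norm_neg, hn]; gcongr; linarith only [hyn])
  simp only [map_neg, map_smul, LinearMap.smul_apply, LinearMap.neg_apply, smul_eq_mul, neg_neg] at e1' e2'
  rw [inner_add_right] at hb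
  have c1' := mul_le_mul_of_nonneg_left c1 hC.le
  have c2' := mul_le_mul_of_nonneg_left c2 hC.le
  have hht : C * (3 * h * τ) ≤ C * (3 * τ) := by gcongr; nlinarith only [hτ, hh1]
  rename_bvar zz → zz
  have key : 2 * h ^ 2 * |q v v| ≤ 2 * C * (8 * h ^ 3 + δ) + 4 * C * τ + 6 * C * τ := by
    have : 2 * h ^ 2 * |q v v| = |2 * (h * (h * q v v))| := by
      rw [show 2 * (h * (h * q v v)) = (2 * h ^ 2) * q v v by ring, abs_mul, abs_of_pos (by positivity : 0 < 2 * h ^ 2)]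
    rw [this]
    rw [abs_le] at *
    constructor <;> linarith only [a1, a2, hb, hb2, e1', e2', c1', c2', hht]
  have hδ := hA.pos
  have : |q v v| ≤ (2 * C * (8 * h ^ 3 + δ) + 4 * C * τ + 6 * C * τ) / (2 * h ^ 2) := by
    rw [le_div_iff₀ (by positivity)]; linarith only [key]
  refine this.trans ?_
  rw [div_le_iff₀ (by positivity)]
  have : 100 * (1 + C) * (h + (τ + δ) / h ^ 2) * (2 * h ^ 2) = 200 * (1 + C) * (h ^ 3 + τ + δ) := by
    field_simp; ring
  rw [this]
  rename_bvar zz → zz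
  have h3 : 0 < h ^ 3 := by positivity
  have := mul_nonneg hC.le hτ
  have := mul_pos hC hδ
  have := mul_pos hC h3
  linarith


lemma pow_le_self' {ε : ℝ} (h0 : 0 < ε) (h1 : ε ≤ 1) {a b : ℕ} (h : a ≤ b) : ε ^ b ≤ ε ^ a :=
  pow_le_pow_of_le_one h0.le h1 h

lemma two_sheet (K : ℝ) (hK : 1 ≤ K) : ∃ C : ℝ, 1 ≤ C ∧ ∀ ε : ℝ, 0 < ε → ε * C ≤ 1 → ∀ μ S, AU μ S (ε ^ 20) →
    (0:V) ∈ S → ∀ ν : V, ‖ν‖ = 1 → (∀ x ∈ S, ‖x‖ ≤ ε ^ 6 → |⟪ν, x⟫| ≤ K * ε ^ 20) →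
    ∀ y ∈ S, ‖y‖ ≤ 1 / 2 → |⟪ν, y⟫| ≤ C * ε := by
  obtain ⟨δ1, C1, hδ1, hδ1', hC1, hCS⟩ := CS
  obtain ⟨Ct, hCt, hT⟩ := tang
  obtain ⟨Cp, hCp, hP⟩ := P_lemma
  rename_bvar zz → zz
  have hc := cG_pos
  obtain ⟨C6, hC6⟩ : ∃ C6, C6 = Ct * (1 + 32 * C1 * K) := ⟨_, rfl⟩
  have hC6p : 0 < C6 := by rw [hC6]; positivity
  obtain ⟨C8, hC8⟩ : ∃ C8, C8 = cG / 2 * (3 * C6 + Cp) := ⟨_, rfl⟩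
  rename_bvar zz → zz
  have hC8p : 0 < C8 := by rw [hC8]; positivity
  have hCK : 1 ≤ C1 * K := by nlinarith only [hK, hC1]
  refine ⟨4 * C1 * K + 32 * C8 + 2 / δ1, by have : 0 < 2 / δ1 := by positivity
                                            linarith only [hδ1, hδ1', hC8p, hCK, this], ?_⟩
  intro ε hε hεC μ S hA h0 ν hν hfl y hy hy1
  have hd1 : 0 < 2 / δ1 := by positivity
  have p1 : ε * (4 * (C1 * K)) ≤ 1 := by
    refine le_trans ?_ hεC
    gcongr; linarith only [hC8p, hd1]
  rename_bvar zz → zz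
  have p3 : ε * 2 ≤ δ1 := by
    have : ε * (2 / δ1) ≤ 1 := by
      refine le_trans ?_ hεC
      gcongr; linarith only [hC8p, hδ1, hδ1', hCK]
    rw [← mul_div_assoc, div_le_one hδ1] at this
    exact this
  have hε1 : ε ≤ 1 := by linarith only [hδ1', hε, p3]
  have e20 : ε ^ 20 ≤ ε := by simpa using pow_le_self' hε hε1 (show 1 ≤ 20 by norm_num)
  have e14 : ε ^ 14 ≤ ε := by simpa using pow_le_self' hε hε1 (show 1 ≤ 14 by norm_num)
  rename_bvar zz → zz
  have e6 : ε ^ 6 ≤ ε := by simpa using pow_le_self' hε hε1 (show 1 ≤ 6 by norm_num)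
  have q20 : 0 < ε ^ 20 := by positivity
  have q6 : 0 < ε ^ 6 := by positivity
  have q14 : 0 < ε ^ 14 := by positivity
  rename_bvar zz → zz
  have hd6 : 2 * ε ^ 20 * ε ^ 6 ≤ δ1 := by
    calc _ ≤ 2 * ε ^ 20 * 1 := by gcongr; linarith only [hδ1', hε, p3, e6]
      _ ≤ δ1 := by linarith only [p3, e20]
  have hcs := hCS μ S _ hA 0 h0 (by simp) (ε ^ 6) q6 (by linarith only [p3, e20]) hd6 ν hν (K * ε ^ 14) (by positivity)
    (by intro y hy hy6
        rw [sub_zero] at *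
        have := hfl y hy hy6
        rwa [mul_assoc, ← pow_add])
  obtain ⟨b, q, hG⟩ := GD_exists hA (by linarith only [hδ1', hε, p3, e20]) h0
  obtain ⟨P1, P2, P3, P4, P5⟩ := hP _ _ _ hA (by linarith only [hδ1', hε, p3, e20]) h0 b q hG
  rename_bvar zz → zz
  have htv : ∀ v : V, ‖v‖ = 1 → ⟪ν, v⟫ = 0 → |q v v| ≤ C6 * ε ^ 6 := by
    intro v hv hvn
    have nv : ‖(ε ^ 6 / 4) • v‖ = ε ^ 6 / 4 := by
      rw [norm_smul, hv, mul_one, Real.norm_of_nonneg (by positivity)]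
    obtain ⟨x, hx, hxv⟩ := hcs ((ε ^ 6 / 4) • v) (by rw [inner_smul_right, hvn, mul_zero]) nv.le
    obtain ⟨x', hx', hxv'⟩ := hcs (-((ε ^ 6 / 4) • v)) (by rw [inner_neg_right, inner_smul_right, hvn]; simp) (by
      rw [norm_neg, nv])
    rw [zero_add] at hxv hxv'
    rename_bvar zz → zz
    have t0 : C1 * (K * ε ^ 14 * ε ^ 6) = (C1 * K) * ε ^ 20 := by ring
    rw [t0] at hxv hxv'
    have t1 : C1 * K * ε ^ 20 ≤ ε ^ 6 / 4 := by
      have : ε ^ 20 = ε ^ 14 * ε ^ 6 := by ring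
      rw [this]
      have : (C1 * K * ε ^ 14) * ε ^ 6 ≤ 1 / 4 * ε ^ 6 := by
        gcongr
        calc C1 * K * ε ^ 14 ≤ C1 * K * ε := by gcongr
          _ ≤ 1 / 4 := by linarith only [p1]
      linarith only [this]
    have := hT _ _ _ hA (by linarith only [hδ1', hε, p3, e20]) h0 b q hG v hv (ε ^ 6 / 4) (C1 * K * ε ^ 20) (by positivity) (by linarith only [hδ1', hε, p3, e6])
      (by positivity) t1 x hx x' hx' hxv hxv'
    refine this.trans ?_
    have t2 : (C1 * K * ε ^ 20 + ε ^ 20) / (ε ^ 6 / 4) ^ 2 = 16 * (C1 * K + 1) * ε ^ 8 := by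
      field_simp; ring
    rw [t2, hC6, mul_assoc Ct]
    refine mul_le_mul_of_nonneg_left ?_ (by linarith only [hδ1', hCt, hε, p3])
    have : ε ^ 8 ≤ ε ^ 6 := pow_le_self' hε hε1 (by norm_num)
    have : 16 * (C1 * K + 1) * ε ^ 8 ≤ 32 * (C1 * K) * ε ^ 6 := mul_le_mul (by linarith only [hCK]) this (by positivity) (by positivity)
    linarith only [q6, this]
  obtain ⟨e, he⟩ := onb1 hν
  have he1 : ∀ i, ‖e i‖ = 1 := fun i => e.orthonormal.1 i
  have htr := P2 e
  rw [Fin.sum_univ_four, he] at htr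
  rename_bvar zz → zz
  have hperp : ∀ i, i ≠ 0 → ⟪ν, e i⟫ = 0 := by
    intro i hi; rw [← he, onb_ip]; simp [hi.symm]
  have g1 := (abs_le.1 (htv (e 1) (he1 1) (hperp 1 (by decide)))).1
  have g2 := (abs_le.1 (htv (e 2) (he1 2) (hperp 2 (by decide)))).1
  have g3 := (abs_le.1 (htv (e 3) (he1 3) (hperp 3 (by decide)))).1
  rename_bvar zz → zz
  have g0 := (abs_le.1 htr).2
  have hGν : G μ (fun y => ⟪ν, y⟫ * ⟪ν, y⟫) ≤ C8 * ε ^ 6 := by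
    have h1 := hG.qeq ν ν
    rw [real_inner_self_eq_norm_sq, hν] at h1
    have h2 : q ν ν + 1 ≤ (3 * C6 + Cp) * ε ^ 6 := by
      have : Cp * ε ^ 20 ≤ Cp * ε ^ 6 := by gcongr ?_ * ?_; exact pow_le_self' hε hε1 (by norm_num)
      linarith only [g1, g2, g3, g0, this]
    have h3 := mul_le_mul_of_nonneg_left h2 hc.le
    rw [hC8]; linarith only [h1, h3]
  obtain ⟨a, ha⟩ : ∃ a, a = |⟪ν, y⟫| := ⟨_, rfl⟩
  rw [← ha]
  by_cases ha0 : a = 0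
  · rw [ha0]; positivity
  have hap : 0 < a := lt_of_le_of_ne (by rw [ha]; positivity) (Ne.symm ha0)
  rename_bvar zz → zz
  have ha1 : a ≤ 1 / 2 := by rw [ha]; exact (inner_abs_le_of_unit hν y).trans hy1
  have hlow := G_lower hA (qu_int hA (by linarith only [hδ1', hε, p3, e20]) h0 ν ν) (fun y _ => mul_self_nonneg _)
    (measurableSet_closedBall (x := y) (ε := a / 2)) (by
      intro z hz
      rw [mem_closedBall, dist_eq_norm] at hz
      rw [mem_closedBall_zero_iff]
      calc ‖z‖ = ‖(z - y) + y‖ := by congr 1; abel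
        _ ≤ _ := norm_add_le _ _
        _ ≤ 1 := by linarith only [hδ1', hε, hy1, p3, ha1, hz]) (k := a ^ 2 / 4) (by positivity) (by
      intro z hz _
      rw [mem_closedBall, dist_eq_norm] at hz
      have h1 := (inner_abs_le_of_unit hν (z - y)).trans hz
      rw [inner_sub_right] at h1
      have h2 : a / 2 ≤ |⟪ν, z⟫| := by
        have := abs_sub_abs_le_abs_sub ⟪ν, y⟫ ⟪ν, z⟫
        rw [abs_sub_comm] at this
        linarith only [ha, h1, this]
      have := pow_le_pow_left₀ (by positivity) h2 2
      rw [sq_abs] at this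
      calc a ^ 2 / 4 = (a / 2) ^ 2 := by ring
        _ ≤ _ := this
        _ = _ := by ring)
  have hm := hA.lo hy (by
    calc ε ^ 20 * ‖y‖ ≤ 1 * (1 / 2) := by gcongr; linarith only [hδ1', hε, p3, e20]
      _ ≤ 1 := by norm_num) (half_pos hap) (by
    calc ε ^ 20 * (1 + a / 2) ≤ (1 / 4) * 2 := by gcongr <;> linarith only [hδ1', hε, p3, e20, ha1]
      _ ≤ 1 := by norm_num)
  have h5 : a ^ 2 / 4 * (3 * (a / 2) ^ 3) ≤ 3 * (C8 * ε ^ 6) := by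
    refine le_trans ?_ (hlow.trans (by gcongr))
    gcongr
  rename_bvar zz → zz
  have h6 : a ^ 5 ≤ ((4 * C1 * K + 32 * C8 + 2 / δ1) * ε) ^ 5 := by
    have : a ^ 5 ≤ 32 * C8 * ε ^ 6 := by linarith only [h5]
    refine this.trans ?_
    rw [mul_pow]
    have h7 : ε ^ 6 ≤ ε ^ 5 := pow_le_self' hε hε1 (by norm_num)
    have h8 : 32 * C8 ≤ (4 * C1 * K + 32 * C8 + 2 / δ1) ^ 5 := by
      refine le_trans ?_ (le_self_pow₀ (by linarith only [hδ1', hC8p, hCK, hε, hd1, p3]) (by norm_num))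
      linarith only [hδ1', hCK, hε, hd1, p3]
    gcongr
  exact (pow_le_pow_iff_left₀ hap.le (by positivity) (by norm_num)).1 h6


lemma Improve : ∃ ε0 C : ℝ, 0 < ε0 ∧ ε0 ≤ 1 ∧ 1 ≤ C ∧ ∀ ε : ℝ, 0 < ε → ε * C ≤ 1 → ∀ μ S, AU μ S (ε ^ 500) →
    (0:V) ∈ S → Fl S ((ε⁻¹) ^ 68) ε0 → Fl S (1 / 2) (C * ε) := by
  obtain ⟨δ1, C1, hδ1, hδ1', hC1, hCS⟩ := CS
  obtain ⟨Cp, hCp, hP⟩ := PS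
  obtain ⟨C2, hC2⟩ : ∃ C2, C2 = 25 * (80 * Cp) := ⟨_, rfl⟩
  rename_bvar zz → zz
  obtain ⟨C4, hC4⟩ : ∃ C4, C4 = C2 + 3 * Cp + 16 := ⟨_, rfl⟩
  have hC41 : 1 ≤ C4 := by linarith only [hδ1, hδ1', hCp, hC2, hC4]
  obtain ⟨C5, hC5, hTS⟩ := two_sheet C4 hC41
  have hd1 : 0 < 2 / δ1 := by positivity
  refine ⟨1 / (400 * C1), 2 * C5 + 2 / δ1 + 80 * Cp * 1000 + C4 + 16 * C1 + 10, by positivity, ?_, by linarith only [hδ1, hδ1', hC1, hCp, hC2, hC4, hC5, hd1], ?_⟩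
  · rw [div_le_one (by positivity)]; linarith
  intro ε hε hεC μ S hA h0 hFl
  rename_bvar zz → zz
  obtain ⟨K, hK⟩ : ∃ K, K = 2 * C5 + 2 / δ1 + 80 * Cp * 1000 + C4 + 16 * C1 + 10 := ⟨_, rfl⟩
  rw [← hK] at hεC ⊢
  have sm : ∀ c, c ≤ K → ε * c ≤ 1 := fun c hc => (mul_le_mul_of_nonneg_left hc hε.le).trans hεC
  have s1 := sm C5 (by linarith only [hδ1, hδ1', hC1, hCp, hC2, hC4, hC5, hd1, hK])
  have s3 := sm (80 * Cp * 1000) (by linarith only [hδ1, hδ1', hC1, hCp, hC2, hC4, hC5, hd1, hK])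
  rename_bvar zz → zz
  have s4 := sm C4 (by linarith only [hδ1, hδ1', hC1, hCp, hC5, hd1, hK])
  have s5 := sm (16 * C1) (by linarith only [hδ1, hδ1', hCp, hC2, hC4, hC5, hd1, hK])
  have s6 := sm 10 (by linarith only [hδ1, hδ1', hC1, hCp, hC2, hC4, hC5, hd1, hK])
  have s2 : ε * 2 ≤ δ1 := by
    have := sm (2 / δ1) (by linarith only [hδ1, hδ1', hC1, hCp, hC2, hC4, hC5, hK])
    rwa [← mul_div_assoc, div_le_one hδ1] at this
  rename_bvar zz → zz
  have hε1 : ε ≤ 1 := by linarith only [hδ1', hε, s2]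
  clear sm
  have hK1 : 2 * C5 ≤ K := by linarith only [hδ1', hC1, hCp, hC2, hC4, hd1, hε, hK, s2]
  have hK2 : 4 * Cp + 6 ≤ K := by linarith only [hδ1', hC1, hCp, hC2, hC4, hC5, hd1, hε, hK, s2]
  obtain ⟨M, hM⟩ : ∃ M, M = ε⁻¹ := ⟨_, rfl⟩
  rw [← hM] at hFl
  rename_bvar zz → zz
  have hMp : 0 < M := by rw [hM]; positivity
  have hM1 : 1 ≤ M := by rw [hM]; exact (one_le_inv₀ hε).2 hε1
  have em : ∀ a b : ℕ, ε ^ (a + b) * M ^ b = ε ^ a := by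
    intro a b
    rw [pow_add, mul_assoc, ← mul_pow, hM, mul_inv_cancel₀ hε.ne', one_pow, mul_one]
  have me : ∀ a b : ℕ, M ^ (a + b) * ε ^ b = M ^ a := by
    intro a b
    rw [pow_add, mul_assoc, ← mul_pow, hM, inv_mul_cancel₀ hε.ne', one_pow, mul_one]
  rename_bvar zz → zz
  have ple : ∀ a b : ℕ, a ≤ b → ε ^ b ≤ ε ^ a := fun a b h => pow_le_self' hε hε1 h
  have pMle : ∀ a b : ℕ, a ≤ b → M ^ a ≤ M ^ b := fun a b h => pow_le_pow_right₀ hM1 h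
  have ple1 : ∀ a : ℕ, ε ^ a ≤ 1 := fun a => by simpa using ple 0 a (by norm_num)
  have pM1 : ∀ a : ℕ, 1 ≤ M ^ a := fun a => by simpa using pMle 0 a (by norm_num)
  rename_bvar zz → zz
  have pM0 : ∀ a : ℕ, 0 < M ^ a := fun a => by positivity
  have pe0 : ∀ a : ℕ, 0 < ε ^ a := fun a => by positivity
  have pele : ∀ a : ℕ, 1 ≤ a → ε ^ a ≤ ε := fun a h => by simpa using ple 1 a h
  obtain ⟨b, q, -, hD⟩ := hP μ S _ hA h0 (M ^ 135) (2 * ε ^ 365) (pM0 _) (by have := ple 365 500 (by norm_num); linarith only [this])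
    (by rw [mul_assoc, em 365 135]) (by have := pele 365 (by norm_num); linarith only [hδ1', hε, s2, this])
  rename_bvar zz → zz
  have hpoly : ∀ x ∈ S, ∀ k : ℕ, k ≤ 135 → ‖x‖ ≤ M ^ k → |2 * ⟪b, x⟫ + q x x| ≤ Cp * (M ^ (3 * k) * ε ^ 135 + 2 * ε ^ 95) := by
    intro x hx k hk hxk
    refine (hD.poly x hx (hxk.trans (pMle _ _ hk))).trans ?_
    have h1 : ‖x‖ ^ 3 / M ^ 135 ≤ M ^ (3 * k) * ε ^ 135 := by
      rw [div_le_iff₀ (pM0 _), mul_assoc, em 0 135, pow_zero, mul_one, mul_comm 3 k, pow_mul]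
      gcongr
    have h2 : 2 * ε ^ 365 * (M ^ 135) ^ 2 = 2 * ε ^ 95 := by
      rw [← pow_mul, mul_assoc, em 95 270]
    rw [h2]
    gcongr
  by_cases hb : M ≤ ‖b‖
  · have hbp : 0 < ‖b‖ := by linarith only [hδ1', hε, s2, hM1, hb]
    refine ⟨‖b‖⁻¹ • b, by rw [norm_smul, norm_inv, norm_norm, inv_mul_cancel₀ hbp.ne'], ?_⟩
    intro x hx hx1
    have h1 := hpoly x hx 0 (by norm_num) (by rw [pow_zero]; linarith only [hδ1', hε, s2, hx1])
    rename_bvar zz → zz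
    have h2 := hD.qb x x
    have h3 : Cp * (‖x‖ * ‖x‖) ≤ Cp * (1 * 1) := by gcongr <;> linarith only [hδ1', hε, s2, hx1]
    have h4 : Cp * (M ^ (3 * 0) * ε ^ 135 + 2 * ε ^ 95) ≤ Cp * (1 * 1 + 2 * 1) := by
      gcongr
      · simp
      · exact ple1 _
      · exact ple1 _
    have h5 : 2 * |⟪b, x⟫| ≤ 4 * Cp := by
      have : 2 * |⟪b, x⟫| = |2 * ⟪b, x⟫| := by rw [abs_mul]; norm_num
      rw [this, abs_le]
      rw [abs_le] at h1 h2
      constructor <;> linarith only [h1, h2, h3, h4]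
    rw [inner_smul_left, conj_trivial, abs_mul, abs_of_pos (by positivity), inv_mul_le_iff₀ hbp]
    have h6 : 1 ≤ ε * ‖b‖ := by
      calc 1 = ε * M := by have := em 0 1; simp at this; exact this.symm
        _ ≤ _ := by gcongr
    have : 4 * Cp * 1 ≤ K * (ε * ‖b‖) := mul_le_mul (by linarith only [hδ1', hC1, hCp, hC2, hC4, hC5, hd1, hε, hK, s2]) h6 zero_le_one (by linarith only [hδ1', hC1, hCp, hC2, hC4, hC5, hd1, hε, hK, s2])
    linarith only [h5, this]
  push Not at hb
  have hbx : ∀ x : V, ∀ k : ℕ, ‖x‖ ≤ M ^ k → |⟪b, x⟫| ≤ M ^ (k + 1) := by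
    intro x k hx
    refine (abs_real_inner_le_norm b x).trans ?_
    calc ‖b‖ * ‖x‖ ≤ M * M ^ k := by gcongr
      _ = _ := by ring
  obtain ⟨n, hn, hnf⟩ := hFl
  have d68 : 2 * ε ^ 500 * M ^ 68 ≤ δ1 := by
    rw [mul_assoc, em 432 68]; have := pele 432 (by norm_num); linarith only [s2, this]
  rename_bvar zz → zz
  have d0 : 2 * ε ^ 500 ≤ δ1 := by have := pele 500 (by norm_num); linarith only [s2, this]
  have hcs := hCS μ S _ hA 0 h0 (by simp) (M ^ 68) (pM0 _) d0 d68 n hn (1 / (400 * C1)) (by positivity) (by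
    intro y hy hy1; rw [sub_zero] at *; exact hnf y hy hy1)
  have hq68 : ∀ x ∈ S, ‖x‖ ≤ M ^ 68 → |q x x| ≤ 5 * Cp * M ^ 69 := by
    intro x hx hx1
    have h1 := hpoly x hx 68 (by norm_num) hx1
    have h2 : |⟪b, x⟫| ≤ M ^ 69 := hbx x 68 hx1
    have h3 : M ^ (3 * 68) * ε ^ 135 = M ^ 69 := me 69 135
    rw [h3] at h1
    rename_bvar zz → zz
    have h4 : ε ^ 95 ≤ M ^ 69 := (ple1 _).trans (pM1 _)
    have h5 : Cp * (M ^ 69 + 2 * ε ^ 95) ≤ Cp * (3 * M ^ 69) := by gcongr; linarith only [h4]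
    have h6 : 1 * M ^ 69 ≤ Cp * M ^ 69 := mul_le_mul_of_nonneg_right hCp (pM0 _).le
    rw [abs_le] at h1 h2 ⊢
    constructor <;> linarith only [h1, h2, h5, h6]
  obtain ⟨ν, hν, hqν⟩ : ∃ ν : V, ‖ν‖ = 1 ∧ ∀ x, |q x x + ⟪ν, x⟫ ^ 2| ≤ 25 * (80 * Cp * ε ^ 67) * ‖x‖ ^ 2 := by
    have e67 := pele 67 (by norm_num)
    refine rank1 q hD.sym (by positivity) ?_ hD.lo ?_ n ?_
    · have : 80 * Cp * ε ^ 67 ≤ 80 * Cp * ε := by gcongr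
      linarith only [s3, this]
    · intro f
      refine (hD.tr f).trans ?_
      have : Cp * ε ^ 365 ≤ Cp * ε ^ 67 := by gcongr Cp * ?_; exact ple _ _ (by norm_num)
      have : 0 < Cp * ε ^ 67 := by positivity
      linarith
    · intro v hv hvn
      obtain ⟨x, hx, hxv⟩ := hcs ((M ^ 68 / 4) • v) (by rw [inner_smul_right, hvn, mul_zero]) (by
        rw [norm_smul, hv, mul_one, Real.norm_of_nonneg (by positivity)])
      rw [zero_add] at hxv
      have hc : C1 * (1 / (400 * C1) * M ^ 68) = M ^ 68 / 400 := by field_simp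
      rw [hc] at hxv
      have hxn : ‖x‖ ≤ M ^ 68 := by
        calc ‖x‖ = ‖(x - (M ^ 68 / 4) • v) + (M ^ 68 / 4) • v‖ := by congr 1; abel
          _ ≤ _ := norm_add_le _ _
          _ ≤ _ := by
            rw [norm_smul, hv, mul_one, Real.norm_of_nonneg (by positivity)]
            have := pM0 68
            linarith only [hxv, this]
      refine ⟨(4 / M ^ 68) • x, ?_, ?_⟩
      · have : (4 / M ^ 68) • x - v = (4 / M ^ 68) • (x - (M ^ 68 / 4) • v) := by
          rw [smul_sub, smul_smul, show 4 / M ^ 68 * (M ^ 68 / 4) = 1 by field_simp, one_smul]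
        rw [this, norm_smul, Real.norm_of_nonneg (by positivity)]
        calc _ ≤ 4 / M ^ 68 * (M ^ 68 / 400) := by gcongr
          _ = 1 / 100 := by field_simp; norm_num
      · simp only [map_smul, LinearMap.smul_apply, smul_eq_mul]
        rw [← mul_assoc, abs_mul, abs_of_pos (by positivity)]
        calc _ ≤ 4 / M ^ 68 * (4 / M ^ 68) * (5 * Cp * M ^ 69) := by gcongr; exact hq68 x hx hxn
          _ = 80 * Cp * (M ^ 69 / (M ^ 68 * M ^ 68)) := by field_simp; ring
          _ = 80 * Cp * ε ^ 67 := by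
            have h1 : M ^ 136 * ε ^ 67 = M ^ 69 := me 69 67
            have h2 : M ^ 68 * M ^ 68 = M ^ 136 := by rw [← pow_add]
            have h3 : M ^ 69 / (M ^ 68 * M ^ 68) = ε ^ 67 := by
              rw [div_eq_iff (by positivity), h2, mul_comm, h1]
            rw [h3]
  rename_bvar zz → zz
  have hqν' : ∀ x ∈ S, ‖x‖ ≤ M ^ 23 → |2 * ⟪b, x⟫ - ⟪ν, x⟫ ^ 2| ≤ (C2 + 3 * Cp) * ε ^ 21 := by
    intro x hx hx1
    have h1 := hpoly x hx 23 (by norm_num) hx1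
    have h3 : M ^ (3 * 23) * ε ^ 135 = ε ^ 66 := by rw [mul_comm]; exact em 66 69
    rw [h3] at h1
    have h4 : Cp * (ε ^ 66 + 2 * ε ^ 95) ≤ Cp * (ε ^ 21 + 2 * ε ^ 21) := by
      gcongr Cp * (?_ + 2 * ?_) <;> exact ple _ _ (by norm_num)
    rename_bvar zz → zz
    have h5 := hqν x
    have h6 : 25 * (80 * Cp * ε ^ 67) * ‖x‖ ^ 2 ≤ C2 * ε ^ 21 := by
      calc _ ≤ 25 * (80 * Cp * ε ^ 67) * (M ^ 23) ^ 2 := by gcongr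
        _ = C2 * (ε ^ 67 * M ^ 46) := by rw [hC2]; ring
        _ = _ := by rw [em 21 46]
    rw [abs_le] at h1 h5 ⊢
    constructor <;> linarith only [h1, h4, h5, h6]
  have hE1 : (C2 + 3 * Cp) * ε ^ 21 ≤ 1 := by
    calc _ ≤ C4 * ε := by
          gcongr
          · linarith only [hδ1', hC4, hε, s2]
          · exact pele _ (by norm_num)
      _ ≤ 1 := by linarith
  have hν23 : ∀ x ∈ S, ‖x‖ ≤ M ^ 23 → |⟪ν, x⟫| ≤ 2 * ε ^ 11 * M ^ 23 := by
    intro x hx hx1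
    have h1 := abs_le.1 (hqν' x hx hx1)
    have h2 : -M ^ 24 ≤ ⟪b, x⟫ ∧ ⟪b, x⟫ ≤ M ^ 24 := abs_le.1 (hbx x 23 hx1)
    have h3 : 2 * ε ^ 11 * M ^ 23 = 2 * M ^ 12 := by rw [mul_assoc, mul_comm (ε ^ 11), me 12 11]
    rw [h3]
    rename_bvar zz → zz
    have h4 : ⟪ν, x⟫ ^ 2 ≤ (2 * M ^ 12) ^ 2 := by
      have e1 : (2 * M ^ 12) ^ 2 = 4 * M ^ 24 := by ring
      have e2 := pM1 24
      rw [e1]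
      linarith only [hδ1', hε, s2, hE1, h1, h2, e2]
    exact abs_le_of_sq_le_sq h4 (by positivity)
  obtain ⟨b4, hb4⟩ : ∃ b4, b4 = ⟪ν, b⟫ := ⟨_, rfl⟩
  rename_bvar zz → zz
  obtain ⟨w, hw⟩ : ∃ w, w = b - b4 • ν := ⟨_, rfl⟩
  have hbd : b = b4 • ν + w := by rw [hw]; abel
  have hb4M : |b4| ≤ M := by rw [hb4]; exact (inner_abs_le_of_unit hν b).trans hb.le
  have hwb : ‖w‖ ≤ 8 * ε ^ 21 := by
    by_cases hw0 : w = 0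
    · rw [hw0, norm_zero]; positivity
    obtain ⟨v, hv, hνv, hv2⟩ := unit_proj hν (by rw [← hb4, ← hw]; exact hw0)
    rw [← hb4, ← hw] at hv2
    have hcs2 := hCS μ S _ hA 0 h0 (by simp) (M ^ 23) (pM0 _) d0 (by
      rw [mul_assoc, em 477 23]; have := pele 477 (by norm_num); linarith only [s2, this]) ν hν (2 * ε ^ 11) (by positivity) (by
      intro y hy hy1; rw [sub_zero] at *; exact hν23 y hy hy1)
    obtain ⟨x, hx, hxv⟩ := hcs2 (-((M ^ 23 / 4) • v)) (by rw [inner_neg_right, inner_smul_right, hνv]; simp) (by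
        rw [norm_neg, norm_smul, hv, mul_one, Real.norm_of_nonneg (by positivity)])
    rw [zero_add] at hxv
    rename_bvar zz → zz
    have h12 : C1 * (2 * ε ^ 11 * M ^ 23) ≤ M ^ 23 / 8 := by
      have : C1 * (2 * ε ^ 11) ≤ 1 / 8 := by
        calc _ ≤ C1 * (2 * ε) := by gcongr; exact pele _ (by norm_num)
          _ ≤ _ := by linarith only [s5]
      calc _ = C1 * (2 * ε ^ 11) * M ^ 23 := by ring
        _ ≤ 1 / 8 * M ^ 23 := by gcongr
        _ = _ := by ring
    have hxv := hxv.trans h12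
    have hxn : ‖x‖ ≤ M ^ 23 := by
        calc ‖x‖ = ‖(x - (-((M ^ 23 / 4) • v))) + (-((M ^ 23 / 4) • v))‖ := by congr 1; abel
          _ ≤ _ := norm_add_le _ _
          _ ≤ _ := by
            rw [norm_neg, norm_smul, hv, mul_one, Real.norm_of_nonneg (by positivity)]
            have := pM0 23
            linarith
    have h1 := (abs_le.1 (hqν' x hx hxn)).1
    have h2 := (abs_le.1 ((inner_abs_le_of_unit hv _).trans hxv)).2
    rw [sub_neg_eq_add, inner_add_right, inner_smul_right, real_inner_self_eq_norm_sq, hv] at h2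
    have h3 : ⟪b, x⟫ = b4 * ⟪ν, x⟫ + ‖w‖ * ⟪v, x⟫ := by
      rw [hbd, inner_add_left, inner_smul_left, conj_trivial]
      congr 1
      rw [hv2, inner_smul_left, conj_trivial, norm_smul, hv, norm_norm, mul_one]
    rw [h3] at h1
    have h4 : ‖w‖ * ⟪v, x⟫ ≤ ‖w‖ * (-(M ^ 23 / 8)) := by gcongr; linarith only [h2]
    have h5 : 2 * (b4 * ⟪ν, x⟫) - ⟪ν, x⟫ ^ 2 ≤ b4 ^ 2 := by linarith only [sq_nonneg (b4 - ⟪ν, x⟫)]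
    have h6 := sq_le_of_abs hb4M
    have h7 := pM1 2
    have h8 : ‖w‖ * M ^ 23 ≤ 8 * M ^ 2 := by linarith only [hE1, h1, h4, h5, h6, h7]
    have h9 : 8 * M ^ 2 = 8 * ε ^ 21 * M ^ 23 := by rw [mul_assoc, mul_comm (ε ^ 21), me 2 21]
    rw [h9] at h8
    exact le_of_mul_le_mul_right h8 (pM0 _)
  rename_bvar zz → zz
  have hB1 : ∀ x ∈ S, ‖x‖ ≤ 1 → |⟪ν, x⟫| * |2 * b4 - ⟪ν, x⟫| ≤ C4 * ε ^ 21 := by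
    intro x hx hx1
    have h1 := hqν' x hx (hx1.trans (pM1 _))
    have h3 : ⟪b, x⟫ = b4 * ⟪ν, x⟫ + ⟪w, x⟫ := by
      rw [hbd, inner_add_left, inner_smul_left, conj_trivial]
    have h4 : |⟪w, x⟫| ≤ 8 * ε ^ 21 := by
      refine (abs_real_inner_le_norm w x).trans ?_
      calc ‖w‖ * ‖x‖ ≤ 8 * ε ^ 21 * 1 := by gcongr
        _ = _ := mul_one _
    rw [h3] at h1
    rw [← abs_mul, show ⟪ν, x⟫ * (2 * b4 - ⟪ν, x⟫) = 2 * (b4 * ⟪ν, x⟫) - ⟪ν, x⟫ ^ 2 by ring, hC4]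
    rw [abs_le] at h1 h4 ⊢
    constructor <;> linarith only [h1, h4]
  clear hqν' hν23 hqν hq68 hpoly hcs hbx hnf
  refine ⟨ν, hν, fun y hy hy1 => ?_⟩
  by_cases hbe : |b4| ≤ ε
  · suffices |⟪ν, y⟫| ≤ 3 * ε by
      refine this.trans ?_
      have := mul_le_mul_of_nonneg_right hK2 hε.le
      have : 0 < Cp * ε := by positivity
      linarith
    by_contra hc; push Not at hc
    rename_bvar zz → zz
    have h1 := hB1 y hy (by linarith only [hδ1', hε, s2, hy1])
    have h2 : ε ≤ |2 * b4 - ⟪ν, y⟫| := by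
      have := abs_sub_abs_le_abs_sub ⟪ν, y⟫ (2 * b4)
      rw [abs_sub_comm, abs_mul, abs_two] at this
      linarith only [hbe, hc, this]
    have h3 : 3 * ε * ε ≤ |⟪ν, y⟫| * |2 * b4 - ⟪ν, y⟫| := by gcongr
    have h4 : C4 * ε ^ 21 ≤ ε ^ 2 := by
      calc C4 * ε ^ 21 ≤ C4 * ε ^ 3 := by gcongr C4 * ?_; exact ple _ _ (by norm_num)
        _ = (ε * C4) * ε ^ 2 := by ring
        _ ≤ 1 * ε ^ 2 := by gcongr
        _ = _ := one_mul _
    have := pe0 2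
    linarith only [h1, h3, h4, this]
  · push Not at hbe
    have := hTS ε hε s1 μ S (hA.mono (ple _ _ (by norm_num))) h0 ν hν (by
      intro x hx hx6
      have h6 := pele 6 (by norm_num)
      have h1 := hB1 x hx (by linarith only [hδ1', hε, s2, hx6, h6])
      have h0 := inner_abs_le_of_unit hν x
      have h2 : ε ≤ |2 * b4 - ⟪ν, x⟫| := by
        have := abs_sub_abs_le_abs_sub (2 * b4) ⟪ν, x⟫
        rw [abs_mul, abs_two] at this
        linarith only [hbe, hx6, h6, h0, this]
      have h3 : |⟪ν, x⟫| * ε ≤ C4 * ε ^ 20 * ε := by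
        calc _ ≤ |⟪ν, x⟫| * |2 * b4 - ⟪ν, x⟫| := by gcongr
          _ ≤ _ := h1
          _ = _ := by ring
      exact le_of_mul_le_mul_right h3 hε) y hy hy1
    refine this.trans ?_
    have := mul_le_mul_of_nonneg_right hK1 hε.le
    linarith only [this]


def FlA (S : Set V) (z : V) (t η : ℝ) : Prop :=
  ∃ n : V, ‖n‖ = 1 ∧ ∀ y ∈ S, ‖y - z‖ ≤ t → |⟪n, y - z⟫| ≤ η * t

lemma Fl_rs (S : Set V) (z : V) {s : ℝ} (hs : 0 < s) (k η : ℝ) : Fl (rsS S z s) k η ↔ FlA S z (s * k) η := by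
  constructor
  · rintro ⟨n, hn, h⟩
    refine ⟨n, hn, fun y hy hyt => ?_⟩
    have := h (s⁻¹ • (y - z)) (by simpa [rsS, smul_smul, hs.ne'] using hy) (by
      rw [norm_smul, norm_inv, Real.norm_of_nonneg hs.le, inv_mul_le_iff₀ hs]; exact hyt)
    rw [inner_smul_right, abs_mul, abs_of_pos (by positivity), inv_mul_le_iff₀ hs] at this
    linarith
  · rintro ⟨n, hn, h⟩
    refine ⟨n, hn, fun y hy hyt => ?_⟩
    have := h (z + s • y) hy (by
      rw [add_sub_cancel_left, norm_smul, Real.norm_of_nonneg hs.le]; gcongr)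
    rw [add_sub_cancel_left, inner_smul_right, abs_mul, abs_of_pos hs] at this
    have : s * |⟪n, y⟫| ≤ s * (η * k) := by linarith
    exact le_of_mul_le_mul_left this hs

lemma FlA.sub {S z t η t' η'} (h : FlA S z t η) (ht : t' ≤ t) (he : η * t ≤ η' * t') : FlA S z t' η' := by
  obtain ⟨n, hn, h⟩ := h
  exact ⟨n, hn, fun y hy hyt => (h y hy (hyt.trans ht)).trans he⟩

def OU (μ : Measure V) (S : Set V) (B a : ℝ) : Prop :=
  ∀ z ∈ S, ‖z‖ ≤ 1 / 4 → ∀ s : ℝ, 0 < s → s ≤ 1 → AU (rs μ z s) (rsS S z s) (B * s ^ a)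

lemma OU_exists (μ : Measure V) (hRadon : IsLocallyFiniteMeasure μ) (S : Set V) (hS : S = msupp μ)
    (α C₀ : ℝ) (hα : 0 < α)
    (hreg : ∀ x ∈ S ∩ closedBall (0 : V) 1, ∀ r : ℝ, 0 < r → r ≤ 1 →
      |(μ (closedBall x r)).toReal / (omega3 * r ^ 3) - 1| ≤ C₀ * r ^ α) :
    ∃ ν : Measure V, ∃ B a : ℝ, 1 ≤ B ∧ 0 < a ∧ a ≤ 1 ∧ OU ν (S ∩ closedBall 0 1) B a := by
  have hcl : IsClosed S := by
    rw [hS, ← isOpen_compl_iff, Metric.isOpen_iff]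
    intro x hx
    simp only [msupp, mem_compl_iff, mem_setOf_eq, not_forall, not_lt] at hx
    obtain ⟨r, hr, h0⟩ := hx
    refine ⟨r / 2, by positivity, fun y hy => ?_⟩
    simp only [msupp, mem_compl_iff, mem_setOf_eq, not_forall, not_lt]
    refine ⟨r / 2, by positivity, le_trans (measure_mono ?_) h0⟩
    apply closedBall_subset_closedBall'
    rw [mem_ball] at hy; linarith only [hy]
  have hnull : μ Sᶜ = 0 := by
    refine measure_null_of_locally_null _ fun x hx => ?_
    rw [hS] at hx
    simp only [msupp, mem_compl_iff, mem_setOf_eq, not_forall, not_lt, nonpos_iff_eq_zero] at hx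
    obtain ⟨r, hr, h0⟩ := hx
    exact ⟨closedBall x r, mem_nhdsWithin_of_mem_nhds (closedBall_mem_nhds x hr), h0⟩
  have hball : μ (closedBall 0 1) < ⊤ := (isCompact_closedBall (0:V) 1).measure_lt_top
  rename_bvar zz → zz
  have hfin : IsFiniteMeasure (μ.restrict (closedBall 0 1)) := ⟨by simpa using hball⟩
  obtain ⟨M0, hM0⟩ : ∃ M0, M0 = μ.real (closedBall 0 1) := ⟨_, rfl⟩
  have hM0p : 0 ≤ M0 := by rw [hM0]; positivity
  have hnull' : (μ.restrict (closedBall 0 1)) (S ∩ closedBall 0 1)ᶜ = 0 := by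
    rw [Measure.restrict_apply (hcl.inter isClosed_closedBall).measurableSet.compl]
    refine measure_mono_null ?_ hnull
    rintro y ⟨h1, h2⟩ h3
    exact h1 ⟨h3, h2⟩
  rename_bvar zz → zz
  have ha : 0 < min α 1 := lt_min hα one_pos
  have ha1 : min α 1 ≤ 1 := min_le_right _ _
  obtain ⟨a, haa⟩ : ∃ a, a = min α 1 := ⟨_, rfl⟩
  rw [← haa] at ha ha1
  have haα : a ≤ α := by rw [haa]; exact min_le_left _ _
  rename_bvar zz → zz
  obtain ⟨B, hB⟩ : ∃ B, B = 4 + 5 * |C₀| + (16 * M0 + 10) := ⟨_, rfl⟩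
  have hC0 := abs_nonneg C₀
  refine ⟨μ.restrict (closedBall 0 1), B, a, by linarith, ha, ha1, ?_⟩
  intro z hz hz4 s hs hs1
  obtain ⟨k1, k2, k3⟩ := rs_aux hfin (hcl.inter isClosed_closedBall) hnull' z hs
  have hB4 : 4 ≤ B := by linarith
  rename_bvar zz → zz
  have hsa : 0 < s ^ a := by positivity
  refine ⟨k1, k2, k3, by positivity, ?_⟩
  intro x hx hxd u hu
  obtain ⟨w, hw⟩ : ∃ w, w = z + s • x := ⟨_, rfl⟩
  have hwS : w ∈ S ∩ closedBall 0 1 := by rw [hw]; exact hx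
  have hw2 : ‖w‖ ≤ 1 / 2 := by
    have h1 : s ≤ s ^ a := by
      calc s = s ^ (1:ℝ) := (Real.rpow_one s).symm
        _ ≤ s ^ a := Real.rpow_le_rpow_of_exponent_ge hs hs1 ha1
    have h2 : 4 * (s * ‖x‖) ≤ 1 := by
      calc 4 * (s * ‖x‖) ≤ B * (s ^ a * ‖x‖) := by gcongr
        _ ≤ 1 := by linarith
    calc ‖w‖ ≤ ‖z‖ + ‖s • x‖ := by rw [hw]; exact norm_add_le _ _
      _ ≤ 1 / 2 := by rw [norm_smul, Real.norm_of_nonneg hs.le]; linarith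
  rw [rs_ball _ _ hs, ← hw]
  rename_bvar zz → zz
  have hsu : 0 < s * u := by positivity
  have main : |(μ.restrict (closedBall 0 1)).real (closedBall w (s * u)) - omega3 * (s * u) ^ 3| ≤
      B * (s * u) ^ a * (s * u) ^ 3 := by
    have hr3 : 0 < (s * u) ^ 3 := by positivity
    have hra : 0 < (s * u) ^ a := by positivity
    have hω := om_lo
    rename_bvar zz → zz
    have hω' := om_hi
    by_cases hc : s * u ≤ 1 / 2
    · have e1 : (μ.restrict (closedBall 0 1)).real (closedBall w (s * u)) = (μ (closedBall w (s * u))).toReal := by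
        rw [measureReal_restrict_apply measurableSet_closedBall, inter_eq_left.2]
        · rfl
        · apply closedBall_subset_closedBall'
          rw [dist_zero_right]; linarith only [hw2, hc]
      have h1 := hreg w hwS (s * u) hsu (by linarith)
      rw [e1]
      have e2 : (μ (closedBall w (s * u))).toReal - omega3 * (s * u) ^ 3 =
        (omega3 * (s * u) ^ 3) * ((μ (closedBall w (s * u))).toReal / (omega3 * (s * u) ^ 3) - 1) := by
        have : omega3 * (s * u) ^ 3 ≠ 0 := by positivity
        rw [mul_sub, mul_div_cancel₀ _ this, mul_one]
      rw [e2, abs_mul, abs_of_pos (by positivity)]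
      have h2 : C₀ * (s * u) ^ α ≤ |C₀| * (s * u) ^ a := by
        calc C₀ * (s * u) ^ α ≤ |C₀| * (s * u) ^ α := by gcongr; exact le_abs_self _
          _ ≤ _ := by gcongr ?_ * ?_; exact Real.rpow_le_rpow_of_exponent_ge hsu (by linarith only [hω, hω', hc]) haα
      calc _ ≤ (5 * (s * u) ^ 3) * (|C₀| * (s * u) ^ a) := by gcongr; exact h1.trans h2
        _ = (5 * |C₀|) * (s * u) ^ a * (s * u) ^ 3 := by ring
        _ ≤ _ := by gcongr; linarith only [hM0p, hB, hω, hω']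
    · push Not at hc
      have h1 : (μ.restrict (closedBall 0 1)).real (closedBall w (s * u)) ≤ M0 := by
        rw [measureReal_restrict_apply measurableSet_closedBall, hM0]
        exact measureReal_mono inter_subset_right hball.ne
      have h0 : 0 ≤ (μ.restrict (closedBall 0 1)).real (closedBall w (s * u)) := by positivity
      have h2 : 1 / 8 ≤ (s * u) ^ 3 := by
        calc (1:ℝ) / 8 = (1 / 2) ^ 3 := by norm_num
          _ ≤ _ := by gcongr
      have h3 : 1 / 2 ≤ (s * u) ^ a := by
        calc (1:ℝ) / 2 = (1 / 2) ^ (1:ℝ) := (Real.rpow_one _).symm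
          _ ≤ (1 / 2) ^ a := Real.rpow_le_rpow_of_exponent_ge (by norm_num) (by norm_num) ha1
          _ ≤ _ := by gcongr
      have h4 : M0 * 1 ≤ M0 * (8 * (s * u) ^ 3) := by gcongr; linarith only [h2]
      have h5 : omega3 * (s * u) ^ 3 ≤ 5 * (s * u) ^ 3 := by gcongr
      have h5' : 0 < omega3 * (s * u) ^ 3 := by positivity
      have h6 : (16 * M0 + 10) * (1 / 2) * (s * u) ^ 3 ≤ B * (s * u) ^ a * (s * u) ^ 3 := by
        gcongr; linarith only [hB, hC0, hω, hω']
      rw [abs_le]; constructor <;> linarith only [mul_nonneg hM0p hr3.le, h0, h4, h5, h6, h1, h5']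
  have hs3 : 0 < s ^ 3 := by positivity
  have e3 : (s ^ 3)⁻¹ * (μ.restrict (closedBall 0 1)).real (closedBall w (s * u)) - omega3 * u ^ 3 =
    (s ^ 3)⁻¹ * ((μ.restrict (closedBall 0 1)).real (closedBall w (s * u)) - omega3 * (s * u) ^ 3) := by
    field_simp
  rw [e3, abs_mul, abs_of_pos (by positivity), inv_mul_le_iff₀ hs3]
  refine main.trans ?_
  rw [Real.mul_rpow hs.le hu.le]
  rename_bvar zz → zz
  have hua : u ^ a ≤ 1 + u := by
    by_cases hu1 : u ≤ 1
    · exact (Real.rpow_le_one hu.le hu1 ha.le).trans (by linarith only [hu])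
    · push Not at hu1
      calc u ^ a ≤ u ^ (1:ℝ) := Real.rpow_le_rpow_of_exponent_le hu1.le ha1
        _ = u := Real.rpow_one u
        _ ≤ _ := by linarith
  calc B * (s ^ a * u ^ a) * (s * u) ^ 3 ≤ B * (s ^ a * (1 + u)) * (s * u) ^ 3 := by gcongr
    _ = _ := by ring

lemma small_rpow {p c : ℝ} (hp : 0 < p) (hc : 0 < c) : ∃ s1 : ℝ, 0 < s1 ∧ s1 ≤ 1 ∧ ∀ s : ℝ, 0 < s → s ≤ s1 → s ^ p ≤ c := by
  refine ⟨min 1 (c ^ (1 / p)), by positivity, min_le_left _ _, fun s hs h => ?_⟩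
  calc s ^ p ≤ (c ^ (1 / p)) ^ p := by gcongr; exact h.trans (min_le_right _ _)
    _ = c := by rw [← Real.rpow_mul hc.le]; field_simp; simp

lemma FC : ∃ ε1 : ℝ, 0 < ε1 ∧ ∀ μ S B a, 1 ≤ B → 0 < a → a ≤ 1 → OU μ S B a → ∃ s1 C : ℝ, 0 < s1 ∧ s1 ≤ 1 ∧ 1 ≤ C ∧
    ∀ z ∈ S, ‖z‖ ≤ 1 / 4 → ∀ t0, 0 < t0 → t0 ≤ s1 → FlA S z t0 ε1 → ∀ s, 0 < s → s ≤ s1 →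
      s ^ (1 - 68 * (a / 1000)) ≤ t0 → FlA S z (s / 2) (C * s ^ (a / 1000)) := by
  obtain ⟨ε0, C, he0, he01, hC, hI⟩ := Improve
  obtain ⟨x, hx⟩ : ∃ x, x = ε0 / C := ⟨_, rfl⟩
  have hx0 : 0 < x := by rw [hx]; positivity
  rename_bvar zz → zz
  have hxC : x * C = ε0 := by rw [hx]; field_simp
  obtain ⟨l, hl⟩ : ∃ l, l = x ^ 68 / 2 := ⟨_, rfl⟩
  have hl0 : 0 < l := by rw [hl]; positivity
  have hx1 : x ≤ 1 := by rw [hx, div_le_one (by linarith)]; linarith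
  rename_bvar zz → zz
  have hl1 : l < 1 := by rw [hl]; linarith [pow_le_one₀ hx0.le hx1 (n := 68)]
  refine ⟨ε0 * l, by positivity, ?_⟩
  intro μ S B a hB ha ha1 hO
  obtain ⟨u1, hu1, hu1', hu⟩ := small_rpow ha (c := x ^ 500 / B) (by positivity)
  obtain ⟨u2, hu2, hu2', hu''⟩ := small_rpow (p := a / 2) (by positivity) (c := 1 / B) (by positivity)
  obtain ⟨u3, hu3, hu3', hu'''⟩ := small_rpow (p := a / 1000) (by positivity) (c := 1 / C) (by positivity)
  refine ⟨min u1 (min u2 u3), C, by positivity, (min_le_left _ _).trans hu1', hC, ?_⟩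
  intro z hz hz1 t0 ht0 ht0' hF
  rename_bvar zz → zz
  have St : ∀ t, 0 < t → t ≤ t0 → FlA S z t ε0 → FlA S z (l * t) ε0 := by
    intro t ht htt h
    have e1 : t = (t * x ^ 68) * (x⁻¹) ^ 68 := by
      rw [inv_pow, mul_assoc, mul_inv_cancel₀ (by positivity), mul_one]
    have hs : 0 < t * x ^ 68 := by positivity
    have hs1 : t * x ^ 68 ≤ u1 := by
      have := pow_le_one₀ hx0.le hx1 (n := 68)
      have := mul_le_of_le_one_right ht.le this
      linarith only [min_le_left u1 (min u2 u3), ht0', htt, this]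
    rename_bvar zz → zz
    have hb := hO z hz hz1 (t * x ^ 68) hs (by linarith only [hu1', hs1])
    have hb2 : AU (rs μ z (t * x ^ 68)) (rsS S z (t * x ^ 68)) (x ^ 500) := by
      refine hb.mono ?_
      calc B * (t * x ^ 68) ^ a ≤ B * (x ^ 500 / B) := by gcongr; exact hu _ hs hs1
        _ = _ := by field_simp
    have := hI x hx0 (by linarith only [he01, hxC]) _ _ hb2 (by simpa [rsS] using hz) (by rw [Fl_rs _ _ hs, ← e1]; exact h)
    rw [Fl_rs _ _ hs] at this
    rw [mul_comm] at hxC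
    rw [hxC] at this
    convert this using 1
    rw [hl]; ring
  have Al : ∀ k : ℕ, ∀ t, l ^ (k + 1) * t0 ≤ t → t ≤ t0 → FlA S z t ε0 := by
    intro k
    induction k with
    | zero =>
      intro t h1 h2
      refine hF.sub h2 ?_
      rw [mul_assoc]; gcongr; simpa using h1
    | succ k ih =>
      intro t h1 h2
      by_cases hc : l * t0 ≤ t
      · refine hF.sub h2 ?_
        rw [mul_assoc]; gcongr
      · push Not at hc
        have h3 : t / l ≤ t0 := by rw [div_le_iff₀ hl0]; linarith only [hc]
        have h4 : l ^ (k + 1) * t0 ≤ t / l := by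
          rw [le_div_iff₀ hl0]; calc _ = l ^ (k + 1 + 1) * t0 := by ring
            _ ≤ _ := h1
        have := St (t / l) (lt_of_lt_of_le (by positivity) h4) h3 (ih _ h4 h3)
        rwa [mul_div_cancel₀ _ hl0.ne'] at this
  have Al2 : ∀ t, 0 < t → t ≤ t0 → FlA S z t ε0 := by
    intro t ht h
    obtain ⟨k, hk⟩ := exists_pow_lt_of_lt_one (div_pos ht ht0) hl1
    refine Al k t ?_ h
    rw [lt_div_iff₀ ht0] at hk
    have : l ^ (k + 1) * t0 ≤ l ^ k * t0 := by
      gcongr ?_ * _; exact pow_le_pow_of_le_one hl0.le hl1.le (by omega)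
    linarith
  intro s hs hs1 hst
  have hsu := hs1.trans (min_le_right u1 (min u2 u3))
  rename_bvar zz → zz
  have hs2 : s ≤ u2 := hsu.trans (min_le_left _ _)
  have hs3 : s ≤ u3 := hsu.trans (min_le_right _ _)
  have hb := (hO z hz hz1 s hs (by linarith)).mono (δ' := (s ^ (a / 1000)) ^ 500) (by
    rw [← Real.rpow_natCast, ← Real.rpow_mul hs.le]
    have e : s ^ a = s ^ (a / 2) * s ^ (a / 2) := by rw [← Real.rpow_add hs]; ring_nf
    have e2 : a / 1000 * ((500 : ℕ) : ℝ) = a / 2 := by push_cast; ring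
    rw [e, e2, ← mul_assoc]
    refine mul_le_of_le_one_left (by positivity) ?_
    calc B * s ^ (a / 2) ≤ B * (1 / B) := by gcongr; exact hu'' s hs hs2
      _ = 1 := by field_simp)
  have h2 : s * (s ^ (a / 1000))⁻¹ ^ 68 = s ^ (1 - 68 * (a / 1000)) := by
    rw [← Real.rpow_natCast, ← Real.rpow_neg hs.le, ← Real.rpow_mul hs.le]
    nth_rw 1 [← Real.rpow_one s]
    rw [← Real.rpow_add hs]; congr 1; push_cast; ring
  rename_bvar zz → zz
  have := hI (s ^ (a / 1000)) (by positivity) (by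
    calc s ^ (a / 1000) * C ≤ 1 / C * C := by gcongr; exact hu''' s hs hs3
      _ = 1 := by field_simp) _ _ hb (by simpa [rsS] using hz) (by
    rw [Fl_rs _ _ hs, h2]; exact Al2 _ (by positivity) hst)
  rw [Fl_rs _ _ hs] at this
  convert this using 1
  ring

lemma setD_le {A B : Set V} {c : ℝ} (hc : 0 ≤ c) (h : ∀ a ∈ A, ∃ b ∈ B, ‖a - b‖ ≤ c) : setD A B ≤ c := by
  refine Real.iSup_le (fun a => Real.iSup_le (fun ha => ?_) hc) hc
  obtain ⟨b, hb, hab⟩ := h a ha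
  exact (Metric.infDist_le_dist_of_mem hb).trans (by rwa [dist_eq_norm])

lemma dxr_nonneg (x : V) {r : ℝ} (hr : 0 ≤ r) (A B : Set V) : 0 ≤ dxr x r A B :=
  mul_nonneg (by positivity) (Real.iSup_nonneg fun _ => Real.iSup_nonneg fun _ => Metric.infDist_nonneg)

lemma Dxr_le {x : V} {r c : ℝ} (hr : 0 < r) (hc : 0 ≤ c) {A B : Set V}
    (h1 : ∀ a ∈ A, ‖a - x‖ ≤ r → ∃ b ∈ B, ‖b - x‖ ≤ r ∧ ‖a - b‖ ≤ r * c)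
    (h2 : ∀ a ∈ B, ‖a - x‖ ≤ r → ∃ b ∈ A, ‖b - x‖ ≤ r ∧ ‖a - b‖ ≤ r * c) : Dxr x r A B ≤ c := by
  have key : ∀ A B : Set V, (∀ a ∈ A, ‖a - x‖ ≤ r → ∃ b ∈ B, ‖b - x‖ ≤ r ∧ ‖a - b‖ ≤ r * c) → dxr x r A B ≤ c := by
    intro A B h
    rw [dxr, one_div, inv_mul_le_iff₀ hr]
    refine setD_le (by positivity) ?_
    rintro a ⟨ha, har⟩
    rw [mem_closedBall, dist_eq_norm] at har
    obtain ⟨b, hb, hb1, hb2⟩ := h a ha har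
    exact ⟨b, ⟨hb, by rwa [mem_closedBall, dist_eq_norm]⟩, hb2⟩
  exact max_le (key _ _ h1) (key _ _ h2)

lemma Dxr_inter {x : V} {r : ℝ} {S K : Set V} (h : closedBall x r ⊆ K) (B : Set V) :
    Dxr x r (S ∩ K) B = Dxr x r S B := by
  have : S ∩ K ∩ closedBall x r = S ∩ closedBall x r := by
    rw [inter_assoc, inter_eq_right.2 h]
  simp only [Dxr, dxr, this]

lemma thetaP_inter {x : V} {r : ℝ} {S K : Set V} (h : closedBall x r ⊆ K) :
    thetaP 3 (S ∩ K) x r = thetaP 3 S x r := by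
  simp only [thetaP, Dxr_inter h]

lemma thetaP_nonneg (S : Set V) (x : V) {r : ℝ} (hr : 0 ≤ r) : 0 ≤ thetaP 3 S x r :=
  Real.iInf_nonneg fun _ => (dxr_nonneg x hr _ _).trans (le_max_left _ _)

lemma thetaP_le {S : Set V} {x n : V} {r c : ℝ} (hr : 0 < r) (hc : 0 ≤ c) (hn : ‖n‖ = 1)
    (h1 : ∀ a ∈ S, ‖a - x‖ ≤ r → |⟪n, a - x⟫| ≤ r * c)
    (h2 : ∀ p, ⟪n, p⟫ = 0 → ‖p‖ ≤ r → ∃ b ∈ S, ‖b - x‖ ≤ r ∧ ‖b - (x + p)‖ ≤ r * c) : thetaP 3 S x r ≤ c := by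
  have hL : Module.finrank ℝ (AffineSubspace.mk' x (ℝ ∙ n)ᗮ).direction = 3 := by
    haveI : Fact (Module.finrank ℝ V = 3 + 1) := ⟨by simp⟩
    rw [AffineSubspace.direction_mk']
    exact Submodule.finrank_orthogonal_span_singleton (by rintro rfl; simp at hn)
  refine (ciInf_le ⟨0, ?_⟩ ⟨AffineSubspace.mk' x (ℝ ∙ n)ᗮ, AffineSubspace.self_mem_mk' _ _, hL⟩).trans ?_
  · rintro _ ⟨L, rfl⟩
    exact (dxr_nonneg x hr.le _ _).trans (le_max_left _ _)
  refine Dxr_le hr hc ?_ ?_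
  · intro a ha har
    have e : a - ⟪n, a - x⟫ • n - x = (a - x) - ⟪n, a - x⟫ • n := by abel
    have e2 : ⟪n, (a - x) - ⟪n, a - x⟫ • n⟫ = 0 := by
      rw [inner_sub_right, inner_smul_right, real_inner_self_eq_norm_sq, hn]; ring
    refine ⟨a - ⟪n, a - x⟫ • n, ?_, ?_, ?_⟩
    · simp only [SetLike.mem_coe, AffineSubspace.mem_mk', vsub_eq_sub]
      rw [e, Submodule.mem_orthogonal_singleton_iff_inner_right]; exact e2
    · rw [e]
      have : ‖a - x‖ ^ 2 = ‖(a - x) - ⟪n, a - x⟫ • n‖ ^ 2 + ⟪n, a - x⟫ ^ 2 := by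
        conv_lhs => rw [show a - x = ((a - x) - ⟪n, a - x⟫ • n) + ⟪n, a - x⟫ • n by abel]
        rw [norm_add_sq_real, inner_smul_right, real_inner_comm n, e2, norm_smul, hn]; simp
      refine le_trans ?_ har
      rw [← sq_le_sq₀ (by positivity) (by positivity), this]; linarith only [sq_nonneg ⟪n, a - x⟫]
    · rw [sub_sub_cancel, norm_smul, hn, mul_one]; exact h1 a ha har
  · intro a ha har
    simp only [SetLike.mem_coe, AffineSubspace.mem_mk', vsub_eq_sub] at ha
    rw [Submodule.mem_orthogonal_singleton_iff_inner_right] at ha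
    obtain ⟨b, hb, hb1, hb2⟩ := h2 (a - x) ha har
    exact ⟨b, hb, hb1, by rw [norm_sub_rev]; simpa using hb2⟩

lemma TP : ∃ d C : ℝ, 0 < d ∧ 1 ≤ C ∧ ∀ μ S z r δ, 0 < r → AU (rs μ z (4 * r)) (rsS S z (4 * r)) δ → δ ≤ d →
    z ∈ S → ∀ η > 0, FlA S z (4 * r) η → thetaP 3 S z r ≤ C * η := by
  obtain ⟨d, C, hd, hd', hC, h⟩ := CS
  refine ⟨d / 2, 8 * C, by positivity, by linarith, ?_⟩
  intro μ S z r δ hr hA hδ hz η hη hF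
  have hδp := hA.pos
  have h4 : 0 < 4 * r := by positivity
  rename_bvar zz → zz
  obtain ⟨n, hn, hF⟩ := hF
  have hF' : ∀ y ∈ rsS S z (4 * r), ‖y - 0‖ ≤ 1 → |⟪n, y - 0⟫| ≤ η * 1 := by
    intro y hy hy1
    have := hF (z + (4 * r) • y) hy (by
      rw [add_sub_cancel_left, norm_smul, Real.norm_of_nonneg h4.le]; rw [sub_zero] at hy1
      exact mul_le_of_le_one_right h4.le hy1)
    rw [add_sub_cancel_left, inner_smul_right, abs_mul, abs_of_pos h4] at this
    rw [sub_zero]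
    nlinarith only [this, hr]
  have hCη : 0 < C * η := by positivity
  refine thetaP_le hr (by positivity) hn ?_ ?_
  · intro a ha har
    refine (hF a ha (by linarith)).trans ?_
    have : 1 * (η * r) ≤ C * (η * r) := by gcongr
    have : 0 < η * r := by positivity
    linarith
  · intro p hp hpr
    by_cases hc : 4 * (C * η) ≤ 1
    · have hq : ‖((1 - 4 * (C * η)) * (4 * r)⁻¹) • p‖ ≤ (1 - 4 * (C * η)) / 4 := by
        rw [norm_smul, Real.norm_of_nonneg (mul_nonneg (by linarith) (by positivity)), mul_assoc, div_eq_mul_inv]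
        refine mul_le_mul_of_nonneg_left ?_ (by linarith)
        rw [inv_mul_le_iff₀ h4]; linarith
      obtain ⟨x, hx, hxp⟩ := h _ _ _ hA 0 (by simpa [rsS] using hz) (by simp) 1 one_pos (by linarith only [hδ])
        (by linarith) n hn η hη hF' (((1 - 4 * (C * η)) * (4 * r)⁻¹) • p) (by rw [inner_smul_right, hp, mul_zero])
        (by linarith only [hCη, hq])
      rw [zero_add, mul_one] at hxp
      refine ⟨z + (4 * r) • x, hx, ?_, ?_⟩
      · rw [add_sub_cancel_left, norm_smul, Real.norm_of_nonneg h4.le]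
        have : ‖x‖ ≤ 1 / 4 := by
          have := norm_le_norm_add_norm_sub' x (((1 - 4 * (C * η)) * (4 * r)⁻¹) • p)
          linarith only [hq, hxp, this]
        nlinarith only [hd, hd', hr, this]
      · have e : z + (4 * r) • x - (z + p) = (4 * r) • (x - ((1 - 4 * (C * η)) * (4 * r)⁻¹) • p) - (4 * (C * η)) • p := by
          rw [smul_sub, smul_smul, show 4 * r * ((1 - 4 * (C * η)) * (4 * r)⁻¹) = 1 - 4 * (C * η) by field_simp, sub_smul]
          module
        rw [e]
        refine (norm_sub_le _ _).trans ?_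
        rw [norm_smul, norm_smul, Real.norm_of_nonneg h4.le, Real.norm_of_nonneg (by positivity)]
        have h1 : 4 * r * ‖x - ((1 - 4 * (C * η)) * (4 * r)⁻¹) • p‖ ≤ 4 * r * (C * η) := by gcongr
        have h2 : 4 * (C * η) * ‖p‖ ≤ 4 * (C * η) * r := by gcongr
        linarith only [h1, h2]
    · push Not at hc
      refine ⟨z, hz, by simpa using hr.le, ?_⟩
      rw [sub_add_cancel_left, norm_neg]
      nlinarith only [hpr, hd, hd', hr, hδ, hδp, hc]

lemma NF : ∃ ε1 : ℝ, 0 < ε1 ∧ (∀ μ S B a, 1 ≤ B → 0 < a → a ≤ 1 → OU μ S B a → ∃ s1 C : ℝ, 0 < s1 ∧ s1 ≤ 1 ∧ 1 ≤ C ∧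
    ∀ z ∈ S, ‖z‖ ≤ 1 / 4 → ∀ t0, 0 < t0 → t0 ≤ s1 → FlA S z t0 ε1 → ∀ r, 0 < r → r ≤ s1 →
      (8 * r) ^ (1 - 68 * (a / 1000)) ≤ t0 → thetaP 3 S z r ≤ C * r ^ (a / 1000)) ∧
   (∀ μ S B a, 1 ≤ B → 0 < a → a ≤ 1 → OU μ S B a → (0:V) ∈ S → ¬ Tendsto (fun r : ℝ => thetaP 3 S 0 r) (𝓝[>] 0) (𝓝 0) →
     ∃ s1 : ℝ, 0 < s1 ∧ ∀ t, 0 < t → t ≤ s1 → ¬ FlA S 0 t ε1) := by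
  obtain ⟨ε1, he1, hFC⟩ := FC
  obtain ⟨d, C', hd, hC', hTP⟩ := TP
  have key : ∀ μ S B a, 1 ≤ B → 0 < a → a ≤ 1 → OU μ S B a → ∃ s1 C : ℝ, 0 < s1 ∧ s1 ≤ 1 ∧ 1 ≤ C ∧
    ∀ z ∈ S, ‖z‖ ≤ 1 / 4 → ∀ t0, 0 < t0 → t0 ≤ s1 → FlA S z t0 ε1 → ∀ r, 0 < r → r ≤ s1 →
      (8 * r) ^ (1 - 68 * (a / 1000)) ≤ t0 → thetaP 3 S z r ≤ C * r ^ (a / 1000) := by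
    intro μ S B a hB ha ha1 hO
    obtain ⟨s1, C, hs1, hs1', hC, h⟩ := hFC μ S B a hB ha ha1 hO
    obtain ⟨u1, hu1, hu1', hu⟩ := small_rpow ha (c := d / B) (by positivity)
    refine ⟨min (s1 / 8) (u1 / 8), C' * C * 8, by positivity, ?_, ?_, ?_⟩
    · linarith [min_le_left (s1 / 8) (u1 / 8)]
    · nlinarith only [hC', hC]
    intro z hz hz1 t0 ht0 ht0' hF r hr hr1 hrt
    have hr2 := hr1.trans (min_le_left (s1 / 8) (u1 / 8))
    have hr3 := hr1.trans (min_le_right (s1 / 8) (u1 / 8))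
    have ht2 := ht0'.trans (min_le_left (s1 / 8) (u1 / 8))
    have h1 := h z hz hz1 t0 ht0 (by linarith only [hr, hr2, ht2]) hF (8 * r) (by positivity) (by linarith only [hr2]) hrt
    rw [show 8 * r / 2 = 4 * r by ring] at h1
    have hb := hO z hz hz1 (4 * r) (by positivity) (by linarith only [hs1', hr, hr2])
    have := hTP μ S z r _ hr hb (by
      calc B * (4 * r) ^ a ≤ B * (d / B) := by gcongr; exact hu _ (by positivity) (by linarith only [hr, hr3])
        _ = d := by field_simp) hz _ (by positivity) h1
    refine this.trans ?_
    have h8 : (8 * r) ^ (a / 1000) ≤ 8 * r ^ (a / 1000) := by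
      rw [Real.mul_rpow (by norm_num) hr.le]
      gcongr
      calc (8:ℝ) ^ (a / 1000) ≤ 8 ^ (1:ℝ) := Real.rpow_le_rpow_of_exponent_le (by norm_num) (by linarith only [ha1, hs1', hr, hr2])
        _ = 8 := Real.rpow_one _
    calc C' * (C * (8 * r) ^ (a / 1000)) ≤ C' * (C * (8 * r ^ (a / 1000))) := by gcongr
      _ = _ := by ring
  refine ⟨ε1, he1, key, ?_⟩
  intro μ S B a hB ha ha1 hO h0 hnt
  rename_bvar zz → zz
  obtain ⟨s1, C, hs1, hs1', hC, h⟩ := key μ S B a hB ha ha1 hO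
  refine ⟨s1, hs1, fun t ht ht1 hF => hnt ?_⟩
  have hlim : Tendsto (fun r : ℝ => C * r ^ (a / 1000)) (𝓝[>] 0) (𝓝 0) := by
    have : Tendsto (fun r : ℝ => C * r ^ (a / 1000)) (𝓝 0) (𝓝 (C * 0 ^ (a / 1000))) :=
      ((Real.continuous_rpow_const (by positivity)).tendsto 0).const_mul C
    rw [Real.zero_rpow (by positivity), mul_zero] at this
    exact this.mono_left nhdsWithin_le_nhds
  obtain ⟨u1, hu1, hu1', hu⟩ := small_rpow (p := 1 - 68 * (a / 1000)) (by linarith) ht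
  refine squeeze_zero' ?_ ?_ hlim
  · filter_upwards [self_mem_nhdsWithin] with r hr using thetaP_nonneg _ _ (le_of_lt hr)
  · have : Ioo (0:ℝ) (min s1 (u1 / 8)) ∈ 𝓝[>] (0:ℝ) := Ioo_mem_nhdsGT (by positivity)
    filter_upwards [this] with r hr
    have h1 := hr.2.le.trans (min_le_left s1 (u1 / 8))
    have h2 := hr.2.le.trans (min_le_right s1 (u1 / 8))
    exact h 0 h0 (by simp) t ht ht1 hF r hr.1 h1 (hu _ (by linarith [hr.1]) (by linarith))

def vec (e : OrthonormalBasis (Fin 4) ℝ V) (c : Fin 4 → ℝ) : V := ∑ i, c i • e i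

lemma vec_ip (e : OrthonormalBasis (Fin 4) ℝ V) (c : Fin 4 → ℝ) (i) : ⟪e i, vec e c⟫ = c i := by
  simp [vec, inner_sum, inner_smul_right, onb_ip]

lemma vec_self (e : OrthonormalBasis (Fin 4) ℝ V) (x : V) : vec e (fun i => ⟪e i, x⟫) = x := e.sum_repr' x

lemma inner_vec (e : OrthonormalBasis (Fin 4) ℝ V) (c : Fin 4 → ℝ) (y : V) :
    ⟪vec e c, y⟫ = c 0 * ⟪e 0, y⟫ + c 1 * ⟪e 1, y⟫ + c 2 * ⟪e 2, y⟫ + c 3 * ⟪e 3, y⟫ := by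
  simp [vec, inner_add_left, inner_smul_left, Fin.sum_univ_four]

lemma vec_norm (e : OrthonormalBasis (Fin 4) ℝ V) (c : Fin 4 → ℝ) :
    ‖vec e c‖ ^ 2 = c 0 ^ 2 + c 1 ^ 2 + c 2 ^ 2 + c 3 ^ 2 := by
  rw [norm_sq4 e]; simp only [vec_ip]

def AQ (e : OrthonormalBasis (Fin 4) ℝ V) (l : Fin 4 → ℝ) (x : V) : ℝ :=
  l 0 * ⟪e 0, x⟫ ^ 2 + l 1 * ⟪e 1, x⟫ ^ 2 + l 2 * ⟪e 2, x⟫ ^ 2 + l 3 * ⟪e 3, x⟫ ^ 2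

def AO (e : OrthonormalBasis (Fin 4) ℝ V) (l : Fin 4 → ℝ) (x : V) : V := vec e (fun i => l i * ⟪e i, x⟫)

lemma AQ_expand (e l) (x y : V) : AQ e l y - AQ e l x = 2 * ⟪AO e l x, y - x⟫ + AQ e l (y - x) := by
  simp only [AQ, AO, inner_vec, inner_sub_right]; ring

lemma AQ_le {e l} (hl : ∀ i, |l i| ≤ 4) (x : V) : |AQ e l x| ≤ 4 * ‖x‖ ^ 2 := by
  rw [norm_sq4 e x, AQ, abs_le]
  have h : ∀ i, -4 * ⟪e i, x⟫ ^ 2 ≤ l i * ⟪e i, x⟫ ^ 2 ∧ l i * ⟪e i, x⟫ ^ 2 ≤ 4 * ⟪e i, x⟫ ^ 2 := fun i =>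
    ⟨mul_le_mul_of_nonneg_right (abs_le.1 (hl i)).1 (sq_nonneg _), mul_le_mul_of_nonneg_right (abs_le.1 (hl i)).2 (sq_nonneg _)⟩
  have h0 := h 0; have h1 := h 1; have h2 := h 2; have h3 := h 3
  constructor <;> linarith only [h0, h1, h2, h3]

lemma AO_norm (e l) (x : V) : ‖AO e l x‖ ^ 2 = l 0 ^ 2 * ⟪e 0, x⟫ ^ 2 + l 1 ^ 2 * ⟪e 1, x⟫ ^ 2 + l 2 ^ 2 * ⟪e 2, x⟫ ^ 2
    + l 3 ^ 2 * ⟪e 3, x⟫ ^ 2 := by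
  rw [AO, vec_norm]; ring

lemma AO_le {e l} (hl : ∀ i, |l i| ≤ 4) (x : V) : ‖AO e l x‖ ≤ 4 * ‖x‖ := by
  rw [← sq_le_sq₀ (by positivity) (by positivity), AO_norm, mul_pow, norm_sq4 e x]
  have h : ∀ i, l i ^ 2 * ⟪e i, x⟫ ^ 2 ≤ 4 ^ 2 * ⟪e i, x⟫ ^ 2 := fun i =>
    mul_le_mul_of_nonneg_right (sq_le_sq' (abs_le.1 (hl i)).1 (abs_le.1 (hl i)).2) (sq_nonneg _)
  linarith [h 0, h 1, h 2, h 3]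

lemma AO_sub (e l) (x y : V) : AO e l x - AO e l y = AO e l (x - y) := by
  simp only [AO, vec, ← Finset.sum_sub_distrib, ← sub_smul, inner_sub_right, mul_sub]

/-- local improvement: `2τ`-close implies `τ`-close -/
lemma fill_loc : ∃ d C : ℝ, 0 < d ∧ 1 ≤ C ∧ ∀ μ S δ, AU μ S δ → δ ≤ d → ∀ e l, (∀ i, |l i| ≤ 4) →
    ∀ κ τ g : ℝ, 0 < τ → κ ≤ τ ^ 2 → τ * C ≤ g → g ≤ 1 → (∀ y ∈ S, ‖y‖ ≤ 2 → |AQ e l y| ≤ κ) →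
    ∀ w, ‖w‖ ≤ 1 → |AQ e l w| ≤ κ → g ≤ ‖AO e l w‖ → ∀ x ∈ S, ‖x - w‖ ≤ 2 * τ → ∃ x' ∈ S, ‖x' - w‖ ≤ τ := by
  obtain ⟨d, C, hd, hd', hC, h⟩ := CS
  refine ⟨d / 4, 2 * (C + 1) * 513, by positivity, by linarith, ?_⟩
  intro μ S δ hA hδ e l hl κ τ g hτ hκ hτg hg hS w hw hAw hgw x hx hxw
  have hδp := hA.pos
  have hgτ : 2052 * τ ≤ g := by
    have : τ * (2 * (1 + 1) * 513) ≤ τ * (2 * (C + 1) * 513) := by gcongr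
    linarith
  rename_bvar zz → zz
  have hg0 : 0 < g := by linarith
  have hxn : ‖x‖ ≤ 1 + 2 * τ := by
    have := norm_le_norm_add_norm_sub' x w
    linarith
  have hAx : |AQ e l x| ≤ κ := hS x hx (by linarith)
  have hN : g / 2 ≤ ‖AO e l x‖ := by
    have h1 := norm_le_norm_add_norm_sub' (AO e l w) (AO e l x)
    rw [AO_sub] at h1
    have h2 := AO_le (e := e) hl (w - x)
    rw [norm_sub_rev] at hxw
    linarith only [hτ, hgw, hxw, hgτ, h1, h2]
  rename_bvar zz → zz
  have hN0 : 0 < ‖AO e l x‖ := by linarith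
  have key : ∀ y m, 0 ≤ m → |AQ e l y| ≤ κ → ‖y - x‖ ≤ m → |⟪‖AO e l x‖⁻¹ • AO e l x, y - x⟫| ≤ (2 / g) * (κ + 2 * m ^ 2) := by
    intro y m hm hy hym
    have h1 := AQ_expand e l x y
    have h2 := AQ_le (e := e) hl (y - x)
    have h3 : ‖y - x‖ ^ 2 ≤ m ^ 2 := by gcongr
    rename_bvar zz → zz
    have h4 : |⟪AO e l x, y - x⟫| ≤ κ + 2 * m ^ 2 := by
      rw [abs_le] at *; constructor <;> linarith only [hAx, hy, h1, h2, h3]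
    rw [real_inner_smul_left, abs_mul, abs_inv, abs_norm]
    have : ‖AO e l x‖⁻¹ ≤ 2 / g := by
      rw [show 2 / g = (g / 2)⁻¹ by field_simp]; gcongr
    gcongr
  obtain ⟨n, hn⟩ : ∃ n, n = ‖AO e l x‖⁻¹ • AO e l x := ⟨_, rfl⟩
  rw [← hn] at key
  have hn1 : ‖n‖ = 1 := by rw [hn, norm_smul, norm_inv, norm_norm, inv_mul_cancel₀ hN0.ne']
  rename_bvar zz → zz
  have hκ0 : 0 ≤ κ := (abs_nonneg _).trans hAw
  obtain ⟨T, hT⟩ : ∃ T, T = (2 / g) * (κ + 2 * (16 * τ) ^ 2) := ⟨_, rfl⟩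
  have hT0 : 0 < T := by rw [hT]; positivity
  have hw2 : |⟪n, w - x⟫| ≤ T := by
    refine (key w (2 * τ) (by positivity) hAw (by rwa [norm_sub_rev])).trans ?_
    rw [hT]; gcongr; norm_num
  rename_bvar zz → zz
  have hpp : ‖w - x - ⟪n, w - x⟫ • n‖ ≤ 2 * τ := by
    have e2 : ⟪(w - x) - ⟪n, w - x⟫ • n, n⟫ = 0 := by
      rw [inner_sub_left, real_inner_smul_left, real_inner_self_eq_norm_sq, hn1, real_inner_comm]; ring
    have : ‖w - x‖ ^ 2 = ‖(w - x) - ⟪n, w - x⟫ • n‖ ^ 2 + ⟪n, w - x⟫ ^ 2 := by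
      conv_lhs => rw [show w - x = ((w - x) - ⟪n, w - x⟫ • n) + ⟪n, w - x⟫ • n by abel]
      rw [norm_add_sq_real, inner_smul_right, e2, norm_smul, hn1]; simp
    rw [norm_sub_rev] at hxw
    refine le_trans ?_ hxw
    rw [← sq_le_sq₀ (by positivity) (by positivity), this]; linarith only [sq_nonneg ⟪n, w - x⟫]
  obtain ⟨x', hx', hxx⟩ := h μ S δ hA x hx (by nlinarith only [hd', hδ, hg, hgτ, hC, hd, hτ, hτg, hδp, hxn]) (16 * τ) (by positivity) (by linarith) (by nlinarith only [hd, hτ, hg, hgτ, hd', hδ]) n hn1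
    (T / (16 * τ)) (by positivity) (by
      intro y hy hym
      rw [div_mul_cancel₀ _ (by positivity)]
      have h1 := norm_le_norm_add_norm_sub' y x
      exact (key y (16 * τ) (by positivity) (hS y hy (by linarith only [hτ, hg, hgτ, hxn, hym, h1])) hym).trans hT.ge)
    (w - x - ⟪n, w - x⟫ • n) (by
      rw [inner_sub_right, inner_smul_right, real_inner_self_eq_norm_sq, hn1]; ring) (by linarith only [hτ, hpp])
  rw [div_mul_cancel₀ _ (by positivity)] at hxx
  refine ⟨x', hx', ?_⟩
  have e1 : x' - w = (x' - (x + (w - x - ⟪n, w - x⟫ • n))) - ⟪n, w - x⟫ • n := by abel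
  have h1 : ‖x' - w‖ ≤ C * T + T := by
    rw [e1]; refine (norm_sub_le _ _).trans ?_
    rw [norm_smul, hn1, mul_one, Real.norm_eq_abs]; linarith only [hw2, hxx]
  rename_bvar zz → zz
  have h2 : T ≤ (2 / g) * (513 * τ ^ 2) := by rw [hT]; gcongr; linarith only [hκ]
  calc _ ≤ (C + 1) * T := by linarith only [h1]
    _ ≤ (C + 1) * ((2 / g) * (513 * τ ^ 2)) := by gcongr
    _ = τ * (2 * (C + 1) * 513) * τ / g := by ring
    _ ≤ g * τ / g := by gcongr
    _ = τ := by field_simp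

lemma fill : ∃ d C : ℝ, 0 < d ∧ 1 ≤ C ∧ ∀ μ S δ, AU μ S δ → δ ≤ d → ∀ e l, (∀ i, |l i| ≤ 4) →
    ∀ κ τ g : ℝ, 0 < τ → κ ≤ τ ^ 2 → τ * C ≤ g → g ≤ 1 → (∀ y ∈ S, ‖y‖ ≤ 2 → |AQ e l y| ≤ κ) →
    ∀ p q, ‖p‖ ≤ 1 → |AQ e l p| ≤ κ → g ≤ ‖AO e l p‖ → ‖q‖ ≤ 1 → |AQ e l q| ≤ κ → g ≤ ‖AO e l q‖ →
    (∀ i, 0 ≤ ⟪e i, p⟫ * ⟪e i, q⟫) → (∃ x ∈ S, ‖x - p‖ ≤ τ) → ∃ x ∈ S, ‖x - q‖ ≤ τ := by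
  obtain ⟨d, C, hd, hC, h⟩ := fill_loc
  refine ⟨d, C, hd, hC, ?_⟩
  intro μ S δ hA hδ e l hl κ τ g hτ hκ hτg hg hS p q hp hAp hgp hq hAq hgq hpq hx
  have hg0 : 0 < g := lt_of_lt_of_le (by positivity) hτg
  have hsg : ∀ i, ∃ s : ℝ, s ^ 2 = 1 ∧ s * |⟪e i, p⟫| = ⟪e i, p⟫ ∧ s * |⟪e i, q⟫| = ⟪e i, q⟫ := by
    intro i
    rcases mul_nonneg_iff.1 (hpq i) with ⟨h1, h2⟩ | ⟨h1, h2⟩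
    · exact ⟨1, by norm_num, by rw [abs_of_nonneg h1, one_mul], by rw [abs_of_nonneg h2, one_mul]⟩
    · exact ⟨-1, by norm_num, by rw [abs_of_nonpos h1]; ring, by rw [abs_of_nonpos h2]; ring⟩
  choose sg hsg1 hsgp hsgq using hsg
  rename_bvar zz → zz
  obtain ⟨γ, hγ⟩ : ∃ γ : ℝ → V, γ = fun s => vec e (fun i => sg i * √((1 - s) * ⟪e i, p⟫ ^ 2 + s * ⟪e i, q⟫ ^ 2)) := ⟨_, rfl⟩
  have hγc : Continuous γ := by rw [hγ]; unfold vec; fun_prop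
  have hγ0 : γ 0 = p := by
    rw [hγ]; simpa [Real.sqrt_sq_eq_abs, hsgp] using vec_self e p
  have hγ1 : γ 1 = q := by
    rw [hγ]; simpa [Real.sqrt_sq_eq_abs, hsgq] using vec_self e q
  rename_bvar zz → zz
  have hco : ∀ s, 0 ≤ s → s ≤ 1 → ∀ i, ⟪e i, γ s⟫ ^ 2 = (1 - s) * ⟪e i, p⟫ ^ 2 + s * ⟪e i, q⟫ ^ 2 := by
    intro s hs hs1 i
    rw [hγ, vec_ip, mul_pow, hsg1, Real.sq_sqrt, one_mul]
    exact add_nonneg (mul_nonneg (by linarith) (sq_nonneg _)) (mul_nonneg hs (sq_nonneg _))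
  have step : ∀ s, 0 ≤ s → s ≤ 1 → ∀ x ∈ S, ‖x - γ s‖ ≤ 2 * τ → ∃ x' ∈ S, ‖x' - γ s‖ ≤ τ := by
    intro s hs hs1
    have hs' : 0 ≤ 1 - s := by linarith
    refine h μ S δ hA hδ e l hl κ τ g hτ hκ hτg hg hS (γ s) ?_ ?_ ?_
    · rw [← sq_le_sq₀ (by positivity) (by positivity), norm_sq4 e]
      simp only [hco s hs hs1]
      have h1 : ‖p‖ ^ 2 ≤ 1 := pow_le_one₀ (by positivity) hp
      have h2 : ‖q‖ ^ 2 ≤ 1 := pow_le_one₀ (by positivity) hq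
      rw [norm_sq4 e] at h1 h2
      have := mul_le_mul_of_nonneg_left h1 hs'
      have := mul_le_mul_of_nonneg_left h2 hs
      linarith
    · have : AQ e l (γ s) = (1 - s) * AQ e l p + s * AQ e l q := by
        simp only [AQ, hco s hs hs1]; ring
      rw [this]
      refine (abs_add_le _ _).trans ?_
      rw [abs_mul, abs_mul, abs_of_nonneg hs, abs_of_nonneg hs']
      have := mul_le_mul_of_nonneg_left hAp hs'
      have := mul_le_mul_of_nonneg_left hAq hs
      linarith
    · rw [← sq_le_sq₀ (by positivity) (by positivity)]
      have : ‖AO e l (γ s)‖ ^ 2 = (1 - s) * ‖AO e l p‖ ^ 2 + s * ‖AO e l q‖ ^ 2 := by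
        simp only [AO_norm, hco s hs hs1]; ring
      rw [this]
      have h1 : g ^ 2 ≤ ‖AO e l p‖ ^ 2 := by gcongr
      have h2 : g ^ 2 ≤ ‖AO e l q‖ ^ 2 := by gcongr
      have := mul_le_mul_of_nonneg_left h1 hs'
      have := mul_le_mul_of_nonneg_left h2 hs
      linarith
  have huc : UniformContinuousOn γ (Icc 0 1) := isCompact_Icc.uniformContinuousOn_of_continuous hγc.continuousOn
  rw [Metric.uniformContinuousOn_iff] at huc
  obtain ⟨θ, hθ, huc⟩ := huc τ hτ
  rename_bvar zz → zz
  obtain ⟨N, hN⟩ := exists_nat_one_div_lt hθ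
  have ind : ∀ k : ℕ, k ≤ N + 1 → ∃ x ∈ S, ‖x - γ (k / (N + 1 : ℝ))‖ ≤ τ := by
    intro k
    induction k with
    | zero => intro _; simpa [hγ0] using hx
    | succ k ih =>
      intro hk
      obtain ⟨x, hx, hxk⟩ := ih (by omega)
      have hN1 : (0:ℝ) < N + 1 := by positivity
      have hk1 : (((k + 1 : ℕ)) / (N + 1 : ℝ)) ≤ 1 := by
        rw [div_le_one hN1]; exact_mod_cast hk
      have hk2 : (k / (N + 1 : ℝ)) ≤ ((k + 1 : ℕ)) / (N + 1 : ℝ) := by gcongr; simp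
      have hk0 : 0 ≤ (k / (N + 1 : ℝ)) := by positivity
      have hd := huc (k / (N + 1 : ℝ)) ⟨hk0, hk2.trans hk1⟩ (((k + 1 : ℕ)) / (N + 1 : ℝ)) ⟨by positivity, hk1⟩ (by
        rw [dist_comm, Real.dist_eq, ← sub_div, Nat.cast_succ, add_sub_cancel_left, abs_of_pos (by positivity)]; exact hN)
      rw [dist_eq_norm] at hd
      refine step _ (by positivity) hk1 x hx ?_
      have := norm_sub_le_norm_sub_add_norm_sub x (γ (k / (N + 1 : ℝ))) (γ (((k + 1 : ℕ)) / (N + 1 : ℝ)))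
      linarith only [hxk, hd, this]
  have := ind (N + 1) le_rfl
  rwa [Nat.cast_succ, div_self (by positivity), hγ1] at this

lemma pairpt (e : OrthonormalBasis (Fin 4) ℝ V) {l : Fin 4 → ℝ} (hl : ∀ i, |l i| ≤ 4) {σ : ℝ} (hσ : 0 < σ) (hσ1 : σ ≤ 1)
    (h0 : σ ≤ l 0) (i : Fin 4) (hi : i = 2 ∨ i = 3) (hi' : l i ≤ -σ / 2) (s t : ℝ) (hs : s ^ 2 = 1) (ht : t ^ 2 = 1) :
    ∃ P : V, ‖P‖ ≤ 1 ∧ AQ e l P = 0 ∧ σ ^ 2 / 5 ≤ ‖AO e l P‖ ∧ ∀ j, ∃ a : ℝ, 0 ≤ a ∧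
      ⟪e j, P⟫ = a * (if j = 0 then s else if j = i then t else 0) := by
  have hn : 0 ≤ -l i := by linarith only [hσ, hi']
  have hp : 0 ≤ l 0 := by linarith
  have a0 := (abs_le.1 (hl 0)).2
  rename_bvar zz → zz
  have ai := (abs_le.1 (hl i)).1
  obtain ⟨c, hc⟩ : ∃ c : Fin 4 → ℝ, c = fun j => (if j = 0 then √(-l i) / 3 else √(l 0) / 3) * (if j = 0 then s else if j = i then t else 0) := ⟨_, rfl⟩
  have q1 : (√(-l i) / 3 * s) ^ 2 = -l i / 9 := by rw [mul_pow, div_pow, Real.sq_sqrt hn, hs]; ring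
  have q2 : (√(l 0) / 3 * t) ^ 2 = l 0 / 9 := by rw [mul_pow, div_pow, Real.sq_sqrt hp, ht]; ring
  rename_bvar zz → zz
  have key : ‖vec e c‖ ^ 2 = (l 0 - l i) / 9 ∧ AQ e l (vec e c) = 0 ∧
      ‖AO e l (vec e c)‖ ^ 2 = l 0 ^ 2 * (-l i / 9) + l i ^ 2 * (l 0 / 9) := by
    rw [vec_norm, AO_norm, AQ]
    simp only [vec_ip]
    rcases hi with rfl | rfl <;> simp [hc, q1, q2] <;> ring_nf <;> simp
  refine ⟨vec e c, ?_, key.2.1, ?_, fun j => ⟨_, ?_, by rw [vec_ip, hc]⟩⟩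
  · rw [← sq_le_sq₀ (by positivity) (by positivity), key.1]; linarith only [a0, ai]
  · rw [← sq_le_sq₀ (by positivity) (by positivity), key.2.2]
    have h1 : σ ^ 2 * (σ / 2 / 9) ≤ l 0 ^ 2 * (-l i / 9) := by gcongr; linarith only [hi']
    have h2 : 0 ≤ l i ^ 2 * (l 0 / 9) := by positivity
    have h3 : σ ^ 3 * σ ≤ σ ^ 3 * 1 := by gcongr
    rename_bvar zz → zz
    have : 0 < σ ^ 3 := by positivity
    linarith only [h1, h2, h3, this]
  · split_ifs <;> positivity

lemma sgn_ex (a : ℝ) : ∃ s : ℝ, s ^ 2 = 1 ∧ 0 ≤ s * a := by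
  rcases le_total 0 a with h | h
  · exact ⟨1, by norm_num, by linarith⟩
  · exact ⟨-1, by norm_num, by linarith⟩

lemma sgn_ex2 {a b : ℝ} (h : 0 ≤ a * b) : ∃ s : ℝ, s ^ 2 = 1 ∧ 0 ≤ s * a ∧ 0 ≤ s * b := by
  rcases mul_nonneg_iff.1 h with ⟨h1, h2⟩ | ⟨h1, h2⟩
  · exact ⟨1, by norm_num, by linarith, by linarith⟩
  · exact ⟨-1, by norm_num, by linarith, by linarith⟩

lemma fillc : ∃ d C : ℝ, 0 < d ∧ 1 ≤ C ∧ ∀ μ S δ, AU μ S δ → δ ≤ d → ∀ e l, (∀ i, |l i| ≤ 4) →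
    ∀ σ ρ κ τ : ℝ, 0 < σ → σ ≤ 1 → 0 < ρ → ρ ≤ 1 → 0 < τ → κ ≤ τ ^ 2 → τ * C ≤ σ ^ 2 * ρ →
    σ ≤ l 0 → l 2 ≤ -σ / 2 → l 3 ≤ -σ / 2 → (∀ y ∈ S, ‖y‖ ≤ 2 → |AQ e l y| ≤ κ) →
    ∀ z ∈ S, ‖z‖ ≤ 1 → (1 / 4000 < |⟪e 0, z⟫| ∨ 1 / 4000 < |⟪e 3, z⟫|) →
    ∀ q, ‖q‖ ≤ 1 → |AQ e l q| ≤ κ → ρ ≤ |⟪e 0, q⟫| → 0 ≤ ⟪e 0, z⟫ * ⟪e 0, q⟫ → ∃ x ∈ S, ‖x - q‖ ≤ τ := by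
  obtain ⟨d, C, hd, hC, h⟩ := fill
  refine ⟨d, 20000 * C, hd, by linarith, ?_⟩
  intro μ S δ hA hδ e l hl σ ρ κ τ hσ hσ1 hρ hρ1 hτ hκ hτC h0 h2 h3 hS z hz hz1 hzk q hq hAq hq0 hzq
  obtain ⟨g, hg⟩ : ∃ g, g = σ ^ 2 * ρ / 20000 := ⟨_, rfl⟩
  have hg0 : 0 < g := by rw [hg]; positivity
  rename_bvar zz → zz
  have hs2 : σ ^ 2 ≤ σ := by nlinarith only [hσ, hσ1]
  have g1 : g ≤ σ ^ 2 / 20000 := by rw [hg]; gcongr; nlinarith only [hρ1]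
  have g2 : g ≤ σ * ρ := by
    rw [hg]; have : σ ^ 2 * ρ ≤ σ * ρ := by gcongr
    have : 0 < σ * ρ := by positivity
    linarith
  have hκ0 : 0 ≤ κ := (abs_nonneg _).trans hAq
  rename_bvar zz → zz
  have H := h μ S δ hA hδ e l hl κ τ g hτ hκ (by rw [hg]; linarith only [hτC]) (by linarith only [hσ1, hg0, hs2, g1]) hS
  obtain ⟨s, hs, hsz, hsq⟩ := sgn_ex2 hzq
  obtain ⟨t, ht, htz⟩ := sgn_ex ⟪e 3, z⟫
  obtain ⟨w, hw, hwq⟩ := sgn_ex ⟪e 2, q⟫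
  rename_bvar zz → zz
  obtain ⟨P, hP, hAP, hgP, hcP⟩ := pairpt e hl hσ hσ1 h0 3 (Or.inr rfl) h3 s t hs ht
  obtain ⟨R, hR, hAR, hgR, hcR⟩ := pairpt e hl hσ hσ1 h0 2 (Or.inl rfl) h2 s w hs hw
  have gz : g ≤ ‖AO e l z‖ := by
    rw [← sq_le_sq₀ (by positivity) (by positivity), AO_norm]
    have k1 : (σ / 2) ^ 2 * (1 / 4000) ^ 2 ≤ l 0 ^ 2 * ⟪e 0, z⟫ ^ 2 + l 3 ^ 2 * ⟪e 3, z⟫ ^ 2 := by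
      rcases hzk with hk | hk
      · have : (σ / 2) ^ 2 * (1 / 4000) ^ 2 ≤ l 0 ^ 2 * |⟪e 0, z⟫| ^ 2 := by gcongr; linarith only [h0, hg0, hs2, g1]
        rw [sq_abs] at this; linarith only [mul_nonneg (sq_nonneg (l 3)) (sq_nonneg ⟪e 3, z⟫), this]
      · have : (σ / 2) ^ 2 * (1 / 4000) ^ 2 ≤ (-l 3) ^ 2 * |⟪e 3, z⟫| ^ 2 := by gcongr; linarith only [h3]
        rw [sq_abs, neg_sq] at this; linarith only [mul_nonneg (sq_nonneg (l 0)) (sq_nonneg ⟪e 0, z⟫), this]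
    have k2 : g ^ 2 ≤ (σ / 20000) ^ 2 := by gcongr; linarith only [hs2, g1]
    have k3 := mul_nonneg (sq_nonneg (l 1)) (sq_nonneg ⟪e 1, z⟫)
    rename_bvar zz → zz
    have k4 := mul_nonneg (sq_nonneg (l 2)) (sq_nonneg ⟪e 2, z⟫)
    have k5 := sq_nonneg σ
    linarith only [hg0, g1, k1, k2, k3, k4]
  have gq : g ≤ ‖AO e l q‖ := by
    rw [← sq_le_sq₀ (by positivity) (by positivity), AO_norm]
    have k1 : g ^ 2 ≤ (σ * ρ) ^ 2 := by gcongr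
    have k2 : σ ^ 2 * ρ ^ 2 ≤ l 0 ^ 2 * |⟪e 0, q⟫| ^ 2 := by gcongr
    rw [sq_abs] at k2
    have k3 := mul_nonneg (sq_nonneg (l 1)) (sq_nonneg ⟪e 1, q⟫)
    rename_bvar zz → zz
    have k4 := mul_nonneg (sq_nonneg (l 2)) (sq_nonneg ⟪e 2, q⟫)
    have k5 := mul_nonneg (sq_nonneg (l 3)) (sq_nonneg ⟪e 3, q⟫)
    linarith only [k1, k2, k3, k4, k5]
  rename_bvar zz → zz
  have gP : g ≤ ‖AO e l P‖ := by linarith only [sq_nonneg σ, hg0, g1, hgP]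
  have gR : g ≤ ‖AO e l R‖ := by linarith only [sq_nonneg σ, hg0, g1, hgR]
  have aP : |AQ e l P| ≤ κ := by rw [hAP, abs_zero]; exact hκ0
  have aR : |AQ e l R| ≤ κ := by rw [hAR, abs_zero]; exact hκ0
  refine H R q hR aR gR hq hAq gq ?_ (H P R hP aP gP hR aR gR ?_ (H z P hz1 (hS z hz (by linarith only [hσ1, hz1, hg0, hs2, g1])) gz hP aP gP ?_
    ⟨z, hz, by simpa using hτ.le⟩))
  · intro j
    obtain ⟨a, ha, e1⟩ := hcR j
    rw [e1, mul_assoc]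
    refine mul_nonneg ha ?_
    split_ifs with h1 h2
    · subst h1; exact hsq
    · subst h2; exact hwq
    · simp
  · intro j
    obtain ⟨a, ha, e1⟩ := hcR j
    obtain ⟨a', ha', e2⟩ := hcP j
    rw [e1, e2]
    fin_cases j <;> simp
    rename_bvar zz → zz
    have : a' * s * (a * s) = a * a' * s ^ 2 := by ring
    rw [this]; positivity
  · intro j
    obtain ⟨a, ha, e1⟩ := hcP j
    rw [e1, mul_comm, mul_assoc]
    refine mul_nonneg ha ?_
    split_ifs with h1 h2
    · subst h1; exact hsz
    · subst h2; exact htz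
    · simp

lemma exp5 (t : ℝ) : |Real.exp t - 1 - t - t ^ 2 / 2 - t ^ 3 / 6 - t ^ 4 / 24| ≤ |t| ^ 5 * Real.exp |t| := by
  have := Complex.norm_exp_sub_sum_le_norm_mul_exp (t : ℂ) 5
  have e : (Complex.exp t - ∑ m ∈ Finset.range 5, (t:ℂ) ^ m / m.factorial) =
    ((Real.exp t - 1 - t - t ^ 2 / 2 - t ^ 3 / 6 - t ^ 4 / 24 : ℝ) : ℂ) := by
    simp [Finset.sum_range_succ, Nat.factorial]; ring
  rw [e, Complex.norm_real, Complex.norm_real] at this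
  simpa using this

lemma exp_lip {a b M : ℝ} (ha : a ≤ M) (hb : b ≤ M) : |Real.exp a - Real.exp b| ≤ |a - b| * Real.exp M := by
  have key : ∀ a b : ℝ, a ≤ M → b ≤ M → Real.exp a - Real.exp b ≤ |a - b| * Real.exp M := by
    intro a b ha hb
    have h1 : Real.exp b = Real.exp a * Real.exp (b - a) := by rw [← Real.exp_add]; ring_nf
    have h2 := Real.add_one_le_exp (b - a)
    have h3 : Real.exp a ≤ Real.exp M := Real.exp_le_exp.2 ha
    have h4 : |a - b| * Real.exp a ≤ |a - b| * Real.exp M := by gcongr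
    have h5 : Real.exp a * (b - a + 1) ≤ Real.exp b := by rw [h1]; gcongr
    have h6 : (a - b) * Real.exp a ≤ |a - b| * Real.exp a := by gcongr; exact le_abs_self _
    linarith
  rw [abs_le]
  have := key a b ha hb
  have := key b a hb ha
  rw [abs_sub_comm] at this
  constructor <;> linarith

lemma in_int {μ S δ} (h : AU μ S δ) (hd : δ ≤ 1) (h0 : (0:V) ∈ S) (c : ℝ) (w : V) (k : ℕ) :
    Integrable (fun y => Real.exp (-‖y‖ ^ 2) * (c * ⟪w, y⟫ ^ k)) μ := 
  G_int h hd h0 k (K := |c| * ‖w‖ ^ k) (by fun_prop) fun y _ => by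
    rw [abs_mul, abs_pow, mul_assoc]
    have h1 := abs_real_inner_le_norm w y
    have h2 := gr_poly k y
    calc |c| * |⟪w, y⟫| ^ k ≤ |c| * (‖w‖ * ‖y‖) ^ k := by gcongr
      _ = |c| * (‖w‖ ^ k * ‖y‖ ^ k) := by rw [mul_pow]
      _ ≤ _ := by gcongr

lemma sol4 {a0 a1 a2 a3 a4 X h : ℝ} (hh : 0 < h) (H0 : |a0| ≤ X) 
    (H : ∀ k : ℕ, 1 ≤ k → k ≤ 4 → |a0 + (k * h) * a1 + (k * h) ^ 2 * a2 + (k * h) ^ 3 * a3 + (k * h) ^ 4 * a4| ≤ X) :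
    h ^ 2 * |a2| ≤ 20 * X ∧ h ^ 4 * |a4| ≤ 20 * X := by
  have h1 := H 1 (by norm_num) (by norm_num)
  have h2 := H 2 (by norm_num) (by norm_num)
  have h3 := H 3 (by norm_num) (by norm_num)
  rename_bvar zz → zz
  have h4 := H 4 (by norm_num) (by norm_num)
  push_cast at h1 h2 h3 h4
  rw [← abs_of_pos (show 0 < h ^ 2 by positivity), ← abs_of_pos (show 0 < h ^ 4 by positivity), ← abs_mul, ← abs_mul]
  rw [abs_le] at H0 h1 h2 h3 h4
  constructor <;> rw [abs_le] <;> constructor <;> linarith only [H0, h2, h3, h4, h1]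

lemma f4 : ∃ C : ℝ, 1 ≤ C ∧ ∀ μ S δ, AU μ S δ → δ ≤ 1 → 0 ∈ S → ∀ w : V, ‖w‖ ≤ 1 → ∀ h τ : ℝ, 0 < h → h ≤ 1 / 8 →
    0 ≤ τ → τ ≤ 1 / 8 → (∀ k : ℕ, 1 ≤ k → k ≤ 4 → ∃ x ∈ S, ‖x - (k * h) • w‖ ≤ τ) →
    |2 * G μ (fun y => ⟪w, y⟫ ^ 2) - cG * ‖w‖ ^ 2| ≤ C * (h + (τ + δ) / h ^ 4) ∧
    |2 / 3 * G μ (fun y => ⟪w, y⟫ ^ 4) - cG * (‖w‖ ^ 4 / 2)| ≤ C * (h + (τ + δ) / h ^ 4) := by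
  obtain ⟨Cb, hCb, hB⟩ := G_bd 5
  obtain ⟨Cg, hCg, hg⟩ := gen_est
  have hcG := cG_pos
  rename_bvar zz → zz
  obtain ⟨c, hc⟩ : ∃ c, c = Cg + Cb * 32768 + cG * 40000 := ⟨_, rfl⟩
  have hc0 : 0 < c := by rw [hc]; positivity
  refine ⟨20 * c + 1, by linarith, ?_⟩
  intro μ S δ hA hd h0 w hw h τ hh hh1 hτ hτ1 hx
  have hδ := hA.pos
  have H0 : |G μ (fun _ => 1) - cG| ≤ c * (h ^ 5 + τ + δ) := by
    have := hg μ S δ hA hd h0 0 h0 (by simp)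
    simp only [inner_zero_left, mul_zero, Real.exp_zero, norm_zero, mul_one, ne_eq, OfNat.ofNat_ne_zero, not_false_eq_true, zero_pow] at this
    refine this.trans ?_
    have a1 : Cg * δ ≤ c * δ := by gcongr; rw [hc]; linarith only [hCb, hcG]
    have a2 : 0 ≤ c * (h ^ 5 + τ) := by positivity
    linarith
  rename_bvar zz → zz
  have H : ∀ k : ℕ, 1 ≤ k → k ≤ 4 → |(G μ (fun _ => 1) - cG) + (k * h) * G μ (fun y => 2 * ⟪w, y⟫ ^ 1) + (k * h) ^ 2 *
      (G μ (fun y => 2 * ⟪w, y⟫ ^ 2) - cG * ‖w‖ ^ 2) + (k * h) ^ 3 * G μ (fun y => 4 / 3 * ⟪w, y⟫ ^ 3)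
      + (k * h) ^ 4 * (G μ (fun y => 2 / 3 * ⟪w, y⟫ ^ 4) - cG * (‖w‖ ^ 4 / 2))| ≤ c * (h ^ 5 + τ + δ) := by
    intro k hk1 hk4
    obtain ⟨x, hxS, hxw⟩ := hx k hk1 hk4
    obtain ⟨s, hs⟩ : ∃ s, s = (k:ℝ) * h := ⟨_, rfl⟩
    rw [← hs] at hxw ⊢
    have hk4' : (k:ℝ) ≤ 4 := by exact_mod_cast hk4
    rename_bvar zz → zz
    have hs0 : 0 ≤ s := by rw [hs]; positivity
    have hs4 : s ≤ 4 * h := by rw [hs]; gcongr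
    have hsw : ‖s • w‖ ≤ s := by rw [norm_smul, Real.norm_of_nonneg hs0]; exact mul_le_of_le_one_right hs0 hw
    have hxn : ‖x‖ ≤ s + τ := by
      have := norm_le_norm_add_norm_sub' x (s • w)
      linarith only [hxw, hsw, this]
    have hx1 : ‖x‖ ≤ 1 := by linarith only [hh, hh1, hτ1, hs4, hxn]
    have h1 := hg μ S δ hA hd h0 x hxS hx1
    -- the remainder
    have hR : |G μ (fun y => Real.exp (2 * ⟪x, y⟫) - (1 + s * (2 * ⟪w, y⟫ ^ 1) + s ^ 2 * (2 * ⟪w, y⟫ ^ 2) + s ^ 3 * (4 / 3 * ⟪w, y⟫ ^ 3)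
      + s ^ 4 * (2 / 3 * ⟪w, y⟫ ^ 4)))| ≤ Cb * (32768 * h ^ 5 + 2 * τ) := by
      refine (hB μ S δ hA hd h0 _ (by fun_prop) _ (by positivity) ?_).2
      intro y _
      have hwy : |⟪w, y⟫| ≤ ‖y‖ := (abs_real_inner_le_norm w y).trans (mul_le_of_le_one_left (norm_nonneg y) hw)
      have a1 := exp5 (2 * s * ⟪w, y⟫)
      have hst : |2 * s * ⟪w, y⟫| ≤ 8 * h * ‖y‖ := by
        rw [abs_mul, abs_of_nonneg (by positivity)]
        have : 2 * s ≤ 8 * h := by linarith only [hs4]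
        gcongr
      have hst1 : |2 * s * ⟪w, y⟫| ≤ 8 * ‖y‖ := by
        refine hst.trans ?_; gcongr; linarith only [hh, hh1]
      have a2 : |2 * s * ⟪w, y⟫| ^ 5 * Real.exp |2 * s * ⟪w, y⟫| ≤ (8 * h * ‖y‖) ^ 5 * Real.exp (8 * ‖y‖) := by
        gcongr
      have hxy : ⟪x, y⟫ ≤ ‖y‖ := (real_inner_le_norm x y).trans (mul_le_of_le_one_left (norm_nonneg y) hx1)
      have a3 := exp_lip (a := 2 * ⟪x, y⟫) (b := 2 * s * ⟪w, y⟫) (M := 8 * ‖y‖) (by linarith only [norm_nonneg y, hxy]) ((le_abs_self _).trans hst1)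
      have a4 : |2 * ⟪x, y⟫ - 2 * s * ⟪w, y⟫| ≤ 2 * τ * ‖y‖ := by
        have : 2 * ⟪x, y⟫ - 2 * s * ⟪w, y⟫ = 2 * ⟪x - s • w, y⟫ := by
          rw [inner_sub_left, real_inner_smul_left]; ring
        rw [this, abs_mul, abs_two]
        have := abs_real_inner_le_norm (x - s • w) y
        have : ‖x - s • w‖ * ‖y‖ ≤ τ * ‖y‖ := by gcongr
        linarith
      have a5 : |2 * ⟪x, y⟫ - 2 * s * ⟪w, y⟫| * Real.exp (8 * ‖y‖) ≤ 2 * τ * ‖y‖ * Real.exp (8 * ‖y‖) := by gcongr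
      have b1 : ‖y‖ ^ 5 ≤ (1 + ‖y‖) ^ 5 := by gcongr; linarith only [hh, hh1]
      have b2 : ‖y‖ ≤ (1 + ‖y‖) ^ 5 := by
        calc ‖y‖ ≤ 1 + ‖y‖ := by linarith only [hh, hh1]
          _ ≤ _ := le_self_pow₀ (by linarith only [norm_nonneg y]) (by norm_num)
      have b3 : (8 * h * ‖y‖) ^ 5 * Real.exp (8 * ‖y‖) ≤ 32768 * h ^ 5 * ((1 + ‖y‖) ^ 5 * Real.exp (8 * ‖y‖)) := by
        rw [show (8 * h * ‖y‖) ^ 5 * Real.exp (8 * ‖y‖) = 32768 * h ^ 5 * (‖y‖ ^ 5 * Real.exp (8 * ‖y‖)) by ring]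
        gcongr
      have b4 : 2 * τ * ‖y‖ * Real.exp (8 * ‖y‖) ≤ 2 * τ * ((1 + ‖y‖) ^ 5 * Real.exp (8 * ‖y‖)) := by
        rw [mul_assoc]; gcongr
      have a6 := a1.trans (a2.trans b3)
      have a7 := a3.trans (a5.trans b4)
      rw [show Real.exp (2 * ⟪x, y⟫) - (1 + s * (2 * ⟪w, y⟫ ^ 1) + s ^ 2 * (2 * ⟪w, y⟫ ^ 2) + s ^ 3 * (4 / 3 * ⟪w, y⟫ ^ 3)
      + s ^ 4 * (2 / 3 * ⟪w, y⟫ ^ 4)) = (Real.exp (2 * ⟪x, y⟫) - Real.exp (2 * s * ⟪w, y⟫)) + (Real.exp (2 * s * ⟪w, y⟫) - 1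
        - 2 * s * ⟪w, y⟫ - (2 * s * ⟪w, y⟫) ^ 2 / 2 - (2 * s * ⟪w, y⟫) ^ 3 / 6 - (2 * s * ⟪w, y⟫) ^ 4 / 24) by ring]
      refine (abs_add_le _ _).trans ?_
      linarith only [a1, a2, a3, a5, b3, b4]
    have ie : Integrable (fun y => Real.exp (-‖y‖ ^ 2) * Real.exp (2 * ⟪x, y⟫)) μ := by
      refine G_int hA hd h0 0 (K := 1) (by fun_prop) fun y _ => ?_
      rw [Real.abs_exp, pow_zero, one_mul, one_mul, Real.exp_le_exp]
      have hxy : ⟪x, y⟫ ≤ ‖y‖ := (real_inner_le_norm x y).trans (mul_le_of_le_one_left (norm_nonneg y) hx1)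
      linarith only [norm_nonneg y, hxy]
    have i0 : Integrable (fun y => Real.exp (-‖y‖ ^ 2) * (1:ℝ)) μ := by
      have := in_int hA hd h0 1 w 0
      simpa using this
    have ik : ∀ (a c : ℝ) (k : ℕ), Integrable (fun y => Real.exp (-‖y‖ ^ 2) * (a * (c * ⟪w, y⟫ ^ k))) μ := by
      intro a c k
      have := in_int hA hd h0 (a * c) w k
      simpa only [mul_assoc] using this
    have ia : ∀ {f g : V → ℝ}, Integrable (fun y => Real.exp (-‖y‖ ^ 2) * f y) μ → Integrable (fun y => Real.exp (-‖y‖ ^ 2) * g y) μ →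
      Integrable (fun y => Real.exp (-‖y‖ ^ 2) * (f y + g y)) μ := by
      intro f g hf hg
      simp only [mul_add]; exact hf.add hg
    have j1 := ia i0 (ik s 2 1)
    have j2 := ia j1 (ik (s ^ 2) 2 2)
    have j3 := ia j2 (ik (s ^ 3) (4 / 3) 3)
    have j4 := ia j3 (ik (s ^ 4) (2 / 3) 4)
    rw [G_sub ie j4, G_add j3 (ik _ _ _), G_add j2 (ik _ _ _), G_add j1 (ik _ _ _), G_add i0 (ik _ _ _)] at hR
    simp only [G_smul s, G_smul (s ^ 2), G_smul (s ^ 3), G_smul (s ^ 4)] at hR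
    -- the exponential of the norm
    have hE : |Real.exp (‖x‖ ^ 2) - (1 + s ^ 2 * ‖w‖ ^ 2 + s ^ 4 * (‖w‖ ^ 4 / 2))| ≤ 20000 * h ^ 5 + 9 * τ := by
      have a1 := exp3 (s ^ 2 * ‖w‖ ^ 2)
      have hw2 : ‖w‖ ^ 2 ≤ 1 := pow_le_one₀ (norm_nonneg w) hw
      have u0 : 0 ≤ s ^ 2 * ‖w‖ ^ 2 := by positivity
      have u1 : s ^ 2 * ‖w‖ ^ 2 ≤ (4 * h) ^ 2 * 1 := by gcongr
      have u2 : (4 * h) ^ 2 * 1 ≤ 1 := by nlinarith only [hh1, hh]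
      rw [abs_of_nonneg u0] at a1
      have a2 : (s ^ 2 * ‖w‖ ^ 2) ^ 3 * Real.exp (s ^ 2 * ‖w‖ ^ 2) ≤ ((4 * h) ^ 2 * 1) ^ 3 * Real.exp 1 := by
        gcongr; linarith only [u1, u2]
      have a3 : ((4 * h) ^ 2 * 1) ^ 3 * Real.exp 1 ≤ ((4 * h) ^ 2 * 1) ^ 3 * 3 := by
        gcongr; linarith only [Real.exp_one_lt_d9, hh, hh1]
      have h6 : h ^ 5 * h ≤ h ^ 5 * 1 := by gcongr; linarith only [hh, hh1]
      have a4 := exp_lip (a := ‖x‖ ^ 2) (b := s ^ 2 * ‖w‖ ^ 2) (M := 1) (pow_le_one₀ (norm_nonneg x) hx1) (by linarith only [u1, u2])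
      have a5 : |‖x‖ ^ 2 - s ^ 2 * ‖w‖ ^ 2| ≤ 3 * τ := by
        have e1 : ‖x‖ ^ 2 - s ^ 2 * ‖w‖ ^ 2 = (‖x‖ - ‖s • w‖) * (‖x‖ + ‖s • w‖) := by
          rw [norm_smul, Real.norm_of_nonneg hs0]; ring
        rw [e1, abs_mul, abs_of_nonneg (by positivity : 0 ≤ ‖x‖ + ‖s • w‖), mul_comm]
        have : |‖x‖ - ‖s • w‖| ≤ τ := (abs_norm_sub_norm_le _ _).trans hxw
        gcongr; linarith only [hh, hh1, hτ1, hs4, hsw, hxn]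
      have a6 : |‖x‖ ^ 2 - s ^ 2 * ‖w‖ ^ 2| * Real.exp 1 ≤ 3 * τ * 3 := by
        gcongr; linarith only [Real.exp_one_lt_d9, hh, hh1]
      have a7 := a1.trans (a2.trans a3)
      have a8 := a4.trans a6
      rw [abs_le] at a7 a8 ⊢
      constructor <;> nlinarith only [a7, a8, h6]
    have hE2 : cG * |Real.exp (‖x‖ ^ 2) - (1 + s ^ 2 * ‖w‖ ^ 2 + s ^ 4 * (‖w‖ ^ 4 / 2))| ≤ cG * (20000 * h ^ 5 + 9 * τ) := by gcongr
    rw [← abs_of_pos hcG, ← abs_mul, abs_of_pos hcG] at hE2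
    have tot : |(G μ (fun _ => 1) - cG) + s * G μ (fun y => 2 * ⟪w, y⟫ ^ 1) + s ^ 2 *
      (G μ (fun y => 2 * ⟪w, y⟫ ^ 2) - cG * ‖w‖ ^ 2) + s ^ 3 * G μ (fun y => 4 / 3 * ⟪w, y⟫ ^ 3)
      + s ^ 4 * (G μ (fun y => 2 / 3 * ⟪w, y⟫ ^ 4) - cG * (‖w‖ ^ 4 / 2))| ≤ Cg * δ + Cb * (32768 * h ^ 5 + 2 * τ) + cG * (20000 * h ^ 5 + 9 * τ) := by
      rw [abs_le] at h1 hR hE2 ⊢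
      constructor <;> linarith only [h1, hR, hE2]
    refine tot.trans ?_
    have p1 : 0 < h ^ 5 := by positivity
    have q1 := mul_pos hCg p1
    have q2 := mul_nonneg hCg.le hτ
    have q3 := mul_nonneg hCb.le hτ
    have q4 := mul_pos hCb hδ
    have q5 := mul_nonneg hcG.le hτ
    have q6 := mul_pos hcG hδ
    have q7 := mul_pos hcG p1
    rw [hc]; linarith only [q1, q2, q3, q4, q5, q6, q7]
  obtain ⟨r2, r4⟩ := sol4 hh H0 H
  rw [G_smul, G_smul] at *
  have hX : 20 * (c * (h ^ 5 + τ + δ)) ≤ h ^ 4 * ((20 * c + 1) * (h + (τ + δ) / h ^ 4)) := by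
    have : h ^ 4 * ((20 * c + 1) * (h + (τ + δ) / h ^ 4)) = (20 * c + 1) * (h ^ 5 + τ + δ) := by field_simp; ring
    rw [this]
    have : 0 < h ^ 5 + τ + δ := by positivity
    linarith only [this]
  have hh4 : 0 < h ^ 4 := by positivity
  constructor
  · refine le_of_mul_le_mul_left (le_trans ?_ (r2.trans hX)) hh4
    gcongr ?_ * _
    exact pow_le_pow_of_le_one hh.le (by linarith only [hh, hh1]) (by norm_num)
  · exact le_of_mul_le_mul_left (r4.trans hX) hh4

lemma cube_ge {t : ℝ} (ht : 0 ≤ t) : t ^ 3 + 2 ≤ 3 * (1 + t) ^ 3 ∧ t ≤ (1 + t) ^ 3 := by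
  have a := pow_nonneg ht 2
  have b := pow_nonneg ht 3
  have : (1 + t) ^ 3 = 1 + 3 * t + 3 * t ^ 2 + t ^ 3 := by ring
  rw [this]; constructor <;> linarith only [ht, a, b]

set_option maxHeartbeats 1000000 in
lemma Quad {ε1 : ℝ} (h1 : 0 < ε1) (h1' : ε1 ≤ 1) : ∃ C σ : ℝ, 1 ≤ C ∧ 0 < σ ∧ σ ≤ 1 / 10 ∧ ∀ ε : ℝ, 0 < ε → ε * C ≤ 1 →
    ∀ μ S, AU μ S (ε ^ 5) → 0 ∈ S → (∀ t, ε ≤ t → t ≤ 1 → ¬ Fl S t ε1) →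
    ∃ (e : OrthonormalBasis (Fin 4) ℝ V) (l : Fin 4 → ℝ), (∀ i, |l i| ≤ 4) ∧ σ ≤ l 0 ∧ l 2 ≤ -σ / 2 ∧
      l 3 ≤ -(1 / 5) ∧ |l 0 + l 1 + l 2 + l 3 + 1| ≤ C * ε ∧
      ∀ y ∈ S, |AQ e l y| ≤ C * ε * (1 + ‖y‖) ^ 3 := by
  obtain ⟨C, hC, hP⟩ := PS
  obtain ⟨B, hB⟩ : ∃ B, B = 2 * C / ε1 := ⟨_, rfl⟩
  have hB0 : 0 < B := by rw [hB]; positivity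
  refine ⟨1000 * (3 * C + 2 * B) / ε1 ^ 2, ε1 ^ 2 / 40, ?_, by positivity, by nlinarith only [h1', h1], ?_⟩
  · rw [le_div_iff₀ (by positivity)]; nlinarith only [h1', hC, hB0, h1]
  intro ε he heC μ S hA h0 hn
  rename_bvar zz → zz
  obtain ⟨D, hD⟩ : ∃ D, D = 3 * C + 2 * B := ⟨_, rfl⟩
  have hD0 : 3 ≤ D := by linarith
  have hsm : ε * (1000 * D) ≤ ε1 ^ 2 := by
    rw [← hD] at heC
    rw [mul_div_assoc', div_le_one (by positivity)] at heC; exact heC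
  have h12 : ε1 ^ 2 ≤ 1 := by nlinarith only [h1', h1]
  rename_bvar zz → zz
  have hDC : D ≤ 1000 * D / ε1 ^ 2 := by
    rw [le_div_iff₀ (by positivity)]; nlinarith only [hD0, h12]
  have he1 : ε ≤ 1 / 1000 := by nlinarith only [hD0, hsm, h12, he]
  have e4 : ε ^ 4 ≤ ε ^ 2 := pow_le_pow_of_le_one he.le (by linarith) (by norm_num)
  have e5 : ε ^ 5 ≤ ε ^ 4 := pow_le_pow_of_le_one he.le (by linarith) (by norm_num)
  rename_bvar zz → zz
  have e2 : ε ^ 2 ≤ ε := by nlinarith only [he, he1]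
  obtain ⟨b, q, -, hq⟩ := hP μ S _ hA h0 (1 / ε) (2 * ε ^ 4) (by positivity) (by linarith)
    (by apply le_of_eq; field_simp) (by linarith only [he, he1, e4, e2])
  have hpo : ∀ x ∈ S, ‖x‖ ≤ 1 / ε → |2 * ⟪b, x⟫ + q x x| ≤ C * (ε * ‖x‖ ^ 3 + 2 * ε ^ 2) := by
    intro x hx hx1
    refine (hq.poly x hx hx1).trans (le_of_eq ?_)
    field_simp
  have hb : ‖b‖ ≤ B * ε := by
    by_contra hcon; push Not at hcon
    have hb0 : 0 < ‖b‖ := lt_of_le_of_lt (by positivity) hcon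
    refine hn ε le_rfl (by linarith only [he, he1]) ⟨‖b‖⁻¹ • b, by rw [norm_smul, norm_inv, norm_norm]; field_simp, ?_⟩
    intro y hy hye
    have hi : ε ≤ 1 / ε := by rw [le_div_iff₀ he]; nlinarith only [he, he1]
    have k1 := hpo y hy (hye.trans hi)
    rename_bvar zz → zz
    have k2 := hq.qb y y
    have k3 : ‖y‖ * ‖y‖ ≤ ε ^ 2 := by rw [sq]; gcongr
    have k4 : ‖y‖ ^ 3 ≤ ε ^ 3 := by gcongr
    have k5 : C * (‖y‖ * ‖y‖) ≤ C * ε ^ 2 := by gcongr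
    have k6 : C * (ε * ‖y‖ ^ 3 + 2 * ε ^ 2) ≤ C * (3 * ε ^ 2) := by
      gcongr
      calc ε * ‖y‖ ^ 3 + 2 * ε ^ 2 ≤ ε * ε ^ 3 + 2 * ε ^ 2 := by gcongr
        _ = ε ^ 4 + 2 * ε ^ 2 := by ring
        _ ≤ _ := by linarith
    have k7 : |⟪b, y⟫| ≤ 2 * C * ε ^ 2 := by
      rw [abs_le] at k1 k2 ⊢; constructor <;> linarith only [k1, k2, k5, k6]
    rw [inner_smul_left, conj_trivial, abs_mul, abs_of_pos (by positivity), inv_mul_le_iff₀ hb0]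
    have k8 : B * ε1 = 2 * C := by rw [hB]; field_simp
    calc _ ≤ B * ε1 * ε ^ 2 := by rw [k8]; exact k7
      _ = B * ε * (ε1 * ε) := by ring
      _ ≤ _ := by gcongr
  rename_bvar zz → zz
  have hAQ : ∀ y ∈ S, |q y y| ≤ D * ε * (1 + ‖y‖) ^ 3 := by
    intro y hy
    have hy0 := norm_nonneg y
    have k2 := hq.qb y y
    by_cases hc : ‖y‖ ≤ 1 / ε
    · have k1 := hpo y hy hc
      have k3 := abs_real_inner_le_norm b y
      have k4 : ‖b‖ * ‖y‖ ≤ B * ε * ‖y‖ := by gcongr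
      have : |q y y| ≤ C * (ε * ‖y‖ ^ 3 + 2 * ε ^ 2) + 2 * (B * ε * ‖y‖) := by
        have := k3.trans k4
        rw [abs_le] at this k1 ⊢; constructor <;> linarith only [k1, this]
      refine this.trans ?_
      calc _ ≤ C * (ε * ‖y‖ ^ 3 + 2 * ε) + 2 * (B * ε * ‖y‖) := by gcongr
        _ = C * ε * (‖y‖ ^ 3 + 2) + 2 * B * ε * ‖y‖ := by ring
        _ ≤ C * ε * (3 * (1 + ‖y‖) ^ 3) + 2 * B * ε * (1 + ‖y‖) ^ 3 := by
          gcongr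
          · exact (cube_ge hy0).1
          · exact (cube_ge hy0).2
        _ = _ := by rw [hD]; ring
    · push Not at hc
      rw [div_lt_iff₀ he] at hc
      calc _ ≤ C * (‖y‖ * ‖y‖) * 1 := by linarith
        _ ≤ C * (‖y‖ * ‖y‖) * (‖y‖ * ε) := by gcongr
        _ = C * ε * ‖y‖ ^ 3 := by ring
        _ ≤ _ := by gcongr <;> linarith only [hC, hB0, he, hD, he1]
  obtain ⟨e, l, hl, hd⟩ := diag q hq.sym
  have hle : ∀ i, q (e i) (e i) = l i := by
    intro i; rw [hd]; simp only [onb_ip]; fin_cases i <;> simp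
  have hqA : ∀ x, q x x = AQ e l x := by intro x; rw [hd, AQ]; ring
  rename_bvar zz → zz
  have htr := hq.tr e
  simp only [hle] at htr
  have hlo : ∀ i, -1 ≤ l i := by
    intro i; have := hq.lo (e i); rw [hle] at this; simpa using this
  have hCk : C * (2 * ε ^ 4) ≤ D * ε := by
    calc C * (2 * ε ^ 4) ≤ C * (2 * ε) := by gcongr; linarith
      _ ≤ _ := by rw [hD]; nlinarith only [mul_pos hB0 he, mul_pos (lt_of_lt_of_le one_pos hC) he]
  have htr2 := htr.trans hCk
  rename_bvar zz → zz
  have hDe : D * ε ≤ ε1 ^ 2 / 1000 := by linarith only [hsm]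
  have htr3 := abs_le.1 htr2
  have l01 : l 1 ≤ l 0 := hl (by decide)
  have l12 : l 2 ≤ l 1 := hl (by decide)
  rename_bvar zz → zz
  have l23 : l 3 ≤ l 2 := hl (by decide)
  have q0 := hlo 0
  have q1 := hlo 1
  have q2 := hlo 2
  rename_bvar zz → zz
  have q3 := hlo 3
  have h3 : l 3 ≤ -(1 / 5) := by linarith only [he, hsm, h12, he1, htr3, l01, l12, l23]
  have hl0 : ε1 ^ 2 / 20 ≤ l 0 := by
    by_contra hcon; push Not at hcon
    refine hn 1 (by linarith only [he, he1]) le_rfl ⟨e 3, by simp, ?_⟩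
    intro y hy hy1
    have k := hAQ y hy
    have k2 : D * ε * (1 + ‖y‖) ^ 3 ≤ D * ε * (1 + 1) ^ 3 := by gcongr
    have k3 := (abs_le.1 (k.trans k2)).1
    rw [hqA, AQ] at k3
    rename_bvar zz → zz
    have k4 := norm_sq4 e y
    have k5 : ‖y‖ ^ 2 ≤ 1 := pow_le_one₀ (norm_nonneg y) hy1
    have s : ∀ i : Fin 3, l i.castSucc * ⟪e i.castSucc, y⟫ ^ 2 ≤ ε1 ^ 2 / 20 * ⟪e i.castSucc, y⟫ ^ 2 := by
      intro i
      have : l i.castSucc ≤ l 0 := hl (Fin.zero_le _)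
      gcongr; linarith only [hcon, this]
    have s0 := s 0
    have s1 := s 1
    have s2 := s 2
    simp only [Fin.castSucc_zero, Fin.castSucc_one, show (Fin.castSucc (2 : Fin 3)) = (2 : Fin 4) from rfl] at s0 s1 s2
    have s3 : l 3 * ⟪e 3, y⟫ ^ 2 ≤ -(1 / 5) * ⟪e 3, y⟫ ^ 2 := by gcongr
    have k6 : ε1 ^ 2 / 20 * ‖y‖ ^ 2 ≤ ε1 ^ 2 / 20 * 1 := by gcongr
    rw [mul_one]
    apply abs_le_of_sq_le_sq _ h1.le
    have k7 : 0 ≤ ε1 ^ 2 / 20 * ⟪e 3, y⟫ ^ 2 := by positivity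
    rw [k4] at k6
    linarith only [hsm, htr3, k3, s0, s1, s2, s3, k6, k7]
  have hfin : 1000 * (3 * C + 2 * B) / ε1 ^ 2 = 1000 * D / ε1 ^ 2 := by rw [hD]
  rw [hfin]
  refine ⟨e, l, ?_, by linarith only [sq_nonneg ε1, hsm, htr3, hl0], by linarith only [hsm, htr3, l01, l12, q3, hl0], h3, htr2.trans (by gcongr), ?_⟩
  · have u0 : l 0 ≤ 4 := by linarith only [he, hsm, h12, he1, htr3, q1, q2, q3]
    intro i; rw [abs_le]
    have : l i ≤ l 0 := hl (Fin.zero_le _)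
    exact ⟨by linarith only [hlo i, he, he1], by linarith only [he, hsm, h12, he1, htr3, q1, q2, q3, this]⟩
  · intro y hy; rw [← hqA]; refine (hAQ y hy).trans ?_; gcongr

lemma Mom {σ ρ0 C0 : ℝ} (hσ : 0 < σ) (hσ1 : σ ≤ 1) (hρ : 0 < ρ0) (hρ1 : ρ0 ≤ 1) (hC0 : 1 ≤ C0) : ∃ C : ℝ, 1 ≤ C ∧
    ∀ h : ℝ, 0 < h → h * C ≤ 1 → ∀ μ S, AU μ S (h ^ 60) → 0 ∈ S → ∀ e l, (∀ i, |l i| ≤ 4) → σ ≤ l 0 →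
    l 2 ≤ -σ / 2 → l 3 ≤ -σ / 2 → (∀ y ∈ S, |AQ e l y| ≤ C0 * h ^ 12 * (1 + ‖y‖) ^ 3) →
    ∀ w : V, ‖w‖ ≤ 1 → AQ e l w = 0 → ρ0 ≤ |⟪e 0, w⟫| → ∀ r : ℝ, 1 / 2 ≤ r → r ≤ 1 →
    |2 * G (rs μ 0 r) (fun y => ⟪w, y⟫ ^ 2) - cG * ‖w‖ ^ 2| ≤ C * h ∧
    |2 / 3 * G (rs μ 0 r) (fun y => ⟪w, y⟫ ^ 4) - cG * (‖w‖ ^ 4 / 2)| ≤ C * h := by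
  obtain ⟨C1, hC1, hf⟩ := f4
  obtain ⟨d, C2, hd, hC2, hfl⟩ := fillc
  refine ⟨8 + 108 * C0 + C2 / (σ ^ 2 * ρ0) + 1 / d + 4 * C1, ?_, ?_⟩
  · have : 0 < C2 / (σ ^ 2 * ρ0) := by positivity
    have : 0 < 1 / d := by positivity
    linarith
  intro h hh hsm μ S hA h0 e l hl hl0 hl2 hl3 hS w hw hAw hw0 r hr hr1
  have p1 : 0 < h * (C2 / (σ ^ 2 * ρ0)) := by positivity
  rename_bvar zz → zz
  have p2 : 0 < h * (1 / d) := by positivity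
  have p3 : 0 ≤ h * C0 := by positivity
  have p4 : 0 ≤ h * C1 := by positivity
  have q1 : h * (C2 / (σ ^ 2 * ρ0)) ≤ 1 := by linarith only [hh, hsm, p2, p3, p4]
  rename_bvar zz → zz
  have q2 : h * (1 / d) ≤ 1 := by linarith only [hh, hsm, p1, p3, p4]
  have q3 : 108 * (h * C0) ≤ 1 := by linarith only [hh, hsm, p1, p2, p4]
  have h8 : h ≤ 1 / 8 := by linarith only [hsm, p1, p2, p3, p4]
  rw [mul_div_assoc', div_le_one (by positivity)] at q1
  rw [mul_one_div, div_le_one hd] at q2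
  have hp : ∀ {n : ℕ} (m : ℕ), m ≤ n → h ^ n ≤ h ^ m := fun m hm =>
    pow_le_pow_of_le_one hh.le (by linarith only [hh, hsm, p1, p2, p3, p4]) hm
  rename_bvar zz → zz
  have h60 : h ^ 60 ≤ h := by simpa using hp 1 (n := 60) (by norm_num)
  obtain ⟨z, hz, hz1, hzk⟩ := D_contra hA h0 (n := e 0) (v := e 3) (by simp) (by simp)
    (by rw [onb_ip]; simp) (r := 1) (k := 1 / 4000) (by norm_num) (by norm_num) (by linarith only [hh, hsm, p1, p2, p3, p4, h60])
  obtain ⟨s, hs, hs0⟩ := sgn_ex (⟪e 0, z⟫ * ⟪e 0, w⟫)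
  have hs1 : |s| = 1 := by rw [← sq_eq_sq₀ (abs_nonneg s) zero_le_one, sq_abs, hs, one_pow]
  rename_bvar zz → zz
  have hr0 : 0 < r := by linarith only [hh, hsm, hr, p1, p2, p3, p4]
  have hsw : ‖s • w‖ = ‖w‖ := by rw [norm_smul, Real.norm_eq_abs, hs1, one_mul]
  have hAr := hA.rs (z := 0) (by simp) hr0 (δ' := 2 * h ^ 60) (by linarith only) (by
    have := hA.pos; nlinarith only [this, hr1])
  have h5 : h ^ 5 ≤ h := by simpa using hp 1 (n := 5) (by norm_num)
  rename_bvar zz → zz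
  have := hf _ _ _ hAr (by linarith only [hh, hsm, p1, p2, p3, p4, h60]) (by simpa [rsS] using h0) (s • w) (by rwa [hsw]) h (h ^ 5) hh h8
    (by positivity) (by linarith only [hsm, p1, p2, p3, p4, h5]) (by
      intro k hk1 hk4
      have k1 : (1:ℝ) ≤ k := by exact_mod_cast hk1
      have k4 : (k:ℝ) ≤ 4 := by exact_mod_cast hk4
      have hq0 : 0 < r * (k * h) := by positivity
      obtain ⟨x, hx, hxq⟩ := hfl μ S _ hA (h60.trans q2) e l hl σ (h * ρ0 / 2) (27 * C0 * h ^ 12) (h ^ 5 / 2)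
        hσ hσ1 (by positivity) (by nlinarith only [h8, hρ1, hh, hρ]) (by positivity) (by
          calc 27 * C0 * h ^ 12 = (108 * (h * C0)) * h ^ 11 / 4 := by ring
            _ ≤ 1 * h ^ 10 / 4 := by gcongr ?_ * ?_ / 4; exact hp (n := 11) 10 (by norm_num)
            _ = _ := by ring) (by
          calc h ^ 5 / 2 * C2 = h ^ 4 * (h * C2) / 2 := by ring
            _ ≤ h ^ 1 * (σ ^ 2 * ρ0) / 2 := by gcongr ?_ * ?_ / 2; exact hp (n := 4) 1 (by norm_num)
            _ = _ := by ring) hl0 hl2 hl3 (by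
          intro y hy hy2
          refine (hS y hy).trans ?_
          calc C0 * h ^ 12 * (1 + ‖y‖) ^ 3 ≤ C0 * h ^ 12 * (1 + 2) ^ 3 := by gcongr
            _ = _ := by ring) z hz hz1 hzk ((r * (k * h)) • (s • w)) (by
          rw [norm_smul, hsw, Real.norm_of_nonneg hq0.le]
          have : r * (k * h) ≤ 1 * (4 * (1 / 8)) := by gcongr
          nlinarith only [this, hq0, hw, norm_nonneg w]) (by
          have : AQ e l ((r * (k * h)) • (s • w)) = (r * (k * h)) ^ 2 * s ^ 2 * AQ e l w := by
            simp only [AQ, inner_smul_right]; ring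
          rw [this, hAw, mul_zero, abs_zero]; positivity) (by
          rw [inner_smul_right, inner_smul_right, abs_mul, abs_mul s, hs1, one_mul, abs_of_pos hq0]
          calc h * ρ0 / 2 = 1 / 2 * (1 * h) * ρ0 := by ring
            _ ≤ _ := by gcongr) (by
          rw [inner_smul_right, inner_smul_right]
          calc 0 ≤ (r * (k * h)) * (s * (⟪e 0, z⟫ * ⟪e 0, w⟫)) := by positivity
            _ = _ := by ring)
      refine ⟨r⁻¹ • x, by simpa [rsS, smul_smul, hr0.ne'] using hx, ?_⟩
      have e1 : r⁻¹ • x - (k * h) • s • w = r⁻¹ • (x - (r * (k * h)) • s • w) := by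
        rw [smul_sub, smul_smul r⁻¹ (r * _), ← mul_assoc r⁻¹ r, inv_mul_cancel₀ hr0.ne', one_mul]
      rw [e1, norm_smul, norm_inv, Real.norm_of_nonneg hr0.le, inv_mul_le_iff₀ hr0]
      nlinarith only [hxq, hr, pow_pos hh 5])
  have i2 : (fun y => ⟪s • w, y⟫ ^ 2) = fun y => ⟪w, y⟫ ^ 2 := by
    funext y; rw [inner_smul_left, conj_trivial, mul_pow, hs, one_mul]
  have i4 : (fun y => ⟪s • w, y⟫ ^ 4) = fun y => ⟪w, y⟫ ^ 4 := by
    funext y; rw [inner_smul_left, conj_trivial, mul_pow, show s ^ 4 = (s ^ 2) ^ 2 by ring, hs]; ring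
  rw [hsw, i2, i4] at this
  have hE : C1 * (h + (h ^ 5 + 2 * h ^ 60) / h ^ 4) ≤ (8 + 108 * C0 + C2 / (σ ^ 2 * ρ0) + 1 / d + 4 * C1) * h := by
    have : (h ^ 5 + 2 * h ^ 60) / h ^ 4 ≤ 3 * h := by
      rw [div_le_iff₀ (by positivity)]
      have := hp 5 (n := 60) (by norm_num)
      linarith only [this, show 3 * h * h ^ 4 = 3 * h ^ 5 by ring]
    have := mul_le_mul_of_nonneg_left this (by linarith only [hC1, hh, hsm, p1, p2, p3, p4] : 0 ≤ C1)
    linarith only [this, p1, p2, p3, hh, q1]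
  exact ⟨this.1.trans hE, this.2.trans hE⟩

def dt (a b : Fin 4 → ℝ) : ℝ := a 0 * b 0 + a 1 * b 1 + a 2 * b 2 + a 3 * b 3

lemma Hp {σ : ℝ} (hσ : 0 < σ) (hσ1 : σ ≤ 1 / 10) : ∃ c : ℝ, 0 < c ∧ c ≤ 1 / 8 ∧ ∀ l : Fin 4 → ℝ, (∀ i, |l i| ≤ 4) →
    σ ≤ l 0 → l 3 ≤ -(1 / 5) → ∃ p : Fin 4 → ℝ, (∀ w : Fin 4 → ℝ, (∀ i, |w i| ≤ c) → ∀ i, c ≤ p i + w i) ∧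
    (∀ w : Fin 4 → ℝ, (∀ i, |w i| ≤ c) → p 0 + w 0 + (p 1 + w 1) + (p 2 + w 2) + (p 3 + w 3) ≤ 1) ∧ dt l p = 0 := by
  obtain ⟨a, ha⟩ : ∃ a, a = σ / 102400 := ⟨_, rfl⟩
  refine ⟨a / 2, by rw [ha]; positivity, by linarith only [hσ, hσ1, ha], ?_⟩
  intro l hl h0 h3
  have l0 := (abs_le.1 (hl 0)).2
  have l3 := (abs_le.1 (hl 3)).1
  rename_bvar zz → zz
  have l1 := abs_le.1 (hl 1)
  have l2 := abs_le.1 (hl 2)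
  obtain ⟨D, hD⟩ : ∃ D, D = l 0 ^ 2 + l 3 ^ 2 := ⟨_, rfl⟩
  have hD0 : 1 / 25 ≤ D := by rw [hD]; nlinarith only [h3, sq_nonneg (l 0)]
  rename_bvar zz → zz
  have ha0 : 0 < a := by rw [ha]; positivity
  obtain ⟨m, hm⟩ : ∃ m, m = -(a * (l 1 + l 2)) / D := ⟨_, rfl⟩
  have hmD : m * D = -(a * (l 1 + l 2)) := by rw [hm]; field_simp
  have hm1 : |m| ≤ 200 * a := by
    rw [hm, abs_div, abs_of_pos (by linarith only [hD0] : 0 < D), div_le_iff₀ (by linarith), abs_neg, abs_mul, abs_of_pos ha0]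
    have : |l 1 + l 2| ≤ 8 := by rw [abs_le]; constructor <;> linarith only [l1, l2]
    nlinarith only [this, ha0, hD0]
  rename_bvar zz → zz
  have hx : ∀ i, |m * l i| ≤ 800 * a := by
    intro i
    rw [abs_mul]
    calc |m| * |l i| ≤ 200 * a * 4 := by gcongr; exact hl i
      _ = _ := by ring
  have x0 := abs_le.1 (hx 0)
  have x3 := abs_le.1 (hx 3)
  have hp0 : a ≤ -l 3 / 64 + m * l 0 := by linarith only [hσ1, ha, h3, ha0, x0]
  rename_bvar zz → zz
  have hp3 : a ≤ l 0 / 64 + m * l 3 := by linarith only [ha, h0, ha0, x3]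
  refine ⟨![-l 3 / 64 + m * l 0, a, a, l 0 / 64 + m * l 3], ?_, ?_, ?_⟩
  · intro w hw i
    have := (abs_le.1 (hw i)).1
    fin_cases i <;> simp at this ⊢ <;> linarith only [hσ1, ha, h3, ha0, x0, this, h0, x3]
  · intro w hw
    have h0 := (abs_le.1 (hw 0)).2
    have h1 := (abs_le.1 (hw 1)).2
    rename_bvar zz → zz
    have h2 := (abs_le.1 (hw 2)).2
    have h3 := (abs_le.1 (hw 3)).2
    simp
    linarith only [hσ1, ha, l0, l3, ha0, x0, x3, h0, h1, h2, h3]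
  · simp [dt]; rw [hD] at hmD; linear_combination hmD

lemma sgn_q {A a b c d f g η : ℝ} (h : ∀ s t r : ℝ, s ^ 2 = 1 → t ^ 2 = 1 → r ^ 2 = 1 →
    |A + 2 * (s * a + t * b + r * c + s * t * d + s * r * f + t * r * g)| ≤ η) :
    |A| ≤ η ∧ |a| ≤ η ∧ |b| ≤ η ∧ |c| ≤ η ∧ |d| ≤ η ∧ |f| ≤ η ∧ |g| ≤ η := by
  have h1 := abs_le.1 (h 1 1 1 (by norm_num) (by norm_num) (by norm_num))
  have h2 := abs_le.1 (h 1 1 (-1) (by norm_num) (by norm_num) (by norm_num))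
  have h3 := abs_le.1 (h 1 (-1) 1 (by norm_num) (by norm_num) (by norm_num))
  rename_bvar zz → zz
  have h4 := abs_le.1 (h 1 (-1) (-1) (by norm_num) (by norm_num) (by norm_num))
  have h5 := abs_le.1 (h (-1) 1 1 (by norm_num) (by norm_num) (by norm_num))
  have h6 := abs_le.1 (h (-1) 1 (-1) (by norm_num) (by norm_num) (by norm_num))
  have h7 := abs_le.1 (h (-1) (-1) 1 (by norm_num) (by norm_num) (by norm_num))
  rename_bvar zz → zz
  have h8 := abs_le.1 (h (-1) (-1) (-1) (by norm_num) (by norm_num) (by norm_num))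
  simp only [abs_le]
  refine ⟨⟨?_, ?_⟩, ⟨?_, ?_⟩, ⟨?_, ?_⟩, ⟨?_, ?_⟩, ⟨?_, ?_⟩, ⟨?_, ?_⟩, ⟨?_, ?_⟩⟩ <;> linarith only [h1, h4, h6, h7, h2, h3, h5]

lemma wl_perp (l : Fin 4 → ℝ) (i) : dt l (fun j => dt l l * (if j = i then 1 else 0) - l i * l j) = 0 := by
  fin_cases i <;> simp [dt] <;> ring

lemma dt_le {a b : Fin 4 → ℝ} {x y : ℝ} (hx : 0 ≤ x) (ha : ∀ i, |a i| ≤ x) (hb : ∀ i, |b i| ≤ y) : |dt a b| ≤ 4 * (x * y) := by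
  have : ∀ i, |a i * b i| ≤ x * y := fun i => by rw [abs_mul]; gcongr; exacts [ha i, hb i]
  have h0 := abs_le.1 (this 0)
  have h1 := abs_le.1 (this 1)
  rename_bvar zz → zz
  have h2 := abs_le.1 (this 2)
  have h3 := abs_le.1 (this 3)
  rw [dt, abs_le]; constructor <;> linarith only [h0, h1, h2, h3]

lemma wl_le {l : Fin 4 → ℝ} (hl : ∀ i, |l i| ≤ 4) (i j) : |dt l l * (if j = i then 1 else 0) - l i * l j| ≤ 80 := by
  have h1 := dt_le (by norm_num) hl hl
  have h2 : |l i * l j| ≤ 4 * 4 := by rw [abs_mul]; gcongr; exacts [hl i, hl j]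
  have h3 : |dt l l * (if j = i then 1 else 0)| ≤ 64 := by
    split_ifs
    · rw [mul_one]; linarith
    · simp
  rename_bvar zz → zz
  have := abs_sub (dt l l * (if j = i then (1:ℝ) else 0)) (l i * l j)
  linarith

lemma linhyp {c η : ℝ} (hc : 0 < c) (hη : 0 ≤ η) {l p ν : Fin 4 → ℝ} (hl : ∀ i, |l i| ≤ 4) (hl3 : l 3 ≤ -(1 / 5))
    (h : ∀ w : Fin 4 → ℝ, (∀ i, |w i| ≤ c) → dt l w = 0 → |dt ν (fun i => p i + w i)| ≤ η)
    (hν : |ν 0 + ν 1 + ν 2 + ν 3 + 1| ≤ η) (hlt : |l 0 + l 1 + l 2 + l 3 + 1| ≤ η) (hb : |dt ν l| ≤ 100) :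
    ∀ i, |ν i - l i| ≤ 100000 * (1 + 1 / c) * η := by
  obtain ⟨L, hL⟩ : ∃ L, L = dt l l := ⟨_, rfl⟩
  obtain ⟨t, ht⟩ : ∃ t, t = dt ν l := ⟨_, rfl⟩
  have hL0 : 1 / 25 ≤ L := by
    rw [hL, dt]; nlinarith only [hl3, mul_self_nonneg (l 0), mul_self_nonneg (l 1), mul_self_nonneg (l 2)]
  rename_bvar zz → zz
  have hL1 : |L| ≤ 64 := by rw [hL]; have := dt_le (by norm_num) hl hl; linarith
  have key : ∀ i, |L * ν i - l i * t| ≤ 80 / c * η := by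
    intro i
    obtain ⟨w, hw⟩ : ∃ w : Fin 4 → ℝ, w = fun j => dt l l * (if j = i then 1 else 0) - l i * l j := ⟨_, rfl⟩
    have w0 : dt l w = 0 := by rw [hw]; exact wl_perp l i
    have w1 : ∀ j, |w j| ≤ 80 := by rw [hw]; exact wl_le hl i
    rename_bvar zz → zz
    have w2 : ∀ j, |c / 80 * w j| ≤ c := by
      intro j; rw [abs_mul, abs_of_pos (by positivity)]; have := w1 j
      calc c / 80 * |w j| ≤ c / 80 * 80 := by gcongr
        _ = c := by ring
    have k1 := h (fun j => c / 80 * w j) w2 (by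
      rw [dt] at w0 ⊢; linear_combination c / 80 * w0)
    have k2 := h (fun j => -(c / 80 * w j)) (by intro j; rw [abs_neg]; exact w2 j) (by
      rw [dt] at w0 ⊢; linear_combination -(c / 80) * w0)
    have k3 : |c / 80 * dt ν w| ≤ η := by
      rw [abs_le] at k1 k2 ⊢
      simp only [dt] at k1 k2 ⊢
      constructor <;> linarith only [k1, k2]
    have k4 : dt ν w = L * ν i - l i * t := by
      rw [hw, hL, ht]; fin_cases i <;> simp [dt] <;> ring
    rw [abs_mul, abs_of_pos (by positivity), k4] at k3
    calc |L * ν i - l i * t| = c / 80 * |L * ν i - l i * t| * (80 / c) := by field_simp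
      _ ≤ η * (80 / c) := by gcongr
      _ = _ := by ring
  have hK : 0 ≤ 80 / c * η := by positivity
  have hLη : |L * (ν 0 + ν 1 + ν 2 + ν 3 + 1)| ≤ 64 * η := by rw [abs_mul]; gcongr
  rename_bvar zz → zz
  have htη : |t * (l 0 + l 1 + l 2 + l 3 + 1)| ≤ 100 * η := by rw [abs_mul, ht]; gcongr
  have htL : |t - L| ≤ 4 * (80 / c * η) + 164 * η := by
    have a0 := abs_le.1 (key 0)
    have a1 := abs_le.1 (key 1)
    have a2 := abs_le.1 (key 2)
    rename_bvar zz → zz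
    have a3 := abs_le.1 (key 3)
    rw [abs_le] at hLη htη ⊢; constructor <;> linarith only [hLη, htη, a0, a1, a2, a3]
  intro i
  have k := key i
  have k2 : |l i * (t - L)| ≤ 4 * (4 * (80 / c * η) + 164 * η) := by rw [abs_mul]; gcongr; exact hl i
  rename_bvar zz → zz
  have k3 : |L * (ν i - l i)| ≤ 17 * (80 / c * η) + 656 * η := by
    rw [abs_le] at k k2 ⊢; constructor <;> linarith only [k, k2]
  rw [abs_mul, abs_of_pos (by linarith only [hL0] : 0 < L)] at k3
  have k4 : 1 / 25 * |ν i - l i| ≤ L * |ν i - l i| := by gcongr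
  have : 100000 * (1 + 1 / c) * η = 100000 * η + 1250 * (80 / c * η) := by ring
  rw [this]; linarith only [hη, hK, k3, k4]

lemma q_vec (q : V →ₗ[ℝ] V →ₗ[ℝ] ℝ) (hs : ∀ u v, q u v = q v u) (e : OrthonormalBasis (Fin 4) ℝ V) (c : Fin 4 → ℝ) :
    q (vec e c) (vec e c) = c 0 ^ 2 * q (e 0) (e 0) + c 1 ^ 2 * q (e 1) (e 1) + c 2 ^ 2 * q (e 2) (e 2)
      + c 3 ^ 2 * q (e 3) (e 3) + 2 * (c 0 * c 1 * q (e 0) (e 1) + c 0 * c 2 * q (e 0) (e 2) + c 0 * c 3 * q (e 0) (e 3)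
      + c 1 * c 2 * q (e 1) (e 2) + c 1 * c 3 * q (e 1) (e 3) + c 2 * c 3 * q (e 2) (e 3)) := by
  simp only [vec, Fin.sum_univ_four, map_add, map_smul, LinearMap.add_apply, LinearMap.smul_apply, smul_eq_mul]
  rw [hs (e 1) (e 0), hs (e 2) (e 0), hs (e 3) (e 0), hs (e 2) (e 1), hs (e 3) (e 1), hs (e 3) (e 2)]
  ring

def sv (u : Fin 4 → ℝ) (s t r : ℝ) : Fin 4 → ℝ := ![√(u 0), s * √(u 1), t * √(u 2), r * √(u 3)]

lemma sv_prop {c : ℝ} (hc : 0 < c) (hc1 : c ≤ 1 / 8) {e l} {u : Fin 4 → ℝ} (hu : ∀ i, c ≤ u i)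
    (hu1 : u 0 + u 1 + u 2 + u 3 ≤ 1) (hl : dt l u = 0) {s t r : ℝ} (hs : s ^ 2 = 1) (ht : t ^ 2 = 1) (hr : r ^ 2 = 1) :
    ‖vec e (sv u s t r)‖ ≤ 1 ∧ AQ e l (vec e (sv u s t r)) = 0 ∧ c ≤ |⟪e 0, vec e (sv u s t r)⟫| ∧
    ‖vec e (sv u s t r)‖ ^ 2 = u 0 + u 1 + u 2 + u 3 := by
  have hq : ∀ i, √(u i) ^ 2 = u i := fun i => Real.sq_sqrt (hc.le.trans (hu i))
  have hn : ‖vec e (sv u s t r)‖ ^ 2 = u 0 + u 1 + u 2 + u 3 := by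
    rw [vec_norm]; simp [sv, mul_pow, hs, ht, hr, hq]
  refine ⟨?_, ?_, ?_, hn⟩
  · rw [← hn] at hu1
    exact (sq_le_one_iff₀ (norm_nonneg _)).1 hu1
  · rw [dt] at hl
    simp only [AQ, vec_ip]; simp [sv, mul_pow, hs, ht, hr, hq, hl]
  · rw [vec_ip, abs_of_nonneg (by simp [sv])]
    simp only [sv, Matrix.cons_val_zero]
    apply Real.le_sqrt_of_sq_le
    nlinarith only [hu 0, hc, hc1]

lemma Lin {c : ℝ} (hc : 0 < c) (hc1 : c ≤ 1 / 8) {e : OrthonormalBasis (Fin 4) ℝ V} {l p : Fin 4 → ℝ} (hl : ∀ i, |l i| ≤ 4) (hl3 : l 3 ≤ -(1 / 5))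
    (hp : ∀ w : Fin 4 → ℝ, (∀ i, |w i| ≤ c) → ∀ i, c ≤ p i + w i)
    (hp1 : ∀ w : Fin 4 → ℝ, (∀ i, |w i| ≤ c) → p 0 + w 0 + (p 1 + w 1) + (p 2 + w 2) + (p 3 + w 3) ≤ 1)
    (hp2 : dt l p = 0) {η : ℝ} (hη : η ≤ 1) (hlt : |l 0 + l 1 + l 2 + l 3 + 1| ≤ η)
    {q : V →ₗ[ℝ] V →ₗ[ℝ] ℝ} (hs : ∀ u v, q u v = q v u) (hlo : ∀ u, -‖u‖ ^ 2 ≤ q u u)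
    (hν : |q (e 0) (e 0) + q (e 1) (e 1) + q (e 2) (e 2) + q (e 3) (e 3) + 1| ≤ η)
    (h : ∀ w : V, ‖w‖ ≤ 1 → AQ e l w = 0 → c ≤ |⟪e 0, w⟫| → |q w w| ≤ η) :
    (∀ x, |q x x - AQ e l x| ≤ 500000 * (1 + 1 / c) * η * ‖x‖ ^ 2) ∧
    ∀ i, |q (e i) (e i) - l i| ≤ 500000 * (1 + 1 / c) * η := by
  have hη0 : 0 ≤ η := (abs_nonneg _).trans hlt
  have main : ∀ w : Fin 4 → ℝ, (∀ i, |w i| ≤ c) → dt l w = 0 → _ := fun w hw hw0 =>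
    sgn_q (η := η) (A := dt (fun i => q (e i) (e i)) (fun i => p i + w i))
      (a := √(p 0 + w 0) * √(p 1 + w 1) * q (e 0) (e 1)) (b := √(p 0 + w 0) * √(p 2 + w 2) * q (e 0) (e 2))
      (c := √(p 0 + w 0) * √(p 3 + w 3) * q (e 0) (e 3)) (d := √(p 1 + w 1) * √(p 2 + w 2) * q (e 1) (e 2))
      (f := √(p 1 + w 1) * √(p 3 + w 3) * q (e 1) (e 3)) (g := √(p 2 + w 2) * √(p 3 + w 3) * q (e 2) (e 3)) (by
      intro s t r ss tt rr
      have hu := hp w hw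
      obtain ⟨v1, v2, v3, -⟩ := sv_prop (e := e) hc hc1 (u := fun i => p i + w i) hu (hp1 w hw) (l := l) (by
        rw [dt] at hp2 hw0 ⊢; linear_combination hp2 + hw0) ss tt rr
      have := h _ v1 v2 v3
      rw [q_vec q hs] at this
      refine le_trans (le_of_eq ?_) this
      have hq : ∀ i, √(p i + w i) ^ 2 = p i + w i := fun i => Real.sq_sqrt (hc.le.trans (hu i))
      simp only [sv, Matrix.cons_val, mul_pow, ss, tt, rr, hq, dt]
      ring_nf)
  have hb : ∀ i, |q (e i) (e i)| ≤ 4 := by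
    have a0 := hlo (e 0)
    have a1 := hlo (e 1)
    have a2 := hlo (e 2)
    have a3 := hlo (e 3)
    simp only [OrthonormalBasis.norm_eq_one, one_pow] at a0 a1 a2 a3
    have := abs_le.1 hν
    intro i; rw [abs_le]; fin_cases i <;> constructor <;> dsimp <;> linarith only [hc, hc1, a0, hη, a1, a2, a3, this]
  rename_bvar zz → zz
  have hd := linhyp hc hη0 (ν := fun i => q (e i) (e i)) hl hl3 (p := p) (fun w hw hw0 => (main w hw hw0).1) hν hlt
    ((dt_le (by norm_num) hb hl).trans (by norm_num))
  have hz : ∀ i : Fin 4, |(fun _ => (0:ℝ) : Fin 4 → ℝ) i| ≤ c := by intro i; simp [hc.le]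
  obtain ⟨-, o1, o2, o3, o4, o5, o6⟩ := main (fun _ => 0) hz (by simp [dt])
  simp only [add_zero] at o1 o2 o3 o4 o5 o6
  have hpc : ∀ i, √c ≤ √(p i) := fun i => Real.sqrt_le_sqrt (by simpa using hp (fun _ => 0) hz i)
  rename_bvar zz → zz
  have off : ∀ i j, ∀ x : ℝ, |√(p i) * √(p j) * x| ≤ η → |x| ≤ η / c := by
    intro i j x hx
    rw [le_div_iff₀ hc]
    refine le_trans ?_ hx
    rw [abs_mul, abs_of_nonneg (show 0 ≤ √(p i) * √(p j) by positivity), mul_comm]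
    gcongr
    calc c = √c * √c := (Real.mul_self_sqrt hc.le).symm
      _ ≤ _ := mul_le_mul (hpc i) (hpc j) (by positivity) (by positivity)
  obtain ⟨K, hK⟩ : ∃ K, K = 100000 * (1 + 1 / c) * η := ⟨_, rfl⟩
  have hcK : η / c ≤ K := by
    have : K = 100000 * η + 99999 * (η / c) + η / c := by rw [hK]; ring
    have : 0 ≤ η / c := by positivity
    linarith
  have hK0 : 0 ≤ K := by rw [hK]; positivity
  rw [show 500000 * (1 + 1 / c) * η = 5 * K by rw [hK]; ring]
  rw [← hK] at hd
  refine ⟨?_, fun i => (hd i).trans (by linarith only [hK0])⟩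
  intro x
  rename_bvar zz → zz
  have hx : q x x = q (vec e fun i => ⟪e i, x⟫) (vec e fun i => ⟪e i, x⟫) := by rw [vec_self]
  rw [hx, q_vec q hs, AQ, norm_sq4 e x]
  have dg : ∀ i, |⟪e i, x⟫ ^ 2 * (q (e i) (e i) - l i)| ≤ ⟪e i, x⟫ ^ 2 * K := by
    intro i; rw [abs_mul, abs_of_nonneg (sq_nonneg _)]; gcongr; exact hd i
  have og : ∀ i j, ∀ y : ℝ, |√(p i) * √(p j) * y| ≤ η → |2 * (⟪e i, x⟫ * ⟪e j, x⟫ * y)| ≤ (⟪e i, x⟫ ^ 2 + ⟪e j, x⟫ ^ 2) * K := by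
    intro i j y hy
    have k1 : |2 * (⟪e i, x⟫ * ⟪e j, x⟫)| ≤ ⟪e i, x⟫ ^ 2 + ⟪e j, x⟫ ^ 2 := by
      rw [abs_le]; constructor <;> nlinarith only [sq_nonneg (⟪e i, x⟫ - ⟪e j, x⟫), sq_nonneg (⟪e i, x⟫ + ⟪e j, x⟫)]
    rw [show 2 * (⟪e i, x⟫ * ⟪e j, x⟫ * y) = 2 * (⟪e i, x⟫ * ⟪e j, x⟫) * y by ring, abs_mul]
    exact mul_le_mul k1 ((off i j y hy).trans hcK) (abs_nonneg _) (by positivity)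
  have d0 := abs_le.1 (dg 0)
  rename_bvar zz → zz
  have d1 := abs_le.1 (dg 1)
  have d2 := abs_le.1 (dg 2)
  have d3 := abs_le.1 (dg 3)
  have g1 := abs_le.1 (og _ _ _ o1)
  rename_bvar zz → zz
  have g2 := abs_le.1 (og _ _ _ o2)
  have g3 := abs_le.1 (og _ _ _ o3)
  have g4 := abs_le.1 (og _ _ _ o4)
  have g5 := abs_le.1 (og _ _ _ o5)
  rename_bvar zz → zz
  have g6 := abs_le.1 (og _ _ _ o6)
  have y0 : ∀ i, 0 ≤ ⟪e i, x⟫ ^ 2 * K := fun i => by positivity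
  have := y0 0
  have := y0 1
  rename_bvar zz → zz
  have := y0 2
  have := y0 3
  rw [abs_le]; constructor <;> linarith only [d0, d1, d2, d3, g1, g2, g3, g4, g5, g6]

open Matrix in
lemma quadhyp {c η : ℝ} (hc : 0 < c) {l p : Fin 4 → ℝ} (hl : ∀ i, |l i| ≤ 4) {Φ : Matrix (Fin 4) (Fin 4) ℝ} (hΦ : ∀ i j, Φ i j = Φ j i)
    (h : ∀ w : Fin 4 → ℝ, (∀ i, |w i| ≤ c) → dt l w = 0 → |(p + w) ⬝ᵥ Φ *ᵥ (p + w)| ≤ η) (i j) :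
    |dt l l ^ 2 * Φ i j - dt l l * (l j * (Φ *ᵥ l) i + l i * (Φ *ᵥ l) j) + l i * l j * (l ⬝ᵥ Φ *ᵥ l)| ≤ 25600 / c ^ 2 * η := by
  have sym : ∀ u v : Fin 4 → ℝ, u ⬝ᵥ Φ *ᵥ v = v ⬝ᵥ Φ *ᵥ u := by
    intro u v
    rw [dotProduct_comm u, ← vecMul_transpose, ← dotProduct_mulVec]
    congr 2; ext a b; exact hΦ b a
  have h1 : ∀ w : Fin 4 → ℝ, (∀ i, |w i| ≤ c) → dt l w = 0 → |w ⬝ᵥ Φ *ᵥ w| ≤ 2 * η := by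
    intro w hw hw0
    have k1 := abs_le.1 (h w hw hw0)
    have k2 := abs_le.1 (h (-w) (by simpa using hw) (by
      rw [dt] at hw0 ⊢; simp only [Pi.neg_apply]; linear_combination -hw0))
    have k3 := abs_le.1 (h 0 (by simp [hc.le]) (by simp [dt]))
    simp only [mulVec_add, mulVec_neg, mulVec_zero, dotProduct_add, add_dotProduct, neg_dotProduct, dotProduct_neg, add_zero] at k1 k2 k3
    rw [abs_le]; constructor <;> linarith
  obtain ⟨w, hw⟩ : ∃ w : Fin 4 → Fin 4 → ℝ, w = fun i j => dt l l * (if j = i then 1 else 0) - l i * l j := ⟨_, rfl⟩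
  rename_bvar zz → zz
  have w0 : ∀ i, dt l (w i) = 0 := by rw [hw]; exact wl_perp l
  have w1 : ∀ i j, |w i j| ≤ 80 := by rw [hw]; exact wl_le hl
  have h2 : ∀ s : ℝ, s ^ 2 = 1 → |(w i + s • w j) ⬝ᵥ Φ *ᵥ (w i + s • w j)| ≤ 2 * η * (160 / c) ^ 2 := by
    intro s hs
    have hs1 : |s| = 1 := by rw [← sq_eq_sq₀ (abs_nonneg s) zero_le_one, sq_abs, hs, one_pow]
    have := h1 ((c / 160) • (w i + s • w j)) (by
      intro k
      simp only [Pi.smul_apply, Pi.add_apply, smul_eq_mul]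
      rw [abs_mul, abs_of_pos (by positivity)]
      have k1 := abs_add_le (w i k) (s * w j k)
      rw [abs_mul, hs1, one_mul] at k1
      have := w1 i k
      have := w1 j k
      calc c / 160 * |w i k + s * w j k| ≤ c / 160 * 160 := by gcongr; linarith
        _ = c := by ring) (by
      have a := w0 i
      have b := w0 j
      simp only [dt, Pi.smul_apply, Pi.add_apply, smul_eq_mul] at a b ⊢
      linear_combination c / 160 * a + c / 160 * s * b)
    rw [mulVec_smul, dotProduct_smul, smul_dotProduct, smul_eq_mul, smul_eq_mul, ← mul_assoc, abs_mul, abs_of_pos (by positivity)] at this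
    calc _ = c / 160 * (c / 160) * |(w i + s • w j) ⬝ᵥ Φ *ᵥ (w i + s • w j)| * (160 / c) ^ 2 := by field_simp
      _ ≤ _ := by gcongr
  have hww : |w i ⬝ᵥ Φ *ᵥ w j| ≤ 25600 / c ^ 2 * η := by
    have k1 := abs_le.1 (h2 1 (by norm_num))
    have k2 := abs_le.1 (h2 (-1) (by norm_num))
    rw [show 25600 / c ^ 2 * η = η * (160 / c) ^ 2 by ring]
    simp only [one_smul, neg_smul, mulVec_add, mulVec_neg, dotProduct_add, add_dotProduct, neg_dotProduct, dotProduct_neg, sym (w j) (w i)] at k1 k2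
    rw [abs_le]; constructor <;> linarith only [k1, k2]
  rename_bvar zz → zz
  have hwe : ∀ i, w i = dt l l • Pi.single i 1 - l i • l := by
    intro i; rw [hw]; ext k; simp [Pi.single_apply]
  refine le_trans (le_of_eq ?_) hww
  rw [hwe, hwe]
  simp only [mulVec_sub, mulVec_smul, dotProduct_sub, sub_dotProduct, dotProduct_smul, smul_dotProduct, smul_eq_mul]
  rw [sym l (Pi.single j 1)]
  simp only [single_one_dotProduct, mulVec_single_one]
  simp only [col_apply]
  congr 1; ring

lemma G_sum {ι : Type} (s : Finset ι) {μ : Measure V} (a : ι → ℝ) (f : ι → V → ℝ)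
    (hf : ∀ i, Integrable (fun y => Real.exp (-‖y‖ ^ 2) * f i y) μ) :
    G μ (fun y => ∑ i ∈ s, a i * f i y) = ∑ i ∈ s, a i * G μ (f i) := by
  unfold G
  have : ∀ y, Real.exp (-‖y‖ ^ 2) * ∑ i ∈ s, a i * f i y = ∑ i ∈ s, a i * (Real.exp (-‖y‖ ^ 2) * f i y) := by
    intro y; rw [Finset.mul_sum]; congr 1; ext i; ring
  simp_rw [this]
  rw [integral_finset_sum s fun i _ => (hf i).const_mul (a i)]
  simp_rw [integral_const_mul]

lemma e_le (e : OrthonormalBasis (Fin 4) ℝ V) (i) (y : V) : |⟪e i, y⟫| ≤ ‖y‖ := by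
  simpa using abs_real_inner_le_norm (e i) y

lemma ee_le (e : OrthonormalBasis (Fin 4) ℝ V) (i j) (y : V) : |⟪e i, y⟫ ^ 2 * ⟪e j, y⟫ ^ 2| ≤ ‖y‖ ^ 4 := by
  have := e_le e i y
  have := e_le e j y
  rw [abs_mul, abs_pow, abs_pow]
  calc |⟪e i, y⟫| ^ 2 * |⟪e j, y⟫| ^ 2 ≤ ‖y‖ ^ 2 * ‖y‖ ^ 2 := by gcongr
    _ = _ := by ring

def mm (μ : Measure V) (e : OrthonormalBasis (Fin 4) ℝ V) (i j : Fin 4) : ℝ := G μ (fun y => ⟪e i, y⟫ ^ 2 * ⟪e j, y⟫ ^ 2)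

def PM (μ : Measure V) (e : OrthonormalBasis (Fin 4) ℝ V) : Matrix (Fin 4) (Fin 4) ℝ :=
  fun i j => (if i = j then 1 else 3) * mm μ e i j - 3 / 4 * cG

def sg : Fin 2 → ℝ := ![1, -1]

lemma sg_sq (a) : sg a ^ 2 = 1 := by fin_cases a <;> simp [sg]

lemma quart {μ S δ} (h : AU μ S δ) (hd : δ ≤ 1) (h0 : (0:V) ∈ S) (e : OrthonormalBasis (Fin 4) ℝ V) {u : Fin 4 → ℝ} (hu : ∀ i, 0 ≤ u i) {η : ℝ}
    (hq : ∀ s t r : ℝ, s ^ 2 = 1 → t ^ 2 = 1 → r ^ 2 = 1 → |2 / 3 * G μ (fun y => ⟪vec e (sv u s t r), y⟫ ^ 4) - cG * ((u 0 + u 1 + u 2 + u 3) ^ 2 / 2)| ≤ η) :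
    |u ⬝ᵥ Matrix.mulVec (PM μ e) u| ≤ 2 * η := by
  have i1 : G μ (fun y => ∑ i : Fin 2 × Fin 2 × Fin 2, 1 * ⟪vec e (sv u (sg i.1) (sg i.2.1) (sg i.2.2)), y⟫ ^ 4) =
      ∑ i : Fin 2 × Fin 2 × Fin 2, 1 * G μ (fun y => ⟪vec e (sv u (sg i.1) (sg i.2.1) (sg i.2.2)), y⟫ ^ 4) :=
    G_sum _ _ _ fun i => by simpa using in_int h hd h0 1 (vec e (sv u (sg i.1) (sg i.2.1) (sg i.2.2))) 4
  have i2 : G μ (fun y => ∑ i : Fin 4 × Fin 4, (8 * (if i.1 = i.2 then 1 else 3) * u i.1 * u i.2) * (⟪e i.1, y⟫ ^ 2 * ⟪e i.2, y⟫ ^ 2)) =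
      ∑ i : Fin 4 × Fin 4, (8 * (if i.1 = i.2 then 1 else 3) * u i.1 * u i.2) * mm μ e i.1 i.2 :=
    G_sum _ _ _ fun i => G_int h hd h0 4 (K := 1) (by fun_prop) fun y _ => by
      rw [one_mul]; exact (ee_le e _ _ y).trans (gr_poly 4 y)
  have hf : (fun y : V => ∑ i : Fin 2 × Fin 2 × Fin 2, 1 * ⟪vec e (sv u (sg i.1) (sg i.2.1) (sg i.2.2)), y⟫ ^ 4) =
      fun y => ∑ i : Fin 4 × Fin 4, (8 * (if i.1 = i.2 then 1 else 3) * u i.1 * u i.2) * (⟪e i.1, y⟫ ^ 2 * ⟪e i.2, y⟫ ^ 2) := by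
    funext y
    have hs : ∀ i, u i = √(u i) ^ 2 := fun i => (Real.sq_sqrt (hu i)).symm
    simp only [inner_vec, Fintype.sum_prod_type, Fin.sum_univ_two, Fin.sum_univ_four, sv, sg, Matrix.cons_val]
    simp only [if_true, Fin.reduceEq, if_false]
    rw [hs 0, hs 1, hs 2, hs 3]
    simp only [Real.sqrt_sq (Real.sqrt_nonneg _)]
    generalize √(u 0) = a, √(u 1) = b, √(u 2) = c, √(u 3) = d, ⟪e 0, y⟫ = x, ⟪e 1, y⟫ = z, ⟪e 2, y⟫ = v, ⟪e 3, y⟫ = w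
    ring
  rw [hf, i2] at i1
  rename_bvar zz → zz
  have hall : ∀ i : Fin 2 × Fin 2 × Fin 2, _ := fun i => abs_le.1 (hq (sg i.1) (sg i.2.1) (sg i.2.2) (sg_sq _) (sg_sq _) (sg_sq _))
  have hlo := Finset.sum_le_sum (s := Finset.univ) fun i _ => (hall i).1
  have hhi := Finset.sum_le_sum (s := Finset.univ) fun i _ => (hall i).2
  simp only [Finset.sum_sub_distrib, ← Finset.mul_sum, Finset.sum_const, Finset.card_univ, one_mul] at hlo hhi i1
  rw [← i1] at hlo hhi
  simp only [Fintype.card_prod, Fintype.card_fin, nsmul_eq_mul] at hlo hhi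
  have e1 : u ⬝ᵥ Matrix.mulVec (PM μ e) u = 1 / 8 * ∑ i : Fin 4 × Fin 4, (8 * (if i.1 = i.2 then 1 else 3) * u i.1 * u i.2) * mm μ e i.1 i.2
      - 3 / 4 * cG * (u 0 + u 1 + u 2 + u 3) ^ 2 := by
    simp only [dotProduct, Matrix.mulVec, PM, Fintype.sum_prod_type, Fin.sum_univ_four]; ring
  rw [e1, abs_le]
  push_cast at hlo hhi
  constructor <;> linarith only [hlo, hhi]

lemma ab2 {a b x y : ℝ} (h1 : |a| ≤ x) (h2 : |b| ≤ y) : |a * b| ≤ x * y := by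
  rw [abs_mul]; exact mul_le_mul h1 h2 (abs_nonneg _) ((abs_nonneg _).trans h1)

lemma caseA {u x y z K : ℝ} (hx : |x| ≤ 1 / 1000) (hyz : |y - z| ≤ 1 / 1000) (hz : z ≤ -(1 / 5)) (h1 : |u + x + y + z + 1| ≤ 1 / 1000)
    (hu : |u| ≤ 11 / 10) (hzb : |z| ≤ 11 / 10) (hK : |K| ≤ 16)
    (h2 : |u * u + x * x + y * y + z * z - 1| ≤ 1 / 1000) (hW : |8 * K * (z + u) + 30 - 4 * K| ≤ 1 / 1000)
    (hQ : |8 * K * u ^ 2 + (30 - 4 * K) * u + 3 * K - 37.5| ≤ 1 / 1000) : False := by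
  obtain ⟨a, ha⟩ : ∃ a, a = u + 1 + 2 * z := ⟨_, rfl⟩
  obtain ⟨b, hb⟩ : ∃ b, b = y - z := ⟨_, rfl⟩
  rw [← hb] at hyz
  have ha1 : |a| ≤ 3 / 1000 := by clear h2 hW hQ; rw [abs_le] at *; constructor <;> linarith only [hx, hyz, h1, ha, hb]
  rename_bvar zz → zz
  have e1 := abs_le.1 (ab2 ha1 ha1)
  have e2 := abs_le.1 (ab2 ha1 hzb)
  have e3 := abs_le.1 (ab2 hyz hyz)
  have e4 := abs_le.1 (ab2 hyz hzb)
  rename_bvar zz → zz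
  have e5 := abs_le.1 (ab2 hx hx)
  have hu' : u = a - 1 - 2 * z := by linarith only [ha, hb]
  have hy' : y = z + b := by linarith only [ha, hb]
  have h2' := abs_le.1 h2
  rw [hu', hy'] at h2'
  rename_bvar zz → zz
  have ha2 := abs_le.1 ha1
  have q : |z * (6 * z + 4)| ≤ 3 / 100 := by rw [abs_le]; constructor <;> linarith only [e1, e2, e3, e4, e5, h2', ha2]
  rw [abs_mul] at q
  have hz5 : 1 / 5 ≤ |z| := by rw [abs_of_neg (by linarith only [hz])]; linarith only [hz]
  have q2 : |6 * z + 4| ≤ 15 / 100 := by nlinarith only [q, hz5, abs_nonneg (6 * z + 4)]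
  rename_bvar zz → zz
  have q3 := abs_le.1 q2
  obtain ⟨d, hd⟩ : ∃ d, d = z + u + 1 / 3 := ⟨_, rfl⟩
  have hd1 : |d| ≤ 1 / 20 := by rw [abs_le]; constructor <;> linarith only [hd, ha, ha2, q3]
  obtain ⟨f, hf⟩ : ∃ f, f = u - 1 / 3 := ⟨_, rfl⟩
  rename_bvar zz → zz
  have hf1 : |f| ≤ 1 / 10 := by rw [abs_le]; constructor <;> linarith only [hf, ha, ha2, q3]
  have hW' := abs_le.1 hW
  have hQ' := abs_le.1 hQ
  rw [show z + u = d - 1 / 3 by linarith only [hd, hf]] at hW'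
  rw [show u = f + 1 / 3 by linarith only [hd, hf]] at hQ'
  have k1 := abs_le.1 (ab2 hK hd1)
  rename_bvar zz → zz
  have k2 := abs_le.1 (ab2 hK hf1)
  have k3 := abs_le.1 (ab2 (ab2 hf1 hf1) hK)
  have hf2 := abs_le.1 hf1
  linarith only [k1, k2, k3, hf2, hW', hQ']

lemma caseB {u x y z K : ℝ} (hx : |x - u| ≤ 1 / 1000) (hyz : |y - z| ≤ 1 / 1000) (h1 : |u + x + y + z + 1| ≤ 1 / 1000)
    (hu : |u| ≤ 11 / 10) (hzb : |z| ≤ 11 / 10) (hK : |K| ≤ 16)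
    (h2 : |u * u + x * x + y * y + z * z - 1| ≤ 1 / 1000) (hW : |8 * K * (z + u) + 30 - 4 * K| ≤ 1 / 1000)
    (hQ : |8 * K * u ^ 2 + (30 - 4 * K) * u + 3 * K - 37.5| ≤ 1 / 1000) : False := by
  obtain ⟨a, ha⟩ : ∃ a, a = u + z + 1 / 2 := ⟨_, rfl⟩
  obtain ⟨b, hb⟩ : ∃ b, b = y - z := ⟨_, rfl⟩
  obtain ⟨d, hd⟩ : ∃ d, d = x - u := ⟨_, rfl⟩
  rw [← hb] at hyz
  rw [← hd] at hx
  rename_bvar zz → zz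
  have ha1 : |a| ≤ 3 / 1000 := by clear h2 hW hQ; rw [abs_le] at *; constructor <;> linarith only [hx, hyz, h1, ha, hb, hd]
  have hz' : z = a - 1 / 2 - u := by linarith only [ha]
  have e1 := abs_le.1 (ab2 ha1 ha1)
  have e2 := abs_le.1 (ab2 ha1 hu)
  rename_bvar zz → zz
  have e3 := abs_le.1 (ab2 hyz hyz)
  have e4 := abs_le.1 (ab2 hyz hzb)
  have e5 := abs_le.1 (ab2 hx hx)
  have e6 := abs_le.1 (ab2 hx hu)
  rename_bvar zz → zz
  have h2' := abs_le.1 h2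
  rw [show x = u + d by linarith only [hd], show y = z + b by linarith only [hb]] at h2'
  have ha2 := abs_le.1 ha1
  have z2 : z * z = a * a + 1 / 4 + u * u - a - 2 * (a * u) + u := by rw [hz']; ring
  have q : |2 * (u * u) + u - 1 / 4| ≤ 3 / 100 := by rw [abs_le]; constructor <;> linarith only [e1, e2, e3, e4, e5, e6, h2', ha2, z2]
  rename_bvar zz → zz
  have hW' := abs_le.1 hW
  rw [show z + u = a - 1 / 2 by linarith only [ha]] at hW'
  have k1 := abs_le.1 (ab2 hK ha1)
  obtain ⟨f, hf⟩ : ∃ f, f = K - 15 / 4 := ⟨_, rfl⟩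
  have hf1 : |f| ≤ 1 / 10 := by rw [abs_le]; constructor <;> linarith only [hf, hW', k1]
  rename_bvar zz → zz
  have hQ' := abs_le.1 hQ
  rw [show K = f + 15 / 4 by linarith only [hf]] at hQ'
  have k2 := abs_le.1 (ab2 hf1 hu)
  have k3 := abs_le.1 (ab2 (ab2 hu hu) hf1)
  have hf2 := abs_le.1 hf1
  rename_bvar zz → zz
  have q' := abs_le.1 q
  linarith only [k2, k3, hf2, q', hQ']

lemma divb {a b s y : ℝ} (hs : 0 < s) (ha : s ≤ |a|) (h : |a * b| ≤ y) : |b| ≤ y / s := by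
  rw [le_div_iff₀ hs]; rw [abs_mul] at h
  nlinarith only [h, ha, abs_nonneg b]

lemma alg2_end {η u x y z ζ : ℝ} (hζ0 : 0 < ζ) (hζ1 : 1000000000 * ζ ≤ 1) (s0 : 1000000000 * η ≤ ζ) (hz : z ≤ -(1 / 5)) (bz : |z| ≤ 11 / 10)
    (h1 : |u + x + y + z + 1| ≤ η) (h2 : |u * u + x * x + y * y + z * z - 1| ≤ η) (hxz : |x - z| ≤ ζ / 50) (hyz : |y - z| ≤ ζ / 50) :
    |u - 1 / 2| ≤ 1000000000 * ζ ∧ |x + 1 / 2| ≤ 1000000000 * ζ ∧ |y + 1 / 2| ≤ 1000000000 * ζ ∧ |z + 1 / 2| ≤ 1000000000 * ζ := by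
  obtain ⟨a, ha⟩ : ∃ a, a = x - z := ⟨_, rfl⟩
  obtain ⟨b, hb⟩ : ∃ b, b = y - z := ⟨_, rfl⟩
  obtain ⟨d, hd⟩ : ∃ d, d = u + 1 + 3 * z := ⟨_, rfl⟩
  rename_bvar zz → zz
  have hxz' : |a| ≤ ζ / 50 := by rw [ha]; exact hxz
  have hyz' : |b| ≤ ζ / 50 := by rw [hb]; exact hyz
  have hd1 : |d| ≤ ζ / 10 := by
    clear h2
    rw [abs_le] at hxz' hyz' h1 ⊢; constructor <;> linarith only [hxz', hyz', h1, ha, hb, hd, s0, hζ0]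
  have hζs : ζ / 10 ≤ 1 := by linarith only [hζ1]
  rename_bvar zz → zz
  have e1 := abs_le.1 (ab2 hd1 (hd1.trans hζs))
  have e2 := abs_le.1 (ab2 hd1 bz)
  have e3 := abs_le.1 (ab2 hxz' (hxz'.trans (by linarith only [hζ1] : ζ / 50 ≤ 1)))
  have e4 := abs_le.1 (ab2 hxz' bz)
  rename_bvar zz → zz
  have e5 := abs_le.1 (ab2 hyz' (hyz'.trans (by linarith only [hζ1] : ζ / 50 ≤ 1)))
  have e6 := abs_le.1 (ab2 hyz' bz)
  have h2' := abs_le.1 h2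
  rw [show u = d - 1 - 3 * z by linarith only [hd, ha], show x = z + a by linarith only [hd, ha], show y = z + b by linarith only [hb]] at h2'
  have hd2 := abs_le.1 hd1
  rename_bvar zz → zz
  have q : |z * (12 * z + 6)| ≤ 3 * ζ := by rw [abs_le]; constructor <;> linarith only [e1, e2, e3, e4, e5, e6, h2', hd2, hζ0, s0]
  have q2 := abs_le.1 (divb (s := 1 / 5) (by norm_num) (by rw [abs_of_neg (by linarith only [hz])]; linarith only [hz]) q)
  have ha2 := abs_le.1 hxz'
  have hb2 := abs_le.1 hyz'
  simp only [abs_le]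
  refine ⟨⟨?_, ?_⟩, ⟨?_, ?_⟩, ⟨?_, ?_⟩, ⟨?_, ?_⟩⟩ <;> linarith only [q2, ha, hb, hd, ha2, hb2, hd2, hζ0]

lemma alg2 {σ : ℝ} (hσ : 0 < σ) (hσ1 : σ ≤ 1 / 10) : ∃ C : ℝ, 1 ≤ C ∧ ∀ η u x y z K : ℝ, 0 < η → η * C ≤ 1 → σ ≤ u → y ≤ -σ / 2 →
    z ≤ -(1 / 5) → |u + x + y + z + 1| ≤ η → |u * u + x * x + y * y + z * z - 1| ≤ η →
    (∀ t : ℝ, t = u ∨ t = x ∨ t = y ∨ t = z → |t * (8 * K * t ^ 2 + (30 - 4 * K) * t + 3 * K - 37.5)| ≤ η) →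
    |u - 1 / 2| ≤ C * η ∧ |x + 1 / 2| ≤ C * η ∧ |y + 1 / 2| ≤ C * η ∧ |z + 1 / 2| ≤ C * η := by
  obtain ⟨D, hD⟩ : ∃ D, D = 1000000000 / σ ^ 3 := ⟨_, rfl⟩
  have hD0 : 1000000000 ≤ D := by
    rw [hD, le_div_iff₀ (by positivity)]
    have : σ ^ 3 ≤ 1 := pow_le_one₀ hσ.le (by linarith)
    linarith
  refine ⟨1000000000 * D, by linarith, ?_⟩
  intro η u x y z K hη hsm hu hy hz h1 h2 hP
  obtain ⟨ζ, hζ⟩ : ∃ ζ, ζ = D * η := ⟨_, rfl⟩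
  rename_bvar zz → zz
  have hζ1 : 1000000000 * ζ ≤ 1 := by rw [hζ]; linarith
  have hζ0 : 0 < ζ := by rw [hζ]; positivity
  have s1 : 1000000000 * (η / σ) ≤ ζ := by
    rw [hζ, hD, div_mul_eq_mul_div, mul_div_assoc']
    gcongr
    calc σ ^ 3 ≤ σ ^ 1 := pow_le_pow_of_le_one hσ.le (by linarith only [hσ1]) (by norm_num)
      _ = σ := pow_one _
  have s3 : 1000000000 * (η / σ ^ 3) = ζ := by rw [hζ, hD]; ring
  rename_bvar zz → zz
  have s0 : 1000000000 * η ≤ ζ := by rw [hζ]; gcongr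
  have bd : ∀ t : ℝ, t * t ≤ u * u + x * x + y * y + z * z → |t| ≤ 11 / 10 := by
    intro t ht
    have := (abs_le.1 h2).2
    apply abs_le_of_sq_le_sq _ (by norm_num)
    linarith only [sq t, ht, this, s0, hζ1]
  have bu := bd u (by nlinarith only [mul_self_nonneg x, mul_self_nonneg y, mul_self_nonneg z])
  have bx := bd x (by nlinarith only [mul_self_nonneg u, mul_self_nonneg y, mul_self_nonneg z])
  rename_bvar zz → zz
  have by' := bd y (by nlinarith only [mul_self_nonneg x, mul_self_nonneg u, mul_self_nonneg z])
  have bz := bd z (by nlinarith only [mul_self_nonneg x, mul_self_nonneg y, mul_self_nonneg u])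
  have hQ : |8 * K * u ^ 2 + (30 - 4 * K) * u + 3 * K - 37.5| ≤ η / σ :=
    divb hσ (hu.trans (le_abs_self u)) (hP u (by simp))
  have hQ' := abs_le.1 hQ
  rename_bvar zz → zz
  have bu' := abs_le.1 bu
  have hA : 5 / 2 ≤ 8 * u ^ 2 - 4 * u + 3 := by nlinarith only [sq_nonneg (4 * u - 1)]
  have hA2 : 8 * u ^ 2 - 4 * u + 3 ≤ 13 := by nlinarith only [bu'.2, hu, hσ]
  have hKA : K * (8 * u ^ 2 - 4 * u + 3) = (8 * K * u ^ 2 + (30 - 4 * K) * u + 3 * K - 37.5) + 37.5 - 30 * u := by ring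
  rename_bvar zz → zz
  have hK0 : 3 / 10 ≤ K := by
    by_contra hc; push Not at hc
    have : K * (8 * u ^ 2 - 4 * u + 3) ≤ 3 / 10 * 13 := by
      rcases le_total 0 K with h | h
      · exact mul_le_mul hc.le hA2 (by linarith only [hA]) (by norm_num)
      · nlinarith only [h, hA]
    linarith only [this, hKA, hQ', bu', s1, hζ1]
  have hK1 : K ≤ 16 := by
    by_contra hc; push Not at hc
    have : 16 * (5 / 2) ≤ K * (8 * u ^ 2 - 4 * u + 3) := mul_le_mul hc.le hA (by norm_num) (by linarith only [hc])
    linarith only [this, hKA, hQ', hu, hσ, s1, hζ1]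
  have hKb : |K| ≤ 16 := by rw [abs_of_pos (by linarith only [hK0])]; exact hK1
  have hW : ∀ t : ℝ, t = u ∨ t = x ∨ t = y ∨ t = z → |t| ≤ 11 / 10 → |t * ((t - u) * (8 * K * (t + u) + 30 - 4 * K))| ≤ 3 * (η / σ) := by
    intro t ht ht1
    have a := abs_le.1 (hP t ht)
    have b := abs_le.1 (ab2 ht1 hQ)
    have : η ≤ η / σ := by rw [le_div_iff₀ hσ]; nlinarith only [hη, hσ1]
    rw [show t * ((t - u) * (8 * K * (t + u) + 30 - 4 * K)) = t * (8 * K * t ^ 2 + (30 - 4 * K) * t + 3 * K - 37.5)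
      - t * (8 * K * u ^ 2 + (30 - 4 * K) * u + 3 * K - 37.5) by ring, abs_le]
    rename_bvar zz → zz
    have : 0 < η / σ := by positivity
    constructor <;> linarith only [a, b, this, ‹η ≤ η / σ›]
  rename_bvar zz → zz
  have hneg : ∀ t : ℝ, t = u ∨ t = x ∨ t = y ∨ t = z → |t| ≤ 11 / 10 → t ≤ -σ / 2 → |8 * K * (t + u) + 30 - 4 * K| ≤ ζ / 10000000 := by
    intro t ht ht1 ht2
    have a := divb (s := σ / 2) (by positivity) (by rw [abs_of_neg (by linarith only [ht2, hσ, hu])]; linarith only [ht2, hσ, hu]) (hW t ht ht1)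
    have b := divb (s := σ) (by positivity) (by rw [abs_of_neg (by linarith only [ht2, hσ, hu])]; linarith only [ht2, hσ, hu]) a
    refine b.trans ?_
    rw [← s3, show 3 * (η / σ) / (σ / 2) / σ = 6 * (η / σ ^ 3) by field_simp; norm_num]
    have : 0 ≤ η / σ ^ 3 := by positivity
    linarith only [this]
  have wy := hneg y (by simp) by' hy
  have wz := hneg z (by simp) bz (by linarith only [hz, hσ1])
  have hdiff : ∀ t : ℝ, ∀ ξ, |8 * K * (t + u) + 30 - 4 * K| ≤ ξ → |t - z| ≤ ξ + ζ / 10000000 := by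
    intro t ξ ht
    have : |(8 * K) * (t - z)| ≤ ξ + ζ / 10000000 := by
      rw [abs_le] at ht wz ⊢; constructor <;> linarith only [ht, wz]
    have h := divb (s := 1) one_pos (by rw [abs_of_pos (by linarith only [hK0])]; linarith only [hK0]) this
    simpa using h
  rename_bvar zz → zz
  have hyz := hdiff y _ wy
  have hη1 : η ≤ 1 / 1000 := by linarith only [s0, hζ1]
  have hη2 : ζ / 10000000 ≤ 1 / 1000 := by linarith only [hζ1]
  have hη3 : η / σ ≤ 1 / 1000 := by linarith only [s1, hζ1]
  by_cases c1 : |x| ≤ 1 / 1000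
  · exact (caseA (y := y) c1 (by linarith only [hyz, hζ1]) hz (h1.trans hη1) bu bz hKb (h2.trans hη1) (wz.trans hη2) (hQ.trans hη3)).elim
  by_cases c2 : |x - u| ≤ 1 / 1000
  · exact (caseB (y := y) c2 (by linarith only [hyz, hζ1]) (h1.trans hη1) bu bz hKb (h2.trans hη1) (wz.trans hη2) (hQ.trans hη3)).elim
  push Not at c1 c2
  rename_bvar zz → zz
  have wx := divb (by norm_num) c2.le (divb (by norm_num) c1.le (hW x (by simp) bx))
  have wx2 : |8 * K * (x + u) + 30 - 4 * K| ≤ ζ / 100 := by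
    refine wx.trans ?_
    rw [show 3 * (η / σ) / (1 / 1000) / (1 / 1000) = 3000000 * (η / σ) by ring]
    linarith only [s1, hζ0]
  have hxz := hdiff x _ wx2
  rw [show 1000000000 * D * η = 1000000000 * ζ by rw [hζ]; ring]
  exact alg2_end hζ0 hζ1 s0 hz bz h1 h2 (by linarith only [hxz, hζ0]) (by linarith only [hyz, hζ0])

lemma ab4 {f : Fin 4 → ℝ} {x : ℝ} (h : ∀ i, |f i| ≤ x) : |∑ i, f i| ≤ 4 * x :=
  (Finset.abs_sum_le_sum_abs _ _).trans ((Finset.sum_le_sum fun i _ => h i).trans (by simp))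

lemma ad2 {a b x y : ℝ} (h1 : |a| ≤ x) (h2 : |b| ≤ y) : |a + b| ≤ x + y := (abs_add_le a b).trans (add_le_add h1 h2)

lemma su2 {a b x y : ℝ} (h1 : |a| ≤ x) (h2 : |b| ≤ y) : |a - b| ≤ x + y := (abs_sub a b).trans (add_le_add h1 h2)

lemma alg1 {σ B : ℝ} (hσ : 0 < σ) (hσ1 : σ ≤ 1 / 10) (hB : 1 ≤ B) : ∃ C : ℝ, 1 ≤ C ∧ ∀ (η : ℝ) (l : Fin 4 → ℝ) (m Φ : Fin 4 → Fin 4 → ℝ), 0 < η → η * C ≤ 1 →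
    (∀ i, |l i| ≤ 4) → σ ≤ l 0 → l 2 ≤ -σ / 2 → l 3 ≤ -(1 / 5) → (∀ i j, |Φ i j| ≤ B) →
    (∀ i j, 3 * m i j = Φ i j + 3 / 4 + if i = j then 2 * (Φ i i + 3 / 4) else 0) →
    |∑ i, l i + 1| ≤ η → |∑ i, l i * l i - 1| ≤ η →
    (∀ i, |∑ j, m i j - 5 / 4 * (1 + l i)| ≤ η) → (∀ i, |∑ j, l j * m i j| ≤ η) →
    (∀ i j, |(∑ i, l i * l i) ^ 2 * Φ i j - (∑ i, l i * l i) * (l j * (∑ k, Φ i k * l k) + l i * (∑ k, Φ j k * l k))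
      + l i * l j * (∑ k, l k * ∑ n, Φ k n * l n)| ≤ η) →
    |l 0 - 1 / 2| ≤ C * η ∧ |l 1 + 1 / 2| ≤ C * η ∧ |l 2 + 1 / 2| ≤ C * η ∧ |l 3 + 1 / 2| ≤ C * η := by
  obtain ⟨C2, hC2, H⟩ := alg2 hσ hσ1
  have hCB : 1 ≤ B * C2 := by nlinarith only [hB, hC2]
  refine ⟨2300000 * B * C2, by linarith, ?_⟩
  intro η l m Φ hη hsm hl h0 h2 h3 hΦ hm S1 S2 R1 R2 R3
  obtain ⟨L, hL⟩ : ∃ L, L = ∑ i, l i * l i := ⟨_, rfl⟩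
  rename_bvar zz → zz
  obtain ⟨F, hF⟩ : ∃ F : Fin 4 → ℝ, F = fun i => ∑ k, Φ i k * l k := ⟨_, rfl⟩
  obtain ⟨f, hf⟩ : ∃ f, f = ∑ k, l k * F k := ⟨_, rfl⟩
  obtain ⟨b, hb⟩ : ∃ b : Fin 4 → ℝ, b = fun i => 2 * F i - f * l i := ⟨_, rfl⟩
  obtain ⟨ρ, hρ⟩ : ∃ ρ : Fin 4 → Fin 4 → ℝ, ρ = fun i j => Φ i j - (l i * b j + l j * b i) / 2 := ⟨_, rfl⟩
  rename_bvar zz → zz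
  have hη1 : η ≤ 1 := by nlinarith only [hη, hsm, hCB]
  have Fb : ∀ i, |F i| ≤ 16 * B := fun i => by
    rw [hF]; exact (ab4 fun k => ab2 (hΦ i k) (hl k)).trans (by linarith only)
  have fb : |f| ≤ 256 * B := by
    rw [hf]; exact (ab4 fun k => ab2 (hl k) (Fb k)).trans (by linarith only)
  have bb : ∀ i, |b i| ≤ 1100 * B := fun i => by
    rw [hb]
    exact (su2 (ab2 (by norm_num : |(2:ℝ)| ≤ 2) (Fb i)) (ab2 fb (hl i))).trans (by linarith only [hB])
  rw [← hL] at S2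
  rename_bvar zz → zz
  have ρb : ∀ i j, |ρ i j| ≤ 132 * B * η := by
    intro i j
    have r := R3 i j
    rw [← hL, show (∑ k, l k * ∑ n, Φ k n * l n) = f by rw [hf, hF], show (∑ k, Φ i k * l k) = F i by rw [hF],
      show (∑ k, Φ j k * l k) = F j by rw [hF]] at r
    have : ρ i j = ((L ^ 2 * Φ i j - L * (l j * F i + l i * F j) + l i * l j * f) - (L - 1) * ((L + 1) * Φ i j)) + (L - 1) * (l j * F i + l i * F j) := by
      rw [hρ, hb]; ring
    rw [this]
    have hL1 : |L + 1| ≤ 3 := by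
      rw [abs_le] at S2 ⊢; constructor <;> linarith only [S2, hη1]
    refine (ad2 (su2 r (ab2 S2 (ab2 hL1 (hΦ i j)))) (ab2 S2 (ad2 (ab2 (hl j) (Fb i)) (ab2 (hl i) (Fb j))))).trans ?_
    nlinarith only [hB, hη]
  have hΦρ : ∀ i j, Φ i j = (l i * b j + l j * b i) / 2 + ρ i j := fun i j => by rw [hρ]; ring
  obtain ⟨s, hs⟩ : ∃ s, s = ∑ i, l i := ⟨_, rfl⟩
  obtain ⟨β, hβ⟩ : ∃ β, β = ∑ i, b i := ⟨_, rfl⟩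
  rename_bvar zz → zz
  obtain ⟨t, ht⟩ : ∃ t, t = ∑ i, l i * b i := ⟨_, rfl⟩
  obtain ⟨K, hK⟩ : ∃ K, K = 15 - 2 * β := ⟨_, rfl⟩
  have βb : |β| ≤ 4 * (1100 * B) := by rw [hβ]; exact ab4 bb
  have Kb : |K| ≤ 9000 * B := by
    rw [hK]; exact (su2 (by norm_num : |(15:ℝ)| ≤ 15) (ab2 (by norm_num : |(2:ℝ)| ≤ 2) βb)).trans (by linarith only [hB])
  rw [← hs] at S1
  rename_bvar zz → zz
  have e1 : ∀ i, |b i * (8 * l i - 2) - K * l i + 3| ≤ 5400 * B * η := by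
    intro i
    have h3m : 3 * ∑ j, m i j = (∑ j, Φ i j) + 3 + 2 * (Φ i i + 3 / 4) := by
      rw [Finset.mul_sum]; simp only [hm, Finset.sum_add_distrib, Finset.sum_ite_eq, Finset.mem_univ, if_true]; norm_num
    have hs1 : ∑ j, Φ i j = (l i * β + s * b i) / 2 + ∑ j, ρ i j := by
      rw [hβ, hs]; simp only [hΦρ, Finset.sum_add_distrib, Finset.mul_sum, Finset.sum_mul, ← Finset.sum_div]
    have : b i * (8 * l i - 2) - K * l i + 3 = 12 * (∑ j, m i j - 5 / 4 * (1 + l i)) - (2 * (b i * (s + 1)) + 4 * ∑ j, ρ i j + 8 * ρ i i) := by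
      rw [hK]; rw [hs1, hΦρ i i] at h3m; linarith only [h3m]
    rw [this]
    refine (su2 (ab2 (by norm_num : |(12:ℝ)| ≤ 12) (R1 i)) (ad2 (ad2 (ab2 (by norm_num : |(2:ℝ)| ≤ 2) (ab2 (bb i) S1))
      (ab2 (by norm_num : |(4:ℝ)| ≤ 4) (ab4 (ρb i)))) (ab2 (by norm_num : |(8:ℝ)| ≤ 8) (ρb i i)))).trans ?_
    nlinarith only [hB, hη]
  have e2 : ∀ i, |b i * (8 * l i ^ 2 + 2) - 3 + (6 + 2 * t) * l i| ≤ 15000 * B * η := by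
    intro i
    have h3m : 3 * ∑ j, l j * m i j = (∑ j, l j * Φ i j) + 3 / 4 * s + l i * (2 * (Φ i i + 3 / 4)) := by
      rw [Finset.mul_sum, hs, Finset.mul_sum]
      simp only [mul_left_comm (3:ℝ), hm, mul_add, Finset.sum_add_distrib, mul_ite, mul_zero, Finset.sum_ite_eq, Finset.mem_univ, if_true]
      simp only [mul_comm (3 / 4 : ℝ)]
    have hs1 : ∑ j, l j * Φ i j = (l i * t + b i * L) / 2 + ∑ j, l j * ρ i j := by
      rw [ht, hL]; simp only [hΦρ, Finset.mul_sum, ← Finset.sum_add_distrib, Finset.sum_div]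
      exact Finset.sum_congr rfl fun j _ => by ring
    have : b i * (8 * l i ^ 2 + 2) - 3 + (6 + 2 * t) * l i = 12 * (∑ j, l j * m i j) -
        (2 * (b i * (L - 1)) + 4 * ∑ j, l j * ρ i j + 3 * (s + 1) + 8 * (l i * ρ i i)) := by
      rw [hs1, hΦρ i i] at h3m; linarith only [h3m]
    rw [this]
    refine (su2 (ab2 (by norm_num : |(12:ℝ)| ≤ 12) (R2 i)) (ad2 (ad2 (ad2 (ab2 (by norm_num : |(2:ℝ)| ≤ 2) (ab2 (bb i) S2))
      (ab2 (by norm_num : |(4:ℝ)| ≤ 4) (ab4 fun j => ab2 (hl j) (ρb i j)))) (ab2 (by norm_num : |(3:ℝ)| ≤ 3) S1))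
      (ab2 (by norm_num : |(8:ℝ)| ≤ 8) (ab2 (hl i) (ρb i i))))).trans ?_
    nlinarith only [hB, hη]
  have e3 : |8 * t + 2 * K - 3| ≤ 31000 * B * η := by
    have : 8 * t + 2 * K - 3 = ∑ i, (b i * (8 * l i - 2) - K * l i + 3) + K * (s + 1) := by
      rw [ht, hK, hs, hβ]; simp only [Fin.sum_univ_four]; ring
    rw [this]
    refine (ad2 (ab4 e1) (ab2 Kb S1)).trans ?_
    nlinarith only [hB, hη]
  have hP : ∀ i, |l i * (8 * K * l i ^ 2 + (30 - 4 * K) * l i + 3 * K - 37.5)| ≤ 2300000 * B * η := by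
    intro i
    have : l i * (8 * K * l i ^ 2 + (30 - 4 * K) * l i + 3 * K - 37.5) =
        (b i * (8 * l i ^ 2 + 2) - 3 + (6 + 2 * t) * l i) * (8 * l i - 2) - (b i * (8 * l i - 2) - K * l i + 3) * (8 * (l i * l i) + 2)
        - (8 * t + 2 * K - 3) * (1 / 4 * (l i * (8 * l i - 2))) := by ring
    rw [this]
    have h8 := su2 (ab2 (by norm_num : |(8:ℝ)| ≤ 8) (hl i)) (by norm_num : |(2:ℝ)| ≤ 2)
    refine (su2 (su2 (ab2 (e2 i) h8) (ab2 (e1 i) (ad2 (ab2 (by norm_num : |(8:ℝ)| ≤ 8) (ab2 (hl i) (hl i))) (by norm_num : |(2:ℝ)| ≤ 2))))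
      (ab2 e3 (ab2 (abs_of_pos (by norm_num : (0:ℝ) < 1 / 4)).le (ab2 (hl i) h8)))).trans ?_
    nlinarith only [hB, hη]
  rename_bvar zz → zz
  have hBη : η ≤ 2300000 * B * η := by nlinarith only [hB, hη]
  have fin := H (2300000 * B * η) (l 0) (l 1) (l 2) (l 3) K (by positivity) (by linarith only [hsm]) h0 h2 h3
    (by rw [hs, Fin.sum_univ_four] at S1; exact S1.trans hBη) (by rw [hL, Fin.sum_univ_four] at S2; exact S2.trans hBη)
    (by rintro _ (rfl | rfl | rfl | rfl) <;> apply hP)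
  rw [show C2 * (2300000 * B * η) = 2300000 * B * C2 * η by ring] at fin
  exact fin

lemma rs_one (μ : Measure V) : rs μ 0 1 = μ := by simp [rs]

lemma SA {ε1 : ℝ} (h1 : 0 < ε1) (h1' : ε1 ≤ 1) : ∃ C σ : ℝ, 1 ≤ C ∧ 0 < σ ∧ σ ≤ 1 / 10 ∧ ∀ g : ℝ, 0 < g → g * C ≤ 1 → ∀ μ S, AU μ S (g ^ 120) →
    0 ∈ S → (∀ t, g ^ 24 ≤ t → t ≤ 1 → ¬ Fl S t ε1) → ∃ e l, (∀ i, |l i| ≤ 4) ∧ σ ≤ l 0 ∧ l 2 ≤ -σ / 2 ∧ l 3 ≤ -(1 / 5) ∧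
    |l 0 + l 1 + l 2 + l 3 + 1| ≤ C * g ^ 2 ∧ (∀ y ∈ S, |AQ e l y| ≤ C * g ^ 2 * (1 + ‖y‖) ^ 3) ∧
    (∀ r : ℝ, 1 / 2 ≤ r → r ≤ 1 → ∀ b q, GD (rs μ 0 r) b q → ∀ x, |q x x - AQ e l x| ≤ C * g ^ 2 * ‖x‖ ^ 2) ∧
    ∀ i j, |dt l l ^ 2 * PM μ e i j - dt l l * (l j * Matrix.mulVec (PM μ e) l i + l i * Matrix.mulVec (PM μ e) l j) +
      l i * l j * l ⬝ᵥ Matrix.mulVec (PM μ e) l| ≤ C * g ^ 2 := by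
  obtain ⟨C0, σ, hC0, hσ, hσ1, HQ⟩ := Quad h1 h1'
  obtain ⟨c, hc, hc8, HH⟩ := Hp hσ hσ1
  obtain ⟨CM, hCM, HM⟩ := Mom (C0 := C0) hσ (by linarith only [hσ, hσ1]) hc (by linarith) hC0
  rename_bvar zz → zz
  obtain ⟨CP, hCP, HP⟩ := P_lemma
  have hcG := cG_pos
  obtain ⟨K, hK⟩ : ∃ K, K = C0 + 2 * CP + CM / cG := ⟨_, rfl⟩
  have kq : 0 < CM / cG := by positivity
  rename_bvar zz → zz
  have k1 : C0 ≤ K := by rw [hK]; linarith only [hCP, kq]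
  have k2 : 2 * CP ≤ K := by rw [hK]; linarith only [hC0, kq]
  have k3 : CM / cG ≤ K := by rw [hK]; linarith only [hC0, hCP]
  have hK0 : 0 < K := by linarith only [hC0, k1]
  rename_bvar zz → zz
  have hcc : 0 < 1 / c := by positivity
  have t1 : 0 < 500000 * (1 + 1 / c) * K := by positivity
  have t2 : 0 < 25600 / c ^ 2 * (2 * CM) := by positivity
  refine ⟨CM + C0 + K + 500000 * (1 + 1 / c) * K + 25600 / c ^ 2 * (2 * CM), σ, by linarith only [hC0, hK0, t1, t2, hCM], hσ, hσ1, ?_⟩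
  intro g hg hsm μ S hA h0 hnf
  have hg1 : g ≤ 1 := by nlinarith only [hg, hsm, hC0, hK0, t1, t2, hCM]
  rename_bvar zz → zz
  have gM : g * CM ≤ 1 := by nlinarith only [hg, hsm, hC0, hK0, t1, t2, hCM]
  have gQ : g * C0 ≤ 1 := by nlinarith only [hg, hsm, hC0, hK0, t1, t2, hCM]
  have gK : g * K ≤ 1 := by nlinarith only [hg, hsm, hC0, hK0, t1, t2, hCM]
  have hp : ∀ {n : ℕ} (m : ℕ), m ≤ n → g ^ n ≤ g ^ m := fun m hm => pow_le_pow_of_le_one hg.le hg1 hm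
  rename_bvar zz → zz
  have g24 : g ^ 24 ≤ g := by simpa using hp 1 (n := 24) (by norm_num)
  have g2 : g ^ 2 ≤ g := by simpa using hp 1 (n := 2) (by norm_num)
  have g242 := hp 2 (n := 24) (by norm_num)
  have g1202 := hp 2 (n := 120) (by norm_num)
  rename_bvar zz → zz
  have hC0' : (0:ℝ) ≤ C0 := by linarith only [hC0]
  have hη1 : K * g ^ 2 ≤ 1 := by nlinarith only [gK, g2, hK0]
  obtain ⟨e, l, hl, hl0, hl2, hl3, hlt, hS⟩ := HQ (g ^ 24) (by positivity) (by nlinarith only [g24, gQ, hC0'])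
    μ S (by rwa [← pow_mul]) h0 hnf
  obtain ⟨p, hp1, hp2, hp3⟩ := HH l hl hl0 hl3
  rename_bvar zz → zz
  have HM' := HM (g ^ 2) (by positivity) (by nlinarith only [g2, gM, hCM]) μ S (by rwa [← pow_mul]) h0 e l hl hl0 hl2
    (by linarith only [hl3, hσ1]) (by rwa [← pow_mul])
  have hg2 : 0 < g ^ 2 := by positivity
  have g242' : C0 * g ^ 24 ≤ C0 * g ^ 2 := by gcongr
  refine ⟨e, l, hl, hl0, hl2, hl3, hlt.trans (by nlinarith only [g242', hg2, hK0, t1, t2, hCM]), ?_, ?_, ?_⟩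
  · intro y hy
    refine (hS y hy).trans ?_
    gcongr
    nlinarith only [g242', hg2, hK0, t1, t2, hCM]
  · intro r hr hr1 b q hq x
    have hAr := hA.rs (z := 0) (by simp) (r := r) (by linarith only [hr]) (δ' := 2 * g ^ 120) (by linarith only) (by
      have := hA.pos; nlinarith only [this, hr1])
    have gK2 : g ^ 120 ≤ 1 / 2 := by
      have := hp 2 (n := 120) (by norm_num)
      have h2 : 2 * (g ^ 120) ≤ 2 * g ^ 2 := by linarith only [this]
      by_contra hc
      have b1 : g ^ 2 * K ≤ 1 := by linarith only [hη1]
      have b2 : 500000 * (1 + 1 / c) * K * g ≤ 1 := by nlinarith only [hg, hsm, hC0, hK0, t1, t2, hCM]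
      have b3 : 500000 ≤ 500000 * (1 + 1 / c) * K := by nlinarith only [hcc, hC0, k1]
      nlinarith only [b2, b3, hg, this, g2, hc]
    obtain ⟨-, hν, hlo, -, -⟩ := HP _ _ _ hAr (by linarith only [gK2]) (by simpa [rsS] using h0) b q hq
    rename_bvar zz → zz
    have hν' := hν e
    rw [Fin.sum_univ_four] at hν'
    have := (Lin hc hc8 hl hl3 hp1 hp2 hp3 hη1 (hlt.trans (g242'.trans (by gcongr))) hq.symm hlo
      (hν'.trans (by nlinarith only [g1202, k2, hCP, hg2])) (by
        intro w hw hAw hw0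
        have := (HM' w hw hAw hw0 r hr hr1).1
        have e1 := hq.qeq w w
        simp only [← sq] at e1
        rw [← e1, real_inner_self_eq_norm_sq, mul_add, add_sub_cancel_right, abs_mul, abs_of_pos hcG] at this
        have h2 : |q w w| ≤ CM / cG * g ^ 2 := by
          rw [div_mul_eq_mul_div, le_div_iff₀ hcG]; linarith only [this]
        exact h2.trans (by gcongr))).1 x
    refine this.trans (mul_le_mul_of_nonneg_right ?_ (by positivity))
    nlinarith only [hg2, hK0, t1, t2, hCM, hC0]
  · intro i j
    have := quadhyp (η := 2 * (CM * g ^ 2)) hc (p := p) hl (Φ := PM μ e) (by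
        intro i j; simp only [PM, mm, eq_comm (a := i), mul_comm (⟪e i, _⟫ ^ 2)]) (by
        intro w hw hlw
        have hpw : dt l (p + w) = 0 := by
          have : dt l (p + w) = dt l p + dt l w := by simp only [dt, Pi.add_apply]; ring
          rw [this, hp3, hlw, add_zero]
        have hu : ∀ i, c ≤ (p + w) i := fun i => hp1 w hw i
        refine quart hA (by linarith only [g1202, g2, hg1]) h0 e (fun i => hc.le.trans (hu i)) ?_
        intro s t r hs ht hr
        obtain ⟨a1, a2, a3, a4⟩ := sv_prop hc hc8 (e := e) hu (hp2 w hw) hpw hs ht hr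
        have := (HM' _ a1 a2 a3 1 (by norm_num) le_rfl).2
        rw [rs_one, show ∀ a : ℝ, a ^ 4 = (a ^ 2) ^ 2 from fun a => by ring, a4] at this
        exact this) i j
    refine this.trans ?_
    nlinarith only [hg2, hK0, t1, t2, hCM, hC0]

lemma exp_tay {x : ℝ} (hx : 0 ≤ x) : |Real.exp (-x) - 1 + x| ≤ x ^ 2 := by
  rcases le_total x 1 with h | h
  · have := Real.abs_exp_sub_one_sub_id_le (x := -x) (by rwa [abs_neg, abs_of_nonneg hx])
    rwa [sub_neg_eq_add, neg_sq] at this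
  · have a := Real.add_one_le_exp (-x)
    have b : Real.exp (-x) ≤ 1 := Real.exp_le_one_iff.2 (by linarith)
    rw [abs_le]; constructor <;> nlinarith only [a, b, h]

lemma rs_G (μ : Measure V) {r : ℝ} (hr : 0 < r) (u : V) :
    r ^ 5 * G (rs μ 0 r) (fun y => ⟪u, y⟫ ^ 2) = G μ (fun y => Real.exp (-((1 / r ^ 2 - 1) * ‖y‖ ^ 2)) * ⟪u, y⟫ ^ 2) := by
  have he : MeasurableEmbedding (fun y : V => r⁻¹ • (y - 0)) := by
    simp only [sub_zero]
    exact (Homeomorph.smulOfNeZero r⁻¹ (inv_ne_zero hr.ne')).measurableEmbedding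
  unfold G rs
  rw [integral_smul_measure, he.integral_map, ENNReal.toReal_ofReal (by positivity), smul_eq_mul, ← mul_assoc, ← integral_const_mul]
  congr 1; funext y
  beta_reduce
  rw [sub_zero, norm_smul, inner_smul_right, norm_inv, Real.norm_of_nonneg hr.le, ← mul_assoc (Real.exp _), ← Real.exp_add,
    show -‖y‖ ^ 2 + -((1 / r ^ 2 - 1) * ‖y‖ ^ 2) = -(r⁻¹ * ‖y‖) ^ 2 by field_simp; ring]
  field_simp

lemma Mfour : ∃ C : ℝ, 1 ≤ C ∧ ∀ μ S δ, AU μ S δ → δ ≤ 1 → 0 ∈ S → ∀ u : V, ‖u‖ = 1 →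
    |G μ (fun y => ‖y‖ ^ 2 * ⟪u, y⟫ ^ 2)| ≤ C ∧ ∀ r : ℝ, 1 / 2 ≤ r → r ≤ 1 →
    |r ^ 5 * G (rs μ 0 r) (fun y => ⟪u, y⟫ ^ 2) - G μ (fun y => ⟪u, y⟫ ^ 2) + (1 / r ^ 2 - 1) * G μ (fun y => ‖y‖ ^ 2 * ⟪u, y⟫ ^ 2)|
      ≤ C * (1 / r ^ 2 - 1) ^ 2 := by
  obtain ⟨C4, h4, H4⟩ := G_bd 4
  obtain ⟨C6, h6, H6⟩ := G_bd 6
  refine ⟨1 + C4 + C6, by linarith, fun μ S δ h hd h0 u hu => ?_⟩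
  have ip : ∀ y : V, ⟪u, y⟫ ^ 2 ≤ ‖y‖ ^ 2 := fun y => by
    rw [← sq_abs]; exact pow_le_pow_left₀ (abs_nonneg _) ((abs_real_inner_le_norm u y).trans (by rw [hu, one_mul])) 2
  rename_bvar zz → zz
  obtain ⟨i4, b4⟩ := H4 μ S δ h hd h0 (fun y => ‖y‖ ^ 2 * ⟪u, y⟫ ^ 2) (by fun_prop) 1 zero_le_one (fun y _ => by
    rw [one_mul, abs_of_nonneg (by positivity)]
    refine le_trans ?_ (gr_poly 4 y)
    calc ‖y‖ ^ 2 * ⟪u, y⟫ ^ 2 ≤ ‖y‖ ^ 2 * ‖y‖ ^ 2 := mul_le_mul_of_nonneg_left (ip y) (by positivity)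
      _ = _ := by ring)
  refine ⟨by linarith, fun r hr hr1 => ?_⟩
  have hr0 : 0 < r := by linarith
  rw [rs_G μ hr0]
  obtain ⟨s, hs⟩ : ∃ s, s = 1 / r ^ 2 - 1 := ⟨_, rfl⟩
  have hs0 : 0 ≤ s := by
    rw [hs, sub_nonneg, le_div_iff₀ (by positivity)]; nlinarith only [hr0, hr1]
  rw [← hs]
  rename_bvar zz → zz
  have i2 : Integrable (fun y => Real.exp (-‖y‖ ^ 2) * ⟪u, y⟫ ^ 2) μ := by simpa using in_int h hd h0 1 u 2
  obtain ⟨i6, b6⟩ := H6 μ S δ h hd h0 (fun y => (Real.exp (-(s * ‖y‖ ^ 2)) * ⟪u, y⟫ ^ 2 - ⟪u, y⟫ ^ 2) + s * (‖y‖ ^ 2 * ⟪u, y⟫ ^ 2))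
    (by fun_prop) (s ^ 2) (by positivity) (fun y _ => by
      have e1 : (Real.exp (-(s * ‖y‖ ^ 2)) * ⟪u, y⟫ ^ 2 - ⟪u, y⟫ ^ 2) + s * (‖y‖ ^ 2 * ⟪u, y⟫ ^ 2)
        = (Real.exp (-(s * ‖y‖ ^ 2)) - 1 + s * ‖y‖ ^ 2) * ⟪u, y⟫ ^ 2 := by ring
      rw [e1, abs_mul, abs_of_nonneg (sq_nonneg ⟪u, y⟫)]
      calc _ ≤ (s * ‖y‖ ^ 2) ^ 2 * ‖y‖ ^ 2 := mul_le_mul (exp_tay (by positivity)) (ip y) (by positivity) (by positivity)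
        _ = s ^ 2 * ‖y‖ ^ 6 := by ring
        _ ≤ _ := by gcongr; exact gr_poly 6 y)
  have ie : Integrable (fun y => Real.exp (-‖y‖ ^ 2) * (Real.exp (-(s * ‖y‖ ^ 2)) * ⟪u, y⟫ ^ 2)) μ :=
    G_int h hd h0 2 (K := 1) (by fun_prop) fun y _ => by
      rw [one_mul, abs_of_nonneg (by positivity)]
      refine le_trans ?_ (gr_poly 2 y)
      calc _ ≤ 1 * ‖y‖ ^ 2 := mul_le_mul (Real.exp_le_one_iff.2 (by have := sq_nonneg ‖y‖; nlinarith only [this, hs0])) (ip y) (by positivity) zero_le_one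
        _ = _ := one_mul _
  rw [G_add (by simp only [mul_sub]; exact ie.sub i2) (by simpa only [mul_left_comm _ s] using i4.const_mul s), G_sub ie i2, G_smul] at b6
  refine b6.trans (mul_le_mul_of_nonneg_right (by linarith) (by positivity))

lemma step9 {g T A Ar M C : ℝ} (hC : 1 ≤ C) (hg : 0 < g) (hg1 : g ≤ 1 / 100) (hT : |T| ≤ C) (hA : |A - T| ≤ C * g ^ 2) (hAr : |Ar - T| ≤ C * g ^ 2)
    (hM : |M| ≤ C) (h : |(1 - g) ^ 5 * Ar - A + (1 / (1 - g) ^ 2 - 1) * M| ≤ C * (1 / (1 - g) ^ 2 - 1) ^ 2) : |M - 5 / 2 * T| ≤ 100 * C * g := by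
  obtain ⟨s, hs⟩ : ∃ s, s = 1 / (1 - g) ^ 2 - 1 := ⟨_, rfl⟩
  rw [← hs] at h
  have hg2 : 0 < g ^ 2 := by positivity
  have hr : (0:ℝ) < (1 - g) ^ 2 := by have : 0 < 1 - g := by linarith
                                      positivity
  rename_bvar zz → zz
  have hs2 : s * (1 - g) ^ 2 = 2 * g - g ^ 2 := by rw [hs, sub_mul, div_mul_cancel₀ _ hr.ne']; ring
  have hslo : 2 * g ≤ s := by
    by_contra hc; push Not at hc
    nlinarith only [hs2, hc, hr, hg, hg1]
  have hshi : s ≤ 2 * g + 5 * g ^ 2 := by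
    by_contra hc; push Not at hc
    have := mul_lt_mul_of_pos_right hc hr
    nlinarith only [hs2, this, hg, hg1, hg2]
  have hs3 : s ≤ 3 * g := by nlinarith only [hshi, hg, hg1]
  rename_bvar zz → zz
  have hss : s ^ 2 ≤ 9 * g ^ 2 := by nlinarith only [hs3, hslo, hg]
  have r5 : |(1 - g) ^ 5 - (1 - 5 * g)| ≤ 11 * g ^ 2 := by
    have e : (1 - g) ^ 5 - (1 - 5 * g) = g ^ 2 * (10 - 10 * g + 5 * g ^ 2 - g ^ 3) := by ring
    have g3 : 0 < g ^ 3 := by positivity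
    have g31 : g ^ 3 ≤ 1 := pow_le_one₀ hg.le (by linarith)
    rename_bvar zz → zz
    have g21 : g ^ 2 ≤ 1 / 100 := by nlinarith only [hg, hg1]
    rw [e, abs_of_nonneg (mul_nonneg hg2.le (by nlinarith only [hg1, g31, hg2]))]
    nlinarith only [hg2, hg, g3, g21]
  have r51 : |(1 - g) ^ 5| ≤ 1 := by
    rw [abs_of_nonneg (pow_nonneg (by linarith) 5)]; exact pow_le_one₀ (by linarith) (by linarith)
  have a1 := ab2 r5 hT
  rename_bvar zz → zz
  have a2 := ab2 r51 hAr
  have sg : |s - 2 * g| ≤ 5 * g ^ 2 := by rw [abs_le]; constructor <;> linarith only [hg2, hslo, hshi]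
  have a3 := ab2 sg hM
  have h' : |(1 - g) ^ 5 * Ar - A + s * M| ≤ C * (9 * g ^ 2) := h.trans (by gcongr)
  rename_bvar zz → zz
  have key : |2 * g * (M - 5 / 2 * T)| ≤ 100 * (C * g ^ 2) := by
    rw [show 2 * g * (M - 5 / 2 * T) = ((1 - g) ^ 5 * Ar - A + s * M) - (1 - g) ^ 5 * (Ar - T) + (A - T)
      - ((1 - g) ^ 5 - (1 - 5 * g)) * T - (s - 2 * g) * M by ring]
    refine (su2 (su2 (ad2 (su2 h' a2) hA) a1) a3).trans ?_
    nlinarith only [hg2, hC]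
  rw [abs_mul, abs_of_pos (by linarith : 0 < 2 * g)] at key
  have : |M - 5 / 2 * T| * g ≤ (100 * C * g) * g := by nlinarith only [key, hg2, hC]
  exact le_of_mul_le_mul_right this hg

lemma AQ_e (e : OrthonormalBasis (Fin 4) ℝ V) (l : Fin 4 → ℝ) (i : Fin 4) : AQ e l (e i) = l i := by
  unfold AQ; simp only [onb_ip]; fin_cases i <;> simp

lemma AQ_sum (e : OrthonormalBasis (Fin 4) ℝ V) (l : Fin 4 → ℝ) (y : V) : AQ e l y = ∑ i, l i * ⟪e i, y⟫ ^ 2 := by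
  rw [Fin.sum_univ_four]; rfl

lemma AQ_near (e : OrthonormalBasis (Fin 4) ℝ V) (l : Fin 4 → ℝ) {x : ℝ} (h0 : |l 0 - 1 / 2| ≤ x) (h1 : |l 1 + 1 / 2| ≤ x)
    (h2 : |l 2 + 1 / 2| ≤ x) (h3 : |l 3 + 1 / 2| ≤ x) (y : V) : |AQ e l y - (⟪e 0, y⟫ ^ 2 - ‖y‖ ^ 2 / 2)| ≤ x * ‖y‖ ^ 2 := by
  have sq : ∀ i, |⟪e i, y⟫ ^ 2| ≤ ⟪e i, y⟫ ^ 2 := fun i => (abs_of_nonneg (sq_nonneg _)).le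
  rw [norm_sq4 e y, show AQ e l y - (⟪e 0, y⟫ ^ 2 - (⟪e 0, y⟫ ^ 2 + ⟪e 1, y⟫ ^ 2 + ⟪e 2, y⟫ ^ 2 + ⟪e 3, y⟫ ^ 2) / 2)
    = (l 0 - 1 / 2) * ⟪e 0, y⟫ ^ 2 + (l 1 + 1 / 2) * ⟪e 1, y⟫ ^ 2 + (l 2 + 1 / 2) * ⟪e 2, y⟫ ^ 2 + (l 3 + 1 / 2) * ⟪e 3, y⟫ ^ 2 by unfold AQ; ring]
  exact (ad2 (ad2 (ad2 (ab2 h0 (sq 0)) (ab2 h1 (sq 1))) (ab2 h2 (sq 2))) (ab2 h3 (sq 3))).trans (by linarith only)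

lemma KPs {ε1 : ℝ} (h1 : 0 < ε1) (h1' : ε1 ≤ 1) : ∃ C : ℝ, 1 ≤ C ∧ ∀ g : ℝ, 0 < g → g * C ≤ 1 → ∀ μ S, AU μ S (g ^ 120) →
    0 ∈ S → (∀ t, g ^ 24 ≤ t → t ≤ 1 → ¬ Fl S t ε1) → ∃ n : V, ‖n‖ = 1 ∧ (∀ y ∈ S, |⟪n, y⟫ ^ 2 - ‖y‖ ^ 2 / 2| ≤ C * g * (1 + ‖y‖) ^ 3) ∧
    ∀ r : ℝ, 1 / 2 ≤ r → r ≤ 1 → ∀ b q, GD (rs μ 0 r) b q → ∀ x, |q x x - (⟪n, x⟫ ^ 2 - ‖x‖ ^ 2 / 2)| ≤ C * g * ‖x‖ ^ 2 := by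
  obtain ⟨C1, σ, hC1, hσ, hσ1, HA⟩ := SA h1 h1'
  obtain ⟨CT, hCT, HT⟩ := Mfour
  obtain ⟨C3, hC3, H3⟩ := G_bd 3
  rename_bvar zz → zz
  obtain ⟨C4, hC4, H4⟩ := G_bd 4
  obtain ⟨C5, hC5, H5⟩ := G_bd 5
  have hcG := cG_pos
  obtain ⟨B, hB⟩ : ∃ B, B = 2 + 3 * C4 / cG := ⟨_, rfl⟩
  rename_bvar zz → zz
  have hB1 : 1 ≤ B := by have : 0 < 3 * C4 / cG := by positivity
                         rw [hB]; linarith only [this]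
  obtain ⟨C2, hC2, H2⟩ := alg1 hσ hσ1 hB1
  obtain ⟨C9, hC9⟩ : ∃ C9, C9 = CT + 3 * cG + cG * C1 := ⟨_, rfl⟩
  obtain ⟨X, hX⟩ : ∃ X, X = (2 / cG) * (C3 * C1 + 16 * cG * C1) + C1 := ⟨_, rfl⟩
  rename_bvar zz → zz
  obtain ⟨D, hD⟩ : ∃ D, D = C1 + X + 100 * C9 / cG + C5 * C1 / cG + C1 / cG := ⟨_, rfl⟩
  have hC10 : 0 < C1 := by linarith only [hC1]
  have hX0 : 0 < X := by rw [hX]; positivity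
  have hC90 : 1 ≤ C9 := by rw [hC9]; nlinarith only [hCT, hcG, hC10]
  rename_bvar zz → zz
  have d1 : 0 < 100 * C9 / cG := by positivity
  have d2 : 0 < C5 * C1 / cG := by positivity
  have d3 : 0 < C1 / cG := by positivity
  have hD1 : 1 ≤ D := by rw [hD]; linarith only [hC1, hX0, d1, d2, d3]
  rename_bvar zz → zz
  have D1 : C1 ≤ D := by rw [hD]; linarith only [hC1, hX0, d1, d2, d3]
  have D2 : X ≤ D := by rw [hD]; linarith only [hC1, hX0, d1, d2, d3]
  have D3 : 100 * C9 / cG ≤ D := by rw [hD]; linarith only [hC1, hX0, d1, d2, d3]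
  have D4 : C5 * C1 / cG ≤ D := by rw [hD]; linarith only [hC1, hX0, d1, d2, d3]
  rename_bvar zz → zz
  have D5 : C1 / cG ≤ D := by rw [hD]; linarith only [hC1, hX0, d1, d2, d3]
  have hCD : 1 ≤ C2 * D := by nlinarith only [hC2, hD1]
  refine ⟨100 + C1 + C2 * D, by linarith only [hC10, hCD], ?_⟩
  intro g hg hsm μ S hA h0 hnf
  have g1 : g ≤ 1 / 100 := by nlinarith only [hg, hsm, hC10, hCD]
  have gC1 : g * C1 ≤ 1 := by nlinarith only [hg, hsm, hC10, hCD]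
  rename_bvar zz → zz
  have gC2 : (D * g) * C2 ≤ 1 := by nlinarith only [hg, hsm, hC10, hCD]
  obtain ⟨e, l, hl, hl0, hl2, hl3, hlt, hS, hq, hR⟩ := HA g hg gC1 μ S hA h0 hnf
  have g2 : g ^ 2 ≤ g := by nlinarith only [hg, g1]
  have hg2 : 0 < g ^ 2 := by positivity
  rename_bvar zz → zz
  have gb : ∀ x : ℝ, 0 ≤ x → x ≤ D → x * g ^ 2 ≤ D * g := fun x hx hxD => by gcongr
  have g120 : g ^ 120 ≤ 1 / 2 := (pow_le_pow_of_le_one hg.le (by linarith only [g1]) (by norm_num : 1 ≤ 120)).trans (by rw [pow_one]; linarith only [g1])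
  have hA1 : g ^ 120 ≤ 1 := by linarith only [g120]
  have hmom : ∀ r : ℝ, 1 / 2 ≤ r → r ≤ 1 → ∀ i, |G (rs μ 0 r) (fun y => ⟪e i, y⟫ ^ 2) - cG / 2 * (1 + l i)| ≤ cG * C1 * g ^ 2 := by
    intro r hr hr1 i
    have hAr := hA.rs (z := 0) (by simp) (r := r) (by linarith only [hr]) (δ' := 2 * g ^ 120) (by linarith only) (by
      have := hA.pos; nlinarith only [this, hr1])
    obtain ⟨b, q, hGD⟩ := GD_exists hAr (by linarith only [g120]) (by simpa [rsS] using h0)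
    have a := hq r hr hr1 b q hGD (e i)
    rename_bvar zz → zz
    have e1 := hGD.qeq (e i) (e i)
    simp only [← sq] at e1
    rw [AQ_e, e.norm_eq_one, one_pow, mul_one] at a
    rw [onb_ip, if_pos rfl] at e1
    rw [show G (rs μ 0 r) (fun y => ⟪e i, y⟫ ^ 2) - cG / 2 * (1 + l i) = cG / 2 * (q (e i) (e i) - l i) by linarith only [e1],
      abs_mul, abs_of_pos (by positivity)]
    nlinarith only [a, hcG, abs_nonneg (q (e i) (e i) - l i), mul_le_mul_of_nonneg_left a hcG.le]
  rename_bvar zz → zz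
  have hm1 := hmom 1 (by norm_num) le_rfl
  rw [rs_one] at hm1
  have hl5 : ∀ i, |1 + l i| ≤ 5 := fun i => (ad2 (by norm_num : |(1:ℝ)| ≤ 1) (hl i)).trans (by norm_num)
  have hSum : |∑ i, l i + 1| ≤ C1 * g ^ 2 := by rw [Fin.sum_univ_four]; exact hlt
  have S2 : |∑ i, l i * l i - 1| ≤ X * g ^ 2 := by
    have b3 := (H3 μ S _ hA hA1 h0 (AQ e l) (by unfold AQ; fun_prop) (C1 * g ^ 2) (by positivity) (fun y hy => by
      refine (hS y hy).trans (mul_le_mul_of_nonneg_left ?_ (by positivity))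
      exact le_mul_of_one_le_right (by positivity) (Real.one_le_exp (by positivity)))).2
    rw [show AQ e l = fun y => ∑ i, l i * ⟪e i, y⟫ ^ 2 from funext (AQ_sum e l),
      G_sum _ _ _ (fun i => by simpa using in_int hA hA1 h0 1 (e i) 2)] at b3
    have e1 := ab4 fun i => ab2 (hl i) (hm1 i)
    have e2 : cG / 2 * (∑ i, l i * l i + ∑ i, l i) = ∑ i, l i * G μ (fun y => ⟪e i, y⟫ ^ 2)
        - ∑ i, l i * (G μ (fun y => ⟪e i, y⟫ ^ 2) - cG / 2 * (1 + l i)) := by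
      rw [← Finset.sum_sub_distrib, ← Finset.sum_add_distrib, Finset.mul_sum]
      exact Finset.sum_congr rfl fun i _ => by ring
    rename_bvar zz → zz
    have e3 := su2 b3 e1
    rw [← e2, abs_mul, abs_of_pos (by positivity)] at e3
    have e4 : |∑ i, l i * l i + ∑ i, l i| ≤ (2 / cG) * (C3 * (C1 * g ^ 2) + 4 * (4 * (cG * C1 * g ^ 2))) := by
      rw [div_mul_eq_mul_div, le_div_iff₀ hcG]; linarith only [e3]
    have e5 := su2 e4 hSum
    rw [show ∑ i, l i * l i - 1 = ∑ i, l i * l i + ∑ i, l i - (∑ i, l i + 1) by ring, hX]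
    exact e5.trans (le_of_eq (by ring))
  rename_bvar zz → zz
  have imm : ∀ i j, Integrable (fun y => Real.exp (-‖y‖ ^ 2) * (⟪e i, y⟫ ^ 2 * ⟪e j, y⟫ ^ 2)) μ := fun i j =>
    G_int hA hA1 h0 4 (K := 1) (by fun_prop) fun y _ => by rw [one_mul]; exact (ee_le e _ _ y).trans (gr_poly 4 y)
  have R1 : ∀ i, |∑ j, mm μ e i j / cG - 5 / 4 * (1 + l i)| ≤ D * g := by
    intro i
    obtain ⟨a, b⟩ := HT μ S _ hA hA1 h0 (e i) (e.norm_eq_one i)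
    have key := step9 (T := cG / 2 * (1 + l i)) hC90 hg g1 ((ab2 (abs_of_pos (by positivity : 0 < cG / 2)).le (hl5 i)).trans (by
      rw [hC9]; nlinarith only [hCT, hcG, hC10])) ((hm1 i).trans (by rw [hC9]; nlinarith only [hCT, hcG, hg2]))
      ((hmom (1 - g) (by linarith only [g1]) (by linarith only [hg]) i).trans (by rw [hC9]; nlinarith only [hCT, hcG, hg2]))
      (a.trans (by rw [hC9]; nlinarith only [hCT, hcG, hC10]))
      ((b (1 - g) (by linarith only [g1]) (by linarith only [hg])).trans (mul_le_mul_of_nonneg_right (by rw [hC9]; nlinarith only [hCT, hcG, hC10]) (sq_nonneg _)))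
    have e1 : (fun y : V => ‖y‖ ^ 2 * ⟪e i, y⟫ ^ 2) = fun y => ∑ j, 1 * (⟪e i, y⟫ ^ 2 * ⟪e j, y⟫ ^ 2) := by
      funext y; rw [norm_sq4 e y, Fin.sum_univ_four]; ring
    rw [e1, G_sum _ _ _ (imm i)] at key
    rw [show ∑ j, mm μ e i j / cG - 5 / 4 * (1 + l i) = (∑ j, 1 * mm μ e i j - 5 / 2 * (cG / 2 * (1 + l i))) / cG by
      rw [← Finset.sum_div]; field_simp; ring, abs_div, abs_of_pos hcG]
    calc _ ≤ 100 * C9 * g / cG := by gcongr; exact key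
      _ = 100 * C9 / cG * g := by ring
      _ ≤ D * g := by gcongr
  have R2 : ∀ i, |∑ j, l j * (mm μ e i j / cG)| ≤ D * g := by
    intro i
    have b5 := (H5 μ S _ hA hA1 h0 (fun y => ∑ j, l j * (⟪e i, y⟫ ^ 2 * ⟪e j, y⟫ ^ 2)) (by fun_prop) (C1 * g ^ 2) (by positivity) (fun y hy => by
      rw [show ∑ j, l j * (⟪e i, y⟫ ^ 2 * ⟪e j, y⟫ ^ 2) = AQ e l y * ⟪e i, y⟫ ^ 2 by
        rw [AQ_sum, Finset.sum_mul]; exact Finset.sum_congr rfl fun j _ => by ring]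
      have hi : |⟪e i, y⟫ ^ 2| ≤ (1 + ‖y‖) ^ 2 := by
        rw [abs_pow]; exact pow_le_pow_left₀ (abs_nonneg _) ((e_le e i y).trans (by linarith only)) 2
      refine (ab2 (hS y hy) hi).trans ?_
      calc _ = C1 * g ^ 2 * ((1 + ‖y‖) ^ 5 * 1) := by ring
        _ ≤ _ := by gcongr; exact Real.one_le_exp (by positivity))).2
    rw [G_sum _ _ _ (imm i)] at b5
    rw [show ∑ j, l j * (mm μ e i j / cG) = (∑ j, l j * mm μ e i j) / cG by
      rw [Finset.sum_div]; exact Finset.sum_congr rfl fun j _ => by ring, abs_div, abs_of_pos hcG]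
    calc _ ≤ C5 * (C1 * g ^ 2) / cG := by gcongr; exact b5
      _ = C5 * C1 / cG * g ^ 2 := by ring
      _ ≤ D * g := gb _ d2.le D4
  have Φb : ∀ i j, |PM μ e i j / cG| ≤ B := by
    intro i j
    have b4 := (H4 μ S _ hA hA1 h0 (fun y => ⟪e i, y⟫ ^ 2 * ⟪e j, y⟫ ^ 2) (by fun_prop) 1 zero_le_one fun y _ => by
      rw [one_mul]; exact (ee_le e _ _ y).trans (gr_poly 4 y)).2
    rw [abs_div, abs_of_pos hcG, div_le_iff₀ hcG, hB, add_mul, div_mul_cancel₀ _ hcG.ne']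
    have : |if i = j then (1:ℝ) else 3| ≤ 3 := by split_ifs <;> norm_num
    refine (su2 (ab2 this b4) (abs_of_pos (by positivity : 0 < 3 / 4 * cG)).le).trans ?_
    linarith only [hcG]
  rename_bvar zz → zz
  have R3 : ∀ i j, |(∑ i, l i * l i) ^ 2 * (PM μ e i j / cG) - (∑ i, l i * l i) * (l j * (∑ k, PM μ e i k / cG * l k) + l i * (∑ k, PM μ e j k / cG * l k))
      + l i * l j * (∑ k, l k * ∑ n, PM μ e k n / cG * l n)| ≤ D * g := by
    intro i j
    have := hR i j
    calc _ = |dt l l ^ 2 * PM μ e i j - dt l l * (l j * Matrix.mulVec (PM μ e) l i + l i * Matrix.mulVec (PM μ e) l j) +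
            l i * l j * l ⬝ᵥ Matrix.mulVec (PM μ e) l| / cG := by
          rw [← abs_of_pos hcG, ← abs_div, abs_of_pos hcG]
          congr 1
          simp only [dt, Matrix.mulVec, dotProduct, Fin.sum_univ_four]
          ring
      _ ≤ C1 * g ^ 2 / cG := by gcongr
      _ = C1 / cG * g ^ 2 := by ring
      _ ≤ D * g := gb _ d3.le D5
  obtain ⟨n0, n1, n2, n3⟩ := H2 (D * g) l (fun i j => mm μ e i j / cG) (fun i j => PM μ e i j / cG) (by positivity) gC2 hl hl0 hl2 hl3 Φb (by
    intro i j
    by_cases hij : i = j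
    · subst hij; simp only [PM, if_true]; field_simp; ring
    · simp only [PM, hij, if_false]; field_simp; ring) (hSum.trans (gb _ hC10.le D1)) (S2.trans (gb _ hX0.le D2)) R1 R2 R3
  have hn := AQ_near e l n0 n1 n2 n3
  have ng : ∀ y : V, 0 ≤ g * ‖y‖ ^ 2 := fun y => by positivity
  refine ⟨e 0, e.norm_eq_one 0, fun y hy => ?_, fun r hr hr1 b q hGD x => ?_⟩
  · rw [show ⟪e 0, y⟫ ^ 2 - ‖y‖ ^ 2 / 2 = AQ e l y - (AQ e l y - (⟪e 0, y⟫ ^ 2 - ‖y‖ ^ 2 / 2)) by ring]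
    refine (su2 (hS y hy) (hn y)).trans ?_
    have a1 : ‖y‖ ^ 2 ≤ (1 + ‖y‖) ^ 3 := by nlinarith only [norm_nonneg y, sq_nonneg ‖y‖, pow_nonneg (norm_nonneg y) 3]
    have a2 : 0 ≤ (1 + ‖y‖) ^ 3 := by positivity
    calc _ ≤ C1 * g * (1 + ‖y‖) ^ 3 + C2 * (D * g) * (1 + ‖y‖) ^ 3 := by gcongr
      _ ≤ _ := by nlinarith only [mul_nonneg hg.le a2]
  · rw [show q x x - (⟪e 0, x⟫ ^ 2 - ‖x‖ ^ 2 / 2) = (q x x - AQ e l x) + (AQ e l x - (⟪e 0, x⟫ ^ 2 - ‖x‖ ^ 2 / 2)) by ring]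
    refine (ad2 (hq r hr hr1 b q hGD x) (hn x)).trans ?_
    calc _ ≤ C1 * g * ‖x‖ ^ 2 + C2 * (D * g) * ‖x‖ ^ 2 := by gcongr
      _ ≤ _ := by nlinarith only [ng x]

lemma Nap {ε1 : ℝ} (h1 : 0 < ε1) (h1' : ε1 ≤ 1) : ∃ C c R : ℝ, 1 ≤ C ∧ 0 < c ∧ c ≤ 1 ∧ 1 ≤ R ∧ ∀ g : ℝ, 0 < g → g * C ≤ 1 → ∀ μ S,
    AU μ S (g ^ 120) → 0 ∈ S → ¬ Fl S g ε1 → ∀ b q, GD μ b q → ∀ n : V, ‖n‖ = 1 → 0 ≤ q n n → ∃ y ∈ S, c ≤ ⟪n, y⟫ ∧ ‖y‖ ≤ R := by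
  obtain ⟨C1, hC1, HP⟩ := P_lemma
  obtain ⟨C3, hC3, H3⟩ := G_bd 3
  have hcG := cG_pos
  rename_bvar zz → zz
  obtain ⟨R, hR⟩ : ∃ R, R = 16 * C3 / cG + 1 := ⟨_, rfl⟩
  have hR1 : 1 ≤ R := by
    have : 0 < 16 * C3 / cG := by positivity
    rw [hR]; linarith only [this]
  have hR2 : 16 * C3 + cG = cG * R := by rw [hR]; field_simp
  obtain ⟨c, hc⟩ : ∃ c, c = cG / (8 * C3 * (1 + R) + 8 * cG) := ⟨_, rfl⟩
  rename_bvar zz → zz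
  have hc0 : 0 < c := by rw [hc]; positivity
  have hc2 : c * (8 * C3 * (1 + R) + 8 * cG) = cG := by rw [hc]; field_simp
  have hc3 : 0 < c * C3 * (1 + R) := by positivity
  have hc1 : c ≤ 1 := by nlinarith only [hc2, hc3, hcG]
  rename_bvar zz → zz
  obtain ⟨B, hB⟩ : ∃ B, B = 2 * C1 / ε1 := ⟨_, rfl⟩
  have hB0 : 0 < B := by rw [hB]; positivity
  have hRB : 0 < 8 * R * B := by positivity
  refine ⟨2 + 8 * R * B, c, R, by linarith only [hRB], hc0, hc1, hR1, ?_⟩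
  intro g hg hsm μ S hA h0 hnf b q hGD n hn hq
  have hg1 : g ≤ 1 / 2 := by nlinarith only [hg, hsm, hRB]
  rename_bvar zz → zz
  have hgB : 8 * R * B * g ≤ 1 := by nlinarith only [hg, hsm]
  have hg3 : g ^ 120 ≤ g ^ 2 := pow_le_pow_of_le_one hg.le (by linarith only [hg1]) (by norm_num)
  have g120 : g ^ 120 ≤ 1 := pow_le_one₀ hg.le (by linarith only [hg1])
  have hgg : g ^ 3 ≤ g ^ 2 := pow_le_pow_of_le_one hg.le (by linarith only [hg1]) (by norm_num)
  rename_bvar zz → zz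
  obtain ⟨hp, -, -, -, hqb⟩ := HP μ S _ hA g120 h0 b q hGD
  have hb : ‖b‖ ≤ B * g := by
    by_contra hcon; push Not at hcon
    have hb0 : 0 < ‖b‖ := lt_of_le_of_lt (by positivity) hcon
    refine hnf ⟨‖b‖⁻¹ • b, by rw [norm_smul, norm_inv, norm_norm]; field_simp, ?_⟩
    intro y hy hye
    have k1 := hp y hy (by linarith only [hye, hg1])
    have k2 := hqb y y
    rename_bvar zz → zz
    have k3 : ‖y‖ * ‖y‖ ≤ g ^ 2 := by rw [sq]; gcongr
    have k4 : ‖y‖ ^ 3 ≤ g ^ 3 := by gcongr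
    have k5 : C1 * (‖y‖ * ‖y‖) ≤ C1 * g ^ 2 := by gcongr
    have k6 : C1 * (‖y‖ ^ 3 + g ^ 120) ≤ C1 * (2 * g ^ 2) :=
      mul_le_mul_of_nonneg_left (by linarith only [k4, hgg, hg3]) hC1.le
    have k9 : 0 < C1 * g ^ 2 := by positivity
    have k7 : |⟪b, y⟫| ≤ 2 * C1 * g ^ 2 := by
      rw [abs_le] at k1 k2 ⊢; constructor <;> linarith only [k1.1, k1.2, k2.1, k2.2, k5, k6, k9]
    rw [inner_smul_left, conj_trivial, abs_mul, abs_of_pos (by positivity), inv_mul_le_iff₀ hb0]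
    have k8 : B * ε1 = 2 * C1 := by rw [hB]; field_simp
    calc _ ≤ B * ε1 * g ^ 2 := by rw [k8]; exact k7
      _ = B * g * (ε1 * g) := by ring
      _ ≤ _ := by gcongr
  by_contra hcon; push Not at hcon
  have e1 := hGD.beq n
  have e2 := hGD.qeq n n
  simp only [← sq] at e2
  rw [real_inner_self_eq_norm_sq, hn] at e2
  rename_bvar zz → zz
  have e3 : |⟪b, n⟫| ≤ B * g := by
    have := abs_real_inner_le_norm b n
    rw [hn, mul_one] at this; exact this.trans hb
  have i1 := li_int hA g120 h0 n
  have i2 : Integrable (fun y => Real.exp (-‖y‖ ^ 2) * ⟪n, y⟫ ^ 2) μ := by simpa using in_int hA g120 h0 1 n 2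
  obtain ⟨i3, b3⟩ := H3 μ S _ hA g120 h0 (fun y => c * (c + R) + 2 / R * ‖y‖ ^ 3) (by fun_prop) (c * (c + R) + 2 / R) (by positivity)
    (fun y _ => by
      have a := gr_poly 3 y
      have a1 := one_le_gr 3 y
      rw [abs_of_nonneg (by positivity), add_mul]
      exact add_le_add (le_mul_of_one_le_right (by positivity) a1) (mul_le_mul_of_nonneg_left a (by positivity)))
  rename_bvar zz → zz
  have mono : G μ (fun y => ⟪n, y⟫ ^ 2) + R * G μ (fun y => ⟪n, y⟫) ≤ G μ (fun y => c * (c + R) + 2 / R * ‖y‖ ^ 3) := by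
    have : G μ (fun y => ⟪n, y⟫ ^ 2) + R * G μ (fun y => ⟪n, y⟫) = ∫ y, (Real.exp (-‖y‖ ^ 2) * ⟪n, y⟫ ^ 2 + R * (Real.exp (-‖y‖ ^ 2) * ⟪n, y⟫)) ∂μ := by
      rw [integral_add i2 (i1.const_mul R), integral_const_mul]; rfl
    rw [this]
    refine integral_mono_ae (i2.add (i1.const_mul R)) i3 ?_
    filter_upwards [hA.ae] with y hy
    have key : ⟪n, y⟫ ^ 2 + R * ⟪n, y⟫ ≤ c * (c + R) + 2 / R * ‖y‖ ^ 3 := by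
      have hy0 := norm_nonneg y
      have f := abs_real_inner_le_norm n y
      rw [hn, one_mul, abs_le] at f
      have p3 : 0 ≤ 2 / R * ‖y‖ ^ 3 := by positivity
      have pc : 0 < c * (c + R) := by positivity
      rcases le_or_gt ‖y‖ R with hyR | hyR
      · rcases lt_or_ge ⟪n, y⟫ c with hlt | hge
        · rcases le_or_gt ⟪n, y⟫ 0 with hn0 | hn0
          · nlinarith only [hn0, f.1, hyR, p3, pc]
          · nlinarith only [hn0, hlt, hc0, hR1, p3]
        · exact absurd hyR (by have := hcon y hy hge; linarith only [this])
      · have a1 : ‖y‖ ^ 2 ≤ ‖y‖ ^ 3 / R := by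
          rw [le_div_iff₀ (by linarith only [hR1])]; nlinarith only [hyR, sq_nonneg ‖y‖]
        have a2 : 2 / R * ‖y‖ ^ 3 = 2 * (‖y‖ ^ 3 / R) := by ring
        have a3 : ⟪n, y⟫ ^ 2 ≤ ‖y‖ ^ 2 := sq_le_sq' f.1 f.2
        have a4 : R * ⟪n, y⟫ ≤ ‖y‖ ^ 2 := by
          nlinarith only [hyR, f.2, hR1, hy0]
        linarith only [a1, a2, a3, a4, pc]
    calc _ = Real.exp (-‖y‖ ^ 2) * (⟪n, y⟫ ^ 2 + R * ⟪n, y⟫) := by ring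
      _ ≤ _ := mul_le_mul_of_nonneg_left key (Real.exp_pos _).le
  have b4 := (le_abs_self _).trans b3
  have b5 : C3 * (c * (c + R) + 2 / R) ≤ cG / 4 := by
    have u1 : C3 * (2 / R) ≤ cG / 8 := by
      rw [mul_div_assoc', div_le_iff₀ (by linarith only [hR1])]; linarith only [hR2, hcG]
    have u2 : C3 * (c * (c + R)) ≤ c * C3 * (1 + R) := by nlinarith only [mul_pos hC3 hc0, hc1]
    nlinarith only [u1, u2, hc2, mul_pos hc0 hcG]
  have b6 : cG * ⟪b, n⟫ * R ≥ - (cG / 8) := by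
    have u : cG * R * (B * g) ≤ cG / 8 := by nlinarith only [hgB, hcG]
    have u2 : cG * R * (-(B * g)) ≤ cG * R * ⟪b, n⟫ := mul_le_mul_of_nonneg_left (abs_le.1 e3).1 (by positivity)
    linarith only [u, u2]
  rename_bvar zz → zz
  have b7 : 0 ≤ cG * q n n := by positivity
  rw [← e1] at mono
  linarith only [mono, b4, b5, b6, b7, e2, hcG]

lemma rs_rs (μ : Measure V) {s r : ℝ} (hs : 0 < s) (hr : 0 < r) : rs (rs μ 0 s) 0 r = rs μ 0 (s * r) := by
  unfold rs
  rw [Measure.map_smul, Measure.map_map (by fun_prop) (by fun_prop), smul_smul, ← ENNReal.ofReal_mul (by positivity)]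
  congr 2
  · field_simp
  · funext y; simp only [Function.comp, sub_zero, smul_smul]; congr 1; field_simp

lemma sq_close (f : ℕ → V) (hf : ∀ k, ‖f k‖ = 1) {K l : ℝ} (hl1 : l < 1)
    (h : ∀ k x, |⟪f k, x⟫ ^ 2 - ⟪f (k + 1), x⟫ ^ 2| ≤ K * l ^ k * ‖x‖ ^ 2) :
    ∃ e : V, ‖e‖ = 1 ∧ ∀ k x, |⟪f k, x⟫ ^ 2 - ⟪e, x⟫ ^ 2| ≤ K / (1 - l) * l ^ k * ‖x‖ ^ 2 := by
  obtain ⟨e, he, φ, hφ, ht⟩ := (isCompact_sphere (0 : V) 1).tendsto_subseq (x := f) (fun k => by simp [hf k])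
  refine ⟨e, by simpa using he, fun k x => ?_⟩
  have hu : ∀ k, dist (⟪f k, x⟫ ^ 2) (⟪f (k + 1), x⟫ ^ 2) ≤ K * ‖x‖ ^ 2 * l ^ k := fun k => by
    rw [Real.dist_eq]; exact (h k x).trans (le_of_eq (by ring))
  have hc := cauchySeq_of_le_geometric l _ hl1 hu
  rename_bvar zz → zz
  have h2 : Tendsto ((fun k => ⟪f k, x⟫ ^ 2) ∘ φ) atTop (𝓝 (⟪e, x⟫ ^ 2)) := (ht.inner tendsto_const_nhds).pow 2
  have h3 := tendsto_nhds_of_cauchySeq_of_subseq hc hφ.tendsto_atTop h2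
  have := dist_le_of_le_geometric_of_tendsto l _ hl1 hu h3 k
  rw [Real.dist_eq] at this
  exact this.trans (le_of_eq (by ring))

lemma LC1 {ε1 : ℝ} (h1 : 0 < ε1) (h1' : ε1 ≤ 1) {μ S B a} (hB : 1 ≤ B) (ha : 0 < a) (ha1 : a ≤ 1) (hO : OU μ S B a) (h0 : (0 : V) ∈ S)
    {s1 : ℝ} (hs1 : 0 < s1) (hnf : ∀ t, 0 < t → t ≤ s1 → ¬ FlA S 0 t ε1) :
    ∃ (e : V) (D s0 : ℝ), ‖e‖ = 1 ∧ 1 ≤ D ∧ 0 < s0 ∧ s0 ≤ 1 ∧ s0 ≤ s1 ∧ ∀ ρ : ℝ, 0 < ρ → ρ ≤ s0 → ∃ s, ρ ≤ s ∧ s ≤ 2 * ρ ∧ s ≤ s0 ∧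
      (∀ y ∈ rsS S 0 s, |⟪e, y⟫ ^ 2 - ‖y‖ ^ 2 / 2| ≤ D * s ^ (a / 120) * (1 + ‖y‖) ^ 3) ∧
      ∃ b q, GD (rs μ 0 s) b q ∧ 1 / 2 - D * s ^ (a / 120) ≤ q e e := by
  obtain ⟨C, hC, HK⟩ := KPs h1 h1'
  obtain ⟨θ, hθ⟩ : ∃ θ, θ = a / 120 := ⟨_, rfl⟩
  have hθ0 : 0 < θ := by rw [hθ]; positivity
  rw [← hθ]
  rename_bvar zz → zz
  obtain ⟨s2, hs2, hs21, H2⟩ := small_rpow hθ0 (c := 1 / (B * C)) (by positivity)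
  obtain ⟨s0, hs0⟩ : ∃ s0, s0 = min s1 s2 := ⟨_, rfl⟩
  have p0 : 0 < s0 := by rw [hs0]; exact lt_min hs1 hs2
  have p1 : s0 ≤ s1 := by rw [hs0]; exact min_le_left _ _
  rename_bvar zz → zz
  have p2 : s0 ≤ s2 := by rw [hs0]; exact min_le_right _ _
  have hgC : ∀ s, 0 < s → s ≤ s0 → B * s ^ θ * C ≤ 1 := fun s hs hss => by
    have := H2 s hs (hss.trans p2)
    rw [le_div_iff₀ (by positivity)] at this; linarith only [this]
  have hAU : ∀ s, 0 < s → s ≤ s0 → AU (rs μ 0 s) (rsS S 0 s) ((B * s ^ θ) ^ 120) := fun s hs hss => by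
    refine (hO 0 h0 (by simp) s hs (by linarith only [hss, p2, hs21])).mono ?_
    rw [mul_pow, ← Real.rpow_natCast (s ^ θ), ← Real.rpow_mul hs.le, hθ]
    rw [show a / 120 * ((120 : ℕ) : ℝ) = a by push_cast; ring]
    exact mul_le_mul_of_nonneg_right (le_self_pow₀ hB (by norm_num)) (by positivity)
  have h00 : ∀ s, (0 : V) ∈ rsS S 0 s := fun s => by simpa [rsS] using h0
  rename_bvar zz → zz
  have F : ∀ s, 0 < s → s ≤ s0 → ∃ n : V, ‖n‖ = 1 ∧ (∀ y ∈ rsS S 0 s, |⟪n, y⟫ ^ 2 - ‖y‖ ^ 2 / 2| ≤ C * (B * s ^ θ) * (1 + ‖y‖) ^ 3) ∧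
      ∀ r : ℝ, 1 / 2 ≤ r → r ≤ 1 → ∀ b q, GD (rs μ 0 (s * r)) b q → ∀ x, |q x x - (⟪n, x⟫ ^ 2 - ‖x‖ ^ 2 / 2)| ≤ C * (B * s ^ θ) * ‖x‖ ^ 2 := by
    intro s hs hss
    obtain ⟨n, hn, k1, k2⟩ := HK (B * s ^ θ) (by positivity) (hgC s hs hss) _ _ (hAU s hs hss) (h00 s) (fun t ht ht1 => by
      rw [Fl_rs S 0 hs]
      have ht0 : 0 < t := lt_of_lt_of_le (by positivity) ht
      exact hnf _ (by positivity) (by nlinarith only [hs, hss, p1, ht0, ht1]))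
    refine ⟨n, hn, k1, fun r hr hr1 => ?_⟩
    have := k2 r hr hr1
    rwa [rs_rs μ hs (by linarith only [hr])] at this
  obtain ⟨f, hf⟩ : ∃ f : ℕ → ℝ, f = fun k => s0 * (1 / 2) ^ k := ⟨_, rfl⟩
  have f0 : ∀ k, 0 < f k := fun k => by rw [hf]; positivity
  have f1 : ∀ k, f k ≤ s0 := fun k => by
    rw [hf]; exact mul_le_of_le_one_right p0.le (pow_le_one₀ (by norm_num) (by norm_num))
  rename_bvar zz → zz
  have f2 : ∀ k, f (k + 1) = f k * (1 / 2) := fun k => by rw [hf]; simp only; ring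
  obtain ⟨l, hl⟩ : ∃ l : ℝ, l = (1 / 2) ^ θ := ⟨_, rfl⟩
  have hl1 : l < 1 := by rw [hl]; exact Real.rpow_lt_one (by norm_num) (by norm_num) hθ0
  have f3 : ∀ k, f k ^ θ = s0 ^ θ * l ^ k := fun k => by
    rw [hf, hl]; simp only
    rw [Real.mul_rpow p0.le (by positivity), ← Real.rpow_natCast ((1 / 2 : ℝ) ^ θ), ← Real.rpow_mul (by norm_num), mul_comm θ,
      Real.rpow_mul (by norm_num), Real.rpow_natCast]
  choose N N1 N2 N3 using fun k => F (f k) (f0 k) (f1 k)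
  rename_bvar zz → zz
  have hGD : ∀ k, ∃ b q, GD (rs μ 0 (f k)) b q := fun k =>
    GD_exists (hAU _ (f0 k) (f1 k)) (pow_le_one₀ (by have := f0 k; positivity) (by
      have := hgC _ (f0 k) (f1 k)
      have h3 : 0 < B * f k ^ θ := by have := f0 k; positivity
      nlinarith only [this, h3, hC])) (h00 _)
  have hl0 : 0 < l := by rw [hl]; positivity
  obtain ⟨e, he, hcl⟩ := sq_close N N1 (K := 2 * C * B * s0 ^ θ) hl1 (fun k x => by
    obtain ⟨b, q, hq⟩ := hGD (k + 1)
    have a1 := N3 (k + 1) 1 (by norm_num) le_rfl b q (by rwa [mul_one]) x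
    have a2 := N3 k (1 / 2) le_rfl (by norm_num) b q (by rwa [← f2]) x
    rename_bvar zz → zz
    have a3 := su2 a1 a2
    rw [f3, f3] at a3
    rw [show ⟪N k, x⟫ ^ 2 - ⟪N (k + 1), x⟫ ^ 2 = q x x - (⟪N (k + 1), x⟫ ^ 2 - ‖x‖ ^ 2 / 2) - (q x x - (⟪N k, x⟫ ^ 2 - ‖x‖ ^ 2 / 2)) by ring]
    refine a3.trans ?_
    have : l ^ (k + 1) ≤ l ^ k := pow_le_pow_of_le_one hl0.le hl1.le (Nat.le_succ k)
    calc _ ≤ C * (B * (s0 ^ θ * l ^ k)) * ‖x‖ ^ 2 + C * (B * (s0 ^ θ * l ^ k)) * ‖x‖ ^ 2 := by gcongr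
      _ = _ := by ring)
  have hl2 : 0 < 1 - l := by linarith only [hl1]
  rename_bvar zz → zz
  obtain ⟨K, hK⟩ : ∃ K, K = 2 * C * B / (1 - l) := ⟨_, rfl⟩
  have hK0 : 0 < K := by rw [hK]; positivity
  have hcl' : ∀ k x, |⟪N k, x⟫ ^ 2 - ⟪e, x⟫ ^ 2| ≤ K * f k ^ θ * ‖x‖ ^ 2 := fun k x => by
    refine (hcl k x).trans (le_of_eq ?_); rw [f3, hK]; ring
  have hCB : 1 ≤ C * B := by nlinarith only [hC, hB]
  refine ⟨e, C * B + K, s0, he, by linarith only [hCB, hK0], p0, p2.trans hs21, p1, fun ρ hρ hρ0 => ?_⟩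
  rename_bvar zz → zz
  obtain ⟨k, hk1, hk2⟩ := exists_nat_pow_near_of_lt_one (x := ρ / s0) (y := 1 / 2) (by positivity) (by rwa [div_le_one p0]) (by norm_num) (by norm_num)
  have k1 : f (k + 1) < ρ := by rw [lt_div_iff₀ p0] at hk1; rw [hf]; linarith only [hk1]
  have k2 : ρ ≤ f k := by rw [div_le_iff₀ p0] at hk2; rw [hf]; linarith only [hk2]
  have k3 := f2 k
  refine ⟨f k, k2, by linarith only [k1, k3], f1 k, fun y hy => ?_, ?_⟩
  · have a1 := N2 k y hy
    have a2 := hcl' k y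
    rw [show ⟪e, y⟫ ^ 2 - ‖y‖ ^ 2 / 2 = ⟪N k, y⟫ ^ 2 - ‖y‖ ^ 2 / 2 - (⟪N k, y⟫ ^ 2 - ⟪e, y⟫ ^ 2) by ring]
    refine (su2 a1 a2).trans ?_
    have a3 : ‖y‖ ^ 2 ≤ (1 + ‖y‖) ^ 3 := by nlinarith only [norm_nonneg y, sq_nonneg ‖y‖, pow_nonneg (norm_nonneg y) 3]
    have := f0 k
    calc _ ≤ C * (B * f k ^ θ) * (1 + ‖y‖) ^ 3 + K * f k ^ θ * (1 + ‖y‖) ^ 3 := by gcongr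
      _ = _ := by ring
  · obtain ⟨b, q, hq⟩ := hGD k
    refine ⟨b, q, hq, ?_⟩
    rename_bvar zz → zz
    have a1 := abs_le.1 (N3 k 1 (by norm_num) le_rfl b q (by rwa [mul_one]) e)
    have a2 := abs_le.1 (hcl' k e)
    rw [he, real_inner_self_eq_norm_sq, he] at a2
    rw [he] at a1
    linarith only [a1.1, a2.1]

lemma LC2 {ε1 : ℝ} (h1 : 0 < ε1) (h1' : ε1 ≤ 1) {μ S B a} (hB : 1 ≤ B) (ha : 0 < a) (ha1 : a ≤ 1) (hO : OU μ S B a) (h0 : (0 : V) ∈ S)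
    {s1 : ℝ} (hs1 : 0 < s1) (hnf : ∀ t, 0 < t → t ≤ s1 → ¬ FlA S 0 t ε1) :
    ∃ (e : V) (D s0 : ℝ), ‖e‖ = 1 ∧ 1 ≤ D ∧ 0 < s0 ∧ s0 ≤ 1 ∧
      (∀ y ∈ S, ‖y‖ ≤ s0 → |⟪e, y⟫ ^ 2 - ‖y‖ ^ 2 / 2| ≤ D * ‖y‖ ^ (a / 120) * ‖y‖ ^ 2) ∧
      ∀ P : ℝ, 0 < P → P ≤ s0 → ∀ σ : ℝ, σ ^ 2 = 1 → ∃ y ∈ S, P ≤ σ * ⟪e, y⟫ ∧ ‖y‖ ≤ D * P := by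
  obtain ⟨e, D, s0, he, hD, hs0, hs01, hs0s1, H⟩ := LC1 h1 h1' hB ha ha1 hO h0 hs1 hnf
  obtain ⟨C, c, R, hC, hc, hc1, hR, HN⟩ := Nap h1 h1'
  obtain ⟨θ, hθ⟩ : ∃ θ, θ = a / 120 := ⟨_, rfl⟩
  rename_bvar zz → zz
  have hθ0 : 0 < θ := by rw [hθ]; positivity
  have hθ1 : θ ≤ 1 := by rw [hθ]; linarith only [ha1]
  rw [← hθ] at H ⊢
  obtain ⟨s2, hs2, hs21, H2⟩ := small_rpow hθ0 (c := 1 / (B * C + 2 * D)) (by positivity)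
  obtain ⟨s3, hs3⟩ : ∃ s3, s3 = c * min s0 s2 / 2 := ⟨_, rfl⟩
  rename_bvar zz → zz
  have p3 : 0 < s3 := by rw [hs3]; have := lt_min hs0 hs2; positivity
  have p0 : s3 ≤ c * s0 / 2 := by rw [hs3]; gcongr; exact min_le_left _ _
  have p2 : s3 ≤ c * s2 / 2 := by rw [hs3]; gcongr; exact min_le_right _ _
  have q0 : s3 ≤ s0 := p0.trans (by nlinarith only [hc, hc1, hs0])
  rename_bvar zz → zz
  have d1 : 0 ≤ 2 * R / c := by positivity
  refine ⟨e, 64 * D + 2 * R / c, s3, he, by linarith only [hD, d1], p3, q0.trans hs01, fun y hy hys => ?_, fun P hP hPs σ hσ => ?_⟩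
  · rcases eq_or_ne y 0 with rfl | hy0
    · simp [hθ0.ne']
    have hyp : 0 < ‖y‖ := norm_pos_iff.2 hy0
    obtain ⟨s, k1, k2, k3, k4, -⟩ := H ‖y‖ hyp (hys.trans q0)
    have hs : 0 < s := hyp.trans_le k1
    rename_bvar zz → zz
    have k5 := k4 (s⁻¹ • y) (by simpa [rsS, smul_smul, hs.ne'] using hy)
    rw [inner_smul_right, norm_smul, norm_inv, Real.norm_of_nonneg hs.le] at k5
    have k6 : (1 + s⁻¹ * ‖y‖) ^ 3 ≤ 8 := by
      have : s⁻¹ * ‖y‖ ≤ 1 := by rw [inv_mul_le_iff₀ hs]; linarith only [k1]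
      calc _ ≤ (1 + 1 : ℝ) ^ 3 := by gcongr
        _ = 8 := by norm_num
    have k7 : s ^ θ ≤ 2 * ‖y‖ ^ θ := by
      calc _ ≤ (2 * ‖y‖) ^ θ := by gcongr
        _ = 2 ^ θ * ‖y‖ ^ θ := Real.mul_rpow (by norm_num) hyp.le
        _ ≤ 2 ^ (1:ℝ) * ‖y‖ ^ θ := by gcongr; norm_num
        _ = _ := by rw [Real.rpow_one]
    rw [show (s⁻¹ * ⟪e, y⟫) ^ 2 - (s⁻¹ * ‖y‖) ^ 2 / 2 = (s ^ 2)⁻¹ * (⟪e, y⟫ ^ 2 - ‖y‖ ^ 2 / 2) by field_simp, abs_mul,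
      abs_of_pos (by positivity), inv_mul_le_iff₀ (by positivity)] at k5
    refine k5.trans ?_
    have k8 : s ^ 2 ≤ 4 * ‖y‖ ^ 2 := by nlinarith only [k2, hs]
    calc _ ≤ 4 * ‖y‖ ^ 2 * (D * (2 * ‖y‖ ^ θ) * 8) := by gcongr
      _ = 64 * D * ‖y‖ ^ θ * ‖y‖ ^ 2 := by ring
      _ ≤ _ := by gcongr; linarith only [d1]
  · have hPc : P / c ≤ s0 / 2 := by rw [div_le_iff₀ hc]; linarith only [hPs, p0]
    have hPc2 : P / c ≤ s2 / 2 := by rw [div_le_iff₀ hc]; linarith only [hPs, p2]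
    obtain ⟨s, k1, k2, k3, -, b, q, hGD, hq⟩ := H (P / c) (by positivity) (by linarith only [hPc, hs0])
    have hs : 0 < s := lt_of_lt_of_le (by positivity) k1
    have hm := H2 s hs (by linarith only [k2, hPc2])
    rw [le_div_iff₀ (by positivity)] at hm
    have hsθ : 0 < s ^ θ := by positivity
    have m1 : B * s ^ θ * C ≤ 1 := by nlinarith only [hm, hsθ, hD]
    have m2 : D * s ^ θ ≤ 1 / 2 := by
      have : 0 < s ^ θ * (B * C) := by positivity
      nlinarith only [hm, this]
    have hσa : |σ| = 1 := by rw [← abs_one, ← sq_eq_sq_iff_abs_eq_abs, hσ, one_pow]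
    have hAU : AU (rs μ 0 s) (rsS S 0 s) ((B * s ^ θ) ^ 120) := by
      refine (hO 0 h0 (by simp) s hs (by linarith only [k3, hs01])).mono ?_
      rw [mul_pow, ← Real.rpow_natCast (s ^ θ), ← Real.rpow_mul hs.le, hθ]
      rw [show a / 120 * ((120 : ℕ) : ℝ) = a by push_cast; ring]
      exact mul_le_mul_of_nonneg_right (le_self_pow₀ hB (by norm_num)) (by positivity)
    obtain ⟨y, hy, y1, y2⟩ := HN (B * s ^ θ) (by positivity) m1 _ _ hAU (by simpa [rsS] using h0) (by
      rw [Fl_rs S 0 hs]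
      have g1 : B * s ^ θ ≤ 1 := by nlinarith only [m1, hC, mul_pos (zero_lt_one.trans_le hB) hsθ]
      exact hnf _ (by positivity) (by nlinarith only [hs, g1, k3, hs0s1])) b q hGD (σ • e) (by
      rw [norm_smul, he, mul_one, Real.norm_eq_abs, hσa]) (by
      simp only [map_smul, LinearMap.smul_apply, smul_eq_mul]
      rw [← mul_assoc, ← sq, hσ]; linarith only [hq, m2])
    have hy' : s • y ∈ S := by simpa [rsS] using hy
    rw [inner_smul_left, conj_trivial] at y1
    rw [div_le_iff₀ hc] at k1
    refine ⟨s • y, hy', ?_, ?_⟩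
    · rw [inner_smul_right]
      calc P ≤ s * c := k1
        _ ≤ s * (σ * ⟪e, y⟫) := by gcongr
        _ = _ := by ring
    · rw [norm_smul, Real.norm_of_nonneg hs.le]
      calc s * ‖y‖ ≤ 2 * (P / c) * R := by gcongr
        _ = 2 * R / c * P := by ring
        _ ≤ _ := by gcongr; linarith only [hD]
lemma LC3 {ε1 : ℝ} (h1 : 0 < ε1) (h1' : ε1 ≤ 1) {μ S B a} (hB : 1 ≤ B) (ha : 0 < a) (ha1 : a ≤ 1) (hO : OU μ S B a) (h0 : (0 : V) ∈ S)
    {s1 : ℝ} (hs1 : 0 < s1) (hnf : ∀ t, 0 < t → t ≤ s1 → ¬ FlA S 0 t ε1) :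
    ∃ (e : V) (D s0 : ℝ), ‖e‖ = 1 ∧ 1 ≤ D ∧ 0 < s0 ∧ s0 ≤ 1 ∧
      (∀ y ∈ S, ‖y‖ ≤ s0 → |⟪e, y⟫ ^ 2 - ‖y‖ ^ 2 / 2| ≤ D * ‖y‖ ^ (a / 120) * ‖y‖ ^ 2) ∧
      ∀ p : V, ‖p‖ ≤ s0 → ⟪e, p⟫ ^ 2 = ‖p‖ ^ 2 / 2 → ∃ x ∈ S, ‖x - p‖ ≤ D * ‖p‖ ^ (a / 240) * ‖p‖ := by
  obtain ⟨e, D, s0, he, hD, hs0, hs01, H, HN⟩ := LC2 h1 h1' hB ha ha1 hO h0 hs1 hnf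
  obtain ⟨d, C, hd, hC, HF⟩ := fillc
  obtain ⟨θ, hθ⟩ : ∃ θ, θ = a / 240 := ⟨_, rfl⟩
  rename_bvar zz → zz
  have hθ0 : 0 < θ := by rw [hθ]; positivity
  have hθ1 : θ ≤ 1 := by rw [hθ]; linarith only [ha1]
  rw [show a / 120 = 2 * θ by rw [hθ]; ring] at H ⊢
  rw [← hθ]
  obtain ⟨s2, hs2, hs21, H2⟩ := small_rpow hθ0 (c := min (1 / (64 * D ^ 2 * C)) (d / B)) (by
    apply lt_min <;> positivity)
  obtain ⟨s3, hs3⟩ : ∃ s3, s3 = min s0 s2 / (2 * D) := ⟨_, rfl⟩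
  rename_bvar zz → zz
  have p3 : 0 < s3 := by rw [hs3]; have := lt_min hs0 hs2; positivity
  have p0 : 2 * D * s3 ≤ s0 := by rw [hs3, mul_div_cancel₀ _ (by positivity)]; exact min_le_left _ _
  have p2 : 2 * D * s3 ≤ s2 := by rw [hs3, mul_div_cancel₀ _ (by positivity)]; exact min_le_right _ _
  have q0 : s3 ≤ s0 := by nlinarith only [p0, hD, p3]
  rename_bvar zz → zz
  have D3 : D ≤ 8 * D ^ 3 := by nlinarith only [hD, mul_self_nonneg (D - 1), mul_self_nonneg D]
  refine ⟨e, 8 * D ^ 3, s3, he, by linarith only [D3, hD], p3, q0.trans hs01, fun y hy hys => (H y hy (hys.trans q0)).trans (by gcongr), fun p hp hpe => ?_⟩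
  rcases eq_or_ne p 0 with rfl | hp0
  · exact ⟨0, h0, by simp⟩
  have hpp : 0 < ‖p‖ := norm_pos_iff.2 hp0
  obtain ⟨σ, hσ, hσp⟩ := sgn_ex ⟪e, p⟫
  obtain ⟨y, hy, y1, y2⟩ := HN ‖p‖ hpp (hp.trans q0) σ hσ
  rename_bvar zz → zz
  obtain ⟨w, hw⟩ : ∃ w, w = ‖y‖ := ⟨_, rfl⟩
  have hσa : |σ| = 1 := by rw [← abs_one, ← sq_eq_sq_iff_abs_eq_abs, hσ, one_pow]
  have w1 : ‖p‖ ≤ w := by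
    have a1 := abs_real_inner_le_norm e y
    have a2 := le_abs_self (σ * ⟪e, y⟫)
    rw [abs_mul, hσa, one_mul] at a2
    rw [he, one_mul] at a1
    rw [hw]; linarith only [a1, a2, y1]
  rw [← hw] at y2
  have hw0 : 0 < w := hpp.trans_le w1
  rename_bvar zz → zz
  have w2 : 2 * w ≤ 2 * D * s3 := by nlinarith only [y2, hp, hD]
  have hwθ : 0 < w ^ θ := by positivity
  obtain ⟨m1, m2⟩ := le_min_iff.1 (H2 w hw0 (by linarith only [w2, p2, hw0]))
  rw [le_div_iff₀ (by positivity)] at m1 m2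
  have w3 : w ^ (2 * θ) = w ^ θ * w ^ θ := by rw [two_mul, Real.rpow_add hw0]
  rename_bvar zz → zz
  have hD2 : 1 ≤ D ^ 2 := one_le_pow₀ hD
  have wt1 : w ^ θ * 64 ≤ 1 := by
    refine le_trans ?_ m1
    rw [show w ^ θ * (64 * D ^ 2 * C) = w ^ θ * 64 * (D ^ 2 * C) by ring]
    exact le_mul_of_one_le_right (by positivity) (by nlinarith only [hD2, hC])
  have wD : w ^ θ * D ≤ 1 / 64 := by
    have : w ^ θ * 64 * D ≤ w ^ θ * (64 * D ^ 2 * C) := by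
      rw [show w ^ θ * (64 * D ^ 2 * C) = w ^ θ * 64 * D * (D * C) by ring]
      exact le_mul_of_one_le_right (by positivity) (by nlinarith only [hD, hC])
    linarith only [this, m1]
  have wa : B * w ^ a ≤ d := by
    have : w ^ a ≤ w ^ θ := Real.rpow_le_rpow_of_exponent_ge hw0 (by linarith only [w2, p0, hs01, hw0]) (by rw [hθ]; linarith only [ha])
    nlinarith only [this, m2, hB]
  rename_bvar zz → zz
  have hwS : ∀ u : V, w⁻¹ • u ∈ rsS S 0 w ↔ u ∈ S := fun u => by simp [rsS, smul_smul, hw0.ne']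
  have hwn : ∀ u : V, ‖w⁻¹ • u‖ = w⁻¹ * ‖u‖ := fun u => by rw [norm_smul, norm_inv, Real.norm_of_nonneg hw0.le]
  obtain ⟨E, hE⟩ := onb1 he
  obtain ⟨l, hl⟩ : ∃ l : Fin 4 → ℝ, l = ![1 / 2, -1 / 2, -1 / 2, -1 / 2] := ⟨_, rfl⟩
  rename_bvar zz → zz
  have hAQ : ∀ u, AQ E l u = ⟪e, u⟫ ^ 2 - ‖u‖ ^ 2 / 2 := fun u => by
    rw [norm_sq4 E u, hl, AQ, hE]; simp; ring
  have hAp : AQ E l (w⁻¹ • p) = 0 := by rw [hAQ, inner_smul_right, hwn, mul_pow, hpe]; ring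
  have hz : 1 / 4 ≤ ⟪e, w⁻¹ • y⟫ ^ 2 := by
    have a1 := (abs_le.1 (H y hy (by rw [← hw]; linarith only [w2, p0, hw0]))).1
    rw [← hw] at a1
    rw [inner_smul_right, mul_pow, inv_pow, ← div_eq_inv_mul, le_div_iff₀ (by positivity)]
    have : D * w ^ (2 * θ) ≤ 1 / 4 := by rw [w3]; nlinarith only [wD, wt1, hwθ]
    nlinarith only [a1, this, sq_nonneg w]
  obtain ⟨x, hx, hxq⟩ := HF (rs μ 0 w) (rsS S 0 w) (B * w ^ a) (hO 0 h0 (by simp) w hw0 (by linarith only [w2, p0, hs01, hw0])) wa E l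
    (fun i => by rw [hl]; fin_cases i <;> norm_num [abs_le]) (1 / 2) (1 / (2 * D)) (8 * D * w ^ (2 * θ)) (8 * D * w ^ θ) (by norm_num) (by norm_num)
    (by positivity) (by rw [div_le_one (by positivity)]; linarith only [hD]) (by positivity)
    (by rw [w3]; nlinarith only [hD, mul_pos hwθ hwθ, mul_le_mul_of_nonneg_right (show D ≤ 8 * D ^ 2 by nlinarith only [hD]) (mul_pos hwθ hwθ).le])
    (by rw [show (1 / 2 : ℝ) ^ 2 * (1 / (2 * D)) = 1 / (8 * D) by ring, le_div_iff₀ (by positivity)]; linarith only [m1])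
    (by rw [hl]; norm_num) (by rw [hl]; show (-1 / 2 : ℝ) ≤ _; norm_num) (by rw [hl]; show (-1 / 2 : ℝ) ≤ _; norm_num)
    (fun u hu hu2 => by
      have hwu : ‖w • u‖ = w * ‖u‖ := by rw [norm_smul, Real.norm_of_nonneg hw0.le]
      have hu3 : w * ‖u‖ ≤ 2 * w := by nlinarith only [hu2, hw0]
      have a1 := H (w • u) (by simpa [rsS] using hu) (by rw [hwu]; linarith only [hu3, w2, p0])
      rw [hwu, inner_smul_right, show (w * ⟪e, u⟫) ^ 2 - (w * ‖u‖) ^ 2 / 2 = w ^ 2 * AQ E l u by rw [hAQ]; ring, abs_mul,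
        abs_of_pos (by positivity), show D * (w * ‖u‖) ^ (2 * θ) * (w * ‖u‖) ^ 2 = w ^ 2 * (D * (w * ‖u‖) ^ (2 * θ) * ‖u‖ ^ 2) by ring] at a1
      refine (le_of_mul_le_mul_left a1 (by positivity)).trans ?_
      have : ‖u‖ ^ (2 * θ) ≤ 2 := by
        calc ‖u‖ ^ (2 * θ) ≤ 2 ^ (2 * θ) := by gcongr
          _ ≤ 2 ^ (1 : ℝ) := by gcongr; norm_num; rw [hθ]; linarith only [ha1]
          _ = 2 := Real.rpow_one 2
      rw [Real.mul_rpow hw0.le (norm_nonneg u)]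
      calc _ ≤ D * (w ^ (2 * θ) * 2) * 2 ^ 2 := by gcongr
        _ = _ := by ring)
    (w⁻¹ • y) ((hwS y).2 hy) (by rw [hwn, ← hw, inv_mul_cancel₀ hw0.ne'])
    (Or.inl (by
      rw [hE]; by_contra hcon; push Not at hcon
      have := sq_le_of_abs hcon
      linarith only [this, hz])) (w⁻¹ • p) (by rw [hwn, inv_mul_le_iff₀ hw0]; linarith only [w1])
    (by rw [hAp, abs_zero]; positivity)
    (by
      rw [hE, inner_smul_right, abs_mul, abs_of_pos (by positivity), ← div_eq_inv_mul, div_le_div_iff₀ (by positivity) hw0]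
      have : ‖p‖ / 2 ≤ |⟪e, p⟫| := by
        apply le_of_sq_le_sq _ (abs_nonneg _)
        rw [sq_abs, hpe]; nlinarith only [hpp]
      nlinarith only [this, y2, hD])
    (by
      rw [hE, inner_smul_right, inner_smul_right]
      have a1 : 0 ≤ σ * ⟪e, y⟫ := hpp.le.trans y1
      have a2 : 0 ≤ (σ * ⟪e, y⟫) * (σ * ⟪e, p⟫) := mul_nonneg a1 hσp
      have a3 : (σ * ⟪e, y⟫) * (σ * ⟪e, p⟫) = ⟪e, y⟫ * ⟪e, p⟫ := by linear_combination (⟪e, y⟫ * ⟪e, p⟫) * hσ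
      rw [a3] at a2
      calc 0 ≤ w⁻¹ * w⁻¹ * (⟪e, y⟫ * ⟪e, p⟫) := by positivity
        _ = _ := by ring)
  refine ⟨w • x, by simpa [rsS] using hx, ?_⟩
  rw [show w • x - p = w • (x - w⁻¹ • p) by rw [smul_sub, smul_inv_smul₀ hw0.ne'], norm_smul, Real.norm_of_nonneg hw0.le]
  rename_bvar zz → zz
  have wθ : w ^ θ ≤ D * ‖p‖ ^ θ := by
    calc _ ≤ (D * ‖p‖) ^ θ := by gcongr
      _ = D ^ θ * ‖p‖ ^ θ := Real.mul_rpow (by positivity) hpp.le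
      _ ≤ D ^ (1 : ℝ) * ‖p‖ ^ θ := by gcongr
      _ = _ := by rw [Real.rpow_one]
  calc w * ‖x - w⁻¹ • p‖ ≤ (D * ‖p‖) * (8 * D * (D * ‖p‖ ^ θ)) := by gcongr; exact hxq.trans (by gcongr)
    _ = _ := by ring

def Kc (e : V) : Set V := {x | ⟪e, x⟫ ^ 2 = ‖x‖ ^ 2 / 2}

lemma Kc_KP {e : V} (he : ‖e‖ = 1) : IsKPCone (le_refl 4) 0 (Kc e) := by
  obtain ⟨E, hE⟩ := onb1 he
  obtain ⟨E', hE'⟩ : ∃ E' : OrthonormalBasis (Fin 4) ℝ V, E' 3 = e := ⟨E.reindex (Equiv.swap 0 3), by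
    rw [OrthonormalBasis.reindex_apply, Equiv.symm_swap, Equiv.swap_apply_right, hE]⟩
  refine ⟨E'.repr, ?_⟩
  ext z
  have h := norm_sq4 E' z
  rw [hE'] at h
  rename_bvar zz → zz
  have hr : ∀ i, E'.repr z i = ⟪E' i, z⟫ := fun i => E'.repr_apply_apply z i
  simp only [mem_setOf_eq, zero_add, Kc, mem_preimage, stdKP, hr]
  show _ ↔ ⟪E' 3, z⟫ ^ 2 = ⟪E' 0, z⟫ ^ 2 + ⟪E' 1, z⟫ ^ 2 + ⟪E' 2, z⟫ ^ 2
  rw [hE']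
  constructor <;> intro k <;> linarith only [h, k]

lemma Kc_proj {e : V} (he : ‖e‖ = 1) (a : V) : ∃ b ∈ Kc e, ‖b‖ ≤ ‖a‖ ∧ ‖a - b‖ ^ 2 ≤ 2 * |⟪e, a⟫ ^ 2 - ‖a‖ ^ 2 / 2| := by
  obtain ⟨α, hα⟩ : ∃ α, α = ⟪e, a⟫ := ⟨_, rfl⟩
  obtain ⟨v, β, hv, hev, hβ, hav⟩ : ∃ (v : V) (β : ℝ), ‖v‖ = 1 ∧ ⟪e, v⟫ = 0 ∧ 0 ≤ β ∧ a = α • e + β • v := by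
    by_cases h : a - α • e = 0
    · obtain ⟨E, hE⟩ := onb1 he
      exact ⟨E 1, 0, E.norm_eq_one 1, by rw [← hE, onb_ip]; simp, le_rfl, by rw [zero_smul, add_zero]; exact sub_eq_zero.1 h⟩
    · have h' : 0 < ‖a - α • e‖ := norm_pos_iff.2 h
      refine ⟨‖a - α • e‖⁻¹ • (a - α • e), ‖a - α • e‖, ?_, ?_, h'.le, ?_⟩
      · rw [norm_smul, norm_inv, norm_norm, inv_mul_cancel₀ h'.ne']
      · rw [inner_smul_right, inner_sub_right, inner_smul_right, real_inner_self_eq_norm_sq, he, hα]; ring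
      · rw [smul_inv_smul₀ h'.ne']; abel
  obtain ⟨σ, hσ, hσα⟩ := sgn_ex α
  rename_bvar zz → zz
  have hn : ∀ s t : ℝ, ‖s • e + t • v‖ ^ 2 = s ^ 2 + t ^ 2 := fun s t => by
    rw [norm_add_sq_real, inner_smul_left, inner_smul_right, hev, norm_smul, norm_smul, he, hv]; simp
  have hi : ∀ s t : ℝ, ⟪e, s • e + t • v⟫ = s := fun s t => by
    rw [inner_add_right, inner_smul_right, inner_smul_right, hev, real_inner_self_eq_norm_sq, he]; ring
  obtain ⟨γ, hγ⟩ : ∃ γ, γ = (σ * α + β) / 2 := ⟨_, rfl⟩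
  have ha2 : ‖a‖ ^ 2 = α ^ 2 + β ^ 2 := by rw [hav, hn]
  rename_bvar zz → zz
  have hsa : (σ * α) ^ 2 = α ^ 2 := by rw [mul_pow, hσ, one_mul]
  refine ⟨(σ * γ) • e + γ • v, ?_, ?_, ?_⟩
  · show _ = _
    rw [hi, hn, mul_pow, hσ]; ring
  · refine le_of_sq_le_sq ?_ (norm_nonneg a)
    rw [hn, ha2, mul_pow, hσ, hγ]
    nlinarith only [hsa, sq_nonneg (σ * α - β)]
  · rw [show a - ((σ * γ) • e + γ • v) = (α - σ * γ) • e + (β - γ) • v by rw [hav]; module, hn, ha2, ← hα]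
    have e1 : (α - σ * γ) ^ 2 = (σ * α - γ) ^ 2 := by linear_combination (γ ^ 2 - α ^ 2) * hσ
    rw [e1, show α ^ 2 - (α ^ 2 + β ^ 2) / 2 = (σ * α - β) * (σ * α + β) / 2 by linear_combination (-1 / 2) * hsa, abs_div, abs_mul,
      abs_of_nonneg (by positivity : 0 ≤ σ * α + β), abs_of_pos (by norm_num : (0 : ℝ) < 2), hγ]
    have e2 : |σ * α - β| ≤ σ * α + β := abs_le.2 ⟨by linarith only [hσα], by linarith only [hβ]⟩
    have e3 := sq_abs (σ * α - β)
    nlinarith only [e2, e3, abs_nonneg (σ * α - β)]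

lemma Kc_D {S : Set V} {e : V} {D s0 θ : ℝ} (he : ‖e‖ = 1) (hD : 1 ≤ D) (hs0 : 0 < s0) (hs1 : s0 ≤ 1) (hθ : 0 < θ)
    (hDs : D * s0 ^ θ ≤ 1) (H : ∀ y ∈ S, ‖y‖ ≤ s0 → |⟪e, y⟫ ^ 2 - ‖y‖ ^ 2 / 2| ≤ D * ‖y‖ ^ (2 * θ) * ‖y‖ ^ 2)
    (HF : ∀ p : V, ‖p‖ ≤ s0 → ⟪e, p⟫ ^ 2 = ‖p‖ ^ 2 / 2 → ∃ x ∈ S, ‖x - p‖ ≤ D * ‖p‖ ^ θ * ‖p‖) {r : ℝ} (hr : 0 < r) (hrs : r ≤ s0) :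
    Dxr (0 : V) r S (Kc e) ≤ 2 * D * r ^ θ := by
  have hη : D * r ^ θ ≤ 1 := le_trans (by gcongr) hDs
  have hη0 : 0 < D * r ^ θ := by positivity
  obtain ⟨η, hηe⟩ : ∃ η, η = D * r ^ θ := ⟨_, rfl⟩
  rw [← hηe] at hη hη0
  refine Dxr_le hr (by positivity) (fun a ha har => ?_) (fun p hp hpr => ?_)
  · rw [sub_zero] at har
    obtain ⟨b, hb, hba, hab⟩ := Kc_proj he a
    refine ⟨b, hb, by rw [sub_zero]; exact hba.trans har, le_of_sq_le_sq ?_ (by positivity)⟩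
    refine hab.trans ((mul_le_mul_of_nonneg_left (H a ha (har.trans hrs)) (by norm_num)).trans ?_)
    have e1 : r ^ (2 * θ) = r ^ θ * r ^ θ := by rw [two_mul, Real.rpow_add hr]
    calc _ ≤ 2 * (D * r ^ (2 * θ) * r ^ 2) := by gcongr
      _ = 2 * D * (r ^ 2 * r ^ θ * r ^ θ) := by rw [e1]; ring
      _ ≤ 4 * D ^ 2 * (r ^ 2 * r ^ θ * r ^ θ) := mul_le_mul_of_nonneg_right (by nlinarith only [hD]) (by positivity)
      _ = _ := by ring
  · rw [sub_zero] at hpr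
    have hp' : ‖(1 - η) • p‖ = (1 - η) * ‖p‖ := by rw [norm_smul, Real.norm_of_nonneg (by linarith only [hη])]
    have hp0 := norm_nonneg p
    have hpp : (1 - η) * ‖p‖ ≤ r := by nlinarith only [hη, hη0, hpr, hp0]
    obtain ⟨x, hx, hxp⟩ := HF ((1 - η) • p) (by rw [hp']; linarith only [hpp, hrs]) (by
      rw [hp', inner_smul_right, mul_pow, mul_pow, show ⟪e, p⟫ ^ 2 = ‖p‖ ^ 2 / 2 from hp]; ring)
    have k1 : ‖x - (1 - η) • p‖ ≤ η * ((1 - η) * ‖p‖) := by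
      refine hxp.trans ?_
      have : 0 ≤ (1 - η) * ‖p‖ := mul_nonneg (by linarith only [hη]) hp0
      rw [hp']
      calc _ ≤ D * r ^ θ * ((1 - η) * ‖p‖) := by gcongr
        _ = _ := by rw [← hηe]
    refine ⟨x, hx, ?_, ?_⟩
    · rw [sub_zero]
      have := norm_le_insert' x ((1 - η) • p)
      rw [hp'] at this
      nlinarith only [this, k1, hpr, hp0, mul_nonneg (sq_nonneg η) hp0]
    · have k2 : ‖p - x‖ ≤ ‖x - (1 - η) • p‖ + ‖η • p‖ := by
        rw [norm_sub_rev p x, show x - p = (x - (1 - η) • p) - η • p by module]; exact norm_sub_le _ _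
      rw [norm_smul, Real.norm_of_nonneg hη0.le] at k2
      rw [mul_assoc, ← hηe]
      have k3 : η * ((1 - η) * ‖p‖) ≤ η * r := by gcongr
      have k4 : η * ‖p‖ ≤ η * r := by gcongr
      linarith only [k1, k2, k3, k4]

lemma FlX {S : Set V} {e : V} {D s0 θ : ℝ} (he : ‖e‖ = 1) (hD : 1 ≤ D) (hθ : 0 < θ) (hθ1 : θ ≤ 1)
    (H : ∀ y ∈ S, ‖y‖ ≤ s0 → |⟪e, y⟫ ^ 2 - ‖y‖ ^ 2 / 2| ≤ D * ‖y‖ ^ θ * ‖y‖ ^ 2) {x : V} (hx : x ∈ S) (hx0 : x ≠ 0) (hxs : 2 * ‖x‖ ≤ s0)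
    {t η : ℝ} (ht : t ≤ ‖x‖) (hη : 9 * D * ‖x‖ ^ θ * ‖x‖ + t ^ 2 / ‖x‖ ≤ η * t) : FlA S x t η := by
  have hxp : 0 < ‖x‖ := norm_pos_iff.2 hx0
  obtain ⟨u, hu⟩ : ∃ u, u = ⟪e, x⟫ • e - (1 / 2 : ℝ) • x := ⟨_, rfl⟩
  have hun : ‖u‖ = ‖x‖ / 2 := by
    have : ‖u‖ ^ 2 = (‖x‖ / 2) ^ 2 := by
      rw [hu, norm_sub_sq_real, inner_smul_left, inner_smul_right, norm_smul, norm_smul, he, conj_trivial, Real.norm_eq_abs, mul_one, sq_abs]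
      rw [mul_pow, Real.norm_of_nonneg (by norm_num)]; ring
    exact (sq_eq_sq₀ (norm_nonneg _) (by positivity)).1 this
  refine ⟨(2 / ‖x‖) • u, by rw [norm_smul, hun, Real.norm_of_nonneg (by positivity)]; field_simp, fun y hy hyt => le_trans ?_ hη⟩
  rename_bvar zz → zz
  have hy2 : ‖y‖ ≤ 2 * ‖x‖ := by have := norm_le_insert' y x; linarith only [this, hyt, ht]
  have a1 := H x hx (by linarith only [hxs, hxp])
  have a2 := H y hy (hy2.trans hxs)
  have a2' : D * ‖y‖ ^ θ * ‖y‖ ^ 2 ≤ 8 * (D * ‖x‖ ^ θ * ‖x‖ ^ 2) := by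
    have : ‖y‖ ^ θ ≤ 2 * ‖x‖ ^ θ := by
      calc _ ≤ (2 * ‖x‖) ^ θ := by gcongr
        _ = 2 ^ θ * ‖x‖ ^ θ := Real.mul_rpow (by norm_num) hxp.le
        _ ≤ 2 ^ (1:ℝ) * ‖x‖ ^ θ := by gcongr; norm_num
        _ = _ := by rw [Real.rpow_one]
    calc _ ≤ D * (2 * ‖x‖ ^ θ) * (2 * ‖x‖) ^ 2 := by gcongr
      _ = _ := by ring
  rename_bvar zz → zz
  have a3 : |⟪e, y - x⟫ ^ 2 - ‖y - x‖ ^ 2 / 2| ≤ t ^ 2 := by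
    have f := abs_real_inner_le_norm e (y - x)
    rw [he, one_mul] at f
    have f2 := sq_le_of_abs f
    have f3 : ‖y - x‖ ^ 2 ≤ t ^ 2 := pow_le_pow_left₀ (norm_nonneg _) hyt 2
    rw [abs_le]; constructor <;> nlinarith only [f2, f3, sq_nonneg ⟪e, y - x⟫, sq_nonneg ‖y - x‖]
  have id : 2 * ⟪u, y - x⟫ = (⟪e, y⟫ ^ 2 - ‖y‖ ^ 2 / 2) - (⟪e, x⟫ ^ 2 - ‖x‖ ^ 2 / 2) - (⟪e, y - x⟫ ^ 2 - ‖y - x‖ ^ 2 / 2) := by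
    rw [hu, norm_sub_sq_real, inner_sub_left, inner_smul_left, inner_smul_left, inner_sub_right, inner_sub_right, real_inner_self_eq_norm_sq,
      real_inner_comm x y, conj_trivial, conj_trivial]
    ring
  have a4 := su2 (su2 (a2.trans a2') a1) a3
  rw [← id] at a4
  rw [inner_smul_left, conj_trivial, show 2 / ‖x‖ * ⟪u, y - x⟫ = (2 * ⟪u, y - x⟫) / ‖x‖ by ring, abs_div, abs_norm, div_le_iff₀ hxp, add_mul,
    div_mul_cancel₀ _ hxp.ne']
  linarith only [a4]

lemma Fin1 {S : Set V} {μ : Measure V} {e : V} {B a D s0 : ℝ} (hB : 1 ≤ B) (ha : 0 < a) (ha1 : a ≤ 1) (hO : OU μ S B a)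
    (he : ‖e‖ = 1) (hD : 1 ≤ D) (hs0 : 0 < s0) (hs01 : s0 ≤ 1)
    (H : ∀ y ∈ S, ‖y‖ ≤ s0 → |⟪e, y⟫ ^ 2 - ‖y‖ ^ 2 / 2| ≤ D * ‖y‖ ^ (a / 120) * ‖y‖ ^ 2)
    {ε1 s1 C1 : ℝ} (hε : 0 < ε1) (hs1 : 0 < s1) (hC1 : 1 ≤ C1)
    (HN : ∀ z ∈ S, ‖z‖ ≤ 1 / 4 → ∀ t0, 0 < t0 → t0 ≤ s1 → FlA S z t0 ε1 → ∀ r, 0 < r → r ≤ s1 →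
      (8 * r) ^ (1 - 68 * (a / 100 / 1000)) ≤ t0 → thetaP 3 S z r ≤ C1 * r ^ (a / 100 / 1000)) :
    ∃ C r0 : ℝ, 0 < C ∧ 0 < r0 ∧ r0 ≤ 1 / 4 ∧ ∀ x ∈ S, ‖x‖ ≤ r0 → x ≠ 0 → ∀ γ, 0 < γ → ∀ r, 0 < r → r ≤ ‖x‖ ^ (1 + γ) / 4 →
      thetaP 3 S x r ≤ C * r ^ (γ * (a / 100 / 1000) / (1 + γ)) := by
  obtain ⟨d, C2, hd, hC2, HT⟩ := TP
  obtain ⟨θ, hθ⟩ : ∃ θ, θ = a / 120 := ⟨_, rfl⟩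
  obtain ⟨β, hβ⟩ : ∃ β, β = a / 100 / 1000 := ⟨_, rfl⟩
  rename_bvar zz → zz
  have hθ0 : 0 < θ := by rw [hθ]; positivity
  have hθ1 : θ ≤ 1 := by rw [hθ]; linarith only [ha1]
  have hβ0 : 0 < β := by rw [hβ]; positivity
  have hβ1 : β ≤ 1 := by rw [hβ]; linarith only [ha1]
  rw [← hθ] at H
  rw [← hβ] at HN ⊢
  rename_bvar zz → zz
  obtain ⟨c, hc⟩ : ∃ c, c = min 1 (ε1 / 2) := ⟨_, rfl⟩
  have c0 : 0 < c := by rw [hc]; exact lt_min one_pos (by positivity)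
  have c1 : c ≤ 1 := by rw [hc]; exact min_le_left _ _
  have c2 : c ≤ ε1 / 2 := by rw [hc]; exact min_le_right _ _
  rename_bvar zz → zz
  obtain ⟨s2, hs2, hs21, H2⟩ := small_rpow hθ0 (c := ε1 * c / (18 * D)) (by positivity)
  obtain ⟨s3, hs3, hs31, H3⟩ := small_rpow ha (c := d / B) (by positivity)
  obtain ⟨r0, hr0⟩ : ∃ r0, r0 = min (min (min s2 s3) s1) (s0 / 4) := ⟨_, rfl⟩
  have r2 : r0 ≤ s2 := by rw [hr0]; exact (min_le_left _ _).trans ((min_le_left _ _).trans (min_le_left _ _))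
  rename_bvar zz → zz
  have r3 : r0 ≤ s3 := by rw [hr0]; exact (min_le_left _ _).trans ((min_le_left _ _).trans (min_le_right _ _))
  have r1 : r0 ≤ s1 := by rw [hr0]; exact (min_le_left _ _).trans (min_le_right _ _)
  have r4 : r0 ≤ s0 / 4 := by rw [hr0]; exact min_le_right _ _
  have hK : 0 < C2 * (9 * D * (16 / c ^ 2) + 4) := by positivity
  refine ⟨C1 + C2 * (9 * D * (16 / c ^ 2) + 4), r0, by linarith only [hC1, hK], by
    rw [hr0]; exact lt_min (lt_min (lt_min hs2 hs3) hs1) (by positivity), by linarith only [r4, hs01], ?_⟩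
  intro x hx hxr hx0 γ hγ r hr hrx
  rename_bvar zz → zz
  have hxp : 0 < ‖x‖ := norm_pos_iff.2 hx0
  have hx4 : ‖x‖ ≤ 1 / 4 := by linarith only [hxr, r4, hs01]
  have hrx1 : 4 * r ≤ ‖x‖ := by
    have : ‖x‖ ^ (1 + γ) ≤ ‖x‖ ^ (1 : ℝ) := Real.rpow_le_rpow_of_exponent_ge hxp (by linarith only [hx4]) (by linarith only [hγ])
    rw [Real.rpow_one] at this; linarith only [this, hrx]
  have hr1 : r ≤ 1 := by linarith only [hrx1, hx4, hr]
  rename_bvar zz → zz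
  have hx2 : 2 * ‖x‖ ≤ s0 := by linarith only [hxr, r4, hs0]
  obtain ⟨β2, hβ2⟩ : ∃ β2, β2 = γ * β / (1 + γ) := ⟨_, rfl⟩
  have b1 : β2 ≤ β := by rw [hβ2, div_le_iff₀ (by positivity)]; nlinarith only [hβ0, hγ]
  have b2 : β2 ≤ γ / (1 + γ) := by rw [hβ2]; gcongr; nlinarith only [hβ1, hγ]
  rw [← hβ2]
  rename_bvar zz → zz
  have hrβ : r ^ β ≤ r ^ β2 := Real.rpow_le_rpow_of_exponent_ge hr hr1 b1
  have hrβ0 : 0 < r ^ β2 := by positivity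
  by_cases hcase : (8 * r) ^ (1 - 68 * β) ≤ c * ‖x‖
  · have hfl : FlA S x (c * ‖x‖) ε1 := by
      refine FlX he hD hθ0 hθ1 H hx hx0 hx2 (by nlinarith only [c1, hxp]) ?_
      have k1 := H2 ‖x‖ hxp (hxr.trans r2)
      rw [le_div_iff₀ (by positivity)] at k1
      have k2 : (c * ‖x‖) ^ 2 / ‖x‖ = c * c * ‖x‖ := by field_simp
      rw [k2]
      have k3 : c * c * ‖x‖ ≤ ε1 / 2 * c * ‖x‖ := by gcongr
      have k4 : 9 * D * ‖x‖ ^ θ * ‖x‖ ≤ ε1 * c / 2 * ‖x‖ := mul_le_mul_of_nonneg_right (by linarith only [k1]) hxp.le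
      linarith only [k3, k4]
    have := HN x hx hx4 (c * ‖x‖) (by positivity) (by nlinarith only [c1, hxp, hxr, r1]) hfl r hr (by linarith only [hrx1, hxr, r1, hr]) hcase
    calc _ ≤ C1 * r ^ β := this
      _ ≤ C1 * r ^ β2 := by gcongr
      _ ≤ _ := by gcongr; linarith only [hK]
  · push Not at hcase
    have A4 : AU (rs μ x (4 * r)) (rsS S x (4 * r)) (B * (4 * r) ^ a) := hO x hx hx4 (4 * r) (by positivity) (by linarith only [hrx1, hx4])
    have hδ : B * (4 * r) ^ a ≤ d := by
      have := H3 (4 * r) (by positivity) (by linarith only [hrx1, hxr, r3])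
      rw [le_div_iff₀ (by positivity)] at this; linarith only [this]
    rename_bvar zz → zz
    have hr8 : 8 * r ≤ 1 := by linarith only [hrx1, hx4]
    have hxθ : ‖x‖ ^ θ * ‖x‖ ≤ 64 / c ^ 2 * (r ^ β2 * r) := by
      have u1 : ‖x‖ ^ θ * ‖x‖ = ‖x‖ ^ (1 + θ) := by rw [add_comm, Real.rpow_add hxp, Real.rpow_one]
      have u2 : ‖x‖ ≤ (8 * r) ^ (1 - 68 * β) / c := by rw [le_div_iff₀ c0]; linarith only [hcase]
      have u4 : (1 + β) ≤ (1 - 68 * β) * (1 + θ) := by rw [hβ, hθ]; nlinarith only [ha, ha1]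
      calc _ = ‖x‖ ^ (1 + θ) := u1
        _ ≤ ((8 * r) ^ (1 - 68 * β) / c) ^ (1 + θ) := by gcongr
        _ = (8 * r) ^ ((1 - 68 * β) * (1 + θ)) / c ^ (1 + θ) := by
          rw [Real.div_rpow (by positivity) c0.le, ← Real.rpow_mul (by positivity)]
        _ ≤ (8 * r) ^ (1 + β) / c ^ (2 : ℝ) :=
          div_le_div₀ (by positivity) (Real.rpow_le_rpow_of_exponent_ge (by positivity) hr8 u4) (by positivity)
            (Real.rpow_le_rpow_of_exponent_ge c0 c1 (by linarith only [hθ1]))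
        _ = 8 ^ (1 + β) * (r ^ β * r) / c ^ 2 := by
          rw [Real.mul_rpow (by norm_num) hr.le, Real.rpow_two, Real.rpow_add hr, Real.rpow_one, mul_comm r]
        _ ≤ 8 ^ (2 : ℝ) * (r ^ β2 * r) / c ^ 2 := by gcongr <;> linarith only [hβ1]
        _ = _ := by rw [Real.rpow_two]; ring
    have hrx2 : r ≤ r ^ β2 * ‖x‖ := by
      have u0 : r ≤ ‖x‖ ^ (1 + γ) := by have : 0 < ‖x‖ ^ (1 + γ) := by positivity
                                        linarith only [this, hrx]
      have u1 : r ^ (1 / (1 + γ)) ≤ ‖x‖ := by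
        calc _ ≤ (‖x‖ ^ (1 + γ)) ^ (1 / (1 + γ)) := by gcongr
          _ = ‖x‖ := by rw [← Real.rpow_mul hxp.le, mul_one_div_cancel (by positivity), Real.rpow_one]
      calc r = r ^ (γ / (1 + γ)) * r ^ (1 / (1 + γ)) := by
            rw [← Real.rpow_add hr, ← add_div, add_comm γ, div_self (by positivity), Real.rpow_one]
        _ ≤ r ^ β2 * ‖x‖ := mul_le_mul (Real.rpow_le_rpow_of_exponent_ge hr hr1 b2) u1 (by positivity) hrβ0.le
    have hfl : FlA S x (4 * r) ((9 * D * (16 / c ^ 2) + 4) * r ^ β2) := by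
      refine FlX he hD hθ0 hθ1 H hx hx0 hx2 hrx1 ?_
      have k1 : (4 * r) ^ 2 / ‖x‖ ≤ 4 * r ^ β2 * (4 * r) := by
        rw [div_le_iff₀ hxp]; nlinarith only [hrx2, hr]
      have k2 : 9 * D * (‖x‖ ^ θ * ‖x‖) ≤ 9 * D * (64 / c ^ 2 * (r ^ β2 * r)) := by gcongr
      calc _ ≤ 9 * D * (64 / c ^ 2 * (r ^ β2 * r)) + 4 * r ^ β2 * (4 * r) := by linarith only [k1, k2]
        _ = _ := by ring
    have := HT μ S x r _ hr A4 hδ hx _ (by positivity) hfl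
    calc _ ≤ C2 * ((9 * D * (16 / c ^ 2) + 4) * r ^ β2) := this
      _ = C2 * (9 * D * (16 / c ^ 2) + 4) * r ^ β2 := by ring
      _ ≤ _ := by gcongr; linarith only [hC1]

/-- Lemma 4.9 / `flatparts`: Hölder flatness of the support near a nonflat
point, at scales `r ≤ |x|^{1+γ₁}/A`, with exponent `β₂ = γ₁ β/(1+γ₁)` where `β₁` is the
exponent of approximation by the tangent KP cone and `β` is the exponent of
David–Kenig–Toro. -/
theorem holder_flatness_away_from_origin (μ : Measure (E 4))
    (hRadon : IsLocallyFiniteMeasure μ) (S : Set (E 4)) (hS : S = msupp μ)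
    (h0 : (0 : E 4) ∈ S)
    (hnf : ¬ Tendsto (fun r : ℝ => thetaP 3 S 0 r) (nhdsWithin 0 (Set.Ioi 0)) (nhds 0))
    (α C₀ : ℝ) (hα : 0 < α)
    (hreg : ∀ x ∈ S ∩ closedBall (0 : E 4) 1, ∀ r : ℝ, 0 < r → r ≤ 1 →
      |(μ (closedBall x r)).toReal / (omega3 * r ^ 3) - 1| ≤ C₀ * r ^ α) :
    ∃ β₁ C₁ r₁ : ℝ, 0 < β₁ ∧ 0 < C₁ ∧ 0 < r₁ ∧
      (∃ Cone : Set (E 4), IsKPCone (le_refl 4) 0 Cone ∧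
        ∀ r : ℝ, 0 < r → r ≤ r₁ → Dxr (0 : E 4) r S Cone ≤ C₁ * r ^ β₁) ∧
      ∃ β : ℝ, 0 < β ∧ ∀ γ₁ : ℝ, 0 < γ₁ → γ₁ < β₁ →
        ∃ A C r₀ : ℝ, 1 < A ∧ 0 < C ∧ 0 < r₀ ∧
          ∀ x ∈ S ∩ closedBall (0 : E 4) r₀, x ≠ 0 →
            ∀ r : ℝ, 0 < r → r ≤ ‖x‖ ^ (1 + γ₁) / A →
              thetaP 3 S x r ≤ C * r ^ (γ₁ * β / (1 + γ₁)) := by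
  obtain ⟨ν, B, a, hB, ha, ha1, hO⟩ := OU_exists μ hRadon S hS α C₀ hα hreg
  obtain ⟨K, hK⟩ : ∃ K, K = S ∩ closedBall (0 : E 4) 1 := ⟨_, rfl⟩
  rw [← hK] at hO
  have h0K : (0 : E 4) ∈ K := by rw [hK]; exact ⟨h0, by simp⟩
  rename_bvar zz → zz
  obtain ⟨ε1, hε, N1, N2⟩ := NF
  have hO' : OU ν K B (a / 100) := fun z hz hz4 s hs hs1 => (hO z hz hz4 s hs hs1).mono
    (mul_le_mul_of_nonneg_left (Real.rpow_le_rpow_of_exponent_ge hs hs1 (by linarith only [ha])) (by linarith only [hB]))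
  have hnfK : ¬ Tendsto (fun r : ℝ => thetaP 3 K 0 r) (𝓝[>] 0) (𝓝 0) := by
    intro hT
    refine hnf (hT.congr' ?_)
    filter_upwards [Ioo_mem_nhdsGT (show (0 : ℝ) < 1 by norm_num)] with r hr
    rw [hK]; exact thetaP_inter (closedBall_subset_closedBall hr.2.le)
  obtain ⟨s1, hs1, hn1⟩ := N2 ν K B a hB ha ha1 hO h0K hnfK
  rename_bvar zz → zz
  obtain ⟨e, D, s0, he, hD, hs0, hs01, H, HF⟩ := LC3 (ε1 := min ε1 1) (lt_min hε one_pos) (min_le_right _ _) hB ha ha1 hO h0K hs1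
    (fun t ht hts hF => hn1 t ht hts (hF.sub le_rfl (mul_le_mul_of_nonneg_right (min_le_left _ _) ht.le)))
  obtain ⟨s2, C1, hs2, hs21, hC1, HN⟩ := N1 ν K B (a / 100) hB (by positivity) (by linarith only [ha1]) hO'
  obtain ⟨C, r0, hC, hr0, hr04, HX⟩ := Fin1 hB ha ha1 hO he hD hs0 hs01 H hε hs2 hC1 HN
  have hth : 0 < a / 240 := by positivity
  rename_bvar zz → zz
  obtain ⟨s3, hs3, hs31, H3⟩ := small_rpow hth (c := 1 / D) (by positivity)
  have hs4 : 0 < min s0 s3 := lt_min hs0 hs3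
  refine ⟨a / 240, 2 * D, min s0 s3, hth, by positivity, hs4, ⟨Kc e, Kc_KP he, fun r hr hrs => ?_⟩, a / 100 / 1000, by positivity, fun γ hγ _ => ?_⟩
  · rw [← Dxr_inter (closedBall_subset_closedBall (hrs.trans ((min_le_left _ _).trans hs01))), ← hK]
    have hDs := H3 _ hs4 (min_le_right _ _)
    rw [le_div_iff₀ (by positivity)] at hDs
    refine Kc_D he hD hs4 ((min_le_left _ _).trans hs01) hth (by linarith only [hDs]) (fun y hy hys => ?_)
      (fun p hp => HF p (hp.trans (min_le_left _ _))) hr hrs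
    rw [show 2 * (a / 240) = a / 120 by ring]
    exact H y hy (hys.trans (min_le_left _ _))
  · refine ⟨4, C, r0, by norm_num, hC, hr0, fun x hx hx0 r hr hrx => ?_⟩
    have hxr : ‖x‖ ≤ r0 := by simpa using hx.2
    have hxp : 0 < ‖x‖ := norm_pos_iff.2 hx0
    rename_bvar zz → zz
    have hrx1 : r ≤ 1 / 4 := by
      have : ‖x‖ ^ (1 + γ) ≤ 1 := Real.rpow_le_one hxp.le (by linarith only [hxr, hr04]) (by linarith only [hγ])
      linarith only [this, hrx]
    have hsub : closedBall x r ⊆ closedBall (0 : E 4) 1 := closedBall_subset_closedBall' (by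
      rw [dist_zero_right]; linarith only [hxr, hr04, hrx1])
    have hxK : x ∈ K := by rw [hK]; exact ⟨hx.1, hsub (mem_closedBall_self hr.le)⟩
    have := HX x hxK hxr hx0 γ hγ r hr hrx
    rw [hK, thetaP_inter hsub] at this
    exact this

end
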